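/- (Suzuki's formula.) Assume f has only finitely many critical points in ℂ² and that each local Milnor number μ_q(f) is finite; let μ be the sum of the μ_q(f) over the critical points q of f. Assume that for every m ∈ ℂ with f_d(1,m) = 0 the polynomial f^{[m]} is admissible, and that, if f_d(0,1) = 0, the polynomial f^σ is admissible. Let λ = Σ_{m : f_d(1,m)=0} Σ_{c ∈ ℂ} ν^{f^{[m]}}_c, plus Σ_{c ∈ ℂ} ν^{f^σ}_c in case f_d(0,1) = 0 (all these sums have only finitely many nonzero terms). Then there is a finite set S ⊂ ℂ such that for every t ∈ ℂ \ S, the generic fiber f⁻¹(t) satisfies dim_ℚ H₁(f⁻¹(t); ℚ) = μ + λ. -/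

import Mathlib

open MvPolynomial Filter

noncomputable section

/-- Evaluation of a two-variable polynomial at a point of `ℂ × ℂ`
(the variable `X 0` is `x`, the variable `X 1` is `y`). -/
def evalP (f : MvPolynomial (Fin 2) ℂ) (p : ℂ × ℂ) : ℂ :=
  MvPolynomial.eval (fun i => if i = 0 then p.1 else p.2) f

/-- The local equation `g_t(u,v) = v^d · f(1/v, u/v) - t·v^d` at `p = [1:0:0]`, as a
polynomial in the variables `u = X 0`, `v = X 1`: if `f = ∑ c_{ab} x^a y^b` then
`v^d f(1/v, u/v) = ∑ c_{ab} u^b v^(d-a-b)`. -/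
def gPoly (f : MvPolynomial (Fin 2) ℂ) (d : ℕ) (t : ℂ) : MvPolynomial (Fin 2) ℂ :=
  (f.support.sum fun m =>
    monomial (Finsupp.single 0 (m 1) + Finsupp.single 1 (d - m 0 - m 1)) (coeff m f))
  - C t * X 1 ^ d

/-- The "Milnor ideal" of a two-variable polynomial germ at the origin: the ideal of the
formal power series ring `ℂ[[u,v]]` generated by the two partial derivatives. -/
def milnorIdeal (g : MvPolynomial (Fin 2) ℂ) : Ideal (MvPowerSeries (Fin 2) ℂ) :=
  Ideal.span {(↑(pderiv 0 g) : MvPowerSeries (Fin 2) ℂ), (↑(pderiv 1 g) : MvPowerSeries (Fin 2) ℂ)}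

/-- The Milnor number `μ_t` of `f` at the point `p = [1:0:0]` at infinity and the value `t`:
`μ_t = dim_ℂ ℂ[[u,v]] / (∂g_t/∂u, ∂g_t/∂v)`. -/
def mu (f : MvPolynomial (Fin 2) ℂ) (d : ℕ) (t : ℂ) : ℕ :=
  Module.finrank ℂ (MvPowerSeries (Fin 2) ℂ ⧸ milnorIdeal (gPoly f d t))

/-- Finiteness of the Milnor number `μ_t`. -/
def MuFinite (f : MvPolynomial (Fin 2) ℂ) (d : ℕ) (t : ℂ) : Prop :=
  Module.Finite ℂ (MvPowerSeries (Fin 2) ℂ ⧸ milnorIdeal (gPoly f d t))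

/-- The rank of the `n`-th singular homology of a topological space with rational
coefficients: homology of the alternating face map complex of the degreewise free
`ℚ`-linearization of the singular simplicial set. -/
def homologyRank (X : Type) [TopologicalSpace X] (n : ℕ) : ℕ :=
  Module.finrank ℚ
    (((AlgebraicTopology.alternatingFaceMapComplex (ModuleCat.{0} ℚ)).obj
      (((CategoryTheory.SimplicialObject.whiskering _ _).obj (ModuleCat.free ℚ)).obj
        (TopCat.toSSet.obj (TopCat.of X)))).homology n)

/-- The translate `f_q(x,y) = f(x + a, y + b)` of `f` by `q = (a,b)`. -/
def shiftPoly (f : MvPolynomial (Fin 2) ℂ) (q : ℂ × ℂ) : MvPolynomial (Fin 2) ℂ :=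
  MvPolynomial.bind₁ (fun i : Fin 2 => X i + C (if i = 0 then q.1 else q.2)) f

/-- The local Milnor number `μ_q(f) = dim_ℂ ℂ[[x,y]]/(∂f_q/∂x, ∂f_q/∂y)` of `f` at a
point `q ∈ ℂ²`. -/
def muLoc (f : MvPolynomial (Fin 2) ℂ) (q : ℂ × ℂ) : ℕ :=
  Module.finrank ℂ (MvPowerSeries (Fin 2) ℂ ⧸ milnorIdeal (shiftPoly f q))

/-- The set of critical points of `f` in `ℂ²`. -/
def critPts (f : MvPolynomial (Fin 2) ℂ) : Set (ℂ × ℂ) :=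
  {q : ℂ × ℂ | evalP (pderiv 0 f) q = 0 ∧ evalP (pderiv 1 f) q = 0}

/-- A polynomial `h` (of degree `d`, with `h_d(1,0) = 0`) is admissible with generic
Milnor number `μg`: all the Milnor numbers `μ^h_t` at `[1:0:0]` are finite and
`μ^h_t = μg` for all `t` outside some finite set. -/
def IsAdmissible (h : MvPolynomial (Fin 2) ℂ) (d : ℕ) (μg : ℕ) : Prop :=
  (∀ t : ℂ, MuFinite h d t) ∧ ∃ S : Set ℂ, S.Finite ∧ ∀ t ∉ S, mu h d t = μg

/-- The linear change of coordinates `f^[m](x,y) = f(x, y + m·x)`, moving the point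
`[1:m:0]` of the line at infinity to `[1:0:0]`. -/
def fSlope (f : MvPolynomial (Fin 2) ℂ) (m : ℂ) : MvPolynomial (Fin 2) ℂ :=
  MvPolynomial.bind₁ (fun i : Fin 2 => if i = 0 then X 0 else X 1 + C m * X 0) f

/-- The change of coordinates `f^σ(x,y) = f(y,x)`, moving `[0:1:0]` to `[1:0:0]`. -/
def fSwap (f : MvPolynomial (Fin 2) ℂ) : MvPolynomial (Fin 2) ℂ :=
  MvPolynomial.bind₁ (fun i : Fin 2 => if i = 0 then X 1 else X 0) f

section

open CategoryTheory AlgebraicTopology Simplicial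

/-- For linear maps `C₂ → C₁ → C₀` of vector spaces, the cocycles in the dual of `C₁`. -/
def dualCocycles {C₂ C₁ : Type} [AddCommGroup C₂] [Module ℚ C₂] [AddCommGroup C₁] [Module ℚ C₁]
    (d₂ : C₂ →ₗ[ℚ] C₁) : Submodule ℚ (Module.Dual ℚ C₁) := LinearMap.ker d₂.dualMap

def dualCoboundaries {C₁ C₀ : Type} [AddCommGroup C₁] [Module ℚ C₁] [AddCommGroup C₀] [Module ℚ C₀]
    (d₁ : C₁ →ₗ[ℚ] C₀) : Submodule ℚ (Module.Dual ℚ C₁) := LinearMap.range d₁.dualMap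

theorem finrank_homology_eq_dual {C₂ C₁ C₀ : Type} [AddCommGroup C₂] [Module ℚ C₂]
    [AddCommGroup C₁] [Module ℚ C₁] [AddCommGroup C₀] [Module ℚ C₀]
    (d₂ : C₂ →ₗ[ℚ] C₁) (d₁ : C₁ →ₗ[ℚ] C₀) (hd : ∀ x, d₁ (d₂ x) = 0) :
    Module.finrank ℚ (LinearMap.ker d₁ ⧸ LinearMap.range (d₂.codRestrict (LinearMap.ker d₁) hd)) =
    Module.finrank ℚ (dualCocycles d₂ ⧸ (dualCoboundaries d₁).comap (dualCocycles d₂).subtype) := by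
  let R := LinearMap.range (d₂.codRestrict (LinearMap.ker d₁) hd)
  let r : dualCocycles d₂ →ₗ[ℚ] R.dualAnnihilator :=
    LinearMap.codRestrict _ ((LinearMap.ker d₁).subtype.dualMap ∘ₗ (dualCocycles d₂).subtype) (by
      rintro ⟨φ, hφ⟩
      rw [Submodule.mem_dualAnnihilator]
      rintro w ⟨x, rfl⟩
      have := LinearMap.congr_fun (LinearMap.mem_ker.1 hφ) x
      exact this)
  have hsurj : Function.Surjective r := by
    rintro ⟨ψ, hψ⟩
    obtain ⟨φ, hφ⟩ := LinearMap.exists_extend ψ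
    refine ⟨⟨φ, ?_⟩, ?_⟩
    · refine LinearMap.mem_ker.2 (LinearMap.ext fun x => ?_)
      have h1 := (Submodule.mem_dualAnnihilator ψ).1 hψ (d₂.codRestrict (LinearMap.ker d₁) hd x)
          ⟨x, rfl⟩
      rw [← hφ] at h1
      exact h1
    · apply Subtype.ext
      exact hφ
  have hker : LinearMap.ker r = (dualCoboundaries d₁).comap (dualCocycles d₂).subtype := by
    ext ⟨φ, hφ⟩
    rw [LinearMap.mem_ker, Submodule.mem_comap]
    have : φ ∈ dualCoboundaries d₁ ↔ ∀ x ∈ LinearMap.ker d₁, φ x = 0 := by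
      rw [dualCoboundaries, LinearMap.range_dualMap_eq_dualAnnihilator_ker,
        Submodule.mem_dualAnnihilator]
    rw [Submodule.subtype_apply, this]
    constructor
    · intro h x hx
      have := congrArg (fun z => z.1 ⟨x, hx⟩) h
      simpa [r] using this
    · intro h
      apply Subtype.ext
      ext ⟨x, hx⟩
      simpa [r] using h x hx
  have e1 := (LinearMap.quotKerEquivOfSurjective r hsurj).finrank_eq
  rw [hker] at e1
  rw [e1, ← Subspace.dual_finrank_eq, (Submodule.dualQuotEquivDualAnnihilator R).finrank_eq]

def simpCocycles (S : SSet.{0}) : Submodule ℚ (S _⦋1⦌ → ℚ) where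
  carrier := {φ | ∀ σ : S _⦋2⦌, φ (S.δ 0 σ) + φ (S.δ 2 σ) = φ (S.δ 1 σ)}
  add_mem' := by intro a b ha hb σ; simp only [Pi.add_apply]; linarith [ha σ, hb σ]
  zero_mem' := by intro σ; simp
  smul_mem' := by intro c a ha σ; simp only [Pi.smul_apply, smul_eq_mul]; rw [← ha σ]; ring

def simpCoboundary (S : SSet.{0}) : (S _⦋0⦌ → ℚ) →ₗ[ℚ] (S _⦋1⦌ → ℚ) where
  toFun h γ := h (S.δ 0 γ) - h (S.δ 1 γ)
  map_add' := by intro a b; ext; simp; ring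
  map_smul' := by intro a b; ext; simp; ring

def simpComplex (S : SSet.{0}) : ChainComplex (ModuleCat.{0} ℚ) ℕ :=
  (alternatingFaceMapComplex (ModuleCat.{0} ℚ)).obj
      (((SimplicialObject.whiskering _ _).obj (ModuleCat.free ℚ)).obj S)

theorem simpComplex_d_two (S : SSet.{0}) (σ : S _⦋2⦌) :
    ((simpComplex S).d 2 1).hom (Finsupp.single σ 1) =
     (Finsupp.single (S.δ 0 σ) 1 - Finsupp.single (S.δ 1 σ) 1 + Finsupp.single (S.δ 2 σ) (1:ℚ) :
         S _⦋1⦌ →₀ ℚ) := by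
  have h : (simpComplex S).d 2 1 = AlternatingFaceMapComplex.objD
      (((SimplicialObject.whiskering _ _).obj (ModuleCat.free ℚ)).obj S) 1 :=
    alternatingFaceMapComplex_obj_d _ 1
  rw [h, AlternatingFaceMapComplex.objD, Fin.sum_univ_three]
  have key : ∀ i : Fin 3, (SimplicialObject.δ (((SimplicialObject.whiskering _ _).obj
      (ModuleCat.free ℚ)).obj S) i).hom (Finsupp.single σ 1) = Finsupp.single (S.δ i σ) (1:ℚ) := by
    intro i
    exact Finsupp.mapDomain_single
  have e : ∀ (a b c : ((((SimplicialObject.whiskering _ _).obj (ModuleCat.free ℚ)).obj S) _⦋1+1⦌) ⟶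
     ((((SimplicialObject.whiskering _ _).obj (ModuleCat.free ℚ)).obj S) _⦋1⦌)),
     (((-1:ℤ)^((0:Fin 3):ℕ)) • a + ((-1:ℤ)^((1:Fin 3):ℕ)) • b + ((-1:ℤ)^((2:Fin 3):ℕ)) • c) =
         a - b + c := by
    intro a b c
    simp [sub_eq_add_neg]
  refine (congrArg (fun z => z.hom (Finsupp.single σ 1)) (e _ _ _)).trans ?_
  have := key 0
  have h1 := key 1
  have h2 := key 2
  exact congrArg₂ (· + ·) (congrArg₂ (· - ·) this h1) h2

theorem simpComplex_d_one (S : SSet.{0}) (σ : S _⦋1⦌) :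
    ((simpComplex S).d 1 0).hom (Finsupp.single σ 1) =
     (Finsupp.single (S.δ 0 σ) 1 - Finsupp.single (S.δ 1 σ) (1:ℚ) : S _⦋0⦌ →₀ ℚ) := by
  have h : (simpComplex S).d 1 0 = AlternatingFaceMapComplex.objD
      (((SimplicialObject.whiskering _ _).obj (ModuleCat.free ℚ)).obj S) 0 :=
    alternatingFaceMapComplex_obj_d _ 0
  rw [h, AlternatingFaceMapComplex.objD, Fin.sum_univ_two]
  have key : ∀ i : Fin 2, (SimplicialObject.δ (((SimplicialObject.whiskering _ _).obj
      (ModuleCat.free ℚ)).obj S) i).hom (Finsupp.single σ 1) = Finsupp.single (S.δ i σ) (1:ℚ) := by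
    intro i
    exact Finsupp.mapDomain_single
  have e : ∀ (a b : ((((SimplicialObject.whiskering _ _).obj (ModuleCat.free ℚ)).obj S) _⦋0+1⦌) ⟶
     ((((SimplicialObject.whiskering _ _).obj (ModuleCat.free ℚ)).obj S) _⦋0⦌)),
     (((-1:ℤ)^((0:Fin 2):ℕ)) • a + ((-1:ℤ)^((1:Fin 2):ℕ)) • b) = a - b := by
    intro a b
    simp [sub_eq_add_neg]
  refine (congrArg (fun z => z.hom (Finsupp.single σ 1)) (e _ _)).trans ?_
  exact congrArg₂ (· - ·) (key 0) (key 1)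

theorem finrank_simpComplex_homology_one (S : SSet.{0}) :
    Module.finrank ℚ ((simpComplex S).homology 1) =
      Module.finrank ℚ (simpCocycles S ⧸
        (LinearMap.range (simpCoboundary S)).comap (simpCocycles S).subtype) := by
  let K := simpComplex S
  let d₂ : (S _⦋2⦌ →₀ ℚ) →ₗ[ℚ] (S _⦋1⦌ →₀ ℚ) := (K.d 2 1).hom
  let d₁ : (S _⦋1⦌ →₀ ℚ) →ₗ[ℚ] (S _⦋0⦌ →₀ ℚ) := (K.d 1 0).hom
  have hd : ∀ x, d₁ (d₂ x) = 0 := fun x =>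
    congrArg (fun z => z.hom x) (K.d_comp_d 2 1 0)
  have i1 : K.homology 1 ≅ (K.sc' 2 1 0).homology :=
    ShortComplex.homologyMapIso (K.isoSc' 2 1 0 (by simp) (by simp))
  have i2 := i1 ≪≫ (K.sc' 2 1 0).moduleCatHomologyIso
  rw [show Module.finrank ℚ ((simpComplex S).homology 1) = Module.finrank ℚ
    (LinearMap.ker d₁ ⧸ LinearMap.range (d₂.codRestrict (LinearMap.ker d₁) hd)) from
    i2.toLinearEquiv.finrank_eq, finrank_homology_eq_dual]
  let E : Module.Dual ℚ (S _⦋1⦌ →₀ ℚ) ≃ₗ[ℚ] (S _⦋1⦌ → ℚ) :=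
    (Finsupp.llift ℚ ℚ ℚ (S _⦋1⦌)).symm
  have hE : ∀ φ γ, E φ γ = φ (Finsupp.single γ 1) := fun φ γ => rfl
  have hd2 : ∀ σ, d₂ (Finsupp.single σ 1) = _ := simpComplex_d_two S
  have hd1 : ∀ σ, d₁ (Finsupp.single σ 1) = _ := simpComplex_d_one S
  have hZ : (dualCocycles d₂).map (E : _ →ₗ[ℚ] _) = simpCocycles S := by
    ext ψ
    rw [Submodule.mem_map_equiv]
    obtain ⟨φ, rfl⟩ := E.surjective ψ
    rw [E.symm_apply_apply]
    constructor
    · intro h σ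
      have := LinearMap.congr_fun (LinearMap.mem_ker.1 h) (Finsupp.single σ 1)
      rw [LinearMap.dualMap_apply, hd2, map_add, map_sub, LinearMap.zero_apply] at this
      rw [hE, hE, hE]; linarith
    · intro h
      refine LinearMap.mem_ker.2 (Finsupp.lhom_ext' fun σ => LinearMap.ext_ring ?_)
      have := h σ
      rw [hE, hE, hE] at this
      change φ (d₂ (Finsupp.single σ 1)) = 0
      rw [hd2, map_add, map_sub]; linarith
  have hB : (dualCoboundaries d₁).map (E : _ →ₗ[ℚ] _) = LinearMap.range (simpCoboundary S) := by
    ext ψ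
    constructor
    · rintro ⟨_, ⟨χ, rfl⟩, rfl⟩
      refine ⟨fun p => χ (Finsupp.single p 1), ?_⟩
      ext γ
      change _ = E _ γ
      rw [hE, LinearMap.dualMap_apply, hd1, map_sub]
      rfl
    · rintro ⟨h, rfl⟩
      refine ⟨_, ⟨Finsupp.linearCombination ℚ h, rfl⟩, ?_⟩
      ext γ
      change E _ γ = _
      rw [hE, LinearMap.dualMap_apply, hd1, map_sub]
      simp [simpCoboundary]
  let e0 : dualCocycles d₂ ≃ₗ[ℚ] simpCocycles S :=
    (E.submoduleMap (dualCocycles d₂)).trans (LinearEquiv.ofEq _ _ hZ)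
  refine (Submodule.Quotient.equiv _ _ e0 ?_).finrank_eq
  ext ⟨ψ, hψ⟩
  rw [Submodule.mem_map_equiv]
  simp only [Submodule.mem_comap, Submodule.subtype_apply]
  rw [← hB, Submodule.mem_map_equiv]
  rfl

end

section

open CategoryTheory AlgebraicTopology Simplicial unitInterval

/-- The `i`-th edge of the standard 2-simplex (opposite to the vertex `i`). -/
def simplexEdge (i : Fin 3) : C(I, stdSimplex ℝ (Fin 3)) :=
  ⟨fun t => stdSimplex.map i.succAbove (stdSimplexHomeomorphUnitInterval.symm t),
    (stdSimplex.continuous_map _).comp stdSimplexHomeomorphUnitInterval.symm.continuous⟩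

/-- Rational singular 1-cocycles, as functions on paths. -/
def pathCocycles (X : Type) [TopologicalSpace X] : Submodule ℚ (C(I, X) → ℚ) where
  carrier := {φ | ∀ τ : C(stdSimplex ℝ (Fin 3), X),
    φ (τ.comp (simplexEdge 0)) + φ (τ.comp (simplexEdge 2)) = φ (τ.comp (simplexEdge 1))}
  add_mem' := by intro a b ha hb τ; simp only [Pi.add_apply]; linarith [ha τ, hb τ]
  zero_mem' := by intro τ; simp
  smul_mem' := by intro c a ha τ; simp only [Pi.smul_apply, smul_eq_mul]; rw [← ha τ]; ring

/-- The coboundary of a function on points, as a function on paths. -/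
def pathCoboundary (X : Type) [TopologicalSpace X] : (X → ℚ) →ₗ[ℚ] (C(I, X) → ℚ) where
  toFun h γ := h (γ 1) - h (γ 0)
  map_add' := by intro a b; ext; simp; ring
  map_smul' := by intro a b; ext; simp; ring

theorem stdSimplex_map_vertex_one :
    stdSimplex.map (Fin.succAbove (0 : Fin 2)) (stdSimplex.vertex (S := ℝ) (0 : Fin 1)) =
      stdSimplexHomeomorphUnitInterval.symm 1 := by
  apply stdSimplexHomeomorphUnitInterval.injective
  rw [Homeomorph.apply_symm_apply, stdSimplex.map_vertex]
  apply Subtype.ext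
  simp [stdSimplexHomeomorphUnitInterval, stdSimplexEquivIcc]

theorem stdSimplex_map_vertex_zero :
    stdSimplex.map (Fin.succAbove (1 : Fin 2)) (stdSimplex.vertex (S := ℝ) (0 : Fin 1)) =
      stdSimplexHomeomorphUnitInterval.symm 0 := by
  apply stdSimplexHomeomorphUnitInterval.injective
  rw [Homeomorph.apply_symm_apply, stdSimplex.map_vertex]
  apply Subtype.ext
  simp [stdSimplexHomeomorphUnitInterval, stdSimplexEquivIcc]

theorem homologyRank_one_eq (X : Type) [TopologicalSpace X] :
    Module.finrank ℚ ((simpComplex (TopCat.toSSet.obj (TopCat.of X))).homology 1) =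
      Module.finrank ℚ (pathCocycles X ⧸
        (LinearMap.range (pathCoboundary X)).comap (pathCocycles X).subtype) := by
  rw [finrank_simpComplex_homology_one]
  set S := TopCat.toSSet.obj (TopCat.of X) with hS
  let e1 : S _⦋1⦌ ≃ C(I, X) := (TopCat.toSSetObjEquiv (TopCat.of X) _).trans
    (Homeomorph.continuousMapCongr stdSimplexHomeomorphUnitInterval (.refl _))
  let e2 : S _⦋2⦌ ≃ C(stdSimplex ℝ (Fin 3), X) := (TopCat.toSSetObjEquiv (TopCat.of X) _)
  let e0 : S _⦋0⦌ ≃ X := (TopCat.toSSetObjEquiv (TopCat.of X) _).trans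
    ⟨fun c => c (stdSimplex.vertex (S := ℝ) (0 : Fin 1)), fun x => ContinuousMap.const _ x,
        fun c => by
      ext y; exact congrArg c (Subsingleton.elim (α := stdSimplex ℝ (Fin 1)) _ _), fun x => rfl⟩
  have h2 : ∀ (i : Fin 3) τ, e1 (S.δ i τ) = (e2 τ).comp (simplexEdge i) := by
    intro i τ
    rfl
  have h1 : ∀ γ, e0 (S.δ 0 γ) = e1 γ 1 := by
    intro γ
    exact congrArg (TopCat.toSSetObjEquiv (TopCat.of X) _ γ) stdSimplex_map_vertex_one
  have h0 : ∀ γ, e0 (S.δ 1 γ) = e1 γ 0 := by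
    intro γ
    exact congrArg (TopCat.toSSetObjEquiv (TopCat.of X) _ γ) stdSimplex_map_vertex_zero
  let E : (S _⦋1⦌ → ℚ) ≃ₗ[ℚ] (C(I, X) → ℚ) := LinearEquiv.funCongrLeft ℚ ℚ e1.symm
  have hE : ∀ φ γ, E φ (e1 γ) = φ γ := fun φ γ => congrArg φ (e1.symm_apply_apply γ)
  have hZ : (simpCocycles S).map (E : _ →ₗ[ℚ] _) = pathCocycles X := by
    ext ψ
    rw [Submodule.mem_map_equiv]
    obtain ⟨φ, rfl⟩ := E.surjective ψ
    rw [E.symm_apply_apply]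
    change (∀ τ, _) ↔ ∀ τ, _
    rw [e2.forall_congr_left]
    refine forall_congr' fun τ => ?_
    obtain ⟨ω, rfl⟩ := e2.surjective τ
    rw [e2.symm_apply_apply, ← h2, ← h2, ← h2, hE, hE, hE]
  have hB : (LinearMap.range (simpCoboundary S)).map (E : _ →ₗ[ℚ] _) =
      LinearMap.range (pathCoboundary X) := by
    ext ψ
    constructor
    · rintro ⟨_, ⟨h, rfl⟩, rfl⟩
      refine ⟨h ∘ e0.symm, funext fun γ => ?_⟩
      obtain ⟨γ, rfl⟩ := e1.surjective γ
      change _ = E _ (e1 γ)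
      rw [hE]
      simp only [pathCoboundary, LinearMap.coe_mk, AddHom.coe_mk, Function.comp, ← h1, ← h0,
        Equiv.symm_apply_apply]
      rfl
    · rintro ⟨h, rfl⟩
      refine ⟨_, ⟨h ∘ e0, rfl⟩, funext fun γ => ?_⟩
      obtain ⟨γ, rfl⟩ := e1.surjective γ
      change E _ (e1 γ) = _
      rw [hE]
      simp only [pathCoboundary, LinearMap.coe_mk, AddHom.coe_mk, ← h1, ← h0]
      rfl
  let e3 : simpCocycles S ≃ₗ[ℚ] pathCocycles X :=
    (E.submoduleMap (simpCocycles S)).trans (LinearEquiv.ofEq _ _ hZ)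
  refine (Submodule.Quotient.equiv _ _ e3 ?_).finrank_eq
  ext ⟨ψ, hψ⟩
  rw [Submodule.mem_map_equiv]
  simp only [Submodule.mem_comap, Submodule.subtype_apply]
  rw [← hB, Submodule.mem_map_equiv]
  rfl

end

section

open unitInterval

/-- Convex combination in the unit interval. -/
def mixI (a b t : I) : I := ⟨(1 - t) * a + t * b, by
  have := a.2; have := b.2; have := t.2
  have h := (convex_Icc (0:ℝ) 1) a.2 b.2 (sub_nonneg.2 t.2.2) t.2.1 (by ring)
  simpa using h⟩

@[simp] theorem mixI_zero (a b : I) : mixI a b 0 = a := Subtype.ext (by simp [mixI])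
@[simp] theorem mixI_one (a b : I) : mixI a b 1 = b := Subtype.ext (by simp [mixI])
@[simp] theorem mixI_zero_one (t : I) : mixI 0 1 t = t := Subtype.ext (by simp [mixI])
@[simp] theorem mixI_self (a t : I) : mixI a a t = a := Subtype.ext (by simp [mixI]; ring)

@[fun_prop] theorem continuous_mixI {Y : Type*} [TopologicalSpace Y] {a b t : Y → I}
    (ha : Continuous a) (hb : Continuous b) (ht : Continuous t) :
    Continuous fun y => mixI (a y) (b y) (t y) := by
  unfold mixI
  fun_prop

/-- The segment between two points of the unit square. -/
def segI (p q : I × I) : C(I, I × I) :=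
  ⟨fun t => (mixI p.1 q.1 t, mixI p.2 q.2 t), by fun_prop⟩

/-- The affine triangle in the unit interval. -/
def triI (a b c : I) (s : stdSimplex ℝ (Fin 3)) : I :=
  ⟨s 0 * a + s 1 * b + s 2 * c, by
    have h := (convex_Icc (0:ℝ) 1).sum_mem (t := Finset.univ) (w := s.1)
      (z := ![(a : ℝ), (b : ℝ), (c : ℝ)]) (fun i _ => s.2.1 i) s.2.2
      (by intro i _; fin_cases i; exacts [a.2, b.2, c.2])
    rw [Fin.sum_univ_three] at h
    exact h⟩

theorem continuous_triI (a b c : I) : Continuous (triI a b c) := by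
  unfold triI
  have : ∀ i, Continuous fun s : stdSimplex ℝ (Fin 3) => s i := fun i =>
    (continuous_apply i).comp continuous_subtype_val
  exact ((((this 0).mul_const _).add ((this 1).mul_const _)).add ((this 2).mul_const
      _)).subtype_mk _

theorem simplexEdge_apply (i : Fin 3) (t : I) (j : Fin 3) :
    simplexEdge i t j = (if i.succAbove 0 = j then (1 - (t:ℝ)) else 0) +
      if i.succAbove 1 = j then (t:ℝ) else 0 := by
  simp only [simplexEdge, ContinuousMap.coe_mk, stdSimplex.map_coe,
      FunOnFinite.linearMap_apply_apply]
  rw [Finset.sum_filter]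
  simp [Fin.sum_univ_two, stdSimplexHomeomorphUnitInterval, stdSimplexEquivIcc]
  rfl

theorem triI_edge (a b c t : I) : triI a b c (simplexEdge 0 t) = mixI b c t ∧
    triI a b c (simplexEdge 1 t) = mixI a c t ∧ triI a b c (simplexEdge 2 t) = mixI a b t := by
  refine ⟨?_, ?_, ?_⟩ <;> apply Subtype.ext <;>
  simp [triI, mixI, simplexEdge_apply, Fin.succAbove]

theorem cocycle_triangle {X : Type} [TopologicalSpace X] {φ : C(I, X) → ℚ}
    (hφ : φ ∈ pathCocycles X) (F : C(I × I, X)) (p q r : I × I) :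
    φ (F.comp (segI p q)) + φ (F.comp (segI q r)) = φ (F.comp (segI p r)) := by
  let T : C(stdSimplex ℝ (Fin 3), I × I) := ⟨fun s => (triI p.1 q.1 r.1 s, triI p.2 q.2 r.2 s),
    (continuous_triI _ _ _).prodMk (continuous_triI _ _ _)⟩
  have := hφ (F.comp T)
  rw [ContinuousMap.comp_assoc, ContinuousMap.comp_assoc, ContinuousMap.comp_assoc] at this
  have h0 : T.comp (simplexEdge 0) = segI q r := by
    ext t : 1; simp [T, segI, triI_edge]
  have h1 : T.comp (simplexEdge 1) = segI p r := by
    ext t : 1; simp [T, segI, triI_edge]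
  have h2 : T.comp (simplexEdge 2) = segI p q := by
    ext t : 1; simp [T, segI, triI_edge]
  rw [h0, h1, h2] at this
  linarith

theorem cocycle_square {X : Type} [TopologicalSpace X] {φ : C(I, X) → ℚ}
    (hφ : φ ∈ pathCocycles X) (H : C(I × I, X)) :
    φ (H.comp (segI (0, 0) (0, 1))) + φ (H.comp (segI (0, 1) (1, 1))) =
      φ (H.comp (segI (0, 0) (1, 0))) + φ (H.comp (segI (1, 0) (1, 1))) := by
  rw [cocycle_triangle hφ, cocycle_triangle hφ]

/-- The reparametrized restriction of a path to a subinterval. -/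
def subPath {X : Type} [TopologicalSpace X] (γ : C(I, X)) (a b : I) : C(I, X) :=
  γ.comp ⟨mixI a b, by fun_prop⟩

theorem subPath_apply {X : Type} [TopologicalSpace X] (γ : C(I, X)) (a b t : I) :
    subPath γ a b t = γ (mixI a b t) := rfl

theorem subPath_zero_one {X : Type} [TopologicalSpace X] (γ : C(I, X)) : subPath γ 0 1 = γ := by
  ext t; simp [subPath_apply]

theorem cocycle_subPath {X : Type} [TopologicalSpace X] {φ : C(I, X) → ℚ}
    (hφ : φ ∈ pathCocycles X) (γ : C(I, X)) (a b c : I) :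
    φ (subPath γ a b) + φ (subPath γ b c) = φ (subPath γ a c) :=
  cocycle_triangle hφ (γ.comp ⟨Prod.fst, continuous_fst⟩) (a, 0) (b, 0) (c, 0)

theorem cocycle_const {X : Type} [TopologicalSpace X] {φ : C(I, X) → ℚ}
    (hφ : φ ∈ pathCocycles X) (x : X) : φ (ContinuousMap.const I x) = 0 := by
  have := cocycle_subPath hφ (ContinuousMap.const I x) 0 0 0
  have h : subPath (ContinuousMap.const I x) 0 0 = ContinuousMap.const I x := rfl
  rw [h] at this
  linarith

/-- A homotopy from the identity to a map that is constant along paths kills `H¹`. -/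
theorem cocycle_exact_of_homotopy {X : Type} [TopologicalSpace X] {φ : C(I, X) → ℚ}
    (hφ : φ ∈ pathCocycles X) (H : C(X × I, X)) (h0 : ∀ x, H (x, 0) = x)
    (h1 : ∀ γ : C(I, X), ∀ t, H (γ t, 1) = H (γ 0, 1)) :
    φ ∈ LinearMap.range (pathCoboundary X) := by
  refine ⟨fun x => - φ ⟨fun t => H (x, t), by fun_prop⟩, funext fun γ => ?_⟩
  have := cocycle_square hφ (H.comp ⟨fun p : I × I => (γ p.1, p.2), by fun_prop⟩)
  have e1 : (H.comp ⟨fun p : I × I => (γ p.1, p.2), by fun_prop⟩).comp (segI (0, 1) (1, 1)) =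
      ContinuousMap.const I (H (γ 0, 1)) := by
    ext t; simp [segI, h1]
  have e2 : (H.comp ⟨fun p : I × I => (γ p.1, p.2), by fun_prop⟩).comp
      (segI (0, 0) (1, 0)) = γ := by
    ext t; simp [segI, h0]
  have e3 : (H.comp ⟨fun p : I × I => (γ p.1, p.2), by fun_prop⟩).comp (segI (0, 0) (0, 1)) =
      ⟨fun t => H (γ 0, t), by fun_prop⟩ := by
    ext t; simp [segI]
  have e4 : (H.comp ⟨fun p : I × I => (γ p.1, p.2), by fun_prop⟩).comp (segI (1, 0) (1, 1)) =
      ⟨fun t => H (γ 1, t), by fun_prop⟩ := by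
    ext t; simp [segI]
  rw [e1, e2, e3, e4, cocycle_const hφ] at this
  simp only [pathCoboundary, LinearMap.coe_mk, AddHom.coe_mk]
  linarith

/-- The rationals with the discrete topology. -/
def DiscreteRat : Type := ℚ

instance : AddCommGroup DiscreteRat := inferInstanceAs (AddCommGroup ℚ)
instance : TopologicalSpace DiscreteRat := ⊥
instance : DiscreteTopology DiscreteRat := ⟨rfl⟩

/-- The twisting of the two-chart bundle: charts are indexed by `Bool`. -/
def twist {X : Type} (g : X → DiscreteRat) : Bool → X → DiscreteRat
  | true, _ => 0
  | false, x => g x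

open scoped Classical in
/-- The covering with fibre `ℚ` defined by a locally constant function on an overlap. -/
def twistCore {X : Type} [TopologicalSpace X] {U V : Set X} (hU : IsOpen U) (hV : IsOpen V)
    (hUV : U ∪ V = Set.univ) (g : X → DiscreteRat) (hg : ContinuousOn g (U ∩ V)) :
    FiberBundleCore Bool X DiscreteRat where
  baseSet b := if b then U else V
  isOpen_baseSet b := by cases b <;> simpa
  indexAt x := decide (x ∈ U)
  mem_baseSet_at x := by
    by_cases h : x ∈ U
    · simp [h]
    · have : x ∈ U ∪ V := hUV ▸ Set.mem_univ x
      simpa [h] using this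
  coordChange i j x v := v + (twist g j x - twist g i x)
  coordChange_self i x _ v := by simp
  continuousOn_coordChange i j := by
    have key : ContinuousOn (fun p : X × DiscreteRat => g p.1) ((U ∩ V) ×ˢ Set.univ) :=
      hg.comp continuousOn_fst fun p hp => hp.1
    rcases i with _ | _ <;> rcases j with _ | _ <;> simp only [twist, sub_self, add_zero]
    · exact continuousOn_snd
    · refine continuousOn_snd.add (continuousOn_const.sub (key.mono ?_))
      rintro p ⟨⟨h1, h2⟩, -⟩
      simp_all
    · refine continuousOn_snd.add ((key.mono ?_).sub continuousOn_const)
      rintro p ⟨⟨h1, h2⟩, -⟩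
      simp_all
    · exact continuousOn_snd
  coordChange_comp i j k x _ v := by abel

theorem continuous_twistCore_translate {X : Type} [TopologicalSpace X] {U V : Set X}
    (hU : IsOpen U) (hV : IsOpen V) (hUV : U ∪ V = Set.univ) (g : X → DiscreteRat)
    (hg : ContinuousOn g (U ∩ V)) (q : DiscreteRat) :
    Continuous (show (twistCore hU hV hUV g hg).TotalSpace →
        (twistCore hU hV hUV g hg).TotalSpace from
      fun p => ⟨p.1, (show DiscreteRat from p.2) + q⟩) := by
  set Z := twistCore hU hV hUV g hg
  refine continuous_iff_continuousAt.2 fun p => ?_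
  have hopen : (Z.localTrivAt p.1).source ∈ nhds p :=
    (Z.localTrivAt p.1).open_source.mem_nhds (by simp)
  refine ((Z.localTrivAt p.1).toOpenPartialHomeomorph.continuousAt_iff_continuousAt_comp_left
    (f := fun p : Z.TotalSpace => (⟨p.1, (show DiscreteRat from p.2) + q⟩ : Z.TotalSpace)) ?_).2 ?_
  · exact hopen
  · have h1 : ContinuousAt (fun z => ((Z.localTrivAt p.1 z).1, (Z.localTrivAt p.1 z).2 + q)) p := by
      have := (Z.localTrivAt p.1).toOpenPartialHomeomorph.continuousAt (x := p) (by simp)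
      exact (continuousAt_fst.comp this).prodMk ((continuousAt_snd.comp this).add
          continuousAt_const)
    refine h1.congr (Eventually.of_forall fun z => ?_)
    refine Prod.ext rfl ?_
    change _ = (show DiscreteRat from z.2) + q + _
    change (show DiscreteRat from z.2) + _ + q = _
    abel

theorem exists_twistCocycle {X : Type} [TopologicalSpace X] {U V : Set X} (hU : IsOpen U)
    (hV : IsOpen V) (hUV : U ∪ V = Set.univ)
    (g : X → DiscreteRat) (hg : ContinuousOn g (U ∩ V)) : ∃ φ ∈ pathCocycles X,
    (∀ γ : C(I, X), (∀ t, γ t ∈ U) → φ γ = 0) ∧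
    (∀ γ : C(I, X), (∀ t, γ t ∈ V) → φ γ =
      (U.indicator (show X → ℚ from g)) (γ 0) - (U.indicator (show X → ℚ from g)) (γ 1)) := by
  classical
  set Z := twistCore hU hV hUV g hg with hZ
  have hbU : Z.baseSet true = U := by simp only [hZ, twistCore, if_true]
  have hbV : Z.baseSet false = V := by
    simp only [hZ, twistCore, Bool.false_eq_true, if_false]
  have cov : IsCoveringMap Z.proj := FiberBundle.isCoveringMap
  let lift (γ : C(I, X)) : C(I, Z.TotalSpace) := cov.liftPath γ ⟨γ 0, (0 : DiscreteRat)⟩ rfl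
  let φ (γ : C(I, X)) : DiscreteRat := (lift γ 1).2
  have hφ : ∀ (γ : C(I, X)) (Γ : C(I, Z.TotalSpace)), Z.proj ∘ Γ = γ →
      φ γ = (show DiscreteRat from (Γ 1).2) - (show DiscreteRat from (Γ 0).2) := by
    intro γ Γ h
    let Γ' : C(I, Z.TotalSpace) := ⟨_, (continuous_twistCore_translate hU hV hUV g hg
      (-(show DiscreteRat from (Γ 0).2))).comp Γ.continuous⟩
    have : Γ' = lift γ := by
      refine (cov.eq_liftPath_iff' _).2 ⟨?_, ?_⟩
      · rw [← h]; rfl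
      · change Bundle.TotalSpace.mk _ _ = Bundle.TotalSpace.mk _ _
        have e : (Γ 0).proj = γ 0 := congrFun h 0
        have e2 : (show DiscreteRat from (Γ 0).2) + -(show DiscreteRat from (Γ 0).2) = 0 := by abel
        rw [e2, e]
    have h1 : φ γ = (show DiscreteRat from (Γ' 1).2) := by rw [this]
    rw [h1, sub_eq_add_neg]
    rfl
  refine ⟨φ, ?_, ?_, ?_⟩
  · intro τ
    let H : C(I × stdSimplex ℝ (Fin 3),
        X) := τ.comp ⟨fun p => ⟨(1 - (p.1 : ℝ)) • (stdSimplex.vertex (S := ℝ) (0 : Fin 3)).1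
      + (p.1 : ℝ) • p.2.1, convex_stdSimplex ℝ (Fin 3) (stdSimplex.vertex (S := ℝ) (0 :
          Fin 3)).2 p.2.2
        (sub_nonneg.2 p.1.2.2) p.1.2.1 (by ring)⟩, by fun_prop⟩
    let x0 := τ (stdSimplex.vertex (S := ℝ) (0 : Fin 3))
    have H0 : ∀ a, H (0, a) = Z.proj (ContinuousMap.const (stdSimplex ℝ (Fin 3)) (⟨x0,
        (0 : DiscreteRat)⟩ : Z.TotalSpace) a) := by
      intro a
      refine congrArg τ (Subtype.ext ?_)
      simp
    let K := cov.liftHomotopy H (ContinuousMap.const _ (⟨x0, (0 : DiscreteRat)⟩ : Z.TotalSpace)) H0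
    have hK : Z.proj ∘ K = H := cov.liftHomotopy_lifts _ _ _
    let S : C(stdSimplex ℝ (Fin 3), Z.TotalSpace) := K.comp ⟨fun a => (1, a), by fun_prop⟩
    have hS : ∀ a, Z.proj (S a) = τ a := by
      intro a
      refine (congrFun hK (1, a)).trans (congrArg τ (Subtype.ext ?_))
      simp
    have e : ∀ i, φ (τ.comp (simplexEdge i)) = (show DiscreteRat from (S (simplexEdge i 1)).2) -
        (show DiscreteRat from (S (simplexEdge i 0)).2) := fun i =>
      hφ _ (S.comp (simplexEdge i)) (funext fun t => hS _)
    have v1 : simplexEdge 2 0 = simplexEdge 1 0 := stdSimplex.ext (funext fun j => by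
      fin_cases j <;> simp [simplexEdge_apply, Fin.succAbove])
    have v2 : simplexEdge 2 1 = simplexEdge 0 0 := stdSimplex.ext (funext fun j => by
      fin_cases j <;> simp [simplexEdge_apply, Fin.succAbove])
    have v3 : simplexEdge 0 1 = simplexEdge 1 1 := stdSimplex.ext (funext fun j => by
      fin_cases j <;> simp [simplexEdge_apply, Fin.succAbove])
    change φ _ + φ _ = φ _
    rw [e, e, e, v1, v2, v3]
    abel
  · intro γ hγ
    let Γ : C(I, Z.TotalSpace) := ⟨fun t => (Z.localTriv true).toOpenPartialHomeomorph.symm (γ t,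
        (0 : DiscreteRat)), by
      refine (Z.localTriv true).toOpenPartialHomeomorph.continuousOn_symm.comp_continuous
          (by fun_prop) fun t => ?_
      exact ⟨(by rw [hbU]; exact hγ t), trivial⟩⟩
    have hz : ∀ t, (show DiscreteRat from (Γ t).2) = 0 := by
      intro t
      change (0 : DiscreteRat) + (twist g (decide (γ t ∈ U)) (γ t) - 0) = 0
      rw [decide_eq_true (hγ t)]
      simp [twist]
    have := hφ γ Γ (funext fun t => rfl)
    rw [hz, hz, sub_zero] at this
    exact this
  · intro γ hγ
    let Γ : C(I, Z.TotalSpace) := ⟨fun t => (Z.localTriv false).toOpenPartialHomeomorph.symm (γ t,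
        (0 : DiscreteRat)), by
      refine (Z.localTriv false).toOpenPartialHomeomorph.continuousOn_symm.comp_continuous
          (by fun_prop) fun t => ?_
      exact ⟨(by rw [hbV]; exact hγ t), trivial⟩⟩
    have hz : ∀ t, (show DiscreteRat from (Γ t).2) = - (U.indicator (show X → ℚ from g)) (γ t) := by
      intro t
      change (0 : DiscreteRat) + (twist g (decide (γ t ∈ U)) (γ t) - g (γ t)) = _
      by_cases h : γ t ∈ U
      · rw [decide_eq_true h, Set.indicator_of_mem h]
        exact (zero_add _).trans (zero_sub _)
      · rw [decide_eq_false h, Set.indicator_of_notMem h]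
        simp [twist]
        rfl
    have := hφ γ Γ (funext fun t => rfl)
    rw [hz, hz] at this
    refine this.trans ?_
    change (- _ - - _ : ℚ) = _
    ring

/-- `r` is a locally constant map on `U` whose fibres are exactly the path components of `U`. -/
structure IsComponentMap {X : Type} [TopologicalSpace X] (U : Set X) {ι : Type}
    [TopologicalSpace ι] (r : X → ι) : Prop where
  cont : ContinuousOn r U
  joined : ∀ x ∈ U, ∀ y ∈ U, r x = r y → JoinedIn U x y
  surj : ∀ i, ∃ x ∈ U, r x = i

/-- All cocycles of `X` are exact on paths in `U`. -/
def CocyclesExactOn {X : Type} [TopologicalSpace X] (U : Set X) : Prop :=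
  ∀ φ ∈ pathCocycles X, ∃ h : X → ℚ, ∀ γ : C(I, X), (∀ t, γ t ∈ U) → φ γ = h (γ 1) - h (γ 0)

theorem IsComponentMap.const_path {X : Type} [TopologicalSpace X] {U : Set X} {ι : Type}
    [TopologicalSpace ι] [DiscreteTopology ι] {r : X → ι} (hr : IsComponentMap U r)
    {γ : C(I, X)} (hγ : ∀ t, γ t ∈ U) (s t : I) : r (γ s) = r (γ t) :=
  PreconnectedSpace.constant inferInstance (hr.cont.comp_continuous γ.continuous hγ)

theorem IsComponentMap.exists_path {X : Type} [TopologicalSpace X] {U : Set X} {ι : Type}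
    [TopologicalSpace ι] {r : X → ι} (hr : IsComponentMap U r) :
    ∃ b : ι → X, (∀ i, b i ∈ U ∧ r (b i) = i) ∧ ∃ p : X → C(I, X), ∀ x ∈ U,
      (∀ t, p x t ∈ U) ∧ p x 0 = b (r x) ∧ p x 1 = x := by
  choose b hb using hr.surj
  have : ∀ x, ∃ p : C(I, X), x ∈ U → (∀ t, p t ∈ U) ∧ p 0 = b (r x) ∧ p 1 = x := by
    intro x
    by_cases hx : x ∈ U
    · obtain ⟨γ, hγ⟩ := hr.joined (b (r x)) (hb _).1 x hx (hb _).2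
      exact ⟨γ.toContinuousMap, fun _ => ⟨hγ, γ.source, γ.target⟩⟩
    · exact ⟨ContinuousMap.const _ x, fun h => absurd h hx⟩
  choose p hp using this
  exact ⟨b, hb, p, hp⟩

theorem cocycle_exact_of_cover {X : Type} [TopologicalSpace X] {U V : Set X} (hU : IsOpen U)
    (hV : IsOpen V) (hUV : U ∪ V = Set.univ) {φ : C(I, X) → ℚ} (hφ : φ ∈ pathCocycles X)
    (h : X → ℚ) (h1 : ∀ γ : C(I, X), (∀ t, γ t ∈ U) → φ γ = h (γ 1) - h (γ 0))
    (h2 : ∀ γ : C(I, X), (∀ t, γ t ∈ V) → φ γ = h (γ 1) - h (γ 0)) (γ : C(I, X)) :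
    φ γ = h (γ 1) - h (γ 0) := by
  obtain ⟨t, t0, tm, ⟨n, hn⟩, ht⟩ := exists_monotone_Icc_subset_open_cover_unitInterval
    (c := fun b : Bool => γ ⁻¹' (if b then U else V))
    (fun b => by
      cases b
      · simpa using hV.preimage γ.continuous
      · simpa using hU.preimage γ.continuous)
    (by
      intro s _
      have : γ s ∈ U ∪ V := hUV ▸ Set.mem_univ _
      rw [Set.mem_iUnion]
      rcases this with h | h
      exacts [⟨true, by simpa using h⟩, ⟨false, by simpa using h⟩])
  have key : ∀ k, φ (subPath γ 0 (t k)) = h (γ (t k)) - h (γ 0) := by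
    intro k
    induction k with
    | zero =>
      rw [t0]
      have : subPath γ 0 0 = ContinuousMap.const I (γ 0) := by ext s; simp [subPath_apply]
      rw [this, cocycle_const hφ, sub_self]
    | succ k ih =>
      rw [← cocycle_subPath hφ γ 0 (t k) (t (k+1)), ih]
      have hmem : ∀ s, mixI (t k) (t (k+1)) s ∈ Set.Icc (t k) (t (k+1)) := by
        intro s
        have h3 : (t k : ℝ) ≤ t (k+1) := tm (Nat.le_succ k)
        have h4 := s.2.1
        have h5 := s.2.2
        constructor <;> rw [← Subtype.coe_le_coe] <;> simp only [mixI] <;> nlinarith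
      have : φ (subPath γ (t k) (t (k+1))) = h (γ (t (k+1))) - h (γ (t k)) := by
        have e1 : subPath γ (t k) (t (k+1)) 1 = γ (t (k+1)) := by simp [subPath_apply]
        have e0 : subPath γ (t k) (t (k+1)) 0 = γ (t k) := by simp [subPath_apply]
        rw [← e1, ← e0]
        obtain ⟨b, hb⟩ := ht k
        cases b
        · exact h2 _ fun s => by simpa [subPath_apply] using hb (hmem s)
        · exact h1 _ fun s => by simpa [subPath_apply] using hb (hmem s)
      rw [this]; ring
  have := key n
  rwa [hn n le_rfl, subPath_zero_one] at this

theorem finrank_pathCohomology_mayerVietoris {X : Type} [TopologicalSpace X] [PathConnectedSpace X]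
    {U V : Set X}
    (hU : IsOpen U) (hV : IsOpen V) (hUV : U ∪ V = Set.univ)
    (eU : CocyclesExactOn U) (eV : CocyclesExactOn V)
    {ιU ιV ιW : Type} [TopologicalSpace ιU] [DiscreteTopology ιU] [Fintype ιU]
    [TopologicalSpace ιV] [DiscreteTopology ιV] [Fintype ιV]
    [TopologicalSpace ιW] [DiscreteTopology ιW] [Fintype ιW]
    {rU : X → ιU} {rV : X → ιV} {rW : X → ιW} (hrU : IsComponentMap U rU)
    (hrV : IsComponentMap V rV) (hrW : IsComponentMap (U ∩ V) rW) :
    Module.finrank ℚ (pathCocycles X ⧸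
        (LinearMap.range (pathCoboundary X)).comap (pathCocycles X).subtype)
      + Fintype.card ιU + Fintype.card ιV = Fintype.card ιW + 1 := by
  classical
  obtain ⟨bU, hbU, pU, hpU⟩ := hrU.exists_path
  obtain ⟨bV, hbV, pV, hpV⟩ := hrV.exists_path
  obtain ⟨bW, hbW, pW, hpW⟩ := hrW.exists_path
  have mem : ∀ x, x ∉ U → x ∈ V := fun x hx =>
    ((hUV ▸ Set.mem_univ x : x ∈ U ∪ V)).resolve_left hx
  have rUW : ∀ x ∈ U ∩ V, rU (bW (rW x)) = rU x := by
    intro x hx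
    obtain ⟨h1, h2, h3⟩ := hpW x hx
    rw [← h2, hrU.const_path (fun t => (h1 t).1) 0 1, h3]
  have rVW : ∀ x ∈ U ∩ V, rV (bW (rW x)) = rV x := by
    intro x hx
    obtain ⟨h1, h2, h3⟩ := hpW x hx
    rw [← h2, hrV.const_path (fun t => (h1 t).2) 0 1, h3]
  -- the restriction map on locally constant functions
  let A : ((ιU → ℚ) × (ιV → ℚ)) →ₗ[ℚ] (ιW → ℚ) :=
    { toFun := fun ab w => ab.1 (rU (bW w)) - ab.2 (rV (bW w))
      map_add' := by intro a b; ext; simp; ring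
      map_smul' := by intro a b; ext; simp; ring }
  have hkerA : Module.finrank ℚ (LinearMap.ker A) = 1 := by
    refine finrank_eq_one (⟨(fun _ => 1, fun _ => 1), by ext; simp [A]⟩ : LinearMap.ker A) ?_ ?_
    · intro h
      have h' := congrArg Subtype.val h
      obtain ⟨x⟩ := (inferInstance : Nonempty X)
      by_cases hx : x ∈ U
      · exact one_ne_zero (congrFun (congrArg Prod.fst h') (rU x))
      · exact one_ne_zero (congrFun (congrArg Prod.snd h') (rV x))
    · rintro ⟨⟨a, b⟩, hab⟩
      have hab' : ∀ x ∈ U ∩ V, a (rU x) = b (rV x) := by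
        intro x hx
        have := congrFun (LinearMap.mem_ker.1 hab) (rW x)
        simp only [A, LinearMap.coe_mk, AddHom.coe_mk, Pi.zero_apply, rUW x hx, rVW x hx] at this
        linarith
      let k : X → ℚ := fun x => if x ∈ U then a (rU x) else b (rV x)
      have kU : ∀ x ∈ U, k x = a (rU x) := fun x hx => if_pos hx
      have kV : ∀ x ∈ V, k x = b (rV x) := fun x hx => by
        by_cases h : x ∈ U
        · rw [kU x h, hab' x ⟨h, hx⟩]
        · exact if_neg h
      have hk : ∀ γ : C(I, X), k (γ 1) = k (γ 0) := by
        intro γ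
        have := cocycle_exact_of_cover hU hV hUV (Submodule.zero_mem (pathCocycles X)) k
          (fun γ hγ => by rw [kU _ (hγ _), kU _ (hγ _), hrU.const_path hγ 0 1, sub_self]; rfl)
          (fun γ hγ => by rw [kV _ (hγ _), kV _ (hγ _), hrV.const_path hγ 0 1, sub_self]; rfl) γ
        rw [Pi.zero_apply] at this
        linarith
      have hk' : ∀ x y, k x = k y := by
        intro x y
        obtain ⟨γ⟩ := PathConnectedSpace.joined y x
        have := hk γ.toContinuousMap
        simpa using this
      obtain ⟨x0⟩ := (inferInstance : Nonempty X)
      refine ⟨k x0, Subtype.ext (Prod.ext (funext fun i => ?_) (funext fun i => ?_))⟩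
      · have := hk' x0 (bU i)
        rw [kU _ (hbU i).1, (hbU i).2] at this
        simp [this]
      · have := hk' x0 (bV i)
        rw [kV _ (hbV i).1, (hbV i).2] at this
        simp [this]
  have hrangeA := A.finrank_range_add_finrank_ker
  rw [hkerA, Module.finrank_prod, Module.finrank_fintype_fun_eq_card,
    Module.finrank_fintype_fun_eq_card] at hrangeA
  -- primitives on `U` and `V`
  have primU : ∀ φ ∈ pathCocycles X, ∀ γ : C(I, X), (∀ t, γ t ∈ U) →
      φ γ = φ (pU (γ 1)) - φ (pU (γ 0)) := by
    intro φ hφ γ hγ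
    obtain ⟨h, hh⟩ := eU φ hφ
    obtain ⟨a1, a2, a3⟩ := hpU _ (hγ 1)
    obtain ⟨b1, b2, b3⟩ := hpU _ (hγ 0)
    rw [hh _ hγ, hh _ a1, hh _ b1, a2, a3, b2, b3, hrU.const_path hγ 0 1]
    ring
  have primV : ∀ φ ∈ pathCocycles X, ∀ γ : C(I, X), (∀ t, γ t ∈ V) →
      φ γ = φ (pV (γ 1)) - φ (pV (γ 0)) := by
    intro φ hφ γ hγ
    obtain ⟨h, hh⟩ := eV φ hφ
    obtain ⟨a1, a2, a3⟩ := hpV _ (hγ 1)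
    obtain ⟨b1, b2, b3⟩ := hpV _ (hγ 0)
    rw [hh _ hγ, hh _ a1, hh _ b1, a2, a3, b2, b3, hrV.const_path hγ 0 1]
    ring
  let Φ : pathCocycles X →ₗ[ℚ] (ιW → ℚ) :=
    { toFun := fun φ w => φ.1 (pU (bW w)) - φ.1 (pV (bW w))
      map_add' := by intro a b; ext; simp; ring
      map_smul' := by intro a b; ext; simp; ring }
  let Ψ := (LinearMap.range A).mkQ ∘ₗ Φ
  have hker : LinearMap.ker Ψ =
      (LinearMap.range (pathCoboundary X)).comap (pathCocycles X).subtype := by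
    ext ⟨φ, hφ⟩
    rw [LinearMap.mem_ker, Submodule.mem_comap, LinearMap.comp_apply, Submodule.mkQ_apply,
      Submodule.Quotient.mk_eq_zero]
    constructor
    · rintro ⟨⟨a, b⟩, hab⟩
      have hab' : ∀ x ∈ U ∩ V, φ (pU x) - a (rU x) = φ (pV x) - b (rV x) := by
        intro x hx
        have h1 := congrFun hab (rW x)
        simp only [A, Φ, LinearMap.coe_mk, AddHom.coe_mk, rUW x hx, rVW x hx] at h1
        obtain ⟨a1, a2, a3⟩ := hpW x hx
        have h2 := primU φ hφ _ (fun t => (a1 t).1)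
        have h3 := primV φ hφ _ (fun t => (a1 t).2)
        rw [a2, a3] at h2 h3
        linarith
      let k : X → ℚ := fun x => if x ∈ U then φ (pU x) - a (rU x) else φ (pV x) - b (rV x)
      have kU : ∀ x ∈ U, k x = φ (pU x) - a (rU x) := fun x hx => if_pos hx
      have kV : ∀ x ∈ V, k x = φ (pV x) - b (rV x) := fun x hx => by
        by_cases h : x ∈ U
        · rw [kU x h, hab' x ⟨h, hx⟩]
        · exact if_neg h
      refine ⟨k, funext fun γ => ?_⟩
      refine (cocycle_exact_of_cover hU hV hUV hφ k ?_ ?_ γ).symm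
      · intro γ hγ
        rw [kU _ (hγ _), kU _ (hγ _), hrU.const_path hγ 0 1, primU φ hφ γ hγ]; ring
      · intro γ hγ
        rw [kV _ (hγ _), kV _ (hγ _), hrV.const_path hγ 0 1, primV φ hφ γ hγ]; ring
    · rintro ⟨h, hh⟩
      refine ⟨(fun i => - h (bU i), fun i => - h (bV i)), funext fun w => ?_⟩
      have e : ∀ γ, φ γ = h (γ 1) - h (γ 0) := fun γ => (congrFun hh γ).symm
      obtain ⟨a1, a2, a3⟩ := hpU _ (hbW w).1.1
      obtain ⟨b1, b2, b3⟩ := hpV _ (hbW w).1.2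
      simp only [A, Φ, LinearMap.coe_mk, AddHom.coe_mk, e, a2, a3, b2, b3]
      ring
  have hsurj : Function.Surjective Ψ := by
    intro q
    obtain ⟨g, rfl⟩ := Submodule.mkQ_surjective _ q
    obtain ⟨φ, hφ, f1, f2⟩ := exists_twistCocycle hU hV hUV
      (fun x => (show DiscreteRat from g (rW x)))
      ((continuous_of_discreteTopology (f :=
          fun w => (show DiscreteRat from g w))).comp_continuousOn hrW.cont)
    refine ⟨⟨φ, hφ⟩, ?_⟩
    rw [LinearMap.comp_apply]
    rw [Submodule.mkQ_apply, Submodule.mkQ_apply, Submodule.Quotient.eq]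
    refine ⟨(0, fun i => U.indicator (fun x => g (rW x)) (bV i)), funext fun w => ?_⟩
    obtain ⟨a1, a2, a3⟩ := hpU _ (hbW w).1.1
    obtain ⟨b1, b2, b3⟩ := hpV _ (hbW w).1.2
    have e1 := f1 _ a1
    have e2 := f2 _ b1
    rw [b2, b3, Set.indicator_of_mem (hbW w).1.1] at e2
    simp only [A, Φ, LinearMap.coe_mk, AddHom.coe_mk, Pi.sub_apply, e1, Pi.zero_apply]
    rw [e2, (hbW w).2]
    ring
  rw [← hker, (LinearMap.quotKerEquivOfSurjective Ψ hsurj).finrank_eq]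
  have := Submodule.finrank_quotient_add_finrank (LinearMap.range A)
  rw [Module.finrank_fintype_fun_eq_card] at this
  omega

theorem cocyclesExactOn_of_homotopy {X : Type} [TopologicalSpace X] {U : Set X}
    (H : C(U × I, U)) (h0 : ∀ x, H (x, 0) = x)
    (h1 : ∀ γ : C(I, U), ∀ t, H (γ t, 1) = H (γ 0, 1)) : CocyclesExactOn U := by
  classical
  intro φ hφ
  let ι : C(U, X) := ⟨Subtype.val, continuous_subtype_val⟩
  have hψ : (fun γ : C(I, U) => φ (ι.comp γ)) ∈ pathCocycles U := fun τ => hφ (ι.comp τ)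
  obtain ⟨h, hh⟩ := cocycle_exact_of_homotopy hψ H h0 h1
  refine ⟨fun x => if hx : x ∈ U then h ⟨x, hx⟩ else 0, fun γ hγ => ?_⟩
  have := congrFun hh ⟨fun t => ⟨γ t, hγ t⟩, by fun_prop⟩
  simp only [hγ, dif_pos]
  exact this.symm

theorem IsClosedMap.exists_fibre_splitting {E : Type} [TopologicalSpace E] {π : E → ℂ}
    (hcl : IsClosedMap π) {w : ℂ} {U : E → Set E} (hU : ∀ y, y ∈ U y ∧ IsOpen (U y))
    (hd : (π ⁻¹' {w}).PairwiseDisjoint U) {y : E} (hy : π y = w) {N : Set E}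
    (hN : N ∈ nhds y) :
    ∃ δ > 0, ∀ x, dist (π x) w < δ → (∃ z, π z = w ∧ x ∈ U z) ∧ (x ∈ U y → x ∈ N) := by
  have := hcl.eventually_nhds_fiber (p := fun x => (∃ z, π z = w ∧ x ∈ U z) ∧ (x ∈ U y → x ∈ N)) w
    (by
      intro z hz
      refine Filter.Eventually.and ?_ ?_
      · filter_upwards [(hU z).2.mem_nhds (hU z).1] with x hx using ⟨z, hz, hx⟩
      · by_cases h : z = y
        · subst h
          filter_upwards [hN] with x hx _ using hx
        · filter_upwards [(hU z).2.mem_nhds (hU z).1] with x hx hxy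
          exact absurd hxy (Set.disjoint_left.1 (hd hz hy h) hx))
  obtain ⟨δ, hδ, h⟩ := Metric.eventually_nhds_iff.1 this
  exact ⟨δ, hδ, fun x hx => h hx x rfl⟩

theorem subset_of_fibre_splitting {E : Type} [TopologicalSpace E] {π : E → ℂ} {w : ℂ}
    {U : E → Set E} (hU : ∀ y, y ∈ U y ∧ IsOpen (U y)) (hd : (π ⁻¹' {w}).PairwiseDisjoint U)
    {y : E} (hy : π y = w) {K : Set E} (hK : IsPreconnected K)
    (hcov : ∀ x ∈ K, ∃ z, π z = w ∧ x ∈ U z) {x : E} (hx : x ∈ K) (hxy : x ∈ U y) : K ⊆ U y := by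
  refine hK.subset_left_of_subset_union (hU y).2
    (isOpen_biUnion (s := {z | π z = w ∧ z ≠ y}) fun z _ => (hU z).2) ?_ ?_ ⟨x, hx, hxy⟩
  · rw [Set.disjoint_iUnion₂_right]
    exact fun z hz => hd hy hz.1 (Ne.symm hz.2)
  · intro a ha
    obtain ⟨z, hz, haz⟩ := hcov a ha
    by_cases h : z = y
    · subst h; exact Or.inl haz
    · exact Or.inr (Set.mem_biUnion (show z ∈ {z | π z = w ∧ z ≠ y} from ⟨hz, h⟩) haz)

theorem exists_puncturedRetract {E : Type} [TopologicalSpace E] {π : E → ℂ}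
    (hc : Continuous π) {W : Set ℂ} {w : ℂ} (hst : StarConvex ℝ w W)
    (hcov : IsCoveringMapOn π (W \ {w})) :
    ∃ G : C((π ⁻¹' (W \ {w})) × Set.Iio (1 : I), π ⁻¹' (W \ {w})),
      (∀ a, G (a, ⟨0, by simp⟩) = a) ∧
      ∀ a s, π (G (a, s)) = w + (1 - (s : I) : ℝ) * (π a - w) := by
  have cov := hcov.isCoveringMap_restrictPreimage
  have key : ∀ (t : I) (a : π ⁻¹' (W \ {w})) (s : Set.Iio (1 : I)),
      w + ((1 - t * (s : I) : ℝ) : ℂ) * (π a - w) ∈ W \ {w} := by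
    intro t a s
    have hs : ((s : I) : ℝ) < 1 := s.2
    have hts : (t : ℝ) * (s : I) ≤ (s : I) := mul_le_of_le_one_left (s : I).2.1 t.2.2
    have h0 : (0 : ℝ) ≤ t * (s : I) := mul_nonneg t.2.1 (s : I).2.1
    refine ⟨?_, ?_⟩
    · have := hst.add_smul_sub_mem a.2.1 (t := 1 - t * ((s : I) : ℝ)) (by linarith) (by linarith)
      simpa [Complex.real_smul] using this
    · have h1 : ((1 - t * (s : I) : ℝ) : ℂ) ≠ 0 := by
        have : (1 - t * (s : I) : ℝ) ≠ 0 := by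
          intro h
          linarith
        exact_mod_cast this
      have h2 : π a - w ≠ 0 := sub_ne_zero.2 a.2.2
      simpa using ⟨by simpa using h1, h2⟩
  let F : C(I × ((π ⁻¹' (W \ {w})) × Set.Iio (1 : I)), (W \ {w} : Set ℂ)) :=
    ⟨fun q => ⟨_, key q.1 q.2.1 q.2.2⟩, by
      refine Continuous.subtype_mk ?_ _
      have h1 : Continuous fun q : I × ((π ⁻¹' (W \ {w})) × Set.Iio (1 : I)) => π q.2.1 := by
        fun_prop
      fun_prop⟩
  let L := cov.liftHomotopy F ⟨fun q => q.1, by fun_prop⟩ (by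
    rintro ⟨a, s⟩; apply Subtype.ext
    change w + ((1 - (0 : I) * (s : I) : ℝ) : ℂ) * (π a - w) = π a
    simp)
  have hL : ∀ t a s, π (L (t, (a, s))) = w + ((1 - t * (s : I) : ℝ) : ℂ) * (π a - w) := by
    intro t a s
    exact congrArg Subtype.val (congrFun (cov.liftHomotopy_lifts F _ _) (t, (a, s)))
  refine ⟨⟨fun q => L (1, q), by fun_prop⟩, ?_, ?_⟩
  · intro a
    have := cov.eq_of_comp_eq (A := I) (g₁ := fun t => L (t, (a, ⟨0, by simp⟩)))
      (g₂ := fun _ => a) (by fun_prop) (by fun_prop) (by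
        funext t; apply Subtype.ext
        change π (L (t, (a, ⟨0, _⟩))) = π a
        rw [hL]; simp) 0 (cov.liftHomotopy_zero F _ _ _)
    exact congrFun this 1
  · intro a s
    change π (L (1, (a, s))) = _
    rw [hL]; simp

theorem exists_starRetract {E : Type} [TopologicalSpace E] [T2Space E] {π : E → ℂ}
    (hc : Continuous π) (hcl : IsClosedMap π) {W : Set ℂ} {w : ℂ}
    (hst : StarConvex ℝ w W) (hfin : (π ⁻¹' {w}).Finite)
    (hcov : IsCoveringMapOn π (W \ {w})) :
    ∃ H : C((π ⁻¹' W) × I, π ⁻¹' W), (∀ p, H (p, 0) = p) ∧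
      (∀ p s, π (H (p, s)) = w + (1 - s : ℝ) * (π p - w)) ∧
      ∀ p : π ⁻¹' W, π p = w → ∀ s, H (p, s) = p := by
  classical
  obtain ⟨G, hG0, hGπ⟩ := exists_puncturedRetract hc hst hcov
  obtain ⟨U, hU, hd⟩ := hfin.t2_separation
  have hdist : ∀ a s, dist (π (G (a, s))) w = (1 - (s : I) : ℝ) * dist (π a) w := by
    intro a s
    have : (0 : ℝ) ≤ 1 - (s : I) := sub_nonneg.2 (s : I).2.2
    rw [hGπ, dist_eq_norm, dist_eq_norm, add_sub_cancel_left, norm_mul, Complex.norm_real,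
      Real.norm_of_nonneg this]
  -- paths stay in one sheet
  have stay : ∀ (δ : ℝ), (∀ x, dist (π x) w < δ → ∃ z, π z = w ∧ x ∈ U z) →
      ∀ (a : π ⁻¹' (W \ {w})) (s₁ : Set.Iio (1 : I)) (y : E), π y = w →
        (1 - (s₁ : I) : ℝ) * dist (π a) w < δ → (G (a, s₁) : E) ∈ U y →
        ∀ s, s₁ ≤ s → (G (a, s) : E) ∈ U y := by
    intro δ hδ a s₁ y hy hs₁ hGy s hs
    have hK : IsPreconnected (Set.range fun s : Set.Ico (s₁ : I) 1 =>
        (G (a, ⟨s, s.2.2⟩) : E)) := by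
      have : PreconnectedSpace (Set.Ico (s₁ : I) 1) :=
        isPreconnected_iff_preconnectedSpace.1 isPreconnected_Ico
      exact isPreconnected_range (by fun_prop)
    refine subset_of_fibre_splitting hU hd hy hK ?_ ⟨⟨s₁, le_refl _, s₁.2⟩, rfl⟩ hGy
      ⟨⟨s, hs, s.2⟩, rfl⟩
    rintro _ ⟨s', rfl⟩
    apply hδ
    rw [hdist]
    refine lt_of_le_of_lt ?_ hs₁
    gcongr
    exact s'.2.1
  have near : ∀ (a : π ⁻¹' (W \ {w})) (δ : ℝ), 0 < δ → ∀ s₀ : I, s₀ < 1 → ∃ s₁ : Set.Iio (1 : I),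
      s₀ ≤ s₁ ∧ (1 - (s₁ : I) : ℝ) * dist (π a) w < δ := by
    intro a δ hδ s₀ hs₀
    have h1 : Tendsto (fun s : I => (1 - s : ℝ) * dist (π a) w) (nhdsWithin 1 (Set.Iio 1))
        (nhds ((1 - (1 : I) : ℝ) * dist (π a) w)) :=
      (Continuous.tendsto (by fun_prop) _).mono_left nhdsWithin_le_nhds
    have h2 : ∀ᶠ s : I in nhdsWithin 1 (Set.Iio 1), (1 - s : ℝ) * dist (π a) w < δ :=
      h1.eventually (gt_mem_nhds (by simpa using hδ))
    have h3 : ∀ᶠ s : I in nhdsWithin 1 (Set.Iio 1), s ∈ Set.Ico s₀ 1 :=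
      Ico_mem_nhdsLT hs₀
    have : (nhdsWithin (1 : I) (Set.Iio 1)).NeBot := nhdsLT_neBot_of_exists_lt ⟨0, by simp⟩
    obtain ⟨s, hs, hs'⟩ := (h2.and h3).exists
    exact ⟨⟨s, hs'.2⟩, hs'.1, hs⟩
  have hr : ∀ p : π ⁻¹' W, ∃ y, π y = w ∧ (π p = w → y = p) ∧
      ∀ h : π p ≠ w, ∃ s₀ : Set.Iio (1 : I), ∀ s, s₀ ≤ s → (G (⟨p, p.2, h⟩, s) : E) ∈ U y := by
    intro p
    by_cases h : π p = w
    · exact ⟨p, h, fun _ => rfl, fun h' => absurd h h'⟩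
    · have : ∃ δ > 0, ∀ x, dist (π x) w < δ → ∃ z, π z = w ∧ x ∈ U z := by
        have := hcl.eventually_nhds_fiber (p := fun x => ∃ z, π z = w ∧ x ∈ U z) w (by
          intro z hz
          filter_upwards [(hU z).2.mem_nhds (hU z).1] with x hx using ⟨z, hz, hx⟩)
        obtain ⟨δ, hδ, h⟩ := Metric.eventually_nhds_iff.1 this
        exact ⟨δ, hδ, fun x hx => h hx x rfl⟩
      obtain ⟨δ, hδ, hδ'⟩ := this
      obtain ⟨s₁, -, hs₁⟩ := near ⟨p, p.2, h⟩ δ hδ 0 (by simp)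
      obtain ⟨y, hy, hyU⟩ := hδ' _ ((hdist _ _).trans_lt hs₁)
      exact ⟨y, hy, fun h' => absurd h' h, fun _ => ⟨s₁, stay δ hδ' _ s₁ y hy hs₁ hyU⟩⟩
  choose r hrw hr1 hr2 using hr
  let H₀ : (π ⁻¹' W) × I → E := fun q =>
    if h : π q.1 ≠ w ∧ q.2 < 1 then G (⟨q.1, q.1.2, h.1⟩, ⟨q.2, h.2⟩) else r q.1
  have hH₀π : ∀ q, π (H₀ q) = w + (1 - q.2 : ℝ) * (π q.1 - w) := by
    intro q
    by_cases h : π q.1 ≠ w ∧ q.2 < 1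
    · simp only [H₀, dif_pos h, hGπ]
    · simp only [H₀, dif_neg h, hrw]
      rw [not_and_or, not_not, not_lt] at h
      rcases h with h | h
      · simp [h]
      · simp [le_antisymm q.2.2.2 h]
  have hH₀W : ∀ q, H₀ q ∈ π ⁻¹' W := by
    intro q
    rw [Set.mem_preimage, hH₀π]
    have := hst.add_smul_sub_mem q.1.2 (t := 1 - (q.2 : ℝ)) (by linarith [q.2.2.2])
      (by linarith [q.2.2.1])
    simpa [Complex.real_smul] using this
  have tail : ∀ (p : π ⁻¹' W) (h : π p ≠ w) (δ : ℝ),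
      (∀ x, dist (π x) w < δ → ∃ z, π z = w ∧ x ∈ U z) → ∀ (s₁ : Set.Iio (1 : I)) (y : E),
      π y = w → (1 - (s₁ : I) : ℝ) * dist (π p) w < δ → (G (⟨p, p.2, h⟩, s₁) : E) ∈ U y →
      ∀ s : I, s₁ ≤ s → H₀ (p, s) ∈ U y := by
    intro p h δ hδ s₁ y hy hs₁ hyU s hs
    by_cases h1 : s < 1
    · simp only [H₀, dif_pos (show π p ≠ w ∧ s < 1 from ⟨h, h1⟩)]
      exact stay δ hδ _ s₁ y hy hs₁ hyU ⟨s, h1⟩ hs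
    · simp only [H₀, dif_neg (show ¬ (π p ≠ w ∧ s < 1) from fun h => h1 h.2)]
      obtain ⟨s₀, hs₀⟩ := hr2 p h
      have hm := hs₀ (max s₀ s₁) (le_max_left _ _)
      have hm' := stay δ hδ _ s₁ y hy hs₁ hyU (max s₀ s₁) (le_max_right _ _)
      have : r p = y := by
        by_contra hne
        exact Set.disjoint_left.1 (hd (hrw p) hy hne) hm hm'
      rw [this]
      exact (hU y).1
  have hcont : Continuous H₀ := by
    rw [continuous_iff_continuousAt]
    rintro ⟨p, s⟩
    by_cases h : π p ≠ w ∧ s < 1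
    · have ho : IsOpen {q : (π ⁻¹' W) × I | π q.1 ≠ w ∧ q.2 < 1} := by
        refine IsOpen.inter ?_ ?_
        · exact isOpen_ne_fun (by fun_prop) (by fun_prop)
        · exact isOpen_lt (by fun_prop) (by fun_prop)
      refine ContinuousOn.continuousAt ?_ (ho.mem_nhds h)
      rw [continuousOn_iff_continuous_domRestrict]
      have : Continuous fun q : {q : (π ⁻¹' W) × I | π q.1 ≠ w ∧ q.2 < 1} =>
        (G (⟨q.1.1, q.1.1.2, q.2.1⟩, ⟨q.1.2, q.2.2⟩) : E) := by fun_prop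
      refine this.congr ?_
      intro q
      simp only [Set.domRestrict_apply, H₀, dif_pos (show π q.1.1 ≠ w ∧ q.1.2 < 1 from q.2)]
    · have hval : H₀ (p, s) = r p := by simp only [H₀, dif_neg h]
      intro N hN
      rw [hval] at hN
      obtain ⟨δ, hδ, hδ'⟩ := hcl.exists_fibre_splitting hU hd (hrw p) hN
      have hδ1 : ∀ x, dist (π x) w < δ → ∃ z, π z = w ∧ x ∈ U z := fun x hx => (hδ' x hx).1
      have hδ2 : ∀ q : (π ⁻¹' W) × I, (1 - q.2 : ℝ) * dist (π q.1) w < δ → H₀ q ∈ U (r p) →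
          H₀ q ∈ N := by
        intro q hq hq'
        refine (hδ' _ ?_).2 hq'
        have : (0 : ℝ) ≤ 1 - q.2 := sub_nonneg.2 q.2.2.2
        rwa [hH₀π, dist_eq_norm, add_sub_cancel_left, norm_mul, Complex.norm_real,
          Real.norm_of_nonneg this, ← dist_eq_norm]
      rw [mem_map]
      by_cases hp : π p = w
      · have e1 : ∀ᶠ q : (π ⁻¹' W) × I in nhds (p, s), dist (π q.1) w < δ := by
          apply (isOpen_lt (by fun_prop) (by fun_prop)).mem_nhds
          simpa [hp] using hδ
        have e2 : ∀ᶠ q : (π ⁻¹' W) × I in nhds (p, s), (q.1 : E) ∈ U (r p) := by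
          apply ((hU (r p)).2.preimage (by fun_prop :
            Continuous fun q : (π ⁻¹' W) × I => (q.1 : E))).mem_nhds
          change (p : E) ∈ U (r p)
          rw [hr1 p hp]; exact (hU p).1
        filter_upwards [e1, e2] with q hq1 hq2
        have hle : (1 - q.2 : ℝ) * dist (π q.1) w < δ := by
          refine lt_of_le_of_lt ?_ hq1
          exact mul_le_of_le_one_left dist_nonneg (by linarith [q.2.2.1])
        refine hδ2 q hle ?_
        by_cases hqw : π q.1 = w
        · have : H₀ q = q.1 := by
            simp only [H₀, dif_neg (show ¬ (π q.1 ≠ w ∧ q.2 < 1) from fun h => h.1 hqw)]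
            exact hr1 _ hqw
          rwa [this]
        · refine tail q.1 hqw δ hδ1 ⟨0, by simp⟩ _ (hrw p) (by simpa using hq1) ?_ q.2 q.2.2.1
          rw [hG0]; exact hq2
      · have hs : s = 1 := by
          by_contra hs
          exact h ⟨hp, lt_of_le_of_ne s.2.2 hs⟩
        subst hs
        obtain ⟨s₀, hs₀⟩ := hr2 p hp
        obtain ⟨s₁, h01, hs₁⟩ := near ⟨p, p.2, hp⟩ δ hδ s₀ s₀.2
        have ho : IsOpen {q : π ⁻¹' W | π q ≠ w} := isOpen_ne_fun (by fun_prop) (by fun_prop)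
        have hnear : ∀ᶠ q : π ⁻¹' W in nhds p, ∃ hq : π q ≠ w,
            (G (⟨q, q.2, hq⟩, s₁) : E) ∈ U (r p) := by
          have hop : IsOpen {q : {q : π ⁻¹' W | π q ≠ w} |
              (G (⟨q, q.1.2, q.2⟩, s₁) : E) ∈ U (r p)} :=
            (hU (r p)).2.preimage (by fun_prop)
          have := (ho.isOpenMap_subtype_val _ hop).mem_nhds ⟨⟨p, hp⟩, hs₀ s₁ h01, rfl⟩
          filter_upwards [this]
          rintro _ ⟨q, hq, rfl⟩
          exact ⟨q.2, hq⟩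
        have e1 : ∀ᶠ q : (π ⁻¹' W) × I in nhds (p, 1), (1 - (s₁ : I) : ℝ) * dist (π q.1) w < δ :=
          (isOpen_lt (by fun_prop) (by fun_prop)).mem_nhds hs₁
        have e2 : ∀ᶠ q : (π ⁻¹' W) × I in nhds (p, 1), (s₁ : I) < q.2 :=
          (isOpen_lt (by fun_prop) (by fun_prop)).mem_nhds s₁.2
        have e3 := (continuous_fst.tendsto (p, (1 : I))).eventually hnear
        filter_upwards [e1, e2, e3] with q hq1 hq2 hq3
        obtain ⟨hqw, hq⟩ := hq3
        refine hδ2 q (lt_of_le_of_lt ?_ hq1)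
          (tail q.1 hqw δ hδ1 s₁ _ (hrw p) hq1 hq q.2 hq2.le)
        gcongr
  refine ⟨⟨fun q => ⟨H₀ q, hH₀W q⟩, hcont.subtype_mk _⟩, ?_, fun p s => hH₀π (p, s), ?_⟩
  · intro p
    apply Subtype.ext
    change H₀ (p, 0) = p
    by_cases h : π p = w
    · simp only [H₀, dif_neg (show ¬ (π p ≠ w ∧ (0 : I) < 1) from fun h' => h'.1 h)]
      exact hr1 p h
    · simp only [H₀, dif_pos (show π p ≠ w ∧ (0 : I) < 1 from ⟨h, by simp⟩)]
      rw [hG0]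
  · intro p h s
    apply Subtype.ext
    change H₀ (p, s) = p
    simp only [H₀, dif_neg (show ¬ (π p ≠ w ∧ s < 1) from fun h' => h'.1 h)]
    exact hr1 p h

/-- Over a star-shaped region branched at most at its centre, a branched cover is a disjoint
union of contractible pieces indexed by the central fibre. -/
theorem exists_isComponentMap_of_starConvex {E : Type} [TopologicalSpace E] [T2Space E] {π : E → ℂ}
    (hc : Continuous π) (hcl : IsClosedMap π) {W : Set ℂ} {w : ℂ} (hw : w ∈ W)
    (hst : StarConvex ℝ w W) (hfin : (π ⁻¹' {w}).Finite)
    (hcov : IsCoveringMapOn π (W \ {w})) (hne : (π ⁻¹' {w}).Nonempty) :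
    CocyclesExactOn (π ⁻¹' W) ∧ ∃ r : E → π ⁻¹' {w}, IsComponentMap (π ⁻¹' W) r := by
  classical
  obtain ⟨H, H0, Hπ, Hw⟩ := exists_starRetract hc hcl hst hfin hcov
  have : Finite (π ⁻¹' {w}) := hfin
  have hH1 : ∀ p, (H (p, 1) : E) ∈ π ⁻¹' {w} := fun p => by simp [Hπ]
  let R : C(π ⁻¹' W, π ⁻¹' {w}) := ⟨fun p => ⟨H (p, 1), hH1 p⟩, by fun_prop⟩
  obtain ⟨e₀, he₀⟩ := hne
  have hWw : ∀ e : π ⁻¹' {w}, (e : E) ∈ π ⁻¹' W := fun e => by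
    have : π e = w := e.2
    simpa [this] using hw
  refine ⟨cocyclesExactOn_of_homotopy H H0 ?_, fun x => if h : x ∈ π ⁻¹' W then R ⟨x, h⟩ else
    ⟨e₀, he₀⟩, ?_, ?_, ?_⟩
  · intro γ t
    have : R (γ t) = R (γ 0) :=
      PreconnectedSpace.constant inferInstance (by fun_prop : Continuous fun t => R (γ t))
    exact Subtype.ext (congrArg (fun z : π ⁻¹' {w} => (z : E)) this)
  · rw [continuousOn_iff_continuous_domRestrict]
    refine R.continuous.congr fun x => ?_
    simp only [Set.domRestrict_apply, dif_pos x.2]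
  · intro x hx y hy hxy
    rw [dif_pos hx, dif_pos hy] at hxy
    have key : ∀ x (hx : x ∈ π ⁻¹' W), JoinedIn (π ⁻¹' W) x (R ⟨x, hx⟩ : E) := by
      intro x hx
      refine ⟨⟨⟨fun s => H (⟨x, hx⟩, s), by fun_prop⟩, ?_, rfl⟩, fun s => (H (⟨x, hx⟩, s)).2⟩
      simp [H0]
    have h2 := key y hy
    rw [← hxy] at h2
    exact (key x hx).trans h2.symm
  · intro e
    refine ⟨e, hWw e, ?_⟩
    rw [dif_pos (hWw e)]
    apply Subtype.ext
    exact congrArg (fun z : π ⁻¹' W => (z : E)) (Hw ⟨e, hWw e⟩ e.2 1)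

/-- Disjoint families of open sets: component maps and exactness glue. -/
theorem exists_isComponentMap_iUnion {X : Type} [TopologicalSpace X] {κ : Type} [TopologicalSpace κ]
    [DiscreteTopology κ]
    {V : κ → Set X} (hV : ∀ k, IsOpen (V k)) (hd : Pairwise fun i j => Disjoint (V i) (V j))
    {ι : κ → Type} [∀ k, TopologicalSpace (ι k)] [∀ k, DiscreteTopology (ι k)] {r : ∀ k, X → ι k}
    (hr : ∀ k, IsComponentMap (V k) (r k)) (he : ∀ k, CocyclesExactOn (V k))
    [Nonempty (Σ k, ι k)] :
    CocyclesExactOn (⋃ k, V k) ∧ ∃ R : X → Σ k, ι k, IsComponentMap (⋃ k, V k) R := by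
  classical
  have huniq : ∀ {x i j}, x ∈ V i → x ∈ V j → i = j := by
    intro x i j hi hj
    by_contra h
    exact Set.disjoint_left.1 (hd h) hi hj
  have hsub : ∀ γ : C(I, X), (∀ t, γ t ∈ ⋃ k, V k) → ∃ k, ∀ t, γ t ∈ V k := by
    intro γ hγ
    choose k hk using fun t => Set.mem_iUnion.1 (hγ t)
    have hc : Continuous k := by
      rw [continuous_iff_continuousAt]
      intro t
      refine (continuousAt_const (y := k t)).congr ?_
      filter_upwards [((hV (k t)).preimage γ.continuous).mem_nhds (hk t)] with s hs
      exact huniq hs (hk s)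
    refine ⟨k 0, fun t => ?_⟩
    rw [PreconnectedSpace.constant inferInstance hc (x := 0) (y := t)]
    exact hk t
  have : ∀ x : X, ∃ k, ∀ j, x ∈ V j → k = j := by
    intro x
    by_cases h : ∃ j, x ∈ V j
    · obtain ⟨k, hk⟩ := h
      exact ⟨k, fun j hj => huniq hk hj⟩
    · obtain ⟨k, _⟩ := (inferInstance : Nonempty (Σ k, ι k))
      exact ⟨k, fun j hj => absurd ⟨j, hj⟩ h⟩
  choose k hk using this
  refine ⟨?_, fun x => ⟨k x, r (k x) x⟩, ?_, ?_, ?_⟩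
  · intro φ hφ
    choose h hh using fun j => he j φ hφ
    refine ⟨fun x => h (k x) x, fun γ hγ => ?_⟩
    obtain ⟨j, hj⟩ := hsub γ hγ
    simp only [hk _ j (hj _)]
    exact hh j γ hj
  · intro x hx
    obtain ⟨j, hj⟩ := Set.mem_iUnion.1 hx
    refine ContinuousAt.continuousWithinAt ?_
    have h1 : ContinuousAt (fun x => (⟨j, r j x⟩ : Σ k, ι k)) x :=
      (continuous_sigmaMk.continuousAt).comp ((hr j).cont.continuousAt ((hV j).mem_nhds hj))
    refine h1.congr ?_
    filter_upwards [(hV j).mem_nhds hj] with y hy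
    rw [hk y j hy]
  · intro x hx y hy hxy
    obtain ⟨i, hi⟩ := Set.mem_iUnion.1 hx
    obtain ⟨j, hj⟩ := Set.mem_iUnion.1 hy
    change (⟨k x, r (k x) x⟩ : Σ k, ι k) = ⟨k y, r (k y) y⟩ at hxy
    rw [hk x i hi, hk y j hj] at hxy
    obtain rfl : i = j := congrArg Sigma.fst hxy
    have := eq_of_heq (Sigma.mk.inj hxy).2
    exact ((hr i).joined x hi y hj this).mono (Set.subset_iUnion V i)
  · rintro ⟨j, e⟩
    obtain ⟨x, hx, rfl⟩ := (hr j).surj e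
    exact ⟨x, Set.mem_iUnion.2 ⟨j, hx⟩, by rw [hk x j hx]⟩

/-- A point `c` off `B` from which distinct points of `B` are seen in non-parallel directions. -/
theorem exists_generic_centre (B : Finset ℂ) :
    ∃ c : ℂ, c ∉ B ∧ ∀ b ∈ B, ∀ b' ∈ B, b ≠ b' → ((b - c) / (b' - c)).im ≠ 0 := by
  classical
  let q : ℂ × ℂ → Polynomial ℝ := fun p =>
    Polynomial.C (p.2.im * p.1.re - p.2.re * p.1.im) +
      Polynomial.C (p.1.im - p.2.im) * Polynomial.X
      + Polynomial.C (p.2.re - p.1.re) * Polynomial.X ^ 2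
  have hq : ∀ p : ℂ × ℂ, p.1 ≠ p.2 → q p ≠ 0 := by
    intro p hp h
    apply hp
    have h1 := congrArg (fun r => Polynomial.coeff r 1) h
    have h2 := congrArg (fun r => Polynomial.coeff r 2) h
    simp only [q, Polynomial.coeff_add, Polynomial.coeff_C_mul, Polynomial.coeff_X_pow,
      Polynomial.coeff_X, Polynomial.coeff_C, Polynomial.coeff_zero] at h1 h2
    norm_num at h1 h2
    exact Complex.ext (by linarith) (by linarith)
  let Q : Polynomial ℝ := (∏ b ∈ B, (Polynomial.X - Polynomial.C b.re)) *
    ∏ p ∈ B ×ˢ B with p.1 ≠ p.2, q p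
  have hQ : Q ≠ 0 := by
    refine mul_ne_zero (Finset.prod_ne_zero_iff.2 fun b _ => Polynomial.X_sub_C_ne_zero _)
      (Finset.prod_ne_zero_iff.2 fun p hp => hq p (Finset.mem_filter.1 hp).2)
  obtain ⟨s, hs⟩ : ∃ s, Q.eval s ≠ 0 := by
    by_contra! h
    exact hQ (Polynomial.funext (by simpa using h))
  simp only [Q, Polynomial.eval_mul, Polynomial.eval_prod, mul_ne_zero_iff,
    Finset.prod_ne_zero_iff] at hs
  have hcB : (⟨s, s ^ 2⟩ : ℂ) ∉ B := fun h => hs.1 _ h (by simp)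
  refine ⟨⟨s, s ^ 2⟩, hcB, fun b hb b' hb' hne h => ?_⟩
  have := hs.2 (b, b') (by simp [hb, hb', hne])
  apply this
  have hne' : b' - ⟨s, s ^ 2⟩ ≠ 0 := sub_ne_zero.2 fun h => hcB (h ▸ hb')
  rw [Complex.div_im, ← sub_div, div_eq_zero_iff] at h
  have h := h.resolve_right (by simpa using hne')
  simp [q] at h ⊢
  linarith

theorem cone_disjoint_aux {ζ ρ : ℂ} {κ : ℝ} (h0 : 0 < κ) (h1 : κ ≤ 1)
    (hκ : κ * (2 * |ρ.re| + |ρ.im|) < |ρ.im|) (hζ : |ζ.im| < κ * (ζ.re - 1 / 2))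
    (hζ' : |(ζ * ρ).im| < κ * ((ζ * ρ).re - 1 / 2)) : False := by
  have hx : 0 < ζ.re := by
    have := abs_nonneg ζ.im
    have : 0 < κ * (ζ.re - 1 / 2) := by linarith
    have := (pos_iff_pos_of_mul_pos this).1 h0
    linarith
  set x := ζ.re
  have hy : |ζ.im| ≤ κ * x := by nlinarith
  rw [Complex.mul_im, Complex.mul_re] at hζ'
  have a1 : x * |ρ.im| - κ * x * |ρ.re| ≤ |x * ρ.im + ζ.im * ρ.re| := by
    have e1 : |x * ρ.im| ≤ |x * ρ.im + ζ.im * ρ.re| + |ζ.im * ρ.re| := by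
      have := abs_sub (x * ρ.im + ζ.im * ρ.re) (ζ.im * ρ.re)
      simpa using this
    rw [abs_mul, abs_mul, abs_of_pos hx] at e1
    have := mul_le_mul_of_nonneg_right hy (abs_nonneg ρ.re)
    linarith
  have a2 : x * ρ.re - ζ.im * ρ.im ≤ x * |ρ.re| + x * |ρ.im| := by
    have e1 := le_abs_self ρ.re
    have e2 : -(ζ.im * ρ.im) ≤ |ζ.im| * |ρ.im| := by
      rw [← abs_mul]; exact neg_le_abs _
    have e3 : |ζ.im| * |ρ.im| ≤ x * |ρ.im| :=
      mul_le_mul_of_nonneg_right (hy.trans (by nlinarith)) (abs_nonneg _)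
    nlinarith
  have a3 : κ * (x * ρ.re - ζ.im * ρ.im - 1 / 2) ≤ κ * (x * |ρ.re| + x * |ρ.im|) := by
    apply mul_le_mul_of_nonneg_left _ h0.le
    linarith
  have a4 : x * |ρ.im| < x * (κ * (2 * |ρ.re| + |ρ.im|)) := by
    nlinarith
  exact absurd (lt_of_mul_lt_mul_left a4 hx.le) (not_lt.2 hκ.le)

theorem convex_cone_aux (κ : ℝ) : Convex ℝ {ζ : ℂ | |ζ.im| < κ * (ζ.re - 1 / 2)} := by
  intro x hx y hy a b ha hb hab
  simp only [Set.mem_ofPred_eq, Complex.add_im, Complex.add_re, Complex.smul_im, Complex.smul_re,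
    smul_eq_mul, abs_lt] at *
  rcases ha.lt_or_eq with ha | rfl
  · have : b = 1 - a := by linarith
    subst this
    constructor <;> nlinarith
  · obtain rfl : b = 1 := by linarith
    simpa using hy

/-- First Betti number of a branched cover of the plane (Riemann-Hurwitz). -/
theorem finrank_pathCohomology_branchedCover {E : Type} [TopologicalSpace E] [T2Space E]
    [PathConnectedSpace E] {π : E → ℂ} (hc : Continuous π) (hcl : IsClosedMap π)
    (hfin : ∀ x, (π ⁻¹' {x}).Finite) (hne : ∀ x, (π ⁻¹' {x}).Nonempty) (B : Finset ℂ)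
    (hB : B.Nonempty) (hcov : IsCoveringMapOn π (B : Set ℂ)ᶜ) {d : ℕ}
    (hd : ∀ x ∉ B, (π ⁻¹' {x}).ncard = d) :
    Module.finrank ℚ (pathCocycles E ⧸
        (LinearMap.range (pathCoboundary E)).comap (pathCocycles E).subtype)
      + d + ∑ b ∈ B, (π ⁻¹' {b}).ncard = B.card * d + 1 := by
  classical
  obtain ⟨c, hcB, hgen⟩ := exists_generic_centre B
  have hbc : ∀ b ∈ B, b - c ≠ 0 := fun b hb => sub_ne_zero.2 fun h => hcB (h ▸ hb)
  obtain ⟨κ, hκ1, hκ0, hκ⟩ : ∃ κ : ℝ, κ ≤ 1 ∧ 0 < κ ∧ ∀ p : B × B, p.1 ≠ p.2 →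
      κ * (2 * |((p.1 - c) / (p.2 - c) : ℂ).re| + |((p.1 - c) / (p.2 - c) : ℂ).im|)
        < |((p.1 - c) / (p.2 - c) : ℂ).im| := by
    have h1 : ∀ᶠ κ : ℝ in nhdsWithin 0 (Set.Ioi 0), κ ≤ 1 :=
      eventually_nhdsWithin_of_eventually_nhds (Iic_mem_nhds one_pos)
    have h2 : ∀ᶠ κ : ℝ in nhdsWithin 0 (Set.Ioi 0), 0 < κ := self_mem_nhdsWithin
    have h3 : ∀ᶠ κ : ℝ in nhdsWithin 0 (Set.Ioi 0), ∀ p : B × B, p.1 ≠ p.2 →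
      κ * (2 * |((p.1 - c) / (p.2 - c) : ℂ).re| + |((p.1 - c) / (p.2 - c) : ℂ).im|)
        < |((p.1 - c) / (p.2 - c) : ℂ).im| := by
      rw [eventually_all]
      intro p
      by_cases hp : p.1 = p.2
      · simp [hp]
      · refine eventually_nhdsWithin_of_eventually_nhds ?_
        have hpos : 0 < |((p.1 - c) / (p.2 - c) : ℂ).im| := abs_pos.2
          (hgen _ p.1.2 _ p.2.2 fun h => hp (Subtype.ext h))
        have := (isOpen_lt (f := fun κ : ℝ =>
          κ * (2 * |((p.1 - c) / (p.2 - c) : ℂ).re| + |((p.1 - c) / (p.2 - c) : ℂ).im|))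
          (g := fun _ => |((p.1 - c) / (p.2 - c) : ℂ).im|) (by fun_prop) (by fun_prop)).mem_nhds
          (x := 0) (by simpa using hpos)
        filter_upwards [this] with κ hκ _ using hκ
    obtain ⟨κ, h1, h2, h3⟩ := (h1.and (h2.and h3)).exists
    exact ⟨κ, h1, h2, h3⟩
  let ζ : B → ℂ → ℂ := fun b z => (z - c) / (b - c)
  have hζc : ∀ b, Continuous (ζ b) := fun b => by fun_prop
  have hζaff : ∀ b (x y : ℂ) (s t : ℝ),
      s + t = 1 → ζ b (s • x + t • y) = s • ζ b x + t • ζ b y := by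
    intro b x y s t hst
    have : (t : ℂ) = 1 - s := by
      rw [← Complex.ofReal_one, ← hst]; push_cast; ring
    simp only [ζ, Complex.real_smul, this]
    ring
  have hζb : ∀ b : B, ζ b b = 1 := fun b => div_self (hbc b b.2)
  have hζ0 : ∀ b : B, ζ b c = 0 := fun b => by simp [ζ]
  let Cone : B → Set ℂ := fun b => {z | |(ζ b z).im| < κ * ((ζ b z).re - 1 / 2)}
  let Ray : B → Set ℂ := fun b => {z | (ζ b z).im = 0 ∧ 1 ≤ (ζ b z).re}
  have hRay : ∀ b, IsClosed (Ray b) := fun b =>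
    (isClosed_eq (f := fun z => (ζ b z).im) (g := fun _ => 0) (by fun_prop) (by fun_prop)).inter
      (isClosed_le (f := fun _ => 1) (g := fun z => (ζ b z).re) (by fun_prop) (by fun_prop))
  have hRC : ∀ b, Ray b ⊆ Cone b := by
    intro b z hz
    change |(ζ b z).im| < κ * ((ζ b z).re - 1 / 2)
    rw [hz.1, abs_zero]
    exact mul_pos hκ0 (by linarith [hz.2])
  have hbR : ∀ b : B, (b : ℂ) ∈ Ray b := fun b => by simp [Ray, hζb]
  have hConeO : ∀ b, IsOpen (Cone b) := fun b => isOpen_lt (by fun_prop) (by fun_prop)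
  have hConeD : Pairwise fun i j => Disjoint (Cone i) (Cone j) := by
    intro i j hij
    rw [Set.disjoint_left]
    intro z hi hj
    refine cone_disjoint_aux hκ0 hκ1 (hκ (i, j) hij) hi ?_
    have : ζ i z * ((i - c) / (j - c)) = ζ j z := by
      have := hbc i i.2
      have := hbc j j.2
      simp only [ζ]; field_simp
    rw [this]; exact hj
  have hConeX : ∀ b, Convex ℝ (Cone b) := by
    intro b x hx y hy s t hs ht hst
    have := convex_cone_aux κ hx hy hs ht hst
    rw [← hζaff b x y s t hst] at this
    exact this
  let U : Set ℂ := (⋃ b, Ray b)ᶜ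
  have hUO : IsOpen U := (isClosed_iUnion_of_finite hRay).isOpen_compl
  have hUB : ∀ z ∈ U, z ∉ B := fun z hz hzB => hz (Set.mem_iUnion.2 ⟨⟨z, hzB⟩, hbR _⟩)
  have hcU : c ∈ U := by
    simp only [U, Set.mem_compl_iff, Set.mem_iUnion, not_exists]
    intro b hb
    have := hb.2
    rw [hζ0] at this
    norm_num at this
  have hUstar : StarConvex ℝ c U := by
    intro z hz s t hs ht hst hmem
    obtain ⟨b, hb⟩ := Set.mem_iUnion.1 hmem
    apply hz
    refine Set.mem_iUnion.2 ⟨b, ?_⟩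
    have h1 := hb.1
    have h2 := hb.2
    rw [hζaff b c z s t hst, hζ0] at h1 h2
    simp at h1 h2
    have ht0 : t ≠ 0 := by rintro rfl; norm_num at h2
    refine ⟨h1.resolve_left ht0, ?_⟩
    have htpos : 0 < t := lt_of_le_of_ne ht (Ne.symm ht0)
    nlinarith
  have hConeB : ∀ b : B, ∀ z ∈ Cone b, z ∈ B → z = b := by
    intro b z hz hzB
    by_contra h
    exact Set.disjoint_left.1 (hConeD (i := b) (j := ⟨z, hzB⟩) fun h' => h (by rw [h'])) hz
      (hRC _ (hbR ⟨z, hzB⟩))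
  let m : B → ℂ := fun b => c + (3 / 4 : ℝ) • (b - c)
  have hm : ∀ b, ζ b (m b) = (3 / 4 : ℝ) := by
    intro b
    have := hbc b b.2
    simp only [ζ, m, Complex.real_smul, add_sub_cancel_left]
    field_simp
  let W : B → Set ℂ := fun b => U ∩ Cone b
  have hWmem : ∀ b z, z ∈ Cone b → z ∉ Ray b → z ∈ W b := by
    intro b z hz hzR
    refine ⟨fun h => ?_, hz⟩
    obtain ⟨b', hb'⟩ := Set.mem_iUnion.1 h
    by_cases hbb : b = b'
    · subst hbb; exact hzR hb'
    · exact Set.disjoint_left.1 (hConeD hbb) hz (hRC _ hb')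
  have hmC : ∀ b, m b ∈ Cone b := by
    intro b
    change |(ζ b (m b)).im| < κ * ((ζ b (m b)).re - 1 / 2)
    rw [hm, Complex.ofReal_im, Complex.ofReal_re, abs_zero]
    exact mul_pos hκ0 (by norm_num)
  have hmW : ∀ b, m b ∈ W b := by
    intro b
    refine hWmem b _ (hmC b) fun h => ?_
    have := h.2
    rw [hm, Complex.ofReal_re] at this
    norm_num at this
  have hWstar : ∀ b, StarConvex ℝ (m b) (W b) := by
    intro b z hz s t hs ht hst
    refine hWmem b _ (hConeX b (hmC b) hz.2 hs ht hst) fun h => ?_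
    have h1 := h.1
    have h2 := h.2
    rw [hζaff b _ z s t hst, hm] at h1 h2
    simp at h1 h2
    have hs1 : s = 1 - t := by linarith
    have ht0 : t ≠ 0 := by rintro rfl; norm_num [hs1] at h2
    refine hz.1 (Set.mem_iUnion.2 ⟨b, h1.resolve_left ht0, ?_⟩)
    have htpos : 0 < t := lt_of_le_of_ne ht (Ne.symm ht0)
    nlinarith
  have covU : IsCoveringMapOn π (U \ {c}) := hcov.mono fun z hz => hUB z hz.1
  have covV : ∀ b : B, IsCoveringMapOn π (Cone b \ {(b : ℂ)}) := fun b =>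
    hcov.mono fun z hz hzB => hz.2 (hConeB b z hz.1 hzB)
  have covW : ∀ b, IsCoveringMapOn π (W b \ {m b}) := fun b =>
    hcov.mono fun z hz => hUB z hz.1.1
  obtain ⟨eU, rU, hrU⟩ :=
      exists_isComponentMap_of_starConvex hc hcl hcU hUstar (hfin c) covU (hne c)
  have hV := fun b : B => exists_isComponentMap_of_starConvex hc hcl (hRC _ (hbR b))
    ((hConeX b).starConvex (hRC _ (hbR b))) (hfin b) (covV b) (hne b)
  have hW := fun b : B => exists_isComponentMap_of_starConvex hc hcl (hmW b) (hWstar b)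
    (hfin (m b)) (covW b) (hne (m b))
  choose eV rV hrV using hV
  choose eW rW hrW using hW
  have : ∀ x, Finite (π ⁻¹' {x}) := hfin
  have : ∀ x, Fintype (π ⁻¹' {x}) := fun x => Fintype.ofFinite _
  obtain ⟨b₀, hb₀⟩ := hB
  have : Nonempty (Σ b : B, π ⁻¹' {(b : ℂ)}) :=
    ⟨⟨⟨b₀, hb₀⟩, (hne b₀).some, (hne b₀).some_mem⟩⟩
  have : Nonempty (Σ b : B, π ⁻¹' {m b}) :=
    ⟨⟨⟨b₀, hb₀⟩, (hne _).some, (hne _).some_mem⟩⟩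
  obtain ⟨eV', rV', hrV'⟩ := exists_isComponentMap_iUnion (fun b => (hConeO b).preimage hc)
    (fun i j hij => (hConeD hij).preimage π) hrV eV
  obtain ⟨eW', rW', hrW'⟩ := exists_isComponentMap_iUnion
    (fun b => (hUO.inter (hConeO b)).preimage hc)
    (fun i j hij => ((hConeD hij).mono Set.inter_subset_right Set.inter_subset_right).preimage π)
    hrW eW
  have hcap : π ⁻¹' U ∩ ⋃ b, π ⁻¹' Cone b = ⋃ b, π ⁻¹' W b := by
    rw [Set.inter_iUnion]; rfl
  have hcup : π ⁻¹' U ∪ ⋃ b, π ⁻¹' Cone b = Set.univ := by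
    rw [Set.eq_univ_iff_forall]
    intro x
    by_cases h : π x ∈ U
    · exact Or.inl h
    · obtain ⟨b, hb⟩ := Set.mem_iUnion.1 (Set.notMem_compl_iff.1 h)
      exact Or.inr (Set.mem_iUnion.2 ⟨b, hRC b hb⟩)
  rw [← hcap] at hrW'
  have key := finrank_pathCohomology_mayerVietoris (hUO.preimage hc)
    (isOpen_iUnion fun b => (hConeO b).preimage hc) hcup eU eV' hrU hrV' hrW'
  rw [Fintype.card_sigma, Fintype.card_sigma] at key
  have hcard : ∀ x, Fintype.card (π ⁻¹' {x}) = (π ⁻¹' {x}).ncard := fun x => by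
    rw [← Nat.card_coe_set_eq, Nat.card_eq_fintype_card]
  simp only [hcard] at key
  rw [hd c hcB, Finset.sum_congr rfl fun b _ => hd (m b) (hUB _ (hmW b).1)] at key
  rw [Finset.sum_coe_sort B (fun b => (π ⁻¹' {b}).ncard)] at key
  simpa using key

/-- The affine plane curve cut out by a bivariate polynomial. -/
abbrev PlaneCurve (P : Polynomial (Polynomial ℂ)) : Type :=
  {p : ℂ × ℂ // P.evalEval p.1 p.2 = 0}

theorem evalEval_eq_sum (P : Polynomial (Polynomial ℂ)) (x y : ℂ) :
    P.evalEval x y = ∑ n ∈ P.support, (P.coeff n).eval x * y ^ n := by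
  rw [← Polynomial.map_evalRingHom_eval, Polynomial.eval_map, Polynomial.eval₂_eq_sum,
    Polynomial.sum_def]
  rfl

theorem contDiff_evalEval (P : Polynomial (Polynomial ℂ)) :
    ContDiff ℂ 1 fun p : ℂ × ℂ => P.evalEval p.1 p.2 := by
  simp only [evalEval_eq_sum]
  refine ContDiff.sum fun n _ => ContDiff.mul ?_ (contDiff_snd.pow n)
  have h : ContDiff ℂ 1 fun x : ℂ => (P.coeff n).eval x := by
    simp only [Polynomial.eval_eq_sum, Polynomial.sum_def]
    fun_prop
  exact h.comp contDiff_fst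

theorem hasDerivAt_evalEval_right (P : Polynomial (Polynomial ℂ)) (x y : ℂ) :
    HasDerivAt (fun y => P.evalEval x y) (P.derivative.evalEval x y) y := by
  simp only [← Polynomial.map_evalRingHom_eval]
  rw [← Polynomial.derivative_map]
  exact Polynomial.hasDerivAt _ _

namespace PlaneCurve

variable {P : Polynomial (Polynomial ℂ)}

theorem continuous_fst : Continuous fun p : PlaneCurve P => p.1.1 := by fun_prop

theorem norm_snd_le (hP : P.Monic) (p : PlaneCurve P) :
    ‖p.1.2‖ ≤ 1 + ∑ n ∈ Finset.range P.natDegree, ‖(P.coeff n).eval p.1.1‖ := by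
  obtain ⟨⟨x, y⟩, hp⟩ := p
  change P.evalEval x y = 0 at hp
  change ‖y‖ ≤ 1 + ∑ n ∈ Finset.range P.natDegree, ‖(P.coeff n).eval x‖
  by_contra! hlt
  set S := ∑ n ∈ Finset.range P.natDegree, ‖(P.coeff n).eval x‖
  have hS : 0 ≤ S := Finset.sum_nonneg fun _ _ => norm_nonneg _
  have h1 : 1 ≤ ‖y‖ := by linarith
  have hexp : y ^ P.natDegree = -∑ n ∈ Finset.range P.natDegree, (P.coeff n).eval x * y ^ n := by
    have : P.evalEval x y = ∑ n ∈ Finset.range (P.natDegree + 1), (P.coeff n).eval x * y ^ n := by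
      rw [← Polynomial.map_evalRingHom_eval, Polynomial.eval_map, Polynomial.eval₂_eq_sum_range]
      rfl
    rw [hp, Finset.sum_range_succ, hP.coeff_natDegree] at this
    simp only [Polynomial.eval_one, one_mul] at this
    linear_combination -this
  rcases Nat.eq_zero_or_pos P.natDegree with h0 | h0
  · rw [h0] at hexp; simp at hexp
  have hle : ‖y‖ ^ P.natDegree ≤ S * ‖y‖ ^ (P.natDegree - 1) := by
    rw [← norm_pow, hexp, norm_neg]
    refine (norm_sum_le _ _).trans ?_
    rw [Finset.sum_mul]
    refine Finset.sum_le_sum fun n hn => ?_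
    rw [norm_mul, norm_pow]
    gcongr
    have := Finset.mem_range.1 hn
    omega
  have hpos : 0 < ‖y‖ ^ (P.natDegree - 1) := by positivity
  rw [← Nat.sub_add_cancel h0, pow_succ', Nat.add_sub_cancel] at hle
  have := le_of_mul_le_mul_right hle hpos
  linarith

theorem isClosedMap_fst (hP : P.Monic) : IsClosedMap fun p : PlaneCurve P => p.1.1 := by
  refine (isProperMap_iff_isCompact_preimage.2 ⟨continuous_fst, fun K hK => ?_⟩).isClosedMap
  have hcont : Continuous fun x : ℂ => 1 + ∑ n ∈ Finset.range P.natDegree,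
      ‖(P.coeff n).eval x‖ := by
    fun_prop
  obtain ⟨M, hM⟩ := (hK.image hcont).bddAbove
  have hcl : IsClosed {p : ℂ × ℂ | P.evalEval p.1 p.2 = 0} :=
    isClosed_eq (contDiff_evalEval P).continuous continuous_const
  have hemb := hcl.isClosedEmbedding_subtypeVal
  refine (hemb.isCompact_preimage (hK.prod (isCompact_closedBall (0 : ℂ) M))).of_isClosed_subset
    (hK.isClosed.preimage continuous_fst) ?_
  intro p hp
  refine ⟨hp, ?_⟩
  rw [mem_closedBall_zero_iff]
  exact (norm_snd_le hP p).trans (hM ⟨_, hp, rfl⟩)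

theorem fibre_eq (x : ℂ) : (fun p : PlaneCurve P => p.1.1) ⁻¹' {x} =
    Set.range fun y : {y // P.evalEval x y = 0} => (⟨(x, y), y.2⟩ : PlaneCurve P) := by
  ext ⟨⟨a, b⟩, h⟩
  constructor
  · rintro rfl
    exact ⟨⟨b, h⟩, rfl⟩
  · rintro ⟨y, hy⟩
    exact congrArg (fun p : PlaneCurve P => p.1.1) hy.symm

theorem setOf_evalEval_eq (hP : P.Monic) (x : ℂ) : {y | P.evalEval x y = 0} =
    ((P.map (Polynomial.evalRingHom x)).roots.toFinset : Set ℂ) := by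
  ext y
  simp [Polynomial.mem_roots', Polynomial.IsRoot, Polynomial.map_evalRingHom_eval,
    (hP.map (Polynomial.evalRingHom x)).ne_zero]

theorem finite_fibre (hP : P.Monic) (x : ℂ) :
    ((fun p : PlaneCurve P => p.1.1) ⁻¹' {x}).Finite := by
  rw [fibre_eq]
  have : Finite {y | P.evalEval x y = 0} := by
    rw [setOf_evalEval_eq hP]; exact Finset.finite_toSet _
  have : Finite {y // P.evalEval x y = 0} := this
  exact Set.finite_range _

theorem ncard_fibre (hP : P.Monic) (x : ℂ) : ((fun p : PlaneCurve P => p.1.1) ⁻¹' {x}).ncard =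
    (P.map (Polynomial.evalRingHom x)).roots.toFinset.card := by
  rw [fibre_eq, ← Nat.card_coe_set_eq, Nat.card_range_of_injective, ← Set.ncard_coe_finset,
    ← setOf_evalEval_eq hP x, ← Nat.card_coe_set_eq]
  · rfl
  · intro y y' h
    exact Subtype.ext (congrArg (fun p : PlaneCurve P => p.1.2) h)

theorem nonempty_fibre (hP : P.Monic) (hd : P.natDegree ≠ 0) (x : ℂ) :
    ((fun p : PlaneCurve P => p.1.1) ⁻¹' {x}).Nonempty := by
  obtain ⟨y, hy⟩ := IsAlgClosed.exists_root (P.map (Polynomial.evalRingHom x)) (by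
    rw [Polynomial.degree_eq_natDegree (hP.map _).ne_zero, hP.natDegree_map]
    exact_mod_cast hd)
  rw [Polynomial.IsRoot, Polynomial.map_evalRingHom_eval] at hy
  exact ⟨⟨(x, y), hy⟩, rfl⟩

theorem ncard_fibre_of_separable (hP : P.Monic) (x : ℂ)
    (h : ∀ y, P.evalEval x y = 0 → P.derivative.evalEval x y ≠ 0) :
    ((fun p : PlaneCurve P => p.1.1) ⁻¹' {x}).ncard = P.natDegree := by
  have hne := (hP.map (Polynomial.evalRingHom x)).ne_zero
  rw [ncard_fibre hP, Multiset.toFinset_card_of_nodup, IsAlgClosed.card_roots_eq_natDegree,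
    hP.natDegree_map]
  rw [Multiset.nodup_iff_count_le_one]
  intro y
  rw [Polynomial.count_roots]
  by_contra! hlt
  rw [Polynomial.one_lt_rootMultiplicity_iff_isRoot hne] at hlt
  rw [Polynomial.derivative_map, Polynomial.IsRoot, Polynomial.IsRoot,
    Polynomial.map_evalRingHom_eval, Polynomial.map_evalRingHom_eval] at hlt
  exact h y hlt.1 hlt.2

theorem hasStrictFDerivAt_evalEval (P : Polynomial (Polynomial ℂ)) (p : ℂ × ℂ) :
    HasStrictFDerivAt (fun p : ℂ × ℂ => P.evalEval p.1 p.2)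
      (fderiv ℂ (fun p : ℂ × ℂ => P.evalEval p.1 p.2) p) p :=
  (contDiff_evalEval P).hasStrictFDerivAt one_ne_zero

theorem isInvertible_fderiv_comp_inr {p : ℂ × ℂ} (h : P.derivative.evalEval p.1 p.2 ≠ 0) :
    ((fderiv ℂ (fun p : ℂ × ℂ => P.evalEval p.1 p.2) p) ∘L .inr ℂ ℂ ℂ).IsInvertible := by
  have h1 : HasFDerivAt (fun y => P.evalEval p.1 y)
      ((fderiv ℂ (fun p : ℂ × ℂ => P.evalEval p.1 p.2) p) ∘L .inr ℂ ℂ ℂ) p.2 :=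
    HasFDerivAt.comp (g := fun p : ℂ × ℂ => P.evalEval p.1 p.2) (f := fun y => (p.1, y)) p.2
      (hasStrictFDerivAt_evalEval P p).hasFDerivAt (hasFDerivAt_prodMk_right p.1 p.2)
  have h2 := (hasDerivAt_evalEval_right P p.1 p.2).hasFDerivAt.unique h1
  rw [← h2]
  refine ⟨ContinuousLinearEquiv.unitsEquivAut ℂ (Units.mk0 _ h), ?_⟩
  ext
  simp

theorem isLocalHomeomorphOn_fst {B : Set ℂ}
    (hB : ∀ x ∉ B, ∀ y, P.evalEval x y = 0 → P.derivative.evalEval x y ≠ 0) :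
    IsLocalHomeomorphOn (fun p : PlaneCurve P => p.1.1)
      ((fun p : PlaneCurve P => p.1.1) ⁻¹' Bᶜ) := by
  classical
  refine IsLocalHomeomorphOn.mk _ _ fun p hp => ?_
  have inv := isInvertible_fderiv_comp_inr (hB _ hp _ p.2)
  let e := ((hasStrictFDerivAt_evalEval P p.1).implicitFunctionDataOfProdDomain
    inv).toOpenPartialHomeomorph
  have he : ∀ q, e q = (P.evalEval q.1 q.2, q.1) := fun q => rfl
  have hpe : p.1 ∈ e.source := ImplicitFunctionData.pt_mem_toOpenPartialHomeomorph_source _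
  have hinv : ∀ x, (0, x) ∈ e.target →
      P.evalEval (e.symm (0, x)).1 (e.symm (0, x)).2 = 0 ∧ (e.symm (0, x)).1 = x := by
    intro x hx
    have := e.right_inv hx
    rw [he] at this
    exact ⟨congrArg Prod.fst this, congrArg Prod.snd this⟩
  let φ : OpenPartialHomeomorph (PlaneCurve P) ℂ :=
    { toFun := fun q => q.1.1
      invFun := fun x => if h : (0, x) ∈ e.target then ⟨e.symm (0, x), (hinv x h).1⟩ else p
      source := {q | q.1 ∈ e.source}
      target := {x | (0, x) ∈ e.target}
      map_source' := by
        intro q hq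
        have := e.map_source hq
        rw [he, q.2] at this
        exact this
      map_target' := by
        intro x hx
        rw [dif_pos (show (0, x) ∈ e.target from hx)]
        exact e.map_target hx
      left_inv' := by
        intro q hq
        have h1 := e.map_source hq
        have h2 := e.left_inv hq
        rw [he, q.2] at h1 h2
        rw [dif_pos h1]
        exact Subtype.ext h2
      right_inv' := by
        intro x hx
        rw [dif_pos (show (0, x) ∈ e.target from hx)]
        exact (hinv x hx).2
      open_source := e.open_source.preimage continuous_subtype_val
      open_target := e.open_target.preimage (by fun_prop)
      continuousOn_toFun := continuous_fst.continuousOn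
      continuousOn_invFun := by
        rw [continuousOn_iff_continuous_domRestrict, continuous_induced_rng]
        have : Continuous fun x : {x | (0, x) ∈ e.target} => e.symm (0, x) :=
          e.continuousOn_symm.comp_continuous (by fun_prop) fun x => x.2
        refine this.congr fun x => ?_
        simp only [Function.comp, Set.domRestrict_apply]
        rw [dif_pos (show (0, (x : ℂ)) ∈ e.target from x.2)] }
  exact ⟨φ, hpe, fun _ _ => rfl⟩

theorem isCoveringMapOn_fst (hP : P.Monic) {B : Set ℂ}
    (hB : ∀ x ∉ B, ∀ y, P.evalEval x y = 0 → P.derivative.evalEval x y ≠ 0) :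
    IsCoveringMapOn (fun p : PlaneCurve P => p.1.1) Bᶜ :=
  (isClosedMap_fst hP).isCoveringMapOn_of_isLocalHomeomorphOn (fun x _ => finite_fibre hP x)
    (isLocalHomeomorphOn_fst hB)

end PlaneCurve

/-- Growth bounded by a power of `1 + ‖x‖`. -/
def HasPolynomialGrowth {F : Type} [Norm F] (g : ℂ → F) : Prop :=
  ∃ (K : ℝ) (N : ℕ), 0 ≤ K ∧ ∀ x, ‖g x‖ ≤ K * (1 + ‖x‖) ^ N

namespace HasPolynomialGrowth

theorem of_norm_le {F G : Type} [Norm F] [Norm G] {g : ℂ → F} {h : ℂ → G}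
    (hg : HasPolynomialGrowth g) (hh : ∀ x, ‖h x‖ ≤ ‖g x‖) : HasPolynomialGrowth h :=
  let ⟨K, N, hK, H⟩ := hg
  ⟨K, N, hK, fun x => (hh x).trans (H x)⟩

theorem const {F : Type} [NormedRing F] (c : F) : HasPolynomialGrowth fun _ => c :=
  ⟨‖c‖, 0, norm_nonneg _, by simp⟩

theorem add {F : Type} [NormedRing F] {g h : ℂ → F} (hg : HasPolynomialGrowth g)
    (hh : HasPolynomialGrowth h) : HasPolynomialGrowth fun x => g x + h x := by
  obtain ⟨K, N, hK, H⟩ := hg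
  obtain ⟨K', N', hK', H'⟩ := hh
  refine ⟨K + K', max N N', add_nonneg hK hK', fun x => (norm_add_le _ _).trans ?_⟩
  have h1 : 1 ≤ 1 + ‖x‖ := by linarith [norm_nonneg x]
  rw [add_mul]
  refine add_le_add ((H x).trans ?_) ((H' x).trans ?_)
  · gcongr
    exact le_max_left _ _
  · gcongr
    exact le_max_right _ _

theorem mul {F : Type} [NormedRing F] {g h : ℂ → F} (hg : HasPolynomialGrowth g)
    (hh : HasPolynomialGrowth h) : HasPolynomialGrowth fun x => g x * h x := by
  obtain ⟨K, N, hK, H⟩ := hg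
  obtain ⟨K', N', hK', H'⟩ := hh
  refine ⟨K * K', N + N', mul_nonneg hK hK', fun x => (norm_mul_le _ _).trans ?_⟩
  rw [pow_add, mul_mul_mul_comm]
  exact mul_le_mul (H x) (H' x) (norm_nonneg _) (by positivity)

theorem pow {F : Type} [NormedRing F] {g : ℂ → F} (hg : HasPolynomialGrowth g) (n : ℕ) :
    HasPolynomialGrowth fun x => g x ^ n := by
  induction n with
  | zero => simpa using const (1 : F)
  | succ n ih => simpa only [pow_succ] using ih.mul hg

theorem sum {F ι : Type} [NormedRing F] {s : Finset ι} {g : ι → ℂ → F}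
    (hg : ∀ i, HasPolynomialGrowth (g i)) : HasPolynomialGrowth fun x => ∑ i ∈ s, g i x := by
  classical
  induction s using Finset.induction_on with
  | empty => simpa using const (0 : F)
  | insert i s hi ih => simpa only [Finset.sum_insert hi] using (hg i).add ih

theorem eval (p : Polynomial ℂ) : HasPolynomialGrowth fun x => p.eval x := by
  simp only [Polynomial.eval_eq_sum, Polynomial.sum_def]
  refine sum fun n => (const _).mul (pow ⟨1, 1, zero_le_one, fun x => ?_⟩ n)
  simp

/-- An entire function of polynomial growth is a polynomial. -/
theorem exists_polynomial {g : ℂ → ℂ} (hg : HasPolynomialGrowth g) (hd : Differentiable ℂ g) :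
    ∃ p : Polynomial ℂ, ∀ x, p.eval x = g x := by
  obtain ⟨K, N, hK, H⟩ := hg
  have key : ∀ n, N < n → iteratedDeriv n g 0 = 0 := by
    intro n hn
    have hb : ∀ R : ℝ, 1 ≤ R → ‖iteratedDeriv n g 0‖ ≤ (n.factorial * K * 2 ^ N) * R⁻¹ := by
      intro R hR
      have hR0 : 0 < R := by linarith
      refine (Complex.norm_iteratedDeriv_le_of_forall_mem_sphere_norm_le (C := K * (2 * R) ^ N) n
        hR0 hd.diffContOnCl fun z hz => ?_).trans ?_
      · refine (H z).trans ?_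
        have : ‖z‖ = R := by simpa using hz
        rw [this]
        gcongr
        linarith
      · rw [mul_pow, div_le_iff₀ (by positivity)]
        have h1 : R ^ N ≤ R⁻¹ * R ^ n := by
          obtain ⟨k, rfl⟩ := Nat.exists_eq_add_of_lt hn
          have : R⁻¹ * R ^ (N + k + 1) = R ^ (N + k) := by
            rw [pow_succ]; field_simp
          rw [this]
          exact pow_le_pow_right₀ hR (by omega)
        calc (n.factorial : ℝ) * (K * (2 ^ N * R ^ N))
            = (n.factorial * K * 2 ^ N) * R ^ N := by ring
          _ ≤ (n.factorial * K * 2 ^ N) * (R⁻¹ * R ^ n) := by gcongr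
          _ = _ := by ring
    have hlim : Tendsto (fun R : ℝ => (n.factorial * K * 2 ^ N) * R⁻¹) atTop (nhds 0) := by
      simpa using tendsto_inv_atTop_zero.const_mul ((n.factorial : ℝ) * K * 2 ^ N)
    have := ge_of_tendsto hlim ((eventually_ge_atTop 1).mono fun R hR => hb R hR)
    exact norm_le_zero_iff.1 this
  refine ⟨∑ n ∈ Finset.range (N + 1),
    Polynomial.C ((n.factorial : ℂ)⁻¹ * iteratedDeriv n g 0) * Polynomial.X ^ n, fun x => ?_⟩
  rw [← Complex.taylorSeries_eq_of_entire' 0 x hd, tsum_eq_sum (s := Finset.range (N + 1))]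
  · simp [Polynomial.eval_finsetSum]
  · intro n hn
    rw [key n (by simpa [Nat.lt_succ_iff] using hn)]
    simp

end HasPolynomialGrowth

namespace PlaneCurve

variable {P : Polynomial (Polynomial ℂ)}

theorem card_roots_of_separable (hP : P.Monic) (x : ℂ)
    (h : ∀ y, P.evalEval x y = 0 → P.derivative.evalEval x y ≠ 0) :
    (P.map (Polynomial.evalRingHom x)).roots.toFinset.card = P.natDegree := by
  rw [← ncard_fibre hP, ncard_fibre_of_separable hP x h]

theorem mem_roots_iff (hP : P.Monic) (x y : ℂ) :
    y ∈ (P.map (Polynomial.evalRingHom x)).roots.toFinset ↔ P.evalEval x y = 0 := by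
  rw [← Finset.mem_coe, ← setOf_evalEval_eq hP]
  rfl

/-- A polynomial vanishing on the curve away from its branch points is divisible by its
equation. -/
theorem dvd_of_evalEval_eq_zero (hP : P.Monic) {B : Set ℂ} (hBf : B.Finite)
    (hB : ∀ x ∉ B, ∀ y, P.evalEval x y = 0 → P.derivative.evalEval x y ≠ 0)
    {F : Polynomial (Polynomial ℂ)} (hF : ∀ x ∉ B, ∀ y, P.evalEval x y = 0 → F.evalEval x y = 0) :
    P ∣ F := by
  rw [← Polynomial.modByMonic_eq_zero_iff_dvd hP]
  by_cases h1 : P = 1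
  · simp [h1]
  set R := F %ₘ P with hR
  have hdeg : R.natDegree < P.natDegree := Polynomial.natDegree_modByMonic_lt _ hP h1
  have hev : ∀ x ∉ B, R.map (Polynomial.evalRingHom x) = 0 := by
    intro x hx
    refine Polynomial.eq_zero_of_natDegree_lt_card_of_eval_eq_zero' _
      (P.map (Polynomial.evalRingHom x)).roots.toFinset (fun y hy => ?_) ?_
    · rw [mem_roots_iff hP] at hy
      have := congrArg (Polynomial.evalEval x y) (Polynomial.modByMonic_add_div F P)
      rw [Polynomial.evalEval_add, Polynomial.evalEval_mul, hy, hF x hx y hy, zero_mul,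
        add_zero] at this
      rw [Polynomial.map_evalRingHom_eval, this]
    · rw [card_roots_of_separable hP x (hB x hx)]
      exact Polynomial.natDegree_map_le.trans_lt hdeg
  ext1 n
  rw [Polynomial.coeff_zero]
  refine Polynomial.eq_zero_of_infinite_isRoot _ ((hBf.infinite_compl).mono fun x hx => ?_)
  have := congrArg (fun p => Polynomial.coeff p n) (hev x hx)
  simpa [Polynomial.coeff_map] using this

end PlaneCurve

namespace PlaneCurve

variable {P : Polynomial (Polynomial ℂ)}

/-- Local holomorphic branches of the curve over a point away from the branch points. -/
theorem exists_branches (hP : P.Monic) {x₀ : ℂ}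
    (hx₀ : ∀ y, P.evalEval x₀ y = 0 → P.derivative.evalEval x₀ y ≠ 0) :
    ∃ ψ : ℂ → ℂ → ℂ, (∀ y, P.evalEval x₀ y = 0 → ψ y x₀ = y ∧ DifferentiableAt ℂ (ψ y) x₀) ∧
      ∀ᶠ x in nhds x₀, (∀ y, P.evalEval x₀ y = 0 → P.evalEval x (ψ y x) = 0) ∧
        Set.InjOn (fun y => ψ y x) {y | P.evalEval x₀ y = 0} ∧
        (P.map (Polynomial.evalRingHom x)).roots.toFinset =
        (P.map (Polynomial.evalRingHom x₀)).roots.toFinset.image (fun y => ψ y x) := by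
  classical
  have h : ∀ y, ∃ ψ : ℂ → ℂ, P.evalEval x₀ y = 0 → ψ x₀ = y ∧ DifferentiableAt ℂ ψ x₀ ∧
      ∀ᶠ x in nhds x₀, P.evalEval x (ψ x) = 0 := by
    intro y
    by_cases hy : P.evalEval x₀ y = 0
    · have h1 := hasStrictFDerivAt_evalEval P (x₀, y)
      have h2 := isInvertible_fderiv_comp_inr (p := (x₀, y)) (hx₀ y hy)
      refine ⟨h1.implicitFunctionOfProdDomain h2, fun _ => ⟨?_, ?_, ?_⟩⟩
      · have := (h1.eventually_apply_eq_iff_implicitFunctionOfProdDomain h2).self_of_nhds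
        exact this.1 rfl
      · exact (h1.hasStrictFDerivAt_implicitFunctionOfProdDomain h2).hasFDerivAt.differentiableAt
      · refine (h1.eventually_apply_implicitFunctionOfProdDomain h2).mono fun x hx => ?_
        rw [← hy]; exact hx
    · exact ⟨fun _ => 0, fun h => (hy h).elim⟩
  choose ψ hψ using h
  refine ⟨ψ, fun y hy => ⟨(hψ y hy).1, (hψ y hy).2.1⟩, ?_⟩
  have hfin : {y | P.evalEval x₀ y = 0}.Finite := by
    rw [setOf_evalEval_eq hP]; exact Finset.finite_toSet _
  have e1 : ∀ᶠ x in nhds x₀, ∀ y ∈ {y | P.evalEval x₀ y = 0}, P.evalEval x (ψ y x) = 0 :=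
    (eventually_all_finite hfin).2 fun y hy => (hψ y hy).2.2
  have e2 : ∀ᶠ x in nhds x₀, ∀ y ∈ {y | P.evalEval x₀ y = 0}, ∀ y' ∈ {y | P.evalEval x₀ y = 0},
      y ≠ y' → ψ y x ≠ ψ y' x := by
    refine (eventually_all_finite hfin).2 fun y hy => (eventually_all_finite hfin).2
        fun y' hy' => ?_
    by_cases hyy : y = y'
    · simp [hyy]
    have : ∀ᶠ x in nhds x₀, ψ y x ≠ ψ y' x := by
      refine (((hψ y hy).2.1.continuousAt.sub (hψ y' hy').2.1.continuousAt).eventually_ne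
        (y := 0) ?_).mono fun x hx => sub_ne_zero.1 hx
      simpa [(hψ y hy).1, (hψ y' hy').1, sub_ne_zero] using hyy
    exact this.mono fun x hx _ => hx
  filter_upwards [e1, e2] with x h1 h2
  have hinj : Set.InjOn (fun y => ψ y x) {y | P.evalEval x₀ y = 0} := by
    intro y hy y' hy' h
    by_contra hne
    exact h2 y hy y' hy' hne h
  refine ⟨h1, hinj, (Finset.eq_of_subset_of_card_le ?_ ?_).symm⟩
  · intro z hz
    obtain ⟨y, hy, rfl⟩ := Finset.mem_image.1 hz
    exact (mem_roots_iff hP _ _).2 (h1 y ((mem_roots_iff hP _ _).1 hy))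
  · rw [Finset.card_image_of_injOn, card_roots_of_separable hP x₀ hx₀]
    · refine (Multiset.toFinset_card_le _).trans ((Polynomial.card_roots' _).trans ?_)
      rw [hP.natDegree_map]
    · rw [← setOf_evalEval_eq hP]; exact hinj

/-- The power sums of the ordinates of the points of `C` over `x`. -/
def powerSum (C : Set (PlaneCurve P)) (m : ℕ) (x : ℂ) : ℂ :=
  ∑ y ∈ (P.map (Polynomial.evalRingHom x)).roots.toFinset,
    ((fun p : PlaneCurve P => p.1) '' C).indicator (fun p => p.2 ^ m) (x, y)

theorem differentiableAt_powerSum (hP : P.Monic) {C : Set (PlaneCurve P)} (hC : IsClopen C) (m : ℕ)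
    {x₀ : ℂ} (hx₀ : ∀ y, P.evalEval x₀ y = 0 → P.derivative.evalEval x₀ y ≠ 0) :
    DifferentiableAt ℂ (powerSum C m) x₀ := by
  classical
  obtain ⟨ψ, hψ, hev⟩ := exists_branches hP hx₀
  have mem : ∀ x y, (x, y) ∈ (fun p : PlaneCurve P => p.1) '' C ↔
      ∃ h : P.evalEval x y = 0, (⟨(x, y), h⟩ : PlaneCurve P) ∈ C := by
    intro x y
    constructor
    · rintro ⟨p, hp, hpe⟩
      refine ⟨?_, ?_⟩
      · have := p.2; simp only at hpe; rw [hpe] at this; exact this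
      · have h2 : p = ⟨(x, y), hpe ▸ p.2⟩ := Subtype.ext hpe
        exact h2 ▸ hp
    · rintro ⟨h, hp⟩
      exact ⟨_, hp, rfl⟩
  obtain ⟨O, hO, hOC⟩ := isOpen_induced_iff.1 hC.isOpen
  obtain ⟨O', hO', hOC'⟩ := isOpen_induced_iff.1 hC.compl.isOpen
  have e3 : ∀ y, P.evalEval x₀ y = 0 → ∀ᶠ x in nhds x₀, P.evalEval x (ψ y x) = 0 →
      ((x, ψ y x) ∈ (fun p : PlaneCurve P => p.1) '' C ↔
        (x₀, y) ∈ (fun p : PlaneCurve P => p.1) '' C) := by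
    intro y hy
    have hc : Tendsto (fun x => (x, ψ y x)) (nhds x₀) (nhds (x₀, y)) := by
      have := (continuousAt_id (x := x₀)).prodMk (hψ y hy).2.continuousAt
      rw [ContinuousAt, (hψ y hy).1] at this
      exact this
    by_cases hyC : (⟨(x₀, y), hy⟩ : PlaneCurve P) ∈ C
    · have : (x₀, y) ∈ O := by rw [← hOC] at hyC; exact hyC
      filter_upwards [hc (hO.mem_nhds this)] with x hx h0
      rw [mem, mem]
      refine iff_of_true ⟨h0, ?_⟩ ⟨hy, hyC⟩
      rw [← hOC]; exact hx
    · have : (x₀, y) ∈ O' := by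
        have : (⟨(x₀, y), hy⟩ : PlaneCurve P) ∈ Cᶜ := hyC
        rw [← hOC'] at this; exact this
      filter_upwards [hc (hO'.mem_nhds this)] with x hx h0
      rw [mem, mem]
      refine iff_of_false ?_ ?_
      · rintro ⟨h0, hxC⟩
        have : (⟨(x, ψ y x), h0⟩ : PlaneCurve P) ∈ Cᶜ := by rw [← hOC']; exact hx
        exact this hxC
      · rintro ⟨h0, hxC⟩; exact hyC hxC
  have hfin : {y | P.evalEval x₀ y = 0}.Finite := by
    rw [setOf_evalEval_eq hP]; exact Finset.finite_toSet _
  have e4 := (eventually_all_finite hfin).2 e3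
  have key : powerSum C m =ᶠ[nhds x₀] fun x =>
      ∑ y ∈ (P.map (Polynomial.evalRingHom x₀)).roots.toFinset,
        if (x₀, y) ∈ (fun p : PlaneCurve P => p.1) '' C then ψ y x ^ m else 0 := by
    filter_upwards [hev, e4] with x hx hx4
    rw [powerSum, hx.2.2, Finset.sum_image]
    · refine Finset.sum_congr rfl fun y hy => ?_
      rw [mem_roots_iff hP] at hy
      have := hx4 y hy (hx.1 y hy)
      simp only [Set.indicator_apply, this]
    · rw [← setOf_evalEval_eq hP]; exact hx.2.1
  refine DifferentiableAt.congr_of_eventuallyEq ?_ key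
  refine DifferentiableAt.fun_sum fun y hy => ?_
  rw [mem_roots_iff hP] at hy
  split_ifs
  · exact (hψ y hy).2.pow m
  · exact differentiableAt_const _

/-- A bound for the ordinates of the points of the curve. -/
def ordinateBound (P : Polynomial (Polynomial ℂ)) (x : ℂ) : ℝ :=
  1 + ∑ n ∈ Finset.range P.natDegree, ‖(P.coeff n).eval x‖

theorem norm_powerSum_le (hP : P.Monic) (C : Set (PlaneCurve P)) (m : ℕ) (x : ℂ) :
    ‖powerSum C m x‖ ≤ P.natDegree * ordinateBound P x ^ m := by
  refine (norm_sum_le _ _).trans ?_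
  have hpos : 0 ≤ ordinateBound P x := by unfold ordinateBound; positivity
  refine (Finset.sum_le_card_nsmul _ _ (ordinateBound P x ^ m) fun y hy => ?_).trans ?_
  · rw [mem_roots_iff hP] at hy
    refine (norm_indicator_le_norm_self _ _).trans ?_
    rw [norm_pow]
    exact pow_le_pow_left₀ (norm_nonneg _) (norm_snd_le hP ⟨(x, y), hy⟩) m
  · rw [nsmul_eq_mul]
    refine mul_le_mul_of_nonneg_right ?_ (by positivity)
    refine Nat.cast_le.2 ((Multiset.toFinset_card_le _).trans ((Polynomial.card_roots' _).trans ?_))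
    rw [hP.natDegree_map]

theorem continuous_ordinateBound : Continuous (ordinateBound P) := by
  unfold ordinateBound; fun_prop

theorem hasPolynomialGrowth_ordinateBound : HasPolynomialGrowth (ordinateBound P) := by
  refine (HasPolynomialGrowth.const (1 : ℝ)).add (HasPolynomialGrowth.sum fun n => ?_)
  exact (HasPolynomialGrowth.eval (P.coeff n)).of_norm_le fun x => by simp

/-- The power sums of a clopen part of the curve are rational functions with poles at the branch
points. -/
theorem exists_polynomial_powerSum (hP : P.Monic) {C : Set (PlaneCurve P)} (hC : IsClopen C)
    {B : Finset ℂ} (hB : ∀ x ∉ B, ∀ y, P.evalEval x y = 0 → P.derivative.evalEval x y ≠ 0)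
    (m : ℕ) : ∃ p : Polynomial ℂ, ∀ x,
      p.eval x = (∏ b ∈ B, (Polynomial.X - Polynomial.C b) ^ 2).eval x * powerSum C m x := by
  classical
  refine HasPolynomialGrowth.exists_polynomial (g := fun x =>
    (∏ b ∈ B, (Polynomial.X - Polynomial.C b) ^ 2).eval x * powerSum C m x) ?_ fun x => ?_
  · refine (HasPolynomialGrowth.eval _).mul ?_
    refine HasPolynomialGrowth.of_norm_le ((HasPolynomialGrowth.const (P.natDegree : ℝ)).mul
      ((hasPolynomialGrowth_ordinateBound (P := P)).pow m)) fun x => ?_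
    exact (norm_powerSum_le hP C m x).trans (le_abs_self _)
  · by_cases hx : x ∈ B
    · have hbig : (fun z => (∏ b ∈ B, (Polynomial.X - Polynomial.C b) ^ 2).eval z *
          powerSum C m z) =O[nhds x] fun z => ‖z - x‖ ^ 2 := by
        rw [← Finset.mul_prod_erase B _ hx]
        set q := ∏ b ∈ B.erase x, (Polynomial.X - Polynomial.C b) ^ 2
        have h1 : (fun z => (z - x) ^ 2) =O[nhds x] fun z => ‖z - x‖ ^ 2 :=
          Asymptotics.isBigO_of_le _ fun z => by simp
        have h2 : (fun z => q.eval z * powerSum C m z) =O[nhds x] fun _ => (1 : ℝ) := by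
          have hcont : Continuous fun z => ‖q.eval z‖ * (P.natDegree * ordinateBound P z ^ m) := by
            have := continuous_ordinateBound (P := P)
            fun_prop
          have h3 : (fun z => ‖q.eval z‖ * (P.natDegree * ordinateBound P z ^ m)) =O[nhds x]
              fun _ => (1 : ℝ) := (hcont.tendsto x).isBigO_one ℝ
          refine (Asymptotics.isBigO_of_le _ fun z => ?_).trans h3
          rw [norm_mul]
          refine (mul_le_mul_of_nonneg_left (norm_powerSum_le hP C m z) (norm_nonneg _)).trans ?_
          exact le_abs_self _
        have h4 := h1.mul h2
        simpa [mul_assoc] using h4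
      exact (hbig.hasFDerivAt one_lt_two).differentiableAt
    · exact (Polynomial.differentiableAt _).mul (differentiableAt_powerSum hP hC m (hB x hx))

end PlaneCurve

namespace PlaneCurve

variable {P : Polynomial (Polynomial ℂ)}

theorem isOpen_pathComponent (hP : P.Monic) (hd : P.natDegree ≠ 0) {B : Set ℂ} (hBf : B.Finite)
    (hB : ∀ x ∉ B, ∀ y, P.evalEval x y = 0 → P.derivative.evalEval x y ≠ 0) (p : PlaneCurve P) :
    IsOpen (pathComponent p) := by
  rw [isOpen_iff_mem_nhds]
  intro q hq
  set w := q.1.1 with hw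
  obtain ⟨ε, hε, hball⟩ := Metric.isOpen_iff.1 (hBf.subset Set.sdiff_subset).isClosed.isOpen_compl w
    (show w ∉ B \ {w} by simp)
  have hcov : IsCoveringMapOn (fun p : PlaneCurve P => p.1.1) (Metric.ball w ε \ {w}) := by
    refine (isCoveringMapOn_fst hP hB).mono fun x hx hxB => ?_
    exact hball hx.1 ⟨hxB, hx.2⟩
  obtain ⟨-, r, hr⟩ := exists_isComponentMap_of_starConvex continuous_fst (isClosedMap_fst hP)
    (Metric.mem_ball_self hε) ((convex_ball w ε).starConvex (Metric.mem_ball_self hε))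
    (finite_fibre hP w) hcov (nonempty_fibre hP hd w)
  have hfin : Finite ((fun p : PlaneCurve P => p.1.1) ⁻¹' {w}) := finite_fibre hP w
  have hU : IsOpen ((fun p : PlaneCurve P => p.1.1) ⁻¹' Metric.ball w ε) :=
    Metric.isOpen_ball.preimage continuous_fst
  have hqU : q ∈ (fun p : PlaneCurve P => p.1.1) ⁻¹' Metric.ball w ε := Metric.mem_ball_self hε
  have hN := hr.cont.isOpen_inter_preimage hU (isOpen_discrete {r q})
  refine Filter.mem_of_superset (hN.mem_nhds ⟨hqU, rfl⟩) fun z hz => ?_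
  exact Joined.trans hq (hr.joined q hqU z hz.1 hz.2.symm).joined

theorem isClopen_pathComponent (hP : P.Monic) (hd : P.natDegree ≠ 0) {B : Set ℂ} (hBf : B.Finite)
    (hB : ∀ x ∉ B, ∀ y, P.evalEval x y = 0 → P.derivative.evalEval x y ≠ 0) (p : PlaneCurve P) :
    IsClopen (pathComponent p) := by
  refine ⟨⟨?_⟩, isOpen_pathComponent hP hd hBf hB p⟩
  have : (pathComponent p)ᶜ = ⋃ q ∈ (pathComponent p)ᶜ, pathComponent q := by
    ext z
    simp only [Set.mem_iUnion, exists_prop]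
    constructor
    · exact fun hz => ⟨z, hz, mem_pathComponent_self z⟩
    · rintro ⟨q, hq, hz⟩ hzp
      exact hq (Joined.trans hzp (Joined.symm hz))
  rw [this]
  exact isOpen_biUnion fun q _ => isOpen_pathComponent hP hd hBf hB q

/-- No point of the curve is isolated in its complement of finitely many vertical lines. -/
theorem dense_preimage_compl (hP : P.Monic) {B : Set ℂ} (hBf : B.Finite) {O : Set (PlaneCurve P)}
    (hO : IsOpen O) (hne : O.Nonempty) : ∃ p ∈ O, p.1.1 ∉ B := by
  obtain ⟨p, hp⟩ := hne
  by_contra! hcon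
  obtain ⟨V, hV, hVO⟩ := isOpen_induced_iff.1 hO
  have hpV : p.1 ∈ V := by rw [← hVO] at hp; exact hp
  obtain ⟨ε, hε, hball⟩ := Metric.isOpen_iff.1 hV _ hpV
  have hx : ∀ x ∉ B, dist x p.1.1 < ε → ε ^ P.natDegree ≤ ‖P.evalEval x p.1.2‖ := by
    intro x hxB hxε
    have hmon := hP.map (Polynomial.evalRingHom x)
    rw [← Polynomial.map_evalRingHom_eval,
      (IsAlgClosed.splits _).eval_eq_prod_roots_of_monic hmon, ← hP.natDegree_map
      (Polynomial.evalRingHom x), ← IsAlgClosed.card_roots_eq_natDegree]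
    have hroots : ∀ y ∈ (P.map (Polynomial.evalRingHom x)).roots, ε ≤ ‖p.1.2 - y‖ := by
      intro y hy
      by_contra! hlt
      have hy0 : P.evalEval x y = 0 :=
        (mem_roots_iff hP x y).1 (Multiset.mem_toFinset.2 hy)
      refine hxB (hcon ⟨(x, y), hy0⟩ ?_)
      rw [← hVO]
      refine hball ?_
      rw [Metric.mem_ball, Prod.dist_eq, max_lt_iff]
      exact ⟨hxε, by rwa [dist_comm, dist_eq_norm]⟩
    revert hroots
    generalize (P.map (Polynomial.evalRingHom x)).roots = s
    intro hroots
    induction s using Multiset.induction_on with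
    | empty => simp
    | cons a s ih =>
      simp only [Multiset.map_cons, Multiset.prod_cons, Multiset.card_cons, pow_succ', norm_mul]
      refine mul_le_mul (hroots a (Multiset.mem_cons_self _ _)) ?_ (by positivity) (norm_nonneg _)
      exact ih fun y hy => hroots y (Multiset.mem_cons_of_mem hy)
  have hcont : Tendsto (fun x => ‖P.evalEval x p.1.2‖) (nhdsWithin p.1.1 Bᶜ) (nhds 0) := by
    have h1 : Continuous fun x : ℂ => ‖P.evalEval x p.1.2‖ := by
      have := (contDiff_evalEval P).continuous
      exact (this.comp (by fun_prop : Continuous fun x : ℂ => (x, p.1.2))).norm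
    have h2 := h1.tendsto p.1.1
    rw [p.2, norm_zero] at h2
    exact h2.mono_left nhdsWithin_le_nhds
  have hne : (nhdsWithin p.1.1 Bᶜ).NeBot :=
    mem_closure_iff_nhdsWithin_neBot.1 (hBf.countable.dense_compl ℝ p.1.1)
  have hle := ge_of_tendsto (b := ε ^ P.natDegree) hcont (by
    filter_upwards [self_mem_nhdsWithin,
        nhdsWithin_le_nhds (Metric.ball_mem_nhds _ hε)] with x h1 h2
    exact hx x h1 h2)
  exact absurd hle (not_le.2 (by positivity))

/-- The polynomial interpolating `β · P'` on a part of the curve with power sums `t m / β`. -/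
def componentPoly (P : Polynomial (Polynomial ℂ)) (t : ℕ → Polynomial ℂ) :
    Polynomial (Polynomial ℂ) :=
  ∑ n ∈ P.support, ∑ i ∈ Finset.range n,
    Polynomial.C (P.coeff n * t (n - 1 - i)) * Polynomial.X ^ i

theorem evalEval_componentPoly (hP : P.Monic) (C : Set (PlaneCurve P)) {β : Polynomial ℂ}
    {t : ℕ → Polynomial ℂ} {x : ℂ} (ht : ∀ m, (t m).eval x = β.eval x * powerSum C m x) {y : ℂ}
    (hy : P.evalEval x y = 0) : (componentPoly P t).evalEval x y =
      ((fun p : PlaneCurve P => p.1) '' C).indicator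
        (fun _ => β.eval x * P.derivative.evalEval x y) (x, y) := by
  classical
  have hE : ∀ z, ∑ n ∈ P.support, (P.coeff n).eval x *
      ∑ i ∈ Finset.range n, y ^ i * z ^ (n - 1 - i) =
      if z = y then P.derivative.evalEval x y else
        (P.evalEval x y - P.evalEval x z) / (y - z) := by
    intro z
    split_ifs with h
    · rw [h, ← Polynomial.map_evalRingHom_eval, Polynomial.derivative,
        Polynomial.map_evalRingHom_eval]
      simp only [LinearMap.coe_mk, AddHom.coe_mk, Polynomial.sum_def, Polynomial.evalEval_finsetSum]
      refine Finset.sum_congr rfl fun n _ => ?_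
      rw [geom_sum₂_self]
      simp [Polynomial.evalEval, mul_assoc]
    · rw [eq_div_iff (sub_ne_zero.2 (Ne.symm h)), evalEval_eq_sum, evalEval_eq_sum,
        ← Finset.sum_sub_distrib, Finset.sum_mul]
      refine Finset.sum_congr rfl fun n _ => ?_
      rw [mul_assoc, (Commute.all y z).geom_sum₂_mul, mul_sub]
  have h1 : (componentPoly P t).evalEval x y = β.eval x *
      ∑ z ∈ (P.map (Polynomial.evalRingHom x)).roots.toFinset,
        ((fun p : PlaneCurve P => p.1) '' C).indicator (fun p => ∑ n ∈ P.support,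
          (P.coeff n).eval x * ∑ i ∈ Finset.range n, y ^ i * p.2 ^ (n - 1 - i)) (x, z) := by
    have h2 : ∀ z, ((fun p : PlaneCurve P => p.1) '' C).indicator (fun p => ∑ n ∈ P.support,
          (P.coeff n).eval x * ∑ i ∈ Finset.range n, y ^ i * p.2 ^ (n - 1 - i)) (x, z) =
          ∑ n ∈ P.support, ∑ i ∈ Finset.range n, (P.coeff n).eval x * y ^ i *
          ((fun p : PlaneCurve P => p.1) '' C).indicator (fun p => p.2 ^ (n - 1 - i)) (x, z) := by
      intro z
      by_cases hz : (x, z) ∈ (fun p : PlaneCurve P => p.1) '' C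
      · simp only [Set.indicator_of_mem hz, Finset.mul_sum, mul_assoc]
      · simp only [Set.indicator_of_notMem hz, mul_zero, Finset.sum_const_zero]
    simp only [h2]
    rw [Finset.sum_comm, Finset.mul_sum, componentPoly, Polynomial.evalEval_finsetSum]
    refine Finset.sum_congr rfl fun n _ => ?_
    rw [Finset.sum_comm, Finset.mul_sum, Polynomial.evalEval_finsetSum]
    refine Finset.sum_congr rfl fun i _ => ?_
    rw [← Finset.mul_sum]
    simp only [Polynomial.evalEval_mul, Polynomial.evalEval_C, Polynomial.evalEval_pow,
      Polynomial.evalEval_X, Polynomial.eval_mul, ht]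
    rw [powerSum]
    ring
  rw [h1, Finset.sum_eq_single y]
  · simp only [Set.indicator_apply, hE, if_true]
    split_ifs <;> simp
  · intro z hz hzy
    rw [mem_roots_iff hP] at hz
    rw [Set.indicator_apply]
    simp only [hE, if_neg hzy, hy, hz, sub_zero, zero_div, ite_self]
  · intro h
    exact (h ((mem_roots_iff hP x y).2 hy)).elim

theorem pathConnectedSpace (hP : P.Monic) (hd : P.natDegree ≠ 0) (hirr : Irreducible P)
    {B : Finset ℂ} (hB : ∀ x ∉ B, ∀ y, P.evalEval x y = 0 → P.derivative.evalEval x y ≠ 0) :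
    PathConnectedSpace (PlaneCurve P) := by
  classical
  obtain ⟨x₀, hx₀⟩ := Infinite.exists_notMem_finset B
  obtain ⟨p₀, hp₀⟩ := nonempty_fibre hP hd x₀
  have hp₀B : p₀.1.1 ∉ B := by
    have : p₀.1.1 = x₀ := hp₀
    rwa [this]
  set C := pathComponent p₀
  have hC : IsClopen C := isClopen_pathComponent hP hd B.finite_toSet hB p₀
  set β : Polynomial ℂ := ∏ b ∈ B, (Polynomial.X - Polynomial.C b) ^ 2
  have hβ : ∀ x ∉ B, β.eval x ≠ 0 := by
    intro x hx
    rw [Polynomial.eval_prod, Finset.prod_ne_zero_iff]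
    intro b hb
    simp only [Polynomial.eval_pow, Polynomial.eval_sub, Polynomial.eval_X, Polynomial.eval_C]
    exact pow_ne_zero _ (sub_ne_zero.2 fun h => hx (h ▸ hb))
  choose t ht using exists_polynomial_powerSum hP hC hB
  have hA : ∀ x y, P.evalEval x y = 0 → _ := fun x y hy =>
    evalEval_componentPoly (β := β) (x := x) (y := y) hP C (fun m => ht m x) hy
  have hdvd : P ∣ componentPoly P t * (componentPoly P t - Polynomial.C β * P.derivative) := by
    refine dvd_of_evalEval_eq_zero hP B.finite_toSet hB fun x hx y hy => ?_
    rw [Polynomial.evalEval_mul, Polynomial.evalEval_sub, hA x y hy, Polynomial.evalEval_mul,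
      Polynomial.evalEval_C, Set.indicator_apply]
    split_ifs <;> simp
  have hall : ∀ p : PlaneCurve P, p.1.1 ∉ B → p ∈ C := by
    rcases hirr.prime.dvd_or_dvd hdvd with ⟨Q, h⟩ | ⟨Q, h⟩
    · exfalso
      have h1 := hA _ _ p₀.2
      rw [h, Polynomial.evalEval_mul, p₀.2, zero_mul,
        Set.indicator_of_mem (show (p₀.1.1, p₀.1.2) ∈ (fun p : PlaneCurve P => p.1) '' C from
          ⟨p₀, mem_pathComponent_self p₀, rfl⟩)] at h1
      exact mul_ne_zero (hβ _ hp₀B) (hB _ hp₀B _ p₀.2) h1.symm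
    · intro p hp
      by_contra hpC
      have h1 := hA _ _ p.2
      have h2 := congrArg (Polynomial.evalEval p.1.1 p.1.2) h
      rw [Polynomial.evalEval_mul, p.2, zero_mul, Polynomial.evalEval_sub, h1,
        Polynomial.evalEval_mul, Polynomial.evalEval_C, Set.indicator_of_notMem, zero_sub,
        neg_eq_zero] at h2
      · exact mul_ne_zero (hβ _ hp) (hB _ hp _ p.2) h2
      · rintro ⟨q, hq, hqp⟩
        exact hpC ((Subtype.ext hqp : q = p) ▸ hq)
  have huniv : ∀ p, p ∈ C := by
    intro p
    by_contra hpC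
    obtain ⟨q, hq, hqB⟩ := dense_preimage_compl hP B.finite_toSet hC.compl.isOpen ⟨p, hpC⟩
    exact hq (hall q hqB)
  exact ⟨⟨p₀⟩, fun p q => Joined.trans (Joined.symm (huniv p)) (huniv q)⟩

/-- The first Betti number of an irreducible plane curve, from its branched covering of the
line. -/
theorem finrank_pathCohomology (hP : P.Monic) (hd : P.natDegree ≠ 0) (hirr : Irreducible P)
    {B : Finset ℂ} (hne : B.Nonempty)
    (hB : ∀ x ∉ B, ∀ y, P.evalEval x y = 0 → P.derivative.evalEval x y ≠ 0) :
    Module.finrank ℚ (pathCocycles (PlaneCurve P) ⧸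
        (LinearMap.range (pathCoboundary (PlaneCurve P))).comap
          (pathCocycles (PlaneCurve P)).subtype)
      + P.natDegree + ∑ b ∈ B, (P.map (Polynomial.evalRingHom b)).roots.toFinset.card =
      B.card * P.natDegree + 1 := by
  have := pathConnectedSpace hP hd hirr hB
  have key := finrank_pathCohomology_branchedCover continuous_fst (isClosedMap_fst hP)
    (finite_fibre hP) (nonempty_fibre hP hd) B hne (isCoveringMapOn_fst hP hB)
    (fun x hx => ncard_fibre_of_separable hP x (hB x hx))
  simpa only [ncard_fibre hP] using key

end PlaneCurve

end

theorem Polynomial.IsDistinguishedAt.dvd_of_coe_dvd {A : Type*} [CommRing A] {I : Ideal A}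
    [IsAdicComplete I A] {H q : Polynomial A} (hH : H.IsDistinguishedAt I)
    (h : (H : PowerSeries A) ∣ (q : PowerSeries A)) : H ∣ q := by
  rcases subsingleton_or_nontrivial A with hA | hA
  · exact ⟨0, Subsingleton.elim _ _⟩
  rw [← Ideal.mem_span_singleton, ← Ideal.Quotient.eq_zero_iff_mem]
  apply hH.algEquivQuotient.injective
  rw [map_zero, Polynomial.IsDistinguishedAt.algEquivQuotient_apply]
  erw [Ideal.quotientMap_mk]
  erw [Ideal.Quotient.eq_zero_iff_mem]
  · rw [Ideal.mem_span_singleton]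
    simpa using h
  · rw [Ideal.span_singleton_le_iff_mem, Ideal.mem_comap]
    exact Ideal.mem_span_singleton.2 (by simp)

/-- Weierstrass factorization of a polynomial over `ℂ⟦X⟧`, as a product of polynomials. -/
theorem exists_distinguished_factor (q : Polynomial (PowerSeries ℂ))
    (hq : q.map (PowerSeries.constantCoeff (R := ℂ)) ≠ 0) :
    ∃ H Q : Polynomial (PowerSeries ℂ), q = H * Q ∧ H.Monic ∧
      H.natDegree = (q.map (PowerSeries.constantCoeff (R := ℂ))).rootMultiplicity 0 ∧
      H.map (PowerSeries.constantCoeff (R := ℂ)) = Polynomial.X ^ H.natDegree ∧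
      H.IsDistinguishedAt (IsLocalRing.maximalIdeal (PowerSeries ℂ)) ∧
      IsUnit (Q : PowerSeries (PowerSeries ℂ)) ∧
      (Q.map (PowerSeries.constantCoeff (R := ℂ))).eval 0 ≠ 0 := by
  have hmax := PowerSeries.maximalIdeal_eq_span_X (k := ℂ)
  have : IsAdicComplete (IsLocalRing.maximalIdeal (PowerSeries ℂ)) (PowerSeries ℂ) := by
    rw [hmax]; infer_instance
  have hg : (q : PowerSeries (PowerSeries ℂ)).map (IsLocalRing.residue (PowerSeries ℂ)) ≠ 0 := by
    intro h0
    apply hq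
    ext n
    have := congrArg (PowerSeries.coeff n) h0
    rw [PowerSeries.coeff_map, Polynomial.coeff_coe, map_zero, IsLocalRing.residue_eq_zero_iff,
      hmax, Ideal.mem_span_singleton, PowerSeries.X_dvd_iff] at this
    simpa using this
  obtain ⟨H, h, hfac⟩ := PowerSeries.exists_isWeierstrassFactorization hg
  have hH := hfac.isDistinguishedAt
  have hdvd : H ∣ q :=
    hH.dvd_of_coe_dvd ⟨h, hfac.eq_mul⟩
  obtain ⟨Q, rfl⟩ := hdvd
  have hQh : (Q : PowerSeries (PowerSeries ℂ)) = h := by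
    have := hfac.eq_mul
    rw [Polynomial.coe_mul] at this
    refine mul_left_cancel₀ ?_ this
    simpa using hH.monic.ne_zero
  have hQu : IsUnit (Q : PowerSeries (PowerSeries ℂ)) := hQh ▸ hfac.isUnit
  have hQ0 : (Q.map (PowerSeries.constantCoeff (R := ℂ))).eval 0 ≠ 0 := by
    rw [← Polynomial.coeff_zero_eq_eval_zero, Polynomial.coeff_map]
    have h1 := PowerSeries.isUnit_iff_constantCoeff.1 hQu
    have h2 := PowerSeries.isUnit_iff_constantCoeff.1 h1
    simpa using h2.ne_zero
  have hHX : H.map (PowerSeries.constantCoeff (R := ℂ)) = Polynomial.X ^ H.natDegree := by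
    ext n
    rw [Polynomial.coeff_map, Polynomial.coeff_X_pow]
    split_ifs with h
    · rw [h, hH.monic.coeff_natDegree, map_one]
    · rcases lt_or_gt_of_ne h with h | h
      · have := hH.mem h
        rw [hmax, Ideal.mem_span_singleton, PowerSeries.X_dvd_iff] at this
        exact this
      · rw [Polynomial.coeff_eq_zero_of_natDegree_lt h, map_zero]
  refine ⟨H, Q, rfl, hH.monic, ?_, hHX, hH, hQu, hQ0⟩
  rw [Polynomial.map_mul, hHX] at hq ⊢
  rw [Polynomial.rootMultiplicity_mul hq, Polynomial.rootMultiplicity_eq_zero hQ0, add_zero]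
  have := Polynomial.rootMultiplicity_X_sub_C_pow (0 : ℂ) H.natDegree
  rw [map_zero, sub_zero] at this
  exact this.symm

/-- A polynomial over `ℂ⟦X⟧` that becomes a product of linear factors after the substitution
`X ↦ X ^ N` for some `N`. -/
def PuiseuxSplits (p : Polynomial (PowerSeries ℂ)) : Prop :=
  ∃ (N : ℕ) (hN : N ≠ 0) (s : Multiset (PowerSeries ℂ)),
    p.map (PowerSeries.expand N hN : PowerSeries ℂ →ₐ[ℂ] PowerSeries ℂ).toRingHom =
      (s.map fun a => Polynomial.X - Polynomial.C a).prod

namespace PuiseuxSplits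

variable {p q : Polynomial (PowerSeries ℂ)}

theorem map_prod_linear (φ : PowerSeries ℂ →+* PowerSeries ℂ) (s : Multiset (PowerSeries ℂ)) :
    ((s.map fun a => Polynomial.X - Polynomial.C a).prod).map φ =
      ((s.map φ).map fun a => Polynomial.X - Polynomial.C a).prod := by
  rw [Polynomial.map_multiset_prod, Multiset.map_map, Multiset.map_map]
  simp

theorem expand_comp (N M : ℕ) (hN : N ≠ 0) (hM : M ≠ 0) :
    (PowerSeries.expand N hN : PowerSeries ℂ →ₐ[ℂ] PowerSeries ℂ).toRingHom.comp
      (PowerSeries.expand M hM : PowerSeries ℂ →ₐ[ℂ] PowerSeries ℂ).toRingHom =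
    (PowerSeries.expand (N * M) (mul_ne_zero hN hM) :
      PowerSeries ℂ →ₐ[ℂ] PowerSeries ℂ).toRingHom := by
  ext1 a
  exact (PowerSeries.expand_mul N hN M hM a).symm

theorem of_map {N : ℕ} {hN : N ≠ 0}
    (h : PuiseuxSplits (p.map
      (PowerSeries.expand N hN : PowerSeries ℂ →ₐ[ℂ] PowerSeries ℂ).toRingHom)) :
    PuiseuxSplits p := by
  obtain ⟨M, hM, s, hs⟩ := h
  refine ⟨M * N, mul_ne_zero hM hN, s, ?_⟩
  rw [← hs, Polynomial.map_map, expand_comp]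

theorem mul (hp : PuiseuxSplits p) (hq : PuiseuxSplits q) : PuiseuxSplits (p * q) := by
  obtain ⟨N, hN, s, hs⟩ := hp
  obtain ⟨M, hM, t, ht⟩ := hq
  refine ⟨M * N, mul_ne_zero hM hN,
    s.map (PowerSeries.expand M hM : PowerSeries ℂ →ₐ[ℂ] PowerSeries ℂ).toRingHom +
    t.map (PowerSeries.expand N hN : PowerSeries ℂ →ₐ[ℂ] PowerSeries ℂ).toRingHom, ?_⟩
  rw [Multiset.map_add, Multiset.prod_add, ← map_prod_linear, ← map_prod_linear, ← hs, ← ht,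
    Polynomial.map_map, Polynomial.map_map, Polynomial.map_mul, expand_comp, expand_comp]
  simp only [mul_comm N M]

theorem of_comp (a : PowerSeries ℂ)
    (h : PuiseuxSplits (p.comp (Polynomial.X + Polynomial.C a))) : PuiseuxSplits p := by
  obtain ⟨N, hN, s, hs⟩ := h
  set φ := (PowerSeries.expand N hN : PowerSeries ℂ →ₐ[ℂ] PowerSeries ℂ).toRingHom
  refine ⟨N, hN, s.map (fun b => b + φ a), ?_⟩
  rw [Polynomial.map_comp] at hs
  have h2 := congrArg (fun r => Polynomial.comp r (Polynomial.X - Polynomial.C (φ a))) hs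
  simp only [Polynomial.comp_assoc, Polynomial.map_add, Polynomial.map_X, Polynomial.map_C,
    Polynomial.add_comp, Polynomial.X_comp, Polynomial.C_comp, sub_add_cancel,
    Polynomial.comp_X, Polynomial.multiset_prod_comp, Multiset.map_map] at h2
  rw [h2, Multiset.map_map]
  congr 2
  ext1 b
  simp only [Function.comp, Polynomial.sub_comp, Polynomial.X_comp, Polynomial.C_comp, map_add]
  ring

theorem scaleRoots (hq : q.Monic) (h : PuiseuxSplits q) (c : PowerSeries ℂ) :
    PuiseuxSplits (q.scaleRoots c) := by
  obtain ⟨N, hN, s, hs⟩ := h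
  set φ := (PowerSeries.expand N hN : PowerSeries ℂ →ₐ[ℂ] PowerSeries ℂ).toRingHom
  refine ⟨N, hN, s.map (fun b => b * φ c), ?_⟩
  rw [Polynomial.map_scaleRoots _ _ _ (by rw [hq.leadingCoeff, map_one]; exact one_ne_zero), hs,
    Multiset.map_map]
  clear hs
  induction s using Multiset.induction_on with
  | empty => simp
  | cons a s ih =>
    rw [Multiset.map_cons, Multiset.prod_cons, Multiset.map_cons, Multiset.prod_cons,
      Polynomial.mul_scaleRoots_of_noZeroDivisors, ih]
    congr 1
    ext1 n
    rw [Polynomial.coeff_scaleRoots, Polynomial.natDegree_X_sub_C]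
    rcases n with _ | _ | n
    · simp
      exact Or.inl rfl
    · simp
    · simp [Polynomial.coeff_X]

theorem exists_comp_coeff_eq_zero (hp : p.Monic) (hn : p.natDegree ≠ 0) :
    ∃ a : PowerSeries ℂ,
      (p.comp (Polynomial.X + Polynomial.C a)).coeff (p.natDegree - 1) = 0 := by
  obtain ⟨n, hn'⟩ := Nat.exists_eq_succ_of_ne_zero hn
  refine ⟨PowerSeries.C (-((n : ℂ) + 1)⁻¹) * p.coeff n, ?_⟩
  set a := PowerSeries.C (-((n : ℂ) + 1)⁻¹) * p.coeff n with ha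
  rw [hn', Nat.succ_sub_one]
  have h1 := Polynomial.taylor_coeff a p n
  rw [Polynomial.taylor_apply] at h1
  rw [h1, Polynomial.eval_eq_sum_range' (n := 2)]
  · have h3 : p.coeff (1 + n) = 1 := by
      rw [add_comm, ← Nat.succ_eq_add_one, ← hn']; exact hp
    rw [Finset.sum_range_succ, Finset.sum_range_one, Polynomial.hasseDeriv_coeff,
      Polynomial.hasseDeriv_coeff, h3]
    have h4 : (((1 + n).choose n : ℕ) : PowerSeries ℂ) = PowerSeries.C ((n : ℂ) + 1) := by
      rw [add_comm, Nat.choose_succ_self_right]; simp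
    rw [h4, ha, pow_one, mul_one, ← mul_assoc, ← map_mul]
    have : ((n : ℂ) + 1) * -((n : ℂ) + 1)⁻¹ = -1 := by
      have : (n : ℂ) + 1 ≠ 0 := by exact_mod_cast Nat.succ_ne_zero n
      field_simp
    rw [this]
    simp
  · refine lt_of_le_of_lt (Polynomial.natDegree_hasseDeriv_le p n) ?_
    omega

/-- After the substitution `X ↦ X ^ N` and rescaling of the roots, the reduction of a monic
polynomial with vanishing subleading coefficient becomes different from a power of a linear
polynomial. -/
theorem exists_map_eq_scaleRoots (hp : p.Monic) (h0 : p.coeff (p.natDegree - 1) = 0)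
    (hne : p ≠ Polynomial.X ^ p.natDegree) :
    ∃ (N : ℕ) (hN : N ≠ 0) (q : Polynomial (PowerSeries ℂ)) (M : ℕ) (k : ℕ),
      p.map (PowerSeries.expand N hN : PowerSeries ℂ →ₐ[ℂ] PowerSeries ℂ).toRingHom =
        q.scaleRoots (PowerSeries.X ^ M) ∧ q.Monic ∧ q.natDegree = p.natDegree ∧
      q.coeff (p.natDegree - 1) = 0 ∧ k < p.natDegree ∧
      PowerSeries.constantCoeff (q.coeff k) ≠ 0 := by
  set n := p.natDegree with hn
  have hn0 : n ≠ 0 := by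
    intro h
    apply hne
    rw [h, pow_zero]
    exact hp.natDegree_eq_zero.1 h
  classical
  set T := (Finset.range n).filter fun k => p.coeff k ≠ 0 with hT
  have hTne : T.Nonempty := by
    by_contra hT0
    rw [Finset.not_nonempty_iff_eq_empty, hT, Finset.filter_eq_empty_iff] at hT0
    apply hne
    ext1 k
    rw [Polynomial.coeff_X_pow]
    split_ifs with h
    · rw [h]; exact hp
    · rcases lt_or_gt_of_ne h with h | h
      · simpa using hT0 (Finset.mem_range.2 h)
      · exact Polynomial.coeff_eq_zero_of_natDegree_lt h
  obtain ⟨k, hkT, hk⟩ := T.exists_min_image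
    (fun k => ((p.coeff k).order.toNat : ℚ) / ((n - k : ℕ) : ℚ)) hTne
  obtain ⟨hkn, hk0⟩ := Finset.mem_filter.1 hkT
  rw [Finset.mem_range] at hkn
  have hN : n - k ≠ 0 := by omega
  set N := n - k with hNdef
  set φ := (PowerSeries.expand N hN : PowerSeries ℂ →ₐ[ℂ] PowerSeries ℂ).toRingHom with hφ
  set M := (p.coeff k).order.toNat with hM
  have hdvd : ∀ i, ∃ c : PowerSeries ℂ, φ (p.coeff i) = PowerSeries.X ^ (M * (n - i)) * c := by
    intro i
    by_cases hi : i < n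
    · by_cases hi0 : p.coeff i = 0
      · exact ⟨0, by rw [hi0]; simp⟩
      · have h1 := hk i (Finset.mem_filter.2 ⟨Finset.mem_range.2 hi, hi0⟩)
        have h2 : M * (n - i) ≤ N * (p.coeff i).order.toNat := by
          have e1 : (0 : ℚ) < (N : ℚ) := by exact_mod_cast Nat.pos_of_ne_zero hN
          have e2 : (0 : ℚ) < ((n - i : ℕ) : ℚ) := by
            exact_mod_cast (by omega : 0 < n - i)
          rw [div_le_div_iff₀ e1 e2] at h1
          have : M * (n - i) ≤ (p.coeff i).order.toNat * N := by exact_mod_cast h1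
          linarith
        obtain ⟨b, hb⟩ := PowerSeries.X_pow_order_dvd (φ := p.coeff i)
        refine dvd_trans (pow_dvd_pow _ h2) ⟨φ b, ?_⟩
        conv_lhs => rw [hb]
        rw [map_mul, map_pow, pow_mul]
        congr 2
        exact PowerSeries.expand_X N hN
    · exact ⟨φ (p.coeff i), by rw [Nat.sub_eq_zero_of_le (by omega)]; simp⟩
  choose c hc using hdvd
  have hXne : ∀ m : ℕ, (PowerSeries.X : PowerSeries ℂ) ^ m ≠ 0 := fun m =>
    pow_ne_zero _ PowerSeries.X_ne_zero
  have hcn : c n = 1 := by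
    have := hc n
    rw [Nat.sub_self, mul_zero, pow_zero, one_mul, hn, hp.coeff_natDegree, map_one] at this
    exact this.symm
  set q : Polynomial (PowerSeries ℂ) :=
    ∑ i ∈ Finset.range (n + 1), Polynomial.monomial i (c i) with hq
  have hqc : ∀ i, q.coeff i = if i < n + 1 then c i else 0 := by
    intro i
    rw [hq, Polynomial.finsetSum_coeff]
    simp only [Polynomial.coeff_monomial]
    rw [Finset.sum_ite_eq' (Finset.range (n + 1)) i c]
    simp
  have hqle : q.natDegree ≤ n := by
    rw [Polynomial.natDegree_le_iff_coeff_eq_zero]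
    intro i hi
    rw [hqc, if_neg (by omega)]
  have hqn : q.coeff n = 1 := by rw [hqc, if_pos (by omega), hcn]
  have hqm : q.Monic := Polynomial.monic_of_natDegree_le_of_coeff_eq_one n hqle hqn
  have hqd : q.natDegree = n :=
    le_antisymm hqle (Polynomial.le_natDegree_of_ne_zero (by rw [hqn]; exact one_ne_zero))
  refine ⟨N, hN, q, M, k, ?_, hqm, hqd, ?_, hkn, ?_⟩
  · ext1 i
    rw [Polynomial.coeff_map, Polynomial.coeff_scaleRoots, hqd, hqc]
    split_ifs with h
    · change φ _ = _
      rw [hc i, ← pow_mul, mul_comm]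
    · rw [Polynomial.coeff_eq_zero_of_natDegree_lt (by omega), map_zero, zero_mul]
  · rw [hqc, if_pos (by omega)]
    have := hc (n - 1)
    rw [h0, map_zero] at this
    exact (mul_eq_zero.1 this.symm).resolve_left (hXne _)
  · rw [hqc, if_pos (by omega)]
    intro hcon
    obtain ⟨b, hb⟩ := PowerSeries.X_dvd_iff.2 hcon
    have h1 := hc k
    obtain ⟨e, he⟩ := PowerSeries.X_pow_order_dvd (φ := p.coeff k)
    have h2 : φ (p.coeff k) = PowerSeries.X ^ (M * (n - k)) * φ e := by
      conv_lhs => rw [he]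
      rw [map_mul, map_pow, mul_comm M, pow_mul]
      congr 2
      exact PowerSeries.expand_X N hN
    rw [h2] at h1
    have h3 := mul_left_cancel₀ (hXne _) h1
    have h4 : PowerSeries.constantCoeff e = 0 := by
      have := congrArg PowerSeries.constantCoeff h3
      rw [hcon] at this
      rw [← this]
      exact (PowerSeries.constantCoeff_expand N hN e).symm
    obtain ⟨e', rfl⟩ := PowerSeries.X_dvd_iff.2 h4
    have h5 : (PowerSeries.X : PowerSeries ℂ) ^ (M + 1) ∣ p.coeff k :=
      ⟨e', by conv_lhs => rw [he]
              rw [pow_succ, mul_assoc]⟩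
    exact PowerSeries.coeff_order hk0 (PowerSeries.X_pow_dvd_iff.1 h5 _ (Nat.lt_succ_self M))

theorem of_monic (hp : p.Monic) : PuiseuxSplits p := by
  induction hn : p.natDegree using Nat.strong_induction_on generalizing p with
  | _ n ih =>
  subst hn
  by_cases hn0 : p.natDegree = 0
  · refine ⟨1, one_ne_zero, 0, ?_⟩
    rw [hp.natDegree_eq_zero.1 hn0]
    simp
  obtain ⟨a, ha⟩ := exists_comp_coeff_eq_zero hp hn0
  refine of_comp a ?_
  set p₁ := p.comp (Polynomial.X + Polynomial.C a) with hp₁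
  have hm₁ : p₁.Monic := hp.comp_X_add_C a
  have hd₁ : p₁.natDegree = p.natDegree := by
    rw [hp₁, Polynomial.natDegree_comp, Polynomial.natDegree_X_add_C, mul_one]
  by_cases hne : p₁ = Polynomial.X ^ p₁.natDegree
  · refine ⟨1, one_ne_zero, Multiset.replicate p₁.natDegree 0, ?_⟩
    conv_lhs => rw [hne]
    simp
  rw [← hd₁] at ha
  obtain ⟨N, hN, q, M, k, hmap, hqm, hqd, hq1, hkn, hqk⟩ := exists_map_eq_scaleRoots hm₁ ha hne
  refine of_map (N := N) (hN := hN) ?_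
  rw [hmap]
  refine scaleRoots hqm ?_ _
  rw [hd₁] at hqd hq1 hkn
  set κ := (PowerSeries.constantCoeff (R := ℂ))
  have hqbm : (q.map κ).Monic := hqm.map κ
  have hqbd : (q.map κ).natDegree = p.natDegree := by rw [hqm.natDegree_map, hqd]
  obtain ⟨c, hc⟩ := IsAlgClosed.exists_root (q.map κ) (by
    rw [Polynomial.degree_eq_natDegree hqbm.ne_zero, hqbd]
    exact_mod_cast hn0)
  refine of_comp (PowerSeries.C c) ?_
  set q₁ := q.comp (Polynomial.X + Polynomial.C (PowerSeries.C c)) with hq₁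
  have hm₂ : q₁.Monic := hqm.comp_X_add_C _
  have hd₂ : q₁.natDegree = p.natDegree := by
    rw [hq₁, Polynomial.natDegree_comp, Polynomial.natDegree_X_add_C, mul_one, hqd]
  have hmap₁ : q₁.map κ = (q.map κ).comp (Polynomial.X + Polynomial.C c) := by
    rw [hq₁, Polynomial.map_comp]
    simp [κ]
  obtain ⟨H, Q, hHQ, hHm, hHd, -, -, -, -⟩ := exists_distinguished_factor q₁
    (hm₂.map κ).ne_zero
  have hQm : Q.Monic := hHm.of_mul_monic_left (hHQ ▸ hm₂)
  rw [hmap₁, ← Polynomial.rootMultiplicity_eq_rootMultiplicity] at hHd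
  have hsum : H.natDegree + Q.natDegree = p.natDegree := by
    rw [← hd₂, hHQ, hHm.natDegree_mul hQm]
  have hpos : 0 < H.natDegree := by
    rw [hHd]; exact (Polynomial.rootMultiplicity_pos hqbm.ne_zero).2 hc
  have hlt : H.natDegree ≠ p.natDegree := by
    intro hcon
    have h1 : (Polynomial.X - Polynomial.C c) ^ p.natDegree ∣ q.map κ := by
      rw [← hcon, hHd]; exact Polynomial.pow_rootMultiplicity_dvd _ _
    have h2 : q.map κ = (Polynomial.X - Polynomial.C c) ^ p.natDegree := by
      refine (Polynomial.eq_of_monic_of_dvd_of_natDegree_le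
        ((Polynomial.monic_X_sub_C c).pow _) hqbm h1 ?_)
      rw [hqbd, (Polynomial.monic_X_sub_C c).natDegree_pow, Polynomial.natDegree_X_sub_C, mul_one]
    have h3 : (q.map κ).nextCoeff = 0 := by
      rw [Polynomial.nextCoeff_of_natDegree_pos (by omega), hqbd, Polynomial.coeff_map, hq1,
        map_zero]
    rw [h2, (Polynomial.monic_X_sub_C c).nextCoeff_pow, Polynomial.nextCoeff_X_sub_C] at h3
    have h4 : c = 0 := by simpa [hn0] using h3
    apply hqk
    have := congrArg (fun r => Polynomial.coeff r k) h2
    rw [h4, map_zero, sub_zero] at this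
    simp only [Polynomial.coeff_map, Polynomial.coeff_X_pow] at this
    rwa [if_neg (by omega)] at this
  rw [hHQ]
  exact mul (ih _ (by omega) hHm rfl) (ih _ (by omega) hQm rfl)

end PuiseuxSplits

/-- The field of Hahn series over `ℂ` with exponents in `ℚ`, which contains all Puiseux series. -/
abbrev PuiseuxField := HahnSeries ℚ ℂ

namespace PuiseuxField

/-- The embedding of `ℂ⟦X⟧` sending `X` to the `N`-th root of the uniformizer. -/
def ofRoot (N : ℕ) (hN : N ≠ 0) : PowerSeries ℂ →+* PuiseuxField :=
  (HahnSeries.embDomainRingHom (AddMonoidHom.mulLeft ((N : ℚ)⁻¹))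
    (mul_right_injective₀ (inv_ne_zero (Nat.cast_ne_zero.2 hN)))
    (fun _ _ => mul_le_mul_iff_right₀ (inv_pos.2 (Nat.cast_pos.2 (Nat.pos_of_ne_zero hN))))).comp
    (HahnSeries.ofPowerSeries ℚ ℂ)

theorem coeff_ofRoot (N : ℕ) (hN : N ≠ 0) (a : PowerSeries ℂ) (n : ℕ) :
    (ofRoot N hN a).coeff ((N : ℚ)⁻¹ * n) = PowerSeries.coeff n a := by
  rw [← HahnSeries.ofPowerSeries_apply_coeff (Γ := ℚ)]
  exact HahnSeries.embDomain_coeff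

theorem exists_of_coeff_ofRoot_ne_zero (N : ℕ) (hN : N ≠ 0) (a : PowerSeries ℂ) (q : ℚ)
    (h : (ofRoot N hN a).coeff q ≠ 0) : ∃ n : ℕ, q = (N : ℚ)⁻¹ * n := by
  by_contra hcon
  apply h
  change (HahnSeries.embDomain _ (HahnSeries.ofPowerSeries ℚ ℂ a)).coeff q = 0
  by_cases hq : ∃ r : ℚ, q = (N : ℚ)⁻¹ * r
  · obtain ⟨r, rfl⟩ := hq
    refine (HahnSeries.embDomain_coeff).trans ?_
    rw [HahnSeries.ofPowerSeries_apply]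
    apply HahnSeries.embDomain_of_notMem_range
    rintro ⟨n, hn⟩
    exact hcon ⟨n, by rw [← hn]; rfl⟩
  · apply HahnSeries.embDomain_of_notMem_range
    rintro ⟨r, hr⟩
    exact hq ⟨r, hr.symm⟩

theorem ofRoot_expand (N : ℕ) (hN : N ≠ 0) (a : PowerSeries ℂ) :
    ofRoot N hN (PowerSeries.expand N hN a) = HahnSeries.ofPowerSeries ℚ ℂ a := by
  ext q
  have hN' : (N : ℚ) ≠ 0 := Nat.cast_ne_zero.2 hN
  by_cases h : ∃ n : ℕ, q = n
  · obtain ⟨n, rfl⟩ := h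
    have : (n : ℚ) = (N : ℚ)⁻¹ * ((N * n : ℕ) : ℚ) := by push_cast; field_simp
    rw [HahnSeries.ofPowerSeries_apply_coeff, this, coeff_ofRoot, PowerSeries.coeff_expand_mul]
  · have h1 : (HahnSeries.ofPowerSeries ℚ ℂ a).coeff q = 0 := by
      rw [HahnSeries.ofPowerSeries_apply]
      apply HahnSeries.embDomain_of_notMem_range
      rintro ⟨n, hn⟩
      exact h ⟨n, hn.symm⟩
    rw [h1]
    by_contra h2
    obtain ⟨n, rfl⟩ := exists_of_coeff_ofRoot_ne_zero N hN _ q h2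
    rw [coeff_ofRoot, PowerSeries.coeff_expand_of_not_dvd] at h2
    · exact h2 rfl
    · rintro ⟨m, rfl⟩
      exact h ⟨m, by push_cast; field_simp⟩

theorem coeff_zero_ofRoot (N : ℕ) (hN : N ≠ 0) (a : PowerSeries ℂ) :
    (ofRoot N hN a).coeff 0 = PowerSeries.constantCoeff a := by
  have := coeff_ofRoot N hN a 0
  rwa [Nat.cast_zero, mul_zero, PowerSeries.coeff_zero_eq_constantCoeff_apply] at this

theorem orderTop_ofRoot_nonneg (N : ℕ) (hN : N ≠ 0) (a : PowerSeries ℂ) :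
    0 ≤ (ofRoot N hN a).orderTop := by
  rw [HahnSeries.le_orderTop_iff_forall]
  intro q hq
  by_contra h
  obtain ⟨n, rfl⟩ := exists_of_coeff_ofRoot_ne_zero N hN a q h
  have h1 : (N : ℚ)⁻¹ * n < 0 := by exact_mod_cast hq
  have : 0 ≤ (N : ℚ)⁻¹ * n := by positivity
  linarith

/-- **Puiseux's theorem**: a monic polynomial over `ℂ⟦X⟧` splits in the field of Hahn series, with
integral roots whose residues are the roots of the reduction. -/
theorem exists_roots_of_monic {p : Polynomial (PowerSeries ℂ)} (hp : p.Monic) :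
    ∃ s : Multiset PuiseuxField,
      p.map (HahnSeries.ofPowerSeries ℚ ℂ) =
        (s.map fun a => Polynomial.X - Polynomial.C a).prod ∧
      (∀ a ∈ s, 0 ≤ a.orderTop) ∧
      p.map (PowerSeries.constantCoeff (R := ℂ)) =
        ((s.map fun a => a.coeff 0).map fun a => Polynomial.X - Polynomial.C a).prod := by
  obtain ⟨N, hN, s, hs⟩ := PuiseuxSplits.of_monic hp
  refine ⟨s.map (ofRoot N hN), ?_, ?_, ?_⟩
  · have := congrArg (Polynomial.map (ofRoot N hN)) hs
    rw [Polynomial.map_map, Polynomial.map_multiset_prod, Multiset.map_map] at this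
    rw [Multiset.map_map]
    have h2 : (ofRoot N hN).comp
        (PowerSeries.expand N hN : PowerSeries ℂ →ₐ[ℂ] PowerSeries ℂ).toRingHom =
        HahnSeries.ofPowerSeries ℚ ℂ := by
      ext1 a
      exact ofRoot_expand N hN a
    rw [h2] at this
    rw [this]
    simp
  · intro a ha
    obtain ⟨b, -, rfl⟩ := Multiset.mem_map.1 ha
    exact orderTop_ofRoot_nonneg N hN b
  · have := congrArg (Polynomial.map (PowerSeries.constantCoeff (R := ℂ))) hs
    rw [Polynomial.map_map, Polynomial.map_multiset_prod, Multiset.map_map] at this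
    have h2 : (PowerSeries.constantCoeff (R := ℂ)).comp
        (PowerSeries.expand N hN : PowerSeries ℂ →ₐ[ℂ] PowerSeries ℂ).toRingHom =
        PowerSeries.constantCoeff (R := ℂ) := by
      ext1 a
      exact PowerSeries.constantCoeff_expand N hN a
    rw [h2] at this
    rw [this, Multiset.map_map, Multiset.map_map]
    simp [Function.comp_def, coeff_zero_ofRoot]

theorem orderTop_sub_C_coeff_zero_pos {x : PuiseuxField} (hx : 0 ≤ x.orderTop) :
    0 < (x - HahnSeries.C (x.coeff 0)).orderTop := by
  by_contra h
  rw [not_lt] at h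
  set c := x.coeff 0 with hc
  obtain ⟨y, hy⟩ : ∃ y, y = x - HahnSeries.C c := ⟨_, rfl⟩
  rw [← hy] at h
  have hne : y ≠ 0 := by
    intro h0; rw [h0, HahnSeries.orderTop_zero] at h; simp at h
  have h1 := HahnSeries.order_eq_orderTop_of_ne_zero hne
  rw [← h1] at h
  have h2 : y.order ≤ 0 := WithTop.coe_le_coe.1 h
  have h3 : y.coeff y.order ≠ 0 := by rwa [Ne, HahnSeries.coeff_order_eq_zero]
  rcases h2.lt_or_eq with h2 | h2
  · apply h3
    have h4 : x.coeff y.order = 0 :=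
      HahnSeries.coeff_eq_zero_of_lt_orderTop (lt_of_lt_of_le (WithTop.coe_lt_coe.2 h2) hx)
    have h5 : (HahnSeries.C c : PuiseuxField).coeff y.order = 0 :=
      HahnSeries.coeff_single_of_ne h2.ne
    conv_lhs => rw [hy, HahnSeries.coeff_sub]
    rw [← hy, h4, h5, sub_zero]
  · rw [h2] at h3
    apply h3
    simp [hy, hc]

/-- The valuation ring of Hahn series of nonnegative order. -/
def integers : Subring PuiseuxField where
  carrier := {x | 0 ≤ x.orderTop}
  mul_mem' {a b} ha hb := by
    change 0 ≤ (a * b).orderTop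
    rw [HahnSeries.orderTop_mul]; exact add_nonneg ha hb
  one_mem' := by change 0 ≤ (1 : PuiseuxField).orderTop; rw [HahnSeries.orderTop_one]
  add_mem' {a b} ha hb := by
    change 0 ≤ (a + b).orderTop
    exact (le_min ha hb).trans HahnSeries.min_orderTop_le_orderTop_add
  zero_mem' := by change 0 ≤ (0 : PuiseuxField).orderTop; simp
  neg_mem' {a} ha := by change 0 ≤ (-a).orderTop; rwa [HahnSeries.orderTop_neg]

theorem mem_integers {x : PuiseuxField} : x ∈ integers ↔ 0 ≤ x.orderTop := by
  exact Iff.of_eq rfl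

theorem coeff_zero_mul {x y : PuiseuxField} (hx : x ∈ integers) (hy : y ∈ integers) :
    (x * y).coeff 0 = x.coeff 0 * y.coeff 0 := by
  have h1 := orderTop_sub_C_coeff_zero_pos hx
  have h2 := orderTop_sub_C_coeff_zero_pos hy
  set x' := x - HahnSeries.C (x.coeff 0) with hx'
  set y' := y - HahnSeries.C (y.coeff 0) with hy'
  have e : x * y = HahnSeries.C (x.coeff 0 * y.coeff 0) +
      (x' * y + HahnSeries.C (x.coeff 0) * y') := by
    rw [hx', hy', map_mul]; ring
  have h3 : (x' * y).coeff 0 = 0 := by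
    apply HahnSeries.coeff_eq_zero_of_lt_orderTop
    rw [HahnSeries.orderTop_mul]
    exact add_pos_of_pos_of_nonneg h1 hy
  have h4 : y'.coeff 0 = 0 := HahnSeries.coeff_eq_zero_of_lt_orderTop h2
  rw [e]
  simp [h3, h4, HahnSeries.C_apply]

/-- The residue map of the valuation ring of Hahn series. -/
def residue : integers →+* ℂ where
  toFun x := (x : PuiseuxField).coeff 0
  map_one' := by simp
  map_mul' x y := coeff_zero_mul x.2 y.2
  map_zero' := by simp
  map_add' x y := by simp

/-- The Euler derivation `x ↦ v · dx/dv` of the field of Hahn series. -/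
def euler : PuiseuxField →+ PuiseuxField where
  toFun x :=
    { coeff := fun q => (q : ℂ) * x.coeff q
      isPWO_support' := x.isPWO_support.mono fun q hq => by
        rw [HahnSeries.mem_support]
        exact right_ne_zero_of_mul hq }
  map_add' x y := by ext q; simp [mul_add]
  map_zero' := by ext q; simp

@[simp] theorem coeff_euler (x : PuiseuxField) (q : ℚ) :
    (euler x).coeff q = (q : ℂ) * x.coeff q := rfl

theorem support_euler_subset (x : PuiseuxField) : (euler x).support ⊆ x.support := fun q hq => by
  rw [HahnSeries.mem_support] at hq ⊢
  exact right_ne_zero_of_mul (a := (q : ℂ)) hq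

theorem euler_mul (x y : PuiseuxField) : euler (x * y) = x * euler y + euler x * y := by
  ext q
  rw [HahnSeries.coeff_add,
    HahnSeries.coeff_mul_right' y.isPWO_support (support_euler_subset y),
    HahnSeries.coeff_mul_left' x.isPWO_support (support_euler_subset x),
    ← Finset.sum_add_distrib, coeff_euler, HahnSeries.coeff_mul, Finset.mul_sum]
  refine Finset.sum_congr rfl fun ij hij => ?_
  rw [Finset.mem_antidiagonal] at hij
  rw [← hij.2.2, coeff_euler, coeff_euler]
  push_cast
  ring

@[simp] theorem euler_C (c : ℂ) : euler (HahnSeries.C c) = 0 := by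
  ext q
  rw [coeff_euler, HahnSeries.C_apply]
  by_cases hq : q = 0
  · simp [hq]
  · rw [HahnSeries.coeff_single_of_ne hq]; simp

/-- Evaluation of a polynomial in two variables at Hahn series. -/
def eval₂ (x y : PuiseuxField) : MvPolynomial (Fin 2) ℂ →+* PuiseuxField :=
  MvPolynomial.eval₂Hom HahnSeries.C ![x, y]

@[simp] theorem eval₂_C (x y : PuiseuxField) (c : ℂ) : eval₂ x y (C c) = HahnSeries.C c := by
  simp [eval₂]

@[simp] theorem eval₂_X_zero (x y : PuiseuxField) : eval₂ x y (X 0) = x := by simp [eval₂]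

@[simp] theorem eval₂_X_one (x y : PuiseuxField) : eval₂ x y (X 1) = y := by simp [eval₂]

theorem euler_eval₂ (x y : PuiseuxField) (f : MvPolynomial (Fin 2) ℂ) :
    euler (eval₂ x y f) =
      eval₂ x y (pderiv 0 f) * euler x + eval₂ x y (pderiv 1 f) * euler y := by
  induction f using MvPolynomial.induction_on with
  | C a => rw [eval₂_C, euler_C]; simp
  | add p q hp hq =>
    rw [map_add, map_add, hp, hq, map_add, map_add, map_add, map_add]; ring
  | mul_X p n hp =>
    rw [map_mul, euler_mul, hp, pderiv_mul, pderiv_mul, map_add, map_add, map_mul, map_mul,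
      map_mul, map_mul]
    fin_cases n
    · simp; ring
    · simp; ring

theorem orderTop_euler (x : PuiseuxField) :
    (euler x).orderTop = (x - HahnSeries.C (x.coeff 0)).orderTop := by
  have key : ∀ q, (euler x).coeff q = 0 ↔ (x - HahnSeries.C (x.coeff 0)).coeff q = 0 := by
    intro q
    by_cases hq : q = 0
    · subst hq; simp
    · rw [coeff_euler, HahnSeries.coeff_sub, HahnSeries.C_apply,
        HahnSeries.coeff_single_of_ne hq]
      simp [hq]
  apply le_antisymm <;> rw [HahnSeries.le_orderTop_iff_forall] <;> intro q hq
  · exact (key q).1 (HahnSeries.coeff_eq_zero_of_lt_orderTop hq)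
  · exact (key q).2 (HahnSeries.coeff_eq_zero_of_lt_orderTop hq)

end PuiseuxField

theorem PowerSeries.finite_quotient_span_singleton {a : PowerSeries ℂ} (ha : a ≠ 0) :
    Module.Finite ℂ (PowerSeries ℂ ⧸ Ideal.span {a}) ∧
    Module.finrank ℂ (PowerSeries ℂ ⧸ Ideal.span {a}) = a.order.toNat := by
  set n := a.order.toNat with hn
  have hspan : Ideal.span {a} = Ideal.span {(PowerSeries.X : PowerSeries ℂ) ^ n} := by
    rw [Ideal.span_singleton_eq_span_singleton]
    obtain ⟨w, hw⟩ := PowerSeries.isUnit_divided_by_X_pow_order ha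
    exact Associated.symm ⟨w, by rw [hw]; exact PowerSeries.X_pow_order_mul_divXPowOrder⟩
  let φ : PowerSeries ℂ →ₗ[ℂ] (Fin n → ℂ) := LinearMap.pi fun i => PowerSeries.coeff (i : ℕ)
  have hker : LinearMap.ker φ = (Ideal.span {a}).restrictScalars ℂ := by
    ext x
    rw [hspan, LinearMap.mem_ker, Submodule.restrictScalars_mem, Ideal.mem_span_singleton,
      PowerSeries.X_pow_dvd_iff, _root_.funext_iff]
    constructor
    · intro h m hm
      exact h ⟨m, hm⟩
    · intro h i
      exact h i i.2
  have hsurj : Function.Surjective φ := fun c =>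
    ⟨PowerSeries.mk fun m => if h : m < n then c ⟨m, h⟩ else 0, by
      ext i; simp [φ]⟩
  let e1 : (PowerSeries ℂ ⧸ (Ideal.span {a}).restrictScalars ℂ) ≃ₗ[ℂ] (Fin n → ℂ) :=
    (Submodule.quotEquivOfEq _ _ hker.symm).trans (φ.quotKerEquivOfSurjective hsurj)
  let e2 : (PowerSeries ℂ ⧸ Ideal.span {a}) ≃ₗ[ℂ] (Fin n → ℂ) :=
    (Submodule.Quotient.restrictScalarsEquiv ℂ (Ideal.span {a})).symm.trans e1
  exact ⟨Module.Finite.equiv e2.symm, by rw [e2.finrank_eq]; simp⟩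

theorem LinearMap.exists_smith_of_det_ne_zero {A M ι : Type*} [CommRing A] [IsDomain A]
    [IsPrincipalIdealRing A] [AddCommGroup M] [Module A M] [Fintype ι] (b : Module.Basis ι A M)
    (T : M →ₗ[A] M) (hT : LinearMap.det T ≠ 0) :
    ∃ a : ι → A, Associated (LinearMap.det T) (∏ i, a i) ∧
      Nonempty ((M ⧸ LinearMap.range T) ≃ₗ[A] ∀ i, A ⧸ Ideal.span {a i}) := by
  classical
  have hinj : Function.Injective T := by
    rw [← LinearMap.ker_eq_bot]
    have := Module.Free.of_basis b
    have := Module.Finite.of_basis b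
    by_contra h
    exact hT (LinearMap.det_eq_zero_iff_ker_ne_bot.2 h)
  have hrank : Module.finrank A (LinearMap.range T) = Module.finrank A M :=
    LinearMap.finrank_range_of_inj hinj
  refine ⟨Submodule.smithNormalFormCoeffs b hrank, ?_, ⟨Submodule.quotientEquivPiSpan _ b hrank⟩⟩
  let b' := Submodule.smithNormalFormTopBasis b hrank
  rw [← Matrix.det_diagonal, ← LinearMap.det_toLin b']
  let e : M ≃ₗ[A] M := (b'.equiv (Submodule.smithNormalFormBotBasis b hrank) (Equiv.refl _)).trans
      (LinearEquiv.ofInjective T hinj).symm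
  refine (LinearMap.associated_det_of_eq_comp e _ _ ?_).symm
  intro x
  have : T ∘ₗ (LinearEquiv.ofInjective T hinj).symm.toLinearMap =
      (LinearMap.range T).subtype := by
    ext x
    have := (LinearEquiv.ofInjective T hinj).apply_symm_apply x
    exact congrArg Subtype.val this
  have h2 : T ∘ₗ e.toLinearMap = Matrix.toLin b' b'
      (Matrix.diagonal (Submodule.smithNormalFormCoeffs b hrank)) := by
    refine b'.ext fun i => ?_
    rw [Matrix.toLin_self]
    have h4 := Submodule.smithNormalFormBotBasis_def b hrank i
    simp only [Matrix.diagonal_apply, ite_smul, zero_smul, Finset.sum_ite_eq', Finset.mem_univ,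
      if_true]
    rw [← h4]
    simp [e]
  exact (LinearMap.congr_fun h2 x).symm

theorem PowerSeries.finrank_quotient_range {M ι : Type*} [AddCommGroup M] [Module (PowerSeries ℂ) M]
    [Module ℂ M] [IsScalarTower ℂ (PowerSeries ℂ) M] [Fintype ι]
    (b : Module.Basis ι (PowerSeries ℂ) M)
    (T : M →ₗ[PowerSeries ℂ] M) (hT : LinearMap.det T ≠ 0) :
    Module.finrank ℂ (M ⧸ LinearMap.range T) = (LinearMap.det T).order.toNat := by
  obtain ⟨a, ha, ⟨e⟩⟩ := LinearMap.exists_smith_of_det_ne_zero b T hT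
  have ha0 : ∀ i, a i ≠ 0 := by
    have : ∏ i, a i ≠ 0 := fun h => hT (ha.eq_zero_iff.2 h)
    rw [Finset.prod_ne_zero_iff] at this
    exact fun i => this i (Finset.mem_univ i)
  rw [(e.restrictScalars ℂ).finrank_eq]
  have : ∀ i, Module.Finite ℂ (PowerSeries ℂ ⧸ Ideal.span {a i}) := fun i =>
    (PowerSeries.finite_quotient_span_singleton (ha0 i)).1
  rw [Module.finrank_pi_fintype]
  simp_rw [fun i => (PowerSeries.finite_quotient_span_singleton (ha0 i)).2]
  have h1 : (LinearMap.det T).order = (∏ i, a i).order := by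
    obtain ⟨u, hu⟩ := ha
    rw [← hu, PowerSeries.order_mul, PowerSeries.order_zero_of_unit u.isUnit, add_zero]
  have h2 : (∏ i, a i).order = ((∑ i, (a i).order.toNat : ℕ) : ℕ∞) := by
    rw [PowerSeries.order_prod]
    push_cast
    refine Finset.sum_congr rfl fun i _ => ?_
    rw [ENat.natCast_toNat]
    simpa [PowerSeries.order_eq_top] using ha0 i
  rw [h1, h2, ENat.toNat_natCast]

theorem Matrix.det_aeval_eq_prod_of_isAlgClosed {n L : Type*} [Fintype n] [DecidableEq n] [Field L]
    [IsAlgClosed L] (M : Matrix n n L) (s : Multiset L)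
    (hs : M.charpoly = (s.map fun a => Polynomial.X - Polynomial.C a).prod) (g : Polynomial L) :
    (Polynomial.aeval M g).det = (s.map fun a => g.eval a).prod := by
  have hcard : Multiset.card s = Fintype.card n := by
    have := congrArg Polynomial.natDegree hs
    rw [Matrix.charpoly_natDegree_eq_dim,
        Polynomial.natDegree_multiset_prod_X_sub_C_eq_card] at this
    exact this.symm
  have hmul : ∀ p q : Polynomial L, (Polynomial.aeval M p).det = (s.map fun a => p.eval a).prod →
      (Polynomial.aeval M q).det = (s.map fun a => q.eval a).prod →
      (Polynomial.aeval M (p * q)).det = (s.map fun a => (p * q).eval a).prod := by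
    intro p q hp hq
    simp only [map_mul, Matrix.det_mul, hp, hq, Polynomial.eval_mul, Multiset.prod_map_mul]
  have hC : ∀ c : L, (Polynomial.aeval M (Polynomial.C c)).det =
      (s.map fun a => (Polynomial.C c).eval a).prod := by
    intro c
    simp [Matrix.algebraMap_eq_diagonal, hcard]
  have hX : ∀ c : L, (Polynomial.aeval M (Polynomial.X - Polynomial.C c)).det =
      (s.map fun a => (Polynomial.X - Polynomial.C c).eval a).prod := by
    intro c
    have h1 := Matrix.eval_charpoly M c
    rw [hs, Polynomial.eval_multiset_prod, Multiset.map_map] at h1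
    have h2 : (Polynomial.aeval M (Polynomial.X - Polynomial.C c)) = -(Matrix.scalar n c - M) := by
      simp [Matrix.algebraMap_eq_diagonal, Matrix.scalar_apply]
    rw [h2, Matrix.det_neg, ← h1, ← hcard]
    have : ∀ t : Multiset L, (-1) ^ Multiset.card t * (t.map fun a => c - a).prod =
        (t.map fun a => a - c).prod := by
      intro t
      induction t using Multiset.induction_on with
      | empty => simp
      | cons a t ih =>
        rw [Multiset.map_cons, Multiset.prod_cons, Multiset.map_cons, Multiset.prod_cons, ← ih,
          Multiset.card_cons]
        ring
    simpa [Function.comp_def] using this s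
  have hsp := IsAlgClosed.splits g
  rw [hsp.eq_prod_roots]
  apply hmul _ _ (hC _)
  generalize g.roots = r
  induction r using Multiset.induction_on with
  | empty => simp
  | cons a t ih =>
    rw [Multiset.map_cons, Multiset.prod_cons]
    exact hmul _ _ (hX a) ih

theorem Matrix.map_aeval {n A B : Type*} [Fintype n] [DecidableEq n] [CommRing A] [CommRing B]
    (φ : A →+* B) (M : Matrix n n A) (g : Polynomial A) :
    φ.mapMatrix (Polynomial.aeval M g) = Polynomial.aeval (M.map φ) (g.map φ) := by
  refine Polynomial.map_aeval_eq_aeval_map ?_ g M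
  ext1 a
  simp [Matrix.algebraMap_eq_diagonal, Matrix.diagonal_map]

theorem Matrix.det_aeval_eq_prod {n K : Type*} [Fintype n] [DecidableEq n] [Field K]
    (M : Matrix n n K) (s : Multiset K)
    (hs : M.charpoly = (s.map fun a => Polynomial.X - Polynomial.C a).prod) (g : Polynomial K) :
    (Polynomial.aeval M g).det = (s.map fun a => g.eval a).prod := by
  let i := algebraMap K (AlgebraicClosure K)
  apply i.injective
  have h := Matrix.det_aeval_eq_prod_of_isAlgClosed (M.map i) (s.map i)
    (by
      rw [Matrix.charpoly_map, hs, Polynomial.map_multiset_prod, Multiset.map_map, Multiset.map_map]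
      simp) (g.map i)
  rw [RingHom.map_det, map_multiset_prod, Multiset.map_map]
  rw [Multiset.map_map] at h
  simp only [Function.comp_def, Polynomial.eval_map, Polynomial.eval₂_at_apply] at h
  rw [Function.comp_def, ← h]
  congr 1
  exact Matrix.map_aeval i M g

/-- The norm of a polynomial modulo a monic polynomial `H` is the product of its values at the roots
of `H`. -/
theorem AdjoinRoot.map_det_mulLeft {A K : Type*} [CommRing A] [Nontrivial A] [Field K] (φ : A →+* K)
    (H g : Polynomial A)
    (hH : H.Monic) (s : Multiset K)
    (hs : H.map φ = (s.map fun a => Polynomial.X - Polynomial.C a).prod) :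
    φ (LinearMap.det (LinearMap.mulLeft A (AdjoinRoot.mk H g))) =
      (s.map fun a => (g.map φ).eval a).prod := by
  classical
  let pb := AdjoinRoot.powerBasis' hH
  have h1 : LinearMap.det (LinearMap.mulLeft A (AdjoinRoot.mk H g)) =
      (Algebra.leftMulMatrix pb.basis (AdjoinRoot.mk H g)).det := by
    rw [← LinearMap.det_toMatrix pb.basis]; rfl
  have h2 : Algebra.leftMulMatrix pb.basis (AdjoinRoot.mk H g) =
      Polynomial.aeval (Algebra.leftMulMatrix pb.basis pb.gen) g := by
    rw [Polynomial.aeval_algHom_apply]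
    congr 1
    rw [AdjoinRoot.powerBasis'_gen, AdjoinRoot.aeval_eq]
  have h3 : (Algebra.leftMulMatrix pb.basis pb.gen).charpoly = H := by
    have hmin : (Algebra.leftMulMatrix pb.basis pb.gen).charpoly = minpoly A pb.gen :=
      charpoly_leftMulMatrix pb
    refine Polynomial.eq_of_monic_of_dvd_of_natDegree_le hH (Matrix.charpoly_monic _) ?_ ?_
    · have h0 := minpoly.aeval A pb.gen
      rw [← hmin, AdjoinRoot.powerBasis'_gen, AdjoinRoot.aeval_eq, AdjoinRoot.mk_eq_zero] at h0
      exact h0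
    · refine le_of_eq ?_
      rw [Matrix.charpoly_natDegree_eq_dim, Fintype.card_fin, AdjoinRoot.powerBasis'_dim]
  rw [h1, h2, RingHom.map_det, Matrix.map_aeval]
  apply Matrix.det_aeval_eq_prod
  rw [Matrix.charpoly_map, h3, hs]

theorem Polynomial.IsDistinguishedAt.exists_dvd_sub_coe {A : Type*} [CommRing A] {I : Ideal A}
    [IsAdicComplete I A] {H : Polynomial A} (hH : H.IsDistinguishedAt I) (f : PowerSeries A) :
    ∃ r : Polynomial A, (H : PowerSeries A) ∣ f - (r : PowerSeries A) := by
  obtain ⟨x, hx⟩ := hH.algEquivQuotient.surjective (Ideal.Quotient.mk _ f)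
  obtain ⟨r, rfl⟩ := Ideal.Quotient.mk_surjective x
  refine ⟨r, ?_⟩
  rw [← Ideal.mem_span_singleton, ← Ideal.Quotient.eq, ← hx,
    Polynomial.IsDistinguishedAt.algEquivQuotient_apply]
  erw [Ideal.quotientMap_mk]
  simp

theorem Polynomial.IsDistinguishedAt.mem_span_pair_iff {A : Type*} [CommRing A] {I : Ideal A}
    [IsAdicComplete I A] {H : Polynomial A} (hH : H.IsDistinguishedAt I) (g p : Polynomial A) :
    (p : PowerSeries A) ∈ Ideal.span {(H : PowerSeries A), (g : PowerSeries A)} ↔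
      p ∈ Ideal.span {H, g} := by
  constructor
  · intro h
    obtain ⟨a, b, hab⟩ := Ideal.mem_span_pair.1 h
    obtain ⟨r, c, hr⟩ := hH.exists_dvd_sub_coe b
    obtain ⟨k, hk⟩ : H ∣ p - g * r := by
      apply hH.dvd_of_coe_dvd
      refine ⟨a + g * c, ?_⟩
      rw [Polynomial.coe_sub, Polynomial.coe_mul, ← hab]
      linear_combination (g : PowerSeries A) * hr
    rw [Ideal.mem_span_pair]
    exact ⟨k, r, by linear_combination -hk⟩
  · intro h
    obtain ⟨a, b, hab⟩ := Ideal.mem_span_pair.1 h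
    rw [Ideal.mem_span_pair]
    exact ⟨a, b, by rw [← hab]; simp⟩

/-- Power series in two variables `u`, `v` as power series in `u` over power series in `v`. -/
def bivariatePowerSeriesEquiv :
    MvPowerSeries (Fin 2) ℂ ≃+* PowerSeries (PowerSeries ℂ) :=
  ((MvPowerSeries.renameEquiv ℂ (finSuccEquiv 1)).trans
    ((MvPowerSeries.renameEquiv ℂ (Equiv.optionCongr (Equiv.ofUnique (Fin 1) Unit))).trans
    (MvPowerSeries.optionEquivLeft Unit ℂ))).toRingEquiv

theorem bivariatePowerSeriesEquiv_X_zero :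
    bivariatePowerSeriesEquiv (MvPowerSeries.X 0) = PowerSeries.X := by
  simp [bivariatePowerSeriesEquiv]

theorem bivariatePowerSeriesEquiv_X_one :
    bivariatePowerSeriesEquiv (MvPowerSeries.X 1) = PowerSeries.C PowerSeries.X := by
  have h : (_root_.finSuccEquiv 1) 1 = some 0 := rfl
  simp [bivariatePowerSeriesEquiv, h]
  rfl

theorem bivariatePowerSeriesEquiv_C (c : ℂ) :
    bivariatePowerSeriesEquiv (MvPowerSeries.C c) = PowerSeries.C (PowerSeries.C c) := by
  simp [bivariatePowerSeriesEquiv]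
  rfl

/-- A polynomial in `u = X 0` and `v = X 1` as a polynomial in `u` over power series in `v`. -/
def toPolynomialPowerSeries : MvPolynomial (Fin 2) ℂ →+* Polynomial (PowerSeries ℂ) :=
  eval₂Hom (Polynomial.C.comp (PowerSeries.C (R := ℂ)))
    ![Polynomial.X, Polynomial.C PowerSeries.X]

@[simp] theorem toPolynomialPowerSeries_C (c : ℂ) :
    toPolynomialPowerSeries (C c) = Polynomial.C (PowerSeries.C c) := by
  simp [toPolynomialPowerSeries]

@[simp] theorem toPolynomialPowerSeries_X_zero :
    toPolynomialPowerSeries (X 0) = Polynomial.X := by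
  simp [toPolynomialPowerSeries]

@[simp] theorem toPolynomialPowerSeries_X_one :
    toPolynomialPowerSeries (X 1) = Polynomial.C PowerSeries.X := by
  simp [toPolynomialPowerSeries]

theorem bivariatePowerSeriesEquiv_coe (h : MvPolynomial (Fin 2) ℂ) :
    bivariatePowerSeriesEquiv (h : MvPowerSeries (Fin 2) ℂ) =
      (toPolynomialPowerSeries h : PowerSeries (PowerSeries ℂ)) := by
  have : bivariatePowerSeriesEquiv.toRingHom.comp MvPolynomial.coeToMvPowerSeries.ringHom =
      Polynomial.coeToPowerSeries.ringHom.comp toPolynomialPowerSeries := by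
    apply MvPolynomial.ringHom_ext
    · intro c
      simp [bivariatePowerSeriesEquiv_C]
    · intro i
      fin_cases i
      · simp [bivariatePowerSeriesEquiv_X_zero]
      · simp [bivariatePowerSeriesEquiv_X_one]
  exact RingHom.congr_fun this h

theorem finrank_quotient_eq_adjoinRoot {h g : MvPolynomial (Fin 2) ℂ}
    {H Q : Polynomial (PowerSeries ℂ)} (hfac : toPolynomialPowerSeries h = H * Q)
    (hH : H.IsDistinguishedAt (IsLocalRing.maximalIdeal (PowerSeries ℂ)))
    (hQ : IsUnit (Q : PowerSeries (PowerSeries ℂ))) :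
    Module.finrank ℂ (MvPowerSeries (Fin 2) ℂ ⧸
      Ideal.span {(h : MvPowerSeries (Fin 2) ℂ), (g : MvPowerSeries (Fin 2) ℂ)}) =
    Module.finrank ℂ (AdjoinRoot H ⧸ LinearMap.range
      (LinearMap.mulLeft (PowerSeries ℂ) (AdjoinRoot.mk H (toPolynomialPowerSeries g)))) := by
  have : IsAdicComplete (IsLocalRing.maximalIdeal (PowerSeries ℂ)) (PowerSeries ℂ) := by
    rw [PowerSeries.maximalIdeal_eq_span_X]; infer_instance
  set J := Ideal.span {(h : MvPowerSeries (Fin 2) ℂ), (g : MvPowerSeries (Fin 2) ℂ)} with hJ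
  let Ψ := bivariatePowerSeriesEquiv
  have hmem : ∀ x : MvPowerSeries (Fin 2) ℂ, x ∈ J ↔ Ψ x ∈ Ideal.span
      {(H : PowerSeries (PowerSeries ℂ)),
          (toPolynomialPowerSeries g : PowerSeries (PowerSeries ℂ))} := by
    intro x
    have h1 : Ideal.map Ψ J = Ideal.span
      {(H : PowerSeries (PowerSeries ℂ)),
          (toPolynomialPowerSeries g : PowerSeries (PowerSeries ℂ))} := by
      rw [hJ, Ideal.map_span, Set.image_pair, bivariatePowerSeriesEquiv_coe,
        bivariatePowerSeriesEquiv_coe, hfac, Polynomial.coe_mul, Ideal.span_insert,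
        Ideal.span_insert, Ideal.span_singleton_mul_right_unit hQ]
    rw [← h1]
    constructor
    · intro hx
      exact Ideal.mem_map_of_mem _ hx
    · intro hx
      obtain ⟨y, hy, hyx⟩ := (Ideal.mem_map_iff_of_surjective Ψ Ψ.surjective).1 hx
      rwa [← Ψ.injective hyx]
  let φ : Polynomial (PowerSeries ℂ) →+* MvPowerSeries (Fin 2) ℂ ⧸ J :=
    (Ideal.Quotient.mk J).comp (Ψ.symm.toRingHom.comp Polynomial.coeToPowerSeries.ringHom)
  have hφ : ∀ p, φ p = 0 ↔ p ∈ Ideal.span {H, toPolynomialPowerSeries g} := by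
    intro p
    rw [← hH.mem_span_pair_iff]
    change Ideal.Quotient.mk J _ = 0 ↔ _
    rw [Ideal.Quotient.eq_zero_iff_mem, hmem]
    simp [Ψ]
  let θ : AdjoinRoot H →+* MvPowerSeries (Fin 2) ℂ ⧸ J :=
    Ideal.Quotient.lift _ φ fun a ha => by
      rw [hφ]
      exact Ideal.span_mono (by simp) ha
  have hθ : ∀ p, θ (AdjoinRoot.mk H p) = φ p := fun p => rfl
  let θl : AdjoinRoot H →ₗ[ℂ] MvPowerSeries (Fin 2) ℂ ⧸ J :=
    { θ with
      map_smul' := by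
        intro c x
        obtain ⟨p, rfl⟩ := AdjoinRoot.mk_surjective x
        have h1 : c • AdjoinRoot.mk H p =
            AdjoinRoot.mk H (Polynomial.C (PowerSeries.C c) * p) := by
          rw [AdjoinRoot.smul_mk]
          congr 1
          ext n m
          simp
        have h2 : Ψ.symm (PowerSeries.C (PowerSeries.C c)) = MvPowerSeries.C c := by
          rw [← bivariatePowerSeriesEquiv_C, RingEquiv.symm_apply_apply]
        have h3 : ∀ z : MvPowerSeries (Fin 2) ℂ ⧸ J,
            c • z = Ideal.Quotient.mk J (MvPowerSeries.C c) * z := fun z => Algebra.smul_def c z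
        change θ _ = c • θ _
        rw [h1, hθ, hθ, map_mul, h3]
        congr 1
        change Ideal.Quotient.mk J (Ψ.symm (Polynomial.C _ : Polynomial (PowerSeries ℂ))) = _
        rw [Polynomial.coe_C, h2] }
  have hsurj : Function.Surjective θl := by
    intro y
    obtain ⟨f, rfl⟩ := Ideal.Quotient.mk_surjective y
    obtain ⟨r, hr⟩ := hH.exists_dvd_sub_coe (Ψ f)
    refine ⟨AdjoinRoot.mk H r, ?_⟩
    change Ideal.Quotient.mk J _ = _
    rw [eq_comm, Ideal.Quotient.eq, hmem, map_sub]
    refine Ideal.span_mono (s := {(H : PowerSeries (PowerSeries ℂ))}) (by simp)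
      (Ideal.mem_span_singleton.2 ?_)
    simpa [Ψ] using hr
  have hker : LinearMap.ker θl = (LinearMap.range (LinearMap.mulLeft (PowerSeries ℂ)
      (AdjoinRoot.mk H (toPolynomialPowerSeries g)))).restrictScalars ℂ := by
    ext x
    obtain ⟨p, rfl⟩ := AdjoinRoot.mk_surjective x
    rw [LinearMap.mem_ker, Submodule.restrictScalars_mem, LinearMap.mem_range]
    change φ p = 0 ↔ _
    rw [hφ, Ideal.mem_span_pair]
    constructor
    · rintro ⟨a, b, hab⟩
      refine ⟨AdjoinRoot.mk H b, ?_⟩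
      rw [LinearMap.mulLeft_apply, ← map_mul, AdjoinRoot.mk_eq_mk]
      exact ⟨-a, by linear_combination hab⟩
    · rintro ⟨y, hy⟩
      obtain ⟨b, rfl⟩ := AdjoinRoot.mk_surjective y
      rw [LinearMap.mulLeft_apply, ← map_mul, AdjoinRoot.mk_eq_mk] at hy
      obtain ⟨a, ha⟩ := hy
      exact ⟨-a, b, by linear_combination ha⟩
  rw [← (θl.quotKerEquivOfSurjective hsurj).finrank_eq,
    (Submodule.quotEquivOfEq _ _ hker).finrank_eq,
    (Submodule.Quotient.restrictScalarsEquiv ℂ _).finrank_eq]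

namespace PuiseuxField

/-- The uniformizer of the field of Puiseux series. -/
def unif : PuiseuxField := HahnSeries.single 1 1

theorem ofPowerSeries_X_eq : HahnSeries.ofPowerSeries ℚ ℂ PowerSeries.X = unif :=
  HahnSeries.ofPowerSeries_X

theorem unif_ne_zero : unif ≠ 0 := HahnSeries.single_ne_zero one_ne_zero

@[simp] theorem order_unif : unif.order = 1 := HahnSeries.order_single one_ne_zero

theorem eval_map_toPolynomialPowerSeries (h : MvPolynomial (Fin 2) ℂ) (κ : PuiseuxField) :
    ((toPolynomialPowerSeries h).map (HahnSeries.ofPowerSeries ℚ ℂ)).eval κ = eval₂ κ unif h := by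
  have : ((Polynomial.evalRingHom κ).comp
      (Polynomial.mapRingHom (HahnSeries.ofPowerSeries ℚ ℂ))).comp toPolynomialPowerSeries =
      eval₂ κ unif := by
    apply MvPolynomial.ringHom_ext
    · intro c
      simp [HahnSeries.ofPowerSeries_C]
    · intro i
      fin_cases i
      · simp
      · simp [unif]
  exact RingHom.congr_fun this h

open scoped Classical in
/-- The branches `u = κ(v)` at the origin of the plane curve `h = 0`. -/
def branches (h : MvPolynomial (Fin 2) ℂ) : Multiset PuiseuxField :=
  ((toPolynomialPowerSeries h).map (HahnSeries.ofPowerSeries ℚ ℂ)).roots.filter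
    fun κ => 0 < κ.orderTop

theorem eval₂_of_mem_branches {h : MvPolynomial (Fin 2) ℂ} {κ : PuiseuxField}
    (hκ : κ ∈ branches h) : eval₂ κ unif h = 0 := by
  rw [branches, Multiset.mem_filter] at hκ
  rw [← eval_map_toPolynomialPowerSeries]
  exact Polynomial.isRoot_of_mem_roots hκ.1

theorem orderTop_pos_of_mem_branches {h : MvPolynomial (Fin 2) ℂ} {κ : PuiseuxField}
    (hκ : κ ∈ branches h) : 0 < κ.orderTop := by
  rw [branches, Multiset.mem_filter] at hκ
  exact hκ.2

theorem ofPowerSeries_mem_integers (a : PowerSeries ℂ) :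
    HahnSeries.ofPowerSeries ℚ ℂ a ∈ integers := by
  have := orderTop_ofRoot_nonneg 1 one_ne_zero (PowerSeries.expand 1 one_ne_zero a)
  rwa [ofRoot_expand] at this

theorem coeff_zero_ofPowerSeries (a : PowerSeries ℂ) :
    (HahnSeries.ofPowerSeries ℚ ℂ a).coeff 0 = PowerSeries.constantCoeff a := by
  have := HahnSeries.ofPowerSeries_apply_coeff (Γ := ℚ) a 0
  simpa using this

/-- The reduction of the value of an integral polynomial. -/
theorem coeff_zero_eval_map (p : Polynomial (PowerSeries ℂ)) {κ : PuiseuxField}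
    (hκ : κ ∈ integers) :
    (p.map (HahnSeries.ofPowerSeries ℚ ℂ)).eval κ ∈ integers ∧
    ((p.map (HahnSeries.ofPowerSeries ℚ ℂ)).eval κ).coeff 0 =
      (p.map (PowerSeries.constantCoeff (R := ℂ))).eval (κ.coeff 0) := by
  let ψ : PowerSeries ℂ →+* integers :=
    (HahnSeries.ofPowerSeries ℚ ℂ).codRestrict integers ofPowerSeries_mem_integers
  have h1 : (p.map (HahnSeries.ofPowerSeries ℚ ℂ)).eval κ =
      integers.subtype ((p.map ψ).eval ⟨κ, hκ⟩) := by
    rw [← Polynomial.eval_map_apply, Polynomial.map_map]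
    rfl
  rw [h1]
  refine ⟨Subtype.property _, ?_⟩
  change residue _ = _
  rw [← Polynomial.eval_map_apply, Polynomial.map_map]
  congr 2
  ext1 a
  exact coeff_zero_ofPowerSeries a

theorem order_eq_zero_of_coeff_zero_ne {x : PuiseuxField} (hx : x ∈ integers)
    (h : x.coeff 0 ≠ 0) : x.order = 0 := by
  apply le_antisymm (HahnSeries.order_le_of_coeff_ne_zero h)
  have hx0 : x ≠ 0 := by rintro rfl; simp at h
  have := mem_integers.1 hx
  rw [← HahnSeries.order_eq_orderTop_of_ne_zero hx0] at this
  exact_mod_cast this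

theorem order_ofPowerSeries {a : PowerSeries ℂ} (ha : a ≠ 0) :
    (HahnSeries.ofPowerSeries ℚ ℂ a).order = a.order.toNat := by
  have hu := PowerSeries.isUnit_divided_by_X_pow_order ha
  have hc : PowerSeries.constantCoeff (PowerSeries.divXPowOrder a) ≠ 0 :=
    (PowerSeries.isUnit_iff_constantCoeff.1 hu).ne_zero
  have hi := ofPowerSeries_mem_integers (PowerSeries.divXPowOrder a)
  rw [← coeff_zero_ofPowerSeries] at hc
  have h0 := order_eq_zero_of_coeff_zero_ne hi hc
  conv_lhs => rw [← PowerSeries.X_pow_order_mul_divXPowOrder (f := a)]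
  rw [map_mul, map_pow, ofPowerSeries_X_eq, HahnSeries.order_mul (pow_ne_zero _ unif_ne_zero)
    (fun h => by rw [h] at hc; simp at hc), h0, HahnSeries.order_pow, order_unif]
  simp

theorem order_multiset_prod {s : Multiset PuiseuxField} (hs : ∀ x ∈ s, x ≠ 0) :
    s.prod.order = (s.map HahnSeries.order).sum := by
  induction s using Multiset.induction_on with
  | empty => simp
  | cons a t ih =>
    rw [Multiset.prod_cons, Multiset.map_cons, Multiset.sum_cons, HahnSeries.order_mul, ih]
    · exact fun x hx => hs x (Multiset.mem_cons_of_mem hx)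
    · exact hs a (Multiset.mem_cons_self a t)
    · exact Multiset.prod_ne_zero fun h0 => hs 0 (Multiset.mem_cons_of_mem h0) rfl

theorem branches_aux {h : MvPolynomial (Fin 2) ℂ}
    (hh : (toPolynomialPowerSeries h).map (PowerSeries.constantCoeff (R := ℂ)) ≠ 0) :
    ∃ H Q : Polynomial (PowerSeries ℂ), toPolynomialPowerSeries h = H * Q ∧ H.Monic ∧
      H.natDegree =
        ((toPolynomialPowerSeries h).map (PowerSeries.constantCoeff (R := ℂ))).rootMultiplicity 0 ∧
      H.IsDistinguishedAt (IsLocalRing.maximalIdeal (PowerSeries ℂ)) ∧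
      IsUnit (Q : PowerSeries (PowerSeries ℂ)) ∧
      H.map (HahnSeries.ofPowerSeries ℚ ℂ) =
        ((branches h).map fun a => Polynomial.X - Polynomial.C a).prod := by
  classical
  obtain ⟨H, Q, hfac, hmon, hdeg, hred, hdist, hunit, hQ0⟩ := exists_distinguished_factor _ hh
  refine ⟨H, Q, hfac, hmon, hdeg, hdist, hunit, ?_⟩
  obtain ⟨s, hs, hs0, hsred⟩ := exists_roots_of_monic hmon
  have hpos : ∀ a ∈ s, 0 < a.orderTop := by
    intro a ha
    have h1 : (H.map (PowerSeries.constantCoeff (R := ℂ))).eval (a.coeff 0) = 0 := by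
      rw [hsred, Polynomial.eval_multiset_prod, Multiset.prod_eq_zero_iff]
      simp only [Multiset.mem_map]
      exact ⟨Polynomial.X - Polynomial.C (a.coeff 0), ⟨_, ⟨a, ha, rfl⟩, rfl⟩, by simp⟩
    rw [hred, Polynomial.eval_pow, Polynomial.eval_X] at h1
    have h2 : a.coeff 0 = 0 := by
      exact eq_zero_of_pow_eq_zero h1
    have := orderTop_sub_C_coeff_zero_pos (hs0 a ha)
    rwa [h2, map_zero, sub_zero] at this
  have hne : (H * Q).map (HahnSeries.ofPowerSeries ℚ ℂ) ≠ 0 := by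
    rw [← hfac]
    intro h0
    apply hh
    rw [(Polynomial.map_eq_zero_iff HahnSeries.ofPowerSeries_injective).1 h0, Polynomial.map_zero]
  have hb : branches h = s := by
    rw [branches, hfac, Polynomial.map_mul, Polynomial.roots_mul (by rwa [← Polynomial.map_mul]),
      Multiset.filter_add, hs, Polynomial.roots_multiset_prod_X_sub_C,
      Multiset.filter_eq_self.2 hpos, Multiset.filter_eq_nil.2, add_zero]
    intro a ha hapos
    have h1 : (Q.map (HahnSeries.ofPowerSeries ℚ ℂ)).eval a = 0 := Polynomial.isRoot_of_mem_roots ha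
    have h2 := (coeff_zero_eval_map Q (κ := a) (mem_integers.2 hapos.le)).2
    rw [h1, HahnSeries.coeff_eq_zero_of_lt_orderTop hapos] at h2
    exact hQ0 h2.symm
  rw [hb, hs]

theorem card_branches {h : MvPolynomial (Fin 2) ℂ}
    (hh : (toPolynomialPowerSeries h).map (PowerSeries.constantCoeff (R := ℂ)) ≠ 0) :
    Multiset.card (branches h) =
      ((toPolynomialPowerSeries h).map
        (PowerSeries.constantCoeff (R := ℂ))).rootMultiplicity 0 := by
  obtain ⟨H, Q, hfac, hmon, hdeg, hdist, hunit, hs⟩ := branches_aux hh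
  rw [← hdeg, ← Polynomial.natDegree_map_eq_of_injective
    (HahnSeries.ofPowerSeries_injective (Γ := ℚ) (R := ℂ)) H, hs,
    Polynomial.natDegree_multiset_prod_X_sub_C_eq_card]

/-- The intersection number of two plane curve germs is the sum of the orders of the equation of the
second along the branches of the first. -/
theorem finrank_quotient_span_pair {h g : MvPolynomial (Fin 2) ℂ}
    (hh : (toPolynomialPowerSeries h).map (PowerSeries.constantCoeff (R := ℂ)) ≠ 0)
    (hg : ∀ κ ∈ branches h, eval₂ κ unif g ≠ 0) :
    (Module.finrank ℂ (MvPowerSeries (Fin 2) ℂ ⧸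
      Ideal.span {(h : MvPowerSeries (Fin 2) ℂ), (g : MvPowerSeries (Fin 2) ℂ)}) : ℚ) =
    ((branches h).map fun κ => (eval₂ κ unif g).order).sum := by
  obtain ⟨H, Q, hfac, hmon, hdeg, hdist, hunit, hs⟩ := branches_aux hh
  have hdet := AdjoinRoot.map_det_mulLeft (HahnSeries.ofPowerSeries ℚ ℂ) H
    (toPolynomialPowerSeries g) hmon _ hs
  simp only [eval_map_toPolynomialPowerSeries] at hdet
  set D := LinearMap.det (LinearMap.mulLeft (PowerSeries ℂ)
    (AdjoinRoot.mk H (toPolynomialPowerSeries g))) with hD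
  have hD0 : D ≠ 0 := by
    intro h0
    rw [h0, map_zero, eq_comm, Multiset.prod_eq_zero_iff, Multiset.mem_map] at hdet
    obtain ⟨κ, hκ, hκ0⟩ := hdet
    exact hg κ hκ hκ0
  rw [finrank_quotient_eq_adjoinRoot hfac hdist hunit,
    PowerSeries.finrank_quotient_range (AdjoinRoot.powerBasis' hmon).basis _ hD0,
    ← hD, ← order_ofPowerSeries hD0, hdet, order_multiset_prod, Multiset.map_map]
  · rfl
  · intro x hx
    obtain ⟨κ, hκ, rfl⟩ := Multiset.mem_map.1 hx
    exact hg κ hκ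

end PuiseuxField

namespace PuiseuxField

/-- All the branches `u = κ(v)` over `v = 0` of the plane curve `h = 0`. -/
def allBranches (h : MvPolynomial (Fin 2) ℂ) : Multiset PuiseuxField :=
  ((toPolynomialPowerSeries h).map (HahnSeries.ofPowerSeries ℚ ℂ)).roots

/-- The translation `u ↦ u + c`. -/
def shiftU (c : ℂ) : MvPolynomial (Fin 2) ℂ →+* MvPolynomial (Fin 2) ℂ :=
  eval₂Hom C ![X 0 + C c, X 1]

@[simp] theorem shiftU_C (c a : ℂ) : shiftU c (C a) = C a := by simp [shiftU]

@[simp] theorem shiftU_X_zero (c : ℂ) : shiftU c (X 0) = X 0 + C c := by simp [shiftU]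

@[simp] theorem shiftU_X_one (c : ℂ) : shiftU c (X 1) = X 1 := by simp [shiftU]

theorem pderiv_shiftU (c : ℂ) (i : Fin 2) (h : MvPolynomial (Fin 2) ℂ) :
    pderiv i (shiftU c h) = shiftU c (pderiv i h) := by
  induction h using MvPolynomial.induction_on with
  | C a => simp
  | add p q hp hq => simp only [map_add, hp, hq]
  | mul_X p n hp =>
    rw [map_mul, pderiv_mul, pderiv_mul, map_add, map_mul, map_mul, hp]
    congr 2
    fin_cases n <;> fin_cases i <;> simp [pderiv_X]

theorem eval₂_shiftU (c : ℂ) (x y : PuiseuxField) (h : MvPolynomial (Fin 2) ℂ) :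
    eval₂ x y (shiftU c h) = eval₂ (x + HahnSeries.C c) y h := by
  have : (eval₂ x y).comp (shiftU c) = eval₂ (x + HahnSeries.C c) y := by
    apply MvPolynomial.ringHom_ext
    · intro a; simp
    · intro i; fin_cases i <;> simp
  exact RingHom.congr_fun this h

theorem toPolynomialPowerSeries_shiftU (c : ℂ) (h : MvPolynomial (Fin 2) ℂ) :
    toPolynomialPowerSeries (shiftU c h) = (toPolynomialPowerSeries h).comp
      (Polynomial.X + Polynomial.C (PowerSeries.C c)) := by
  have : toPolynomialPowerSeries.comp (shiftU c) =
      (Polynomial.compRingHom (Polynomial.X + Polynomial.C (PowerSeries.C c))).comp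
        toPolynomialPowerSeries := by
    apply MvPolynomial.ringHom_ext
    · intro a; simp
    · intro i; fin_cases i <;> simp
  exact RingHom.congr_fun this h

theorem map_constantCoeff_shiftU (c : ℂ) (h : MvPolynomial (Fin 2) ℂ) :
    (toPolynomialPowerSeries (shiftU c h)).map (PowerSeries.constantCoeff (R := ℂ)) =
      ((toPolynomialPowerSeries h).map (PowerSeries.constantCoeff (R := ℂ))).comp
        (Polynomial.X + Polynomial.C c) := by
  rw [toPolynomialPowerSeries_shiftU, Polynomial.map_comp]
  simp

theorem map_constantCoeff_shiftU_ne_zero (c : ℂ) {h : MvPolynomial (Fin 2) ℂ}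
    (hh : (toPolynomialPowerSeries h).map (PowerSeries.constantCoeff (R := ℂ)) ≠ 0) :
    (toPolynomialPowerSeries (shiftU c h)).map (PowerSeries.constantCoeff (R := ℂ)) ≠ 0 := by
  rw [map_constantCoeff_shiftU, Ne, Polynomial.comp_X_add_C_eq_zero_iff]
  exact hh

open scoped Classical in
theorem branches_shiftU (c : ℂ) (h : MvPolynomial (Fin 2) ℂ) :
    branches (shiftU c h) = ((allBranches h).filter
      fun κ => 0 < (κ - HahnSeries.C c).orderTop).map fun κ => κ - HahnSeries.C c := by
  rw [branches, toPolynomialPowerSeries_shiftU, Polynomial.map_comp]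
  have h1 := Polynomial.roots_comp_C_mul_X_add_C
    ((toPolynomialPowerSeries h).map (HahnSeries.ofPowerSeries ℚ ℂ)) (1 : PuiseuxField)
    (HahnSeries.C c) isUnit_one
  rw [Polynomial.map_add, Polynomial.map_X, Polynomial.map_C, HahnSeries.ofPowerSeries_C]
  simp only [map_one, one_mul, Ring.inverse_one] at h1
  rw [h1, Multiset.filter_map]
  rfl

open scoped Classical in
theorem finrank_quotient_span_pair_shiftU {h g : MvPolynomial (Fin 2) ℂ} (c : ℂ)
    (hh : (toPolynomialPowerSeries h).map (PowerSeries.constantCoeff (R := ℂ)) ≠ 0)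
    (hg : ∀ κ ∈ allBranches h, 0 < (κ - HahnSeries.C c).orderTop → eval₂ κ unif g ≠ 0) :
    (Module.finrank ℂ (MvPowerSeries (Fin 2) ℂ ⧸ Ideal.span
      {(shiftU c h : MvPowerSeries (Fin 2) ℂ), (shiftU c g : MvPowerSeries (Fin 2) ℂ)}) : ℚ) =
    (((allBranches h).filter fun κ => 0 < (κ - HahnSeries.C c).orderTop).map
      fun κ => (eval₂ κ unif g).order).sum := by
  rw [finrank_quotient_span_pair (map_constantCoeff_shiftU_ne_zero c hh), branches_shiftU,
    Multiset.map_map]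
  · congr 1
    apply Multiset.map_congr rfl
    intro κ _
    simp [eval₂_shiftU]
  · intro κ hκ
    rw [branches_shiftU, Multiset.mem_map] at hκ
    obtain ⟨a, ha, rfl⟩ := hκ
    rw [Multiset.mem_filter] at ha
    rw [eval₂_shiftU, sub_add_cancel]
    exact hg a ha.1 ha.2

theorem allBranches_of_leadingCoeff {h : MvPolynomial (Fin 2) ℂ} {ℓ : ℂ} (hℓ : ℓ ≠ 0)
    (hl : (toPolynomialPowerSeries h).leadingCoeff = PowerSeries.C ℓ) :
    (toPolynomialPowerSeries h).map (HahnSeries.ofPowerSeries ℚ ℂ) =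
      Polynomial.C (HahnSeries.C ℓ) *
        ((allBranches h).map fun κ => Polynomial.X - Polynomial.C κ).prod ∧
    (∀ κ ∈ allBranches h, κ ∈ integers) ∧
    (allBranches h).map (fun κ => κ.coeff 0) =
      ((toPolynomialPowerSeries h).map (PowerSeries.constantCoeff (R := ℂ))).roots := by
  set p := toPolynomialPowerSeries h with hp
  have hu : PowerSeries.C ℓ * PowerSeries.C ℓ⁻¹ = (1 : PowerSeries ℂ) := by
    rw [← map_mul, mul_inv_cancel₀ hℓ, map_one]
  have hm : (Polynomial.C (PowerSeries.C ℓ⁻¹) * p).Monic := by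
    apply Polynomial.monic_C_mul_of_mul_leadingCoeff_eq_one
    rw [hl, mul_comm, hu]
  obtain ⟨s, hs1, hs2, hs3⟩ := exists_roots_of_monic hm
  have hpe : p = Polynomial.C (PowerSeries.C ℓ) * (Polynomial.C (PowerSeries.C ℓ⁻¹) * p) := by
    rw [← mul_assoc, ← Polynomial.C_mul, hu, Polynomial.C_1, one_mul]
  have h1 : p.map (HahnSeries.ofPowerSeries ℚ ℂ) = Polynomial.C (HahnSeries.C ℓ) *
      (s.map fun κ => Polynomial.X - Polynomial.C κ).prod := by
    conv_lhs => rw [hpe]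
    rw [Polynomial.map_mul, hs1, Polynomial.map_C, HahnSeries.ofPowerSeries_C]
  have hC : (HahnSeries.C ℓ : PuiseuxField) ≠ 0 := HahnSeries.C_ne_zero hℓ
  have hs : allBranches h = s := by
    rw [allBranches, ← hp, h1, Polynomial.roots_C_mul _ hC,
      Polynomial.roots_multiset_prod_X_sub_C]
  refine ⟨by rw [hs]; exact h1, ?_, ?_⟩
  · intro κ hκ
    rw [hs] at hκ
    exact mem_integers.2 (hs2 κ hκ)
  · conv_rhs => rw [hpe]
    rw [Polynomial.map_mul, hs3, Polynomial.map_C, PowerSeries.constantCoeff_C,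
      Polynomial.roots_C_mul _ hℓ, Polynomial.roots_multiset_prod_X_sub_C, hs]

theorem toPolynomialPowerSeries_pderiv_zero (h : MvPolynomial (Fin 2) ℂ) :
    toPolynomialPowerSeries (pderiv 0 h) = Polynomial.derivative (toPolynomialPowerSeries h) := by
  induction h using MvPolynomial.induction_on with
  | C a => simp
  | add p q hp hq => simp only [map_add, hp, hq]
  | mul_X p n hp =>
    rw [pderiv_mul, map_mul toPolynomialPowerSeries p, Polynomial.derivative_mul, map_add, map_mul,
      map_mul, hp]
    have hX : toPolynomialPowerSeries (pderiv 0 (X n)) =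
        Polynomial.derivative (toPolynomialPowerSeries (X n)) := by
      fin_cases n <;> simp [pderiv_X]
    rw [hX]

theorem mem_branches {h : MvPolynomial (Fin 2) ℂ}
    (hh : (toPolynomialPowerSeries h).map (PowerSeries.constantCoeff (R := ℂ)) ≠ 0)
    {κ : PuiseuxField} : κ ∈ branches h ↔ eval₂ κ unif h = 0 ∧ 0 < κ.orderTop := by
  have h0 : (toPolynomialPowerSeries h).map (HahnSeries.ofPowerSeries ℚ ℂ) ≠ 0 := by
    rw [Ne, Polynomial.map_eq_zero_iff HahnSeries.ofPowerSeries_injective]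
    rintro h0
    exact hh (by rw [h0, Polynomial.map_zero])
  rw [branches, Multiset.mem_filter, Polynomial.mem_roots h0, Polynomial.IsRoot,
    eval_map_toPolynomialPowerSeries]

theorem eval₂_mem_integers {κ : PuiseuxField} (hκ : κ ∈ integers) (h : MvPolynomial (Fin 2) ℂ) :
    eval₂ κ unif h ∈ integers ∧ (eval₂ κ unif h).coeff 0 =
      ((toPolynomialPowerSeries h).map (PowerSeries.constantCoeff (R := ℂ))).eval (κ.coeff 0) := by
  have := coeff_zero_eval_map (toPolynomialPowerSeries h) hκ
  rwa [eval_map_toPolynomialPowerSeries] at this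

theorem euler_unif : euler unif = unif := by
  ext q
  rw [coeff_euler, unif, HahnSeries.coeff_single]
  split_ifs with hq <;> simp [hq]

theorem orderTop_eq_zero_of_coeff_zero_ne {x : PuiseuxField} (hx : x ∈ integers)
    (h : x.coeff 0 ≠ 0) : x.orderTop = 0 := by
  have h0 : x ≠ 0 := by rintro rfl; simp at h
  rw [HahnSeries.orderTop_of_ne_zero h0, ← HahnSeries.order_of_ne h0] at *
  rw [order_eq_zero_of_coeff_zero_ne hx h]
  rfl

/-- Along a branch of `w G_u = σ n G` through a point of `v = 0` where `G` vanishes, the order of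
`G_v` is one less than the order of `G`. -/
theorem order_pderiv_one_along_polar {G : MvPolynomial (Fin 2) ℂ} {κ w : PuiseuxField} {τ : ℂ}
    (hκ : 0 < κ.orderTop) (hw : w.orderTop = 0)
    (hK : w * eval₂ κ unif (pderiv 0 G) = HahnSeries.C τ * eval₂ κ unif G)
    (hG0 : (eval₂ κ unif G).coeff 0 = 0) (hG : eval₂ κ unif G ≠ 0) :
    eval₂ κ unif (pderiv 1 G) ≠ 0 ∧
      (eval₂ κ unif (pderiv 1 G)).order = (eval₂ κ unif G).order - 1 := by
  set g := eval₂ κ unif G with hg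
  have hθ := euler_eval₂ κ unif G
  rw [euler_unif] at hθ
  have h1 : (euler g).orderTop = g.orderTop := by
    rw [orderTop_euler, hG0]; simp
  have h2 : (euler κ).orderTop = κ.orderTop := by
    rw [orderTop_euler, HahnSeries.coeff_eq_zero_of_lt_orderTop hκ]; simp
  have h3 : g.orderTop ≤ (eval₂ κ unif (pderiv 0 G)).orderTop := by
    have := congrArg HahnSeries.orderTop hK
    rw [HahnSeries.orderTop_mul, hw, zero_add, HahnSeries.orderTop_mul] at this
    rw [this]
    have hC : (0 : WithTop ℚ) ≤ (HahnSeries.C τ : PuiseuxField).orderTop := by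
      rw [HahnSeries.le_orderTop_iff_forall]
      intro q hq
      rw [HahnSeries.C_apply, HahnSeries.coeff_single_of_ne (by rintro rfl; simp at hq)]
    calc g.orderTop = 0 + g.orderTop := (zero_add _).symm
      _ ≤ _ := by gcongr
  have hgt : g.orderTop ≠ ⊤ := by rwa [Ne, HahnSeries.orderTop_eq_top]
  have h4 : g.orderTop < (eval₂ κ unif (pderiv 0 G) * euler κ).orderTop := by
    rw [HahnSeries.orderTop_mul, h2]
    calc g.orderTop = g.orderTop + 0 := (add_zero _).symm
      _ < g.orderTop + κ.orderTop := WithTop.add_lt_add_left hgt hκ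
      _ ≤ _ := by gcongr
  have h5 : (eval₂ κ unif (pderiv 1 G) * unif).orderTop = g.orderTop := by
    have : eval₂ κ unif (pderiv 1 G) * unif =
        euler g - eval₂ κ unif (pderiv 0 G) * euler κ := by rw [hθ]; ring
    rw [this, HahnSeries.orderTop_sub (by rwa [h1]), h1]
  have h6 : eval₂ κ unif (pderiv 1 G) ≠ 0 := by
    intro h
    rw [h, zero_mul, HahnSeries.orderTop_zero] at h5
    exact hgt h5.symm
  refine ⟨h6, ?_⟩
  rw [← HahnSeries.order_eq_orderTop_of_ne_zero hG,
    ← HahnSeries.order_eq_orderTop_of_ne_zero (mul_ne_zero h6 unif_ne_zero),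
    HahnSeries.order_mul h6 unif_ne_zero, order_unif] at h5
  have : (eval₂ κ unif (pderiv 1 G)).order + 1 = g.order := by exact_mod_cast h5
  linarith

/-- The Milnor number formula at a point of the line `v = 0`, along the branches of the polar curve;
the generator `w G_u - σ d G` accounts for a projective change of coordinates. -/
theorem finrank_quotient_polar {G : MvPolynomial (Fin 2) ℂ} {ρ σ : ℂ} {n e : ℕ} (hρ : ρ ≠ 0)
    (h0 : (toPolynomialPowerSeries G).map (PowerSeries.constantCoeff (R := ℂ)) ≠ 0)
    (he : ((toPolynomialPowerSeries G).map (PowerSeries.constantCoeff (R := ℂ))).rootMultiplicity 0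
      = e + 1)
    (hG : ∀ κ ∈ branches (pderiv 0 G), eval₂ κ unif G ≠ 0) :
    (Module.finrank ℂ (MvPowerSeries (Fin 2) ℂ ⧸ Ideal.span
      {(((C ρ + C σ * X 0) * pderiv 0 G - C (σ * n) * G : MvPolynomial (Fin 2) ℂ) :
        MvPowerSeries (Fin 2) ℂ), (pderiv 1 G : MvPowerSeries (Fin 2) ℂ)}) : ℚ) =
    ((branches (pderiv 0 G)).map fun κ => (eval₂ κ unif G).order).sum - e := by
  classical
  set K : MvPolynomial (Fin 2) ℂ := (C ρ + C σ * X 0) * pderiv 0 G - C (σ * n) * G with hKdef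
  set g := (toPolynomialPowerSeries G).map (PowerSeries.constantCoeff (R := ℂ)) with hg
  have hgd : (toPolynomialPowerSeries (pderiv 0 G)).map (PowerSeries.constantCoeff (R := ℂ)) =
      Polynomial.derivative g := by
    rw [toPolynomialPowerSeries_pderiv_zero, Polynomial.derivative_map]
  have hroot : g.IsRoot 0 := by
    rw [← Polynomial.rootMultiplicity_pos h0, he]; omega
  have hed : (Polynomial.derivative g).rootMultiplicity 0 = e := by
    rw [Polynomial.derivative_rootMultiplicity_of_root hroot, he]; rfl
  have hgd0 : Polynomial.derivative g ≠ 0 := by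
    intro h
    have := Polynomial.derivative_eq_zero.1 h
    rw [Polynomial.eq_C_of_natDegree_eq_zero this, Polynomial.rootMultiplicity_C] at he
    omega
  have hKr : (toPolynomialPowerSeries K).map (PowerSeries.constantCoeff (R := ℂ)) =
      (Polynomial.C ρ + Polynomial.C σ * Polynomial.X) * Polynomial.derivative g -
        Polynomial.C (σ * n) * g := by
    rw [← hgd, hKdef]
    simp [hg]
  set k := (toPolynomialPowerSeries K).map (PowerSeries.constantCoeff (R := ℂ)) with hk
  have hdg : (Polynomial.X - Polynomial.C 0) ^ (e + 1) ∣ g := by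
    rw [← he]; exact Polynomial.pow_rootMultiplicity_dvd g 0
  have hdd : (Polynomial.X - Polynomial.C 0) ^ e ∣ Polynomial.derivative g := by
    rw [← hed]; exact Polynomial.pow_rootMultiplicity_dvd _ 0
  have hnd : ¬ (Polynomial.X - Polynomial.C 0) ^ (e + 1) ∣ k := by
    intro h
    have h1 : (Polynomial.X - Polynomial.C 0) ^ (e + 1) ∣
        (Polynomial.C ρ + Polynomial.C σ * Polynomial.X) * Polynomial.derivative g := by
      have := dvd_add h (hdg.mul_left (Polynomial.C (σ * n)))
      rwa [hKr, sub_add_cancel] at this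
    have hcop : IsCoprime ((Polynomial.X - Polynomial.C (0 : ℂ)) ^ (e + 1))
        (Polynomial.C ρ + Polynomial.C σ * Polynomial.X) := by
      apply IsCoprime.pow_left
      refine ⟨-Polynomial.C (σ / ρ), Polynomial.C ρ⁻¹, ?_⟩
      have e1 : (Polynomial.C (σ / ρ) : Polynomial ℂ) = Polynomial.C ρ⁻¹ * Polynomial.C σ := by
        rw [← Polynomial.C_mul]; congr 1; field_simp
      have e2 : (Polynomial.C ρ⁻¹ * Polynomial.C ρ : Polynomial ℂ) = 1 := by
        rw [← Polynomial.C_mul, inv_mul_cancel₀ hρ, Polynomial.C_1]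
      rw [Polynomial.C_0, e1]
      linear_combination e2
    have h2 := hcop.dvd_of_dvd_mul_left h1
    have h3 := (Polynomial.le_rootMultiplicity_iff hgd0).2 h2
    omega
  have hk0 : k ≠ 0 := fun h => hnd (h ▸ dvd_zero _)
  have hke : k.rootMultiplicity 0 = e := by
    apply le_antisymm
    · by_contra! hlt
      exact hnd ((Polynomial.le_rootMultiplicity_iff hk0).1 hlt)
    · rw [Polynomial.le_rootMultiplicity_iff hk0, hKr]
      exact dvd_sub (hdd.mul_left _) (((pow_dvd_pow _ (Nat.le_succ e)).trans hdg).mul_left _)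
  have hbr : ∀ κ ∈ branches K, eval₂ κ unif G ≠ 0 ∧ eval₂ κ unif (pderiv 1 G) ≠ 0 ∧
      (eval₂ κ unif (pderiv 1 G)).order = (eval₂ κ unif G).order - 1 := by
    intro κ hκ
    have hpos := orderTop_pos_of_mem_branches hκ
    have h_integral : κ ∈ integers := mem_integers.2 hpos.le
    have hc0 := HahnSeries.coeff_eq_zero_of_lt_orderTop hpos
    have hw : (eval₂ κ unif (C ρ + C σ * X 0)).orderTop = 0 := by
      have := eval₂_mem_integers h_integral (C ρ + C σ * X 0)
      apply orderTop_eq_zero_of_coeff_zero_ne this.1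
      rw [this.2, hc0]
      simpa using hρ
    have hK := eval₂_of_mem_branches hκ
    rw [hKdef, map_sub, map_mul, map_mul, eval₂_C, sub_eq_zero] at hK
    have hG0 : eval₂ κ unif G ≠ 0 := by
      intro h
      rw [h, mul_zero, mul_eq_zero] at hK
      refine hG κ ((mem_branches (by rwa [hgd])).2 ⟨hK.resolve_left ?_, hpos⟩) h
      intro h; rw [h] at hw; simp at hw
    refine ⟨hG0, order_pderiv_one_along_polar hpos hw hK ?_ hG0⟩
    rw [(eval₂_mem_integers h_integral G).2, hc0]
    exact hroot
  have hspan : Ideal.span {(K : MvPowerSeries (Fin 2) ℂ), (G : MvPowerSeries (Fin 2) ℂ)} =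
      Ideal.span {(pderiv 0 G : MvPowerSeries (Fin 2) ℂ), (G : MvPowerSeries (Fin 2) ℂ)} := by
    have hunit : IsUnit ((C ρ + C σ * X 0 : MvPolynomial (Fin 2) ℂ) : MvPowerSeries (Fin 2) ℂ) := by
      rw [MvPowerSeries.isUnit_iff_constantCoeff]
      simpa using hρ
    obtain ⟨u, hu⟩ := hunit
    have hKc : (K : MvPowerSeries (Fin 2) ℂ) =
        u * (pderiv 0 G : MvPowerSeries (Fin 2) ℂ) -
          ((C (σ * n) : MvPolynomial (Fin 2) ℂ) : MvPowerSeries (Fin 2) ℂ) * G := by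
      rw [hu, hKdef]
      simp only [← MvPolynomial.coeToMvPowerSeries.ringHom_apply, map_sub, map_mul]
    apply le_antisymm
    · rw [Ideal.span_le]
      rintro _ (rfl | rfl)
      · rw [SetLike.mem_coe, Ideal.mem_span_pair]
        exact ⟨u, -((C (σ * n) : MvPolynomial (Fin 2) ℂ) : MvPowerSeries (Fin 2) ℂ), by
          rw [hKc]; ring⟩
      · exact Ideal.subset_span (by simp)
    · rw [Ideal.span_le]
      rintro _ (rfl | rfl)
      · rw [SetLike.mem_coe, Ideal.mem_span_pair]
        refine ⟨(↑u⁻¹ : MvPowerSeries (Fin 2) ℂ), ↑u⁻¹ *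
          ((C (σ * n) : MvPolynomial (Fin 2) ℂ) : MvPowerSeries (Fin 2) ℂ), ?_⟩
        rw [hKc]
        linear_combination (pderiv 0 G : MvPowerSeries (Fin 2) ℂ) * u.inv_mul
      · exact Ideal.subset_span (by simp)
  rw [finrank_quotient_span_pair hk0 fun κ hκ => (hbr κ hκ).2.1,
    Multiset.map_congr rfl fun κ hκ => (hbr κ hκ).2.2, Multiset.sum_map_sub,
    ← finrank_quotient_span_pair hk0 fun κ hκ => (hbr κ hκ).1, hspan,
    finrank_quotient_span_pair (by rwa [hgd]) hG, Multiset.map_const', Multiset.sum_replicate,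
    card_branches hk0, hke]
  simp

end PuiseuxField

/-- The automorphism of a power series ring given by mutually inverse substitutions. -/
def MvPowerSeries.substAlgEquiv (a b : Fin 2 → MvPowerSeries (Fin 2) ℂ)
    (ha : MvPowerSeries.HasSubst a) (hb : MvPowerSeries.HasSubst b)
    (hab : ∀ i, MvPowerSeries.substAlgHom (R := ℂ) ha (b i) = MvPowerSeries.X i)
    (hba : ∀ i, MvPowerSeries.substAlgHom (R := ℂ) hb (a i) = MvPowerSeries.X i) :
    MvPowerSeries (Fin 2) ℂ ≃ₐ[ℂ] MvPowerSeries (Fin 2) ℂ :=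
  AlgEquiv.ofAlgHom (MvPowerSeries.substAlgHom ha) (MvPowerSeries.substAlgHom hb)
    (by
      ext1 p
      simp only [AlgHom.comp_apply, AlgHom.id_apply, MvPowerSeries.substAlgHom_apply] at *
      rw [MvPowerSeries.subst_comp_subst_apply hb ha]
      simp only [hab]
      exact congrFun MvPowerSeries.subst_self p)
    (by
      ext1 p
      simp only [AlgHom.comp_apply, AlgHom.id_apply, MvPowerSeries.substAlgHom_apply] at *
      rw [MvPowerSeries.subst_comp_subst_apply ha hb]
      simp only [hba]
      exact congrFun MvPowerSeries.subst_self p)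

theorem finrank_quotient_eq_of_algEquiv {A : Type*} [CommRing A] [Algebra ℂ A] (Φ : A ≃ₐ[ℂ] A)
    {x y x' y' : A} (h : Ideal.span {Φ x, Φ y} = Ideal.span {x', y'}) :
    Module.finrank ℂ (A ⧸ Ideal.span {x, y}) = Module.finrank ℂ (A ⧸ Ideal.span {x', y'}) := by
  refine (Ideal.quotientEquivAlg _ _ Φ ?_).toLinearEquiv.finrank_eq
  rw [Ideal.map_span, Set.image_pair]
  exact h.symm

theorem MvPolynomial.aeval_mul_of_isHomogeneous {σ A : Type*} [CommRing A] [Algebra ℂ A]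
    {p : MvPolynomial σ ℂ} {n : ℕ} (hp : p.IsHomogeneous n) (w : A) (z : σ → A) :
    aeval (fun i => w * z i) p = w ^ n * aeval z p := by
  rw [aeval_def, aeval_def, eval₂_eq, eval₂_eq, Finset.mul_sum]
  refine Finset.sum_congr rfl fun m hm => ?_
  have h1 : ∑ i ∈ m.support, m i = n := by
    have := hp (mem_support_iff.1 hm)
    rw [← this, Finsupp.weight_apply, Finsupp.sum]
    simp
  simp only [mul_pow]
  rw [Finset.prod_mul_distrib, Finset.prod_pow_eq_pow_sum, h1]
  ring

/-- The affine chart `(u, v) ↦ [α + u β : v]` of the projective plane. -/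
def chart (α β : ℂ × ℂ) : MvPolynomial (Fin 3) ℂ →ₐ[ℂ] MvPolynomial (Fin 2) ℂ :=
  aeval ![C α.1 + C β.1 * X 0, C α.2 + C β.2 * X 0, X 1]

@[simp] theorem chart_X_zero (α β : ℂ × ℂ) : chart α β (X 0) = C α.1 + C β.1 * X 0 := by
  simp [chart]

@[simp] theorem chart_X_one (α β : ℂ × ℂ) : chart α β (X 1) = C α.2 + C β.2 * X 0 := by
  simp [chart]

@[simp] theorem chart_X_two (α β : ℂ × ℂ) : chart α β (X 2) = X 1 := by
  simp [chart]

theorem pderiv_zero_chart (α β : ℂ × ℂ) (q : MvPolynomial (Fin 3) ℂ) :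
    pderiv 0 (chart α β q) =
      C β.1 * chart α β (pderiv 0 q) + C β.2 * chart α β (pderiv 1 q) := by
  induction q using MvPolynomial.induction_on with
  | C a => simp [← algebraMap_eq]
  | add p q hp hq => simp only [map_add, hp, hq]; ring
  | mul_X p n hp =>
    have hX : pderiv 0 (chart α β (X n)) =
        C β.1 * chart α β (pderiv 0 (X n)) + C β.2 * chart α β (pderiv 1 (X n)) := by
      fin_cases n <;> simp [pderiv_X]
    rw [map_mul (chart α β), pderiv_mul, hp, hX, pderiv_mul, pderiv_mul, map_add, map_add,
      map_mul, map_mul, map_mul, map_mul]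
    ring

theorem pderiv_one_chart (α β : ℂ × ℂ) (q : MvPolynomial (Fin 3) ℂ) :
    pderiv 1 (chart α β q) = chart α β (pderiv 2 q) := by
  induction q using MvPolynomial.induction_on with
  | C a => simp [← algebraMap_eq]
  | add p q hp hq => simp only [map_add, hp, hq]
  | mul_X p n hp =>
    have hX : pderiv 1 (chart α β (X n)) = chart α β (pderiv 2 (X n)) := by
      fin_cases n <;> simp [pderiv_X]
    rw [map_mul (chart α β), pderiv_mul, hp, hX, pderiv_mul, map_add, map_mul, map_mul]

section ProjectiveChange

variable (ρ σ τ : ℂ)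

/-- The linear power series `ρ + σ u`. -/
def linU : MvPowerSeries (Fin 2) ℂ :=
  MvPowerSeries.C ρ + MvPowerSeries.C σ * MvPowerSeries.X 0

theorem constantCoeff_linU : MvPowerSeries.constantCoeff (linU ρ σ) = ρ := by
  simp [linU]

/-- The projective substitution `u ↦ τ u / (ρ + σ u)`, `v ↦ τ' v / (ρ + σ u)`. -/
def projSubst (τ' : ℂ) : Fin 2 → MvPowerSeries (Fin 2) ℂ :=
  ![MvPowerSeries.C τ * MvPowerSeries.X 0 * (linU ρ σ)⁻¹,
    MvPowerSeries.C τ' * MvPowerSeries.X 1 * (linU ρ σ)⁻¹]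

theorem hasSubst_projSubst (τ' : ℂ) : MvPowerSeries.HasSubst (projSubst ρ σ τ τ') := by
  apply MvPowerSeries.hasSubst_of_constantCoeff_zero
  intro i
  fin_cases i <;> simp [projSubst]

theorem linU_mul_inv {ρ : ℂ} (σ : ℂ) (hρ : ρ ≠ 0) : linU ρ σ * (linU ρ σ)⁻¹ = 1 :=
  MvPowerSeries.mul_inv_cancel _ (by rwa [constantCoeff_linU])

theorem substAlgHom_C {a : Fin 2 → MvPowerSeries (Fin 2) ℂ} (ha : MvPowerSeries.HasSubst a)
    (c : ℂ) : MvPowerSeries.substAlgHom (R := ℂ) ha (MvPowerSeries.C c) = MvPowerSeries.C c :=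
  (MvPowerSeries.substAlgHom (R := ℂ) ha).commutes c

theorem projSubst_comp {ρ σ τ ρ₁ σ₁ τ₁ τ₂ τ₂' : ℂ} (hρ : ρ ≠ 0) (hρ₁ : ρ₁ ≠ 0)
    (h1 : τ₁ * τ = ρ₁ * ρ) (h2 : τ₂' * τ₂ = ρ₁ * ρ) (h3 : ρ₁ * σ + σ₁ * τ = 0) (i : Fin 2) :
    MvPowerSeries.substAlgHom (R := ℂ) (hasSubst_projSubst ρ σ τ τ₂) (projSubst ρ₁ σ₁ τ₁ τ₂' i) =
      MvPowerSeries.X i := by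
  set Φ := MvPowerSeries.substAlgHom (R := ℂ) (hasSubst_projSubst ρ σ τ τ₂) with hΦ
  have hX0 : Φ (MvPowerSeries.X 0) = MvPowerSeries.C τ * MvPowerSeries.X 0 * (linU ρ σ)⁻¹ := by
    rw [hΦ, MvPowerSeries.substAlgHom_apply, MvPowerSeries.subst_X (hasSubst_projSubst ρ σ τ τ₂)]
    rfl
  have hX1 : Φ (MvPowerSeries.X 1) = MvPowerSeries.C τ₂ * MvPowerSeries.X 1 * (linU ρ σ)⁻¹ := by
    rw [hΦ, MvPowerSeries.substAlgHom_apply, MvPowerSeries.subst_X (hasSubst_projSubst ρ σ τ τ₂)]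
    rfl
  have hC : ∀ c, Φ (MvPowerSeries.C c) = MvPowerSeries.C c := substAlgHom_C _
  have hw := linU_mul_inv σ hρ
  have hw1 := congrArg Φ (linU_mul_inv σ₁ hρ₁)
  rw [map_mul, map_one] at hw1
  have hwd : linU ρ σ = MvPowerSeries.C ρ + MvPowerSeries.C σ * MvPowerSeries.X 0 := rfl
  have hlin : linU ρ σ * Φ (linU ρ₁ σ₁) = MvPowerSeries.C (ρ₁ * ρ) := by
    have e : Φ (linU ρ₁ σ₁) = MvPowerSeries.C ρ₁ + MvPowerSeries.C σ₁ *
        (MvPowerSeries.C τ * MvPowerSeries.X 0 * (linU ρ σ)⁻¹) := by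
      rw [linU, map_add, map_mul, hC, hC, hX0]
    have h3' : (MvPowerSeries.C (ρ₁ * σ + σ₁ * τ) : MvPowerSeries (Fin 2) ℂ) = 0 := by
      rw [h3, map_zero]
    rw [map_add, map_mul, map_mul] at h3'
    rw [e, map_mul]
    linear_combination MvPowerSeries.C ρ₁ * hwd + MvPowerSeries.C σ₁ * MvPowerSeries.C τ *
      MvPowerSeries.X 0 * hw + MvPowerSeries.X 0 * h3'
  have key : ∀ (a b : ℂ) (j : Fin 2), a * b = ρ₁ * ρ →
      MvPowerSeries.C a * (MvPowerSeries.C b * MvPowerSeries.X j * (linU ρ σ)⁻¹) *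
        Φ (linU ρ₁ σ₁)⁻¹ = MvPowerSeries.X j := by
    intro a b j hab
    have e : (MvPowerSeries.C a * MvPowerSeries.C b : MvPowerSeries (Fin 2) ℂ) =
        linU ρ σ * Φ (linU ρ₁ σ₁) := by rw [hlin, ← hab, map_mul]
    linear_combination (MvPowerSeries.X j * (linU ρ σ)⁻¹ * Φ (linU ρ₁ σ₁)⁻¹) * e +
      MvPowerSeries.X j * Φ (linU ρ₁ σ₁) * Φ (linU ρ₁ σ₁)⁻¹ * hw + MvPowerSeries.X j * hw1
  fin_cases i
  · simp only [projSubst, Fin.zero_eta, Matrix.cons_val_zero, map_mul, hC, hX0]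
    exact key _ _ _ h1
  · simp only [projSubst, Fin.mk_one, Matrix.cons_val_one, Matrix.cons_val_fin_one, map_mul, hC,
      hX1]
    exact key _ _ _ h2

/-- Invariance of the Milnor number at infinity under projective changes of coordinates. -/
theorem finrank_milnor_chart {ρ σ τ : ℂ} (hρ : ρ ≠ 0) (hτ : τ ≠ 0) {α β α' β' : ℂ × ℂ}
    (hα : α' = ρ • α) (hβ : β' = τ • β + σ • α) {q : MvPolynomial (Fin 3) ℂ} {n : ℕ}
    (hq : q.IsHomogeneous n) :
    Module.finrank ℂ (MvPowerSeries (Fin 2) ℂ ⧸ Ideal.span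
      {(pderiv 0 (chart α β q) : MvPowerSeries (Fin 2) ℂ),
        (pderiv 1 (chart α β q) : MvPowerSeries (Fin 2) ℂ)}) =
    Module.finrank ℂ (MvPowerSeries (Fin 2) ℂ ⧸ Ideal.span
      {(((C ρ + C σ * X 0) * pderiv 0 (chart α' β' q) - C (σ * n) * chart α' β' q :
        MvPolynomial (Fin 2) ℂ) : MvPowerSeries (Fin 2) ℂ),
        (pderiv 1 (chart α' β' q) : MvPowerSeries (Fin 2) ℂ)}) := by
  have ha := hasSubst_projSubst ρ σ τ 1
  have hb := hasSubst_projSubst τ (-σ) ρ (ρ * τ)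
  let Φ := MvPowerSeries.substAlgEquiv _ _ ha hb
    (projSubst_comp hρ hτ (by ring) (by ring) (by ring))
    (projSubst_comp hτ hρ (by ring) (by ring) (by ring))
  have hX0 : Φ (MvPowerSeries.X 0) = MvPowerSeries.C τ * MvPowerSeries.X 0 * (linU ρ σ)⁻¹ := by
    change MvPowerSeries.substAlgHom ha _ = _
    rw [MvPowerSeries.substAlgHom_apply, MvPowerSeries.subst_X ha]
    rfl
  have hX1 : Φ (MvPowerSeries.X 1) = MvPowerSeries.X 1 * (linU ρ σ)⁻¹ := by
    change MvPowerSeries.substAlgHom ha _ = _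
    rw [MvPowerSeries.substAlgHom_apply, MvPowerSeries.subst_X ha]
    simp [projSubst]
  have hC : ∀ c, Φ (MvPowerSeries.C c) = MvPowerSeries.C c := fun c => Φ.commutes c
  have hw := linU_mul_inv σ hρ
  set w := linU ρ σ with hwdef
  have hwd : w = MvPowerSeries.C ρ + MvPowerSeries.C σ * MvPowerSeries.X 0 := rfl
  have key : ∀ (p : MvPolynomial (Fin 3) ℂ) (k : ℕ), p.IsHomogeneous k →
      w ^ k * Φ (chart α β p : MvPowerSeries (Fin 2) ℂ) =
          (chart α' β' p : MvPowerSeries (Fin 2) ℂ) := by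
    intro p k hp
    set z : Fin 3 → MvPowerSeries (Fin 2) ℂ :=
      fun i => Φ (chart α β (X i) : MvPowerSeries (Fin 2) ℂ) with hz
    have h1 : Φ (chart α β p : MvPowerSeries (Fin 2) ℂ) = aeval z p := by
      have : (Φ.toAlgHom.comp (coeToMvPowerSeries.algHom ℂ)).comp (chart α β) = aeval z := by
        apply MvPolynomial.algHom_ext
        intro i
        simp [hz]
      exact DFunLike.congr_fun this p
    have h2 : (chart α' β' p : MvPowerSeries (Fin 2) ℂ) = aeval (fun i => w * z i) p := by
      have : (coeToMvPowerSeries.algHom ℂ).comp (chart α' β') = aeval (fun i => w * z i) := by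
        apply MvPolynomial.algHom_ext
        intro i
        fin_cases i
        · simp [hz, hα, hβ, hX0, hC]
          linear_combination (-MvPowerSeries.C α.1) * hwd - MvPowerSeries.C β.1 *
            MvPowerSeries.C τ * MvPowerSeries.X 0 * hw
        · simp [hz, hα, hβ, hX0, hC]
          linear_combination (-MvPowerSeries.C α.2) * hwd - MvPowerSeries.C β.2 *
            MvPowerSeries.C τ * MvPowerSeries.X 0 * hw
        · simp [hz, hX1]
          linear_combination -MvPowerSeries.X 1 * hw
      exact DFunLike.congr_fun this p
    rw [h1, h2, aeval_mul_of_isHomogeneous hp]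
  have hW : w ^ (n - 1) * w⁻¹ ^ (n - 1) = 1 := by rw [← mul_pow, hw, one_pow]
  have ht := fun i => key _ _ (hq.pderiv (i := i))
  have heuler : (n : MvPolynomial (Fin 2) ℂ) * chart α' β' q =
      (C α'.1 + C β'.1 * X 0) * chart α' β' (pderiv 0 q) +
      (C α'.2 + C β'.2 * X 0) * chart α' β' (pderiv 1 q) + X 1 * chart α' β' (pderiv 2 q) := by
    have := congrArg (chart α' β') hq.sum_X_mul_pderiv
    rw [Fin.sum_univ_three, map_nsmul, nsmul_eq_mul, map_add, map_add, map_mul, map_mul, map_mul,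
      chart_X_zero, chart_X_one, chart_X_two] at this
    exact this.symm
  have hx : Φ (pderiv 0 (chart α β q) : MvPowerSeries (Fin 2) ℂ) =
      MvPowerSeries.C β.1 * Φ (chart α β (pderiv 0 q) : MvPowerSeries (Fin 2) ℂ) +
      MvPowerSeries.C β.2 * Φ (chart α β (pderiv 1 q) : MvPowerSeries (Fin 2) ℂ) := by
    rw [pderiv_zero_chart]
    simp [hC]
  have hK : (C ρ + C σ * X 0) * pderiv 0 (chart α' β' q) - C (σ * n) * chart α' β' q =
      C (ρ * τ) * (C β.1 * chart α' β' (pderiv 0 q) + C β.2 * chart α' β' (pderiv 1 q)) -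
        C σ * X 1 * chart α' β' (pderiv 2 q) := by
    have h1 : α'.1 = ρ * α.1 := by rw [hα]; rfl
    have h2 : α'.2 = ρ * α.2 := by rw [hα]; rfl
    have h3 : β'.1 = τ * β.1 + σ * α.1 := by rw [hβ]; rfl
    have h4 : β'.2 = τ * β.2 + σ * α.2 := by rw [hβ]; rfl
    rw [pderiv_zero_chart]
    rw [h1, h2, h3, h4] at heuler
    rw [h3, h4]
    simp only [map_mul, map_add, map_natCast] at heuler ⊢
    linear_combination -C σ * heuler
  have hx' := congrArg (coeToMvPowerSeries.ringHom (R := ℂ) (σ := Fin 2)) hK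
  simp only [map_sub (coeToMvPowerSeries.ringHom (R := ℂ) (σ := Fin 2)),
    map_add (coeToMvPowerSeries.ringHom (R := ℂ) (σ := Fin 2)),
    map_mul (coeToMvPowerSeries.ringHom (R := ℂ) (σ := Fin 2)),
    coeToMvPowerSeries.ringHom_apply, ← ht, MvPolynomial.coe_C, MvPolynomial.coe_X] at hx'
  apply finrank_quotient_eq_of_algEquiv Φ
  rw [hx, pderiv_one_chart, pderiv_one_chart, ← ht]
  have hcoe : ∀ p : MvPolynomial (Fin 2) ℂ, (p : MvPowerSeries (Fin 2) ℂ) =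
    coeToMvPowerSeries.ringHom p := fun _ => rfl
  rw [hcoe ((C ρ + C σ * X 0) * _ - _), map_sub, map_mul, map_add, map_mul, map_mul]
  simp only [coeToMvPowerSeries.ringHom_apply, MvPolynomial.coe_C, MvPolynomial.coe_X]
  rw [hx']
  set s := fun i => Φ (chart α β (pderiv i q) : MvPowerSeries (Fin 2) ℂ)
  have hinv : (MvPowerSeries.C (ρ * τ) * MvPowerSeries.C (ρ * τ)⁻¹ : MvPowerSeries (Fin 2) ℂ) =
      1 := by
    rw [← map_mul, mul_inv_cancel₀ (mul_ne_zero hρ hτ), map_one]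
  apply le_antisymm
  · rw [Ideal.span_le]
    rintro _ (rfl | rfl)
    · rw [SetLike.mem_coe, Ideal.mem_span_pair]
      refine ⟨MvPowerSeries.C (ρ * τ)⁻¹ * w⁻¹ ^ (n - 1), MvPowerSeries.C (ρ * τ)⁻¹ *
        w⁻¹ ^ (n - 1) * MvPowerSeries.C σ * MvPowerSeries.X 1, ?_⟩
      linear_combination (MvPowerSeries.C β.1 * s 0 + MvPowerSeries.C β.2 * s 1) *
        (w ^ (n - 1) * w⁻¹ ^ (n - 1) * hinv + hW)
    · rw [SetLike.mem_coe, Ideal.mem_span_pair]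
      refine ⟨0, w⁻¹ ^ (n - 1), ?_⟩
      linear_combination s 2 * hW
  · rw [Ideal.span_le]
    rintro _ (rfl | rfl)
    · rw [SetLike.mem_coe, Ideal.mem_span_pair]
      exact ⟨MvPowerSeries.C (ρ * τ) * w ^ (n - 1), -(MvPowerSeries.C σ * MvPowerSeries.X 1 *
        w ^ (n - 1)), by ring⟩
    · rw [SetLike.mem_coe, Ideal.mem_span_pair]
      exact ⟨0, w ^ (n - 1), by ring⟩

end ProjectiveChange

/-- The linear part `f ↦ v ^ d f(1/v, u/v)` of `gPoly`. -/
def gLin (d : ℕ) : MvPolynomial (Fin 2) ℂ →ₗ[ℂ] MvPolynomial (Fin 2) ℂ :=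
  (basisMonomials (Fin 2) ℂ).constr ℂ fun m =>
    monomial (Finsupp.single 0 (m 1) + Finsupp.single 1 (d - m 0 - m 1)) 1

theorem gLin_monomial (d : ℕ) (m : Fin 2 →₀ ℕ) (c : ℂ) :
    gLin d (monomial m c) =
      monomial (Finsupp.single 0 (m 1) + Finsupp.single 1 (d - m 0 - m 1)) c := by
  have : monomial m c = c • basisMonomials (Fin 2) ℂ m := by
    simp [smul_monomial]
  rw [this, map_smul, gLin, Module.Basis.constr_basis, smul_monomial, smul_eq_mul, mul_one]

theorem gPoly_eq (f : MvPolynomial (Fin 2) ℂ) (d : ℕ) (t : ℂ) :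
    gPoly f d t = gLin d f - C t * X 1 ^ d := by
  conv_rhs => rw [f.as_sum]
  rw [map_sum, gPoly]
  simp only [gLin_monomial]

/-- Homogenization in degree `d` of a polynomial in two variables. -/
def homogenization (d : ℕ) : MvPolynomial (Fin 2) ℂ →ₗ[ℂ] MvPolynomial (Fin 3) ℂ :=
  (basisMonomials (Fin 2) ℂ).constr ℂ fun m =>
    X 0 ^ m 0 * X 1 ^ m 1 * X 2 ^ (d - m 0 - m 1)

theorem homogenization_monomial (d : ℕ) (m : Fin 2 →₀ ℕ) (c : ℂ) :
    homogenization d (monomial m c) =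
      C c * (X 0 ^ m 0 * X 1 ^ m 1 * X 2 ^ (d - m 0 - m 1)) := by
  have : monomial m c = c • basisMonomials (Fin 2) ℂ m := by
    simp [smul_monomial]
  rw [this, map_smul, homogenization, Module.Basis.constr_basis, smul_eq_C_mul]

theorem degree_le_of_mem_support {f : MvPolynomial (Fin 2) ℂ} {d : ℕ} (hf : f.totalDegree ≤ d)
    {m : Fin 2 →₀ ℕ} (hm : m ∈ f.support) : m 0 + m 1 ≤ d := by
  have := (le_totalDegree hm).trans hf
  rwa [Finsupp.sum_fintype _ _ (fun _ => rfl), Fin.sum_univ_two] at this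

theorem isHomogeneous_homogenization {f : MvPolynomial (Fin 2) ℂ} {d : ℕ}
    (hf : f.totalDegree ≤ d) : (homogenization d f).IsHomogeneous d := by
  rw [f.as_sum, map_sum]
  apply IsHomogeneous.sum
  intro m hm
  have h := degree_le_of_mem_support hf hm
  rw [homogenization_monomial]
  have h1 := ((isHomogeneous_C (Fin 3) (coeff m f)).mul
    ((((isHomogeneous_X ℂ (0 : Fin 3)).pow (m 0)).mul
    ((isHomogeneous_X ℂ (1 : Fin 3)).pow (m 1))).mul
    ((isHomogeneous_X ℂ (2 : Fin 3)).pow (d - m 0 - m 1))))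
  convert h1 using 1
  omega

/-- The equation of the projective closure of the curve `f = t`. -/
def projEq (f : MvPolynomial (Fin 2) ℂ) (d : ℕ) (t : ℂ) : MvPolynomial (Fin 3) ℂ :=
  homogenization d f - C t * X 2 ^ d

theorem isHomogeneous_projEq {f : MvPolynomial (Fin 2) ℂ} {d : ℕ}
    (hf : f.totalDegree ≤ d) (t : ℂ) : (projEq f d t).IsHomogeneous d := by
  apply (isHomogeneous_homogenization hf).sub
  simpa using (isHomogeneous_C (Fin 3) t).mul ((isHomogeneous_X ℂ (2 : Fin 3)).pow d)

/-- A linear change of coordinates sending `(1, 0)` to `α` and `(0, 1)` to `β`. -/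
def linSubst (α β : ℂ × ℂ) : MvPolynomial (Fin 2) ℂ →ₐ[ℂ] MvPolynomial (Fin 2) ℂ :=
  aeval ![C α.1 * X 0 + C β.1 * X 1, C α.2 * X 0 + C β.2 * X 1]

@[simp] theorem linSubst_X_zero (α β : ℂ × ℂ) :
    linSubst α β (X 0) = C α.1 * X 0 + C β.1 * X 1 := by simp [linSubst]

@[simp] theorem linSubst_X_one (α β : ℂ × ℂ) :
    linSubst α β (X 1) = C α.2 * X 0 + C β.2 * X 1 := by simp [linSubst]

theorem fSlope_eq (f : MvPolynomial (Fin 2) ℂ) (m : ℂ) :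
    fSlope f m = linSubst (1, m) (0, 1) f := by
  rw [fSlope, ← aeval_eq_bind₁, linSubst]
  congr 2
  ext1 i
  fin_cases i
  · simp
  · simp [add_comm]

theorem fSwap_eq (f : MvPolynomial (Fin 2) ℂ) : fSwap f = linSubst (0, 1) (1, 0) f := by
  rw [fSwap, ← aeval_eq_bind₁, linSubst]
  congr 2
  ext1 i
  fin_cases i <;> simp

theorem gLin_of_isHomogeneous {p : MvPolynomial (Fin 2) ℂ} {n d : ℕ} (hp : p.IsHomogeneous n) :
    gLin d p = aeval ![1, X 0] p * X 1 ^ (d - n) := by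
  rw [p.as_sum, map_sum, map_sum, Finset.sum_mul]
  refine Finset.sum_congr rfl fun m hm => ?_
  have h1 : m 0 + m 1 = n := by
    have := hp (mem_support_iff.1 hm)
    rwa [Finsupp.weight_apply, Finsupp.sum_fintype _ _ (fun _ => by simp), Fin.sum_univ_two,
      Pi.one_apply, Pi.one_apply, smul_eq_mul, smul_eq_mul, mul_one, mul_one] at this
  rw [gLin_monomial, aeval_monomial, Finsupp.prod_fintype _ _ (fun _ => pow_zero _),
    Fin.prod_univ_two, monomial_eq, Finsupp.prod_add_index']
  · rw [Finsupp.prod_single_index (by simp), Finsupp.prod_single_index (by simp)]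
    simp [Nat.sub_sub, h1]
    ring
  · intro; simp
  · intro i a b; exact pow_add _ _ _

theorem gLin_linSubst {f : MvPolynomial (Fin 2) ℂ} {d : ℕ} (hf : f.totalDegree ≤ d)
    (α β : ℂ × ℂ) : gLin d (linSubst α β f) = chart α β (homogenization d f) := by
  rw [f.as_sum, map_sum, map_sum, map_sum, map_sum]
  refine Finset.sum_congr rfl fun m hm => ?_
  have h := degree_le_of_mem_support hf hm
  have h1 : (monomial m (coeff m f)).IsHomogeneous (m 0 + m 1) := by
    apply isHomogeneous_monomial
    rw [Finsupp.degree_eq_sum, Fin.sum_univ_two]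
  have h2 : (linSubst α β (monomial m (coeff m f))).IsHomogeneous (1 * (m 0 + m 1)) := by
    apply h1.aeval
    intro i
    fin_cases i
    · exact ((isHomogeneous_C_mul_X _ _).add (isHomogeneous_C_mul_X _ _))
    · exact ((isHomogeneous_C_mul_X _ _).add (isHomogeneous_C_mul_X _ _))
  rw [gLin_of_isHomogeneous h2, homogenization_monomial]
  have h3 : monomial m (coeff m f) = C (coeff m f) * (X 0 ^ m 0 * X 1 ^ m 1) := by
    rw [monomial_eq, Finsupp.prod_fintype _ _ (fun _ => pow_zero _), Fin.prod_univ_two]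
  rw [h3]
  simp [← algebraMap_eq, Nat.sub_sub]
  ring

theorem gPoly_linSubst {f : MvPolynomial (Fin 2) ℂ} {d : ℕ} (hf : f.totalDegree ≤ d)
    (α β : ℂ × ℂ) (t : ℂ) : gPoly (linSubst α β f) d t = chart α β (projEq f d t) := by
  rw [gPoly_eq, gLin_linSubst hf, projEq, map_sub, map_mul, map_pow, chart_X_two,
    ← algebraMap_eq, ← algebraMap_eq, AlgHom.commutes]

theorem chart_add_smul (α β : ℂ × ℂ) (m : ℂ) (q : MvPolynomial (Fin 3) ℂ) :
    chart (α + m • β) β q = PuiseuxField.shiftU m (chart α β q) := by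
  have : (chart (α + m • β) β : MvPolynomial (Fin 3) ℂ →+* MvPolynomial (Fin 2) ℂ) =
      (PuiseuxField.shiftU m).comp (chart α β : MvPolynomial (Fin 3) ℂ →+* _) := by
    apply MvPolynomial.ringHom_ext
    · intro a; simp [← algebraMap_eq]
    · intro i
      fin_cases i <;> simp <;> ring
  exact RingHom.congr_fun this q

section

open PuiseuxField

theorem map_constantCoeff_gPoly (f : MvPolynomial (Fin 2) ℂ) {d : ℕ} (hd : d ≠ 0) (t : ℂ) :
    (toPolynomialPowerSeries (gPoly f d t)).map (PowerSeries.constantCoeff (R := ℂ)) =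
      (toPolynomialPowerSeries (gLin d f)).map (PowerSeries.constantCoeff (R := ℂ)) := by
  rw [gPoly_eq, map_sub, map_mul, map_pow, Polynomial.map_sub, Polynomial.map_mul,
    Polynomial.map_pow]
  simp [hd]

theorem pderiv_zero_gPoly (f : MvPolynomial (Fin 2) ℂ) (d : ℕ) (t : ℂ) :
    pderiv 0 (gPoly f d t) = pderiv 0 (gLin d f) := by
  rw [gPoly_eq, map_sub]
  simp [pderiv_X]

open scoped Classical in
/-- The Milnor number at a point at infinity, computed along the branches of the polar curve in
sheared coordinates. -/
theorem mu_linSubst_eq {f : MvPolynomial (Fin 2) ℂ} {a m t ρ σ τ : ℂ} {α β : ℂ × ℂ} {d e : ℕ}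
    (hd : d ≠ 0) (hf : f.totalDegree ≤ d) (hρ : ρ ≠ 0) (hτ : τ ≠ 0)
    (hα : ((1, 0) : ℂ × ℂ) + m • ((a, 1) : ℂ × ℂ) = ρ • α)
    (hβ : ((a, 1) : ℂ × ℂ) = τ • β + σ • α)
    (h0 : (toPolynomialPowerSeries (gLin d (linSubst (1, 0) (a, 1) f))).map
      (PowerSeries.constantCoeff (R := ℂ)) ≠ 0)
    (he : ((toPolynomialPowerSeries (gLin d (linSubst (1, 0) (a, 1) f))).map
      (PowerSeries.constantCoeff (R := ℂ))).rootMultiplicity m = e + 1)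
    (hG : ∀ κ ∈ allBranches (pderiv 0 (gLin d (linSubst (1, 0) (a, 1) f))),
      0 < (κ - HahnSeries.C m).orderTop →
        eval₂ κ unif (gPoly (linSubst (1, 0) (a, 1) f) d t) ≠ 0) :
    (mu (linSubst α β f) d t : ℚ) =
      (((allBranches (pderiv 0 (gLin d (linSubst (1, 0) (a, 1) f)))).filter fun κ =>
        0 < (κ - HahnSeries.C m).orderTop).map fun κ =>
          (eval₂ κ unif (gPoly (linSubst (1, 0) (a, 1) f) d t)).order).sum - e := by
  have hchart : chart (((1, 0) : ℂ × ℂ) + m • ((a, 1) : ℂ × ℂ)) (a, 1) (projEq f d t) =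
      shiftU m (gPoly (linSubst (1, 0) (a, 1) f) d t) := by
    rw [chart_add_smul, gPoly_linSubst hf]
  set F := linSubst (1, 0) (a, 1) f with hF
  rw [mu, milnorIdeal, gPoly_linSubst hf,
    finrank_milnor_chart hρ hτ hα hβ (isHomogeneous_projEq hf t), hchart,
    finrank_quotient_polar (e := e) hρ, pderiv_shiftU, pderiv_zero_gPoly, branches_shiftU,
    Multiset.map_map]
  · congr 2
    apply Multiset.map_congr rfl
    intro κ _
    simp [eval₂_shiftU]
  · apply map_constantCoeff_shiftU_ne_zero
    rwa [map_constantCoeff_gPoly _ hd]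
  · rw [map_constantCoeff_shiftU, map_constantCoeff_gPoly _ hd, ← he,
      ← Polynomial.rootMultiplicity_eq_rootMultiplicity]
  · intro κ hκ
    rw [pderiv_shiftU, pderiv_zero_gPoly, branches_shiftU, Multiset.mem_map] at hκ
    obtain ⟨κ', hκ', rfl⟩ := hκ
    rw [Multiset.mem_filter] at hκ'
    rw [eval₂_shiftU, sub_add_cancel]
    exact hG κ' hκ'.1 hκ'.2

theorem pderiv_zero_linSubst (α β : ℂ × ℂ) (q : MvPolynomial (Fin 2) ℂ) :
    pderiv 0 (linSubst α β q) =
      C α.1 * linSubst α β (pderiv 0 q) + C α.2 * linSubst α β (pderiv 1 q) := by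
  induction q using MvPolynomial.induction_on with
  | C a => simp
  | add p q hp hq => simp only [map_add, hp, hq]; ring
  | mul_X p n hp =>
    have hX : pderiv 0 (linSubst α β (X n)) =
        C α.1 * linSubst α β (pderiv 0 (X n)) + C α.2 * linSubst α β (pderiv 1 (X n)) := by
      fin_cases n <;> simp [pderiv_X]
    rw [map_mul (linSubst α β), pderiv_mul, hp, hX, pderiv_mul, pderiv_mul, map_add, map_add,
      map_mul, map_mul, map_mul, map_mul]
    ring

theorem pderiv_one_linSubst (α β : ℂ × ℂ) (q : MvPolynomial (Fin 2) ℂ) :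
    pderiv 1 (linSubst α β q) =
      C β.1 * linSubst α β (pderiv 0 q) + C β.2 * linSubst α β (pderiv 1 q) := by
  induction q using MvPolynomial.induction_on with
  | C a => simp
  | add p q hp hq => simp only [map_add, hp, hq]; ring
  | mul_X p n hp =>
    have hX : pderiv 1 (linSubst α β (X n)) =
        C β.1 * linSubst α β (pderiv 0 (X n)) + C β.2 * linSubst α β (pderiv 1 (X n)) := by
      fin_cases n <;> simp [pderiv_X]
    rw [map_mul (linSubst α β), pderiv_mul, hp, hX, pderiv_mul, pderiv_mul, map_add, map_add,
      map_mul, map_mul, map_mul, map_mul]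
    ring

theorem finrank_milnor_linSubst (a : ℂ) (p : MvPolynomial (Fin 2) ℂ) :
    Module.finrank ℂ (MvPowerSeries (Fin 2) ℂ ⧸ milnorIdeal p) =
      Module.finrank ℂ (MvPowerSeries (Fin 2) ℂ ⧸ Ideal.span
        {(pderiv 0 (linSubst (a, 1) (1, 0) p) : MvPowerSeries (Fin 2) ℂ),
          (pderiv 1 (linSubst (a, 1) (1, 0) p) : MvPowerSeries (Fin 2) ℂ)}) := by
  have ha : MvPowerSeries.HasSubst (![MvPowerSeries.C a * MvPowerSeries.X 0 + MvPowerSeries.X 1,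
      MvPowerSeries.X 0] : Fin 2 → MvPowerSeries (Fin 2) ℂ) := by
    apply MvPowerSeries.hasSubst_of_constantCoeff_zero
    intro i
    fin_cases i <;> simp
  have hb : MvPowerSeries.HasSubst (![MvPowerSeries.X 1,
      MvPowerSeries.X 0 - MvPowerSeries.C a * MvPowerSeries.X 1] :
        Fin 2 → MvPowerSeries (Fin 2) ℂ) := by
    apply MvPowerSeries.hasSubst_of_constantCoeff_zero
    intro i
    fin_cases i <;> simp
  let Φ := MvPowerSeries.substAlgEquiv _ _ ha hb
    (by
      have h0 := MvPowerSeries.substAlgHom_X (R := ℂ) ha 0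
      have h1 := MvPowerSeries.substAlgHom_X (R := ℂ) ha 1
      have hC := substAlgHom_C ha a
      generalize MvPowerSeries.substAlgHom (R := ℂ) ha = Ψ at *
      intro i
      fin_cases i <;> simp [h0, h1, hC])
    (by
      have h0 := MvPowerSeries.substAlgHom_X (R := ℂ) hb 0
      have h1 := MvPowerSeries.substAlgHom_X (R := ℂ) hb 1
      have hC := substAlgHom_C hb a
      generalize MvPowerSeries.substAlgHom (R := ℂ) hb = Ψ at *
      intro i
      fin_cases i <;> simp [h0, h1, hC])
  have hΦ : ∀ q : MvPolynomial (Fin 2) ℂ, Φ (q : MvPowerSeries (Fin 2) ℂ) =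
      (linSubst (a, 1) (1, 0) q : MvPowerSeries (Fin 2) ℂ) := by
    intro q
    have : Φ.toAlgHom.comp (coeToMvPowerSeries.algHom ℂ) =
        (coeToMvPowerSeries.algHom ℂ).comp (linSubst (a, 1) (1, 0)) := by
      apply MvPolynomial.algHom_ext
      intro i
      have hX : Φ (MvPowerSeries.X i) = (![MvPowerSeries.C a * MvPowerSeries.X 0 +
          MvPowerSeries.X 1, MvPowerSeries.X 0] : Fin 2 → MvPowerSeries (Fin 2) ℂ) i :=
        MvPowerSeries.substAlgHom_X ha i
      fin_cases i
      · simpa using hX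
      · simpa using hX
    exact DFunLike.congr_fun this q
  apply finrank_quotient_eq_of_algEquiv Φ
  rw [hΦ, hΦ, pderiv_zero_linSubst, pderiv_one_linSubst]
  have h1 : C (1 : ℂ) * linSubst (a, 1) (1, 0) (pderiv 0 p) +
      C (0 : ℂ) * linSubst (a, 1) (1, 0) (pderiv 1 p) = linSubst (a, 1) (1, 0) (pderiv 0 p) := by
    simp
  have h2 : C a * linSubst (a, 1) (1, 0) (pderiv 0 p) +
      C (1 : ℂ) * linSubst (a, 1) (1, 0) (pderiv 1 p) =
        linSubst (a, 1) (1, 0) (pderiv 1 p) + C a * linSubst (a, 1) (1, 0) (pderiv 0 p) := by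
    rw [map_one, one_mul, add_comm]
  rw [h1, h2, MvPolynomial.coe_add, MvPolynomial.coe_mul]
  apply le_antisymm <;> rw [Ideal.span_le, Set.pair_subset_iff] <;>
    simp only [SetLike.mem_coe, Ideal.mem_span_pair]
  · exact ⟨⟨0, 1, by ring⟩, ⟨1, -↑(C a : MvPolynomial (Fin 2) ℂ), by ring⟩⟩
  · exact ⟨⟨↑(C a : MvPolynomial (Fin 2) ℂ), 1, by ring⟩, ⟨1, 0, by ring⟩⟩

/-- The expansion `F(b + v, u)` of `F` along the line `x = b`. -/
def lineExpansion (b : ℂ) : MvPolynomial (Fin 2) ℂ →ₐ[ℂ] MvPolynomial (Fin 2) ℂ :=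
  aeval ![C b + X 1, X 0]

@[simp] theorem lineExpansion_X_zero (b : ℂ) : lineExpansion b (X 0) = C b + X 1 := by
  simp [lineExpansion]

@[simp] theorem lineExpansion_X_one (b : ℂ) : lineExpansion b (X 1) = X 0 := by
  simp [lineExpansion]

theorem muLoc_eq (f : MvPolynomial (Fin 2) ℂ) (a b y : ℂ) :
    muLoc f (b + a * y, y) = Module.finrank ℂ (MvPowerSeries (Fin 2) ℂ ⧸ Ideal.span
      {(shiftU y (lineExpansion b (pderiv 1 (linSubst (1, 0) (a, 1) f))) :
        MvPowerSeries (Fin 2) ℂ),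
        (shiftU y (lineExpansion b (pderiv 0 (linSubst (1, 0) (a, 1) f))) :
          MvPowerSeries (Fin 2) ℂ)}) := by
  have hcomp : ∀ q : MvPolynomial (Fin 2) ℂ,
      shiftU y (lineExpansion b (linSubst (1, 0) (a, 1) q)) =
        linSubst (a, 1) (1, 0) (shiftPoly q (b + a * y, y)) := by
    intro q
    have : ((shiftU y).comp (lineExpansion b : MvPolynomial (Fin 2) ℂ →+* _)).comp
        (linSubst (1, 0) (a, 1) : MvPolynomial (Fin 2) ℂ →+* _) =
        (linSubst (a, 1) (1, 0) : MvPolynomial (Fin 2) ℂ →+* _).comp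
          (bind₁ (fun i : Fin 2 => X i + C (if i = 0 then b + a * y else y)) :
            MvPolynomial (Fin 2) ℂ →+* _) := by
      apply MvPolynomial.ringHom_ext
      · intro c; simp
      · intro i
        fin_cases i <;> simp <;> ring
    exact RingHom.congr_fun this q
  have hsh : ∀ i, pderiv i (shiftPoly f (b + a * y, y)) =
      shiftPoly (pderiv i f) (b + a * y, y) := by
    intro i
    simp only [shiftPoly]
    induction f using MvPolynomial.induction_on with
    | C a => simp
    | add p q hp hq => simp only [map_add, hp, hq]
    | mul_X p n hp =>
      rw [map_mul (bind₁ _), pderiv_mul, hp, pderiv_mul, map_add, map_mul, map_mul]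
      fin_cases i <;> fin_cases n <;> simp [pderiv_X]
  have hlin : ∀ (c c' : ℂ) (p q : MvPolynomial (Fin 2) ℂ),
      shiftU y (lineExpansion b (C c * p + C c' * q)) =
        C c * shiftU y (lineExpansion b p) + C c' * shiftU y (lineExpansion b q) := by
    intro c c' p q
    simp
  rw [muLoc, finrank_milnor_linSubst a, pderiv_zero_linSubst, pderiv_one_linSubst, hsh, hsh,
    ← hcomp, ← hcomp, pderiv_zero_linSubst, pderiv_one_linSubst, hlin, hlin]

end

namespace PuiseuxField

/-- The polynomial `h(x, y)` as a polynomial in `y` over `ℂ[x]`. -/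
abbrev toBiv : MvPolynomial (Fin 2) ℂ ≃ₐ[ℂ] Polynomial (Polynomial ℂ) :=
  (Polynomial.Bivariate.equivMvPolynomial ℂ).symm

theorem derivative_toBiv (h : MvPolynomial (Fin 2) ℂ) :
    Polynomial.derivative (toBiv h) = toBiv (pderiv 1 h) := by
  obtain ⟨p, rfl⟩ := (Polynomial.Bivariate.equivMvPolynomial ℂ).surjective h
  rw [Polynomial.Bivariate.pderiv_one_equivMvPolynomial]
  simp

/-- The substitution `X ↦ x`. -/
def place (x : PuiseuxField) : Polynomial ℂ →+* PuiseuxField :=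
  Polynomial.eval₂RingHom HahnSeries.C x

@[simp] theorem place_C (x : PuiseuxField) (c : ℂ) :
    place x (Polynomial.C c) = HahnSeries.C c := by simp [place]

@[simp] theorem place_X (x : PuiseuxField) : place x Polynomial.X = x := by simp [place]

theorem eval_map_place (x y : PuiseuxField) (h : MvPolynomial (Fin 2) ℂ) :
    ((toBiv h).map (place x)).eval y = eval₂ x y h := by
  have : ((Polynomial.evalRingHom y).comp (Polynomial.mapRingHom (place x))).comp
      (toBiv : MvPolynomial (Fin 2) ℂ →+* Polynomial (Polynomial ℂ)) = eval₂ x y := by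
    apply MvPolynomial.ringHom_ext
    · intro c
      simp
    · intro i
      fin_cases i <;> simp
  exact RingHom.congr_fun this h

theorem eval_map_evalRingHom (b y : ℂ) (h : MvPolynomial (Fin 2) ℂ) :
    ((toBiv h).map (Polynomial.evalRingHom b)).eval y = evalP h (b, y) := by
  have : ((Polynomial.evalRingHom y).comp (Polynomial.mapRingHom (Polynomial.evalRingHom b))).comp
      (toBiv : MvPolynomial (Fin 2) ℂ →+* Polynomial (Polynomial ℂ)) =
      MvPolynomial.eval (fun i : Fin 2 => if i = 0 then b else y) := by
    apply MvPolynomial.ringHom_ext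
    · intro c
      simp
    · intro i
      fin_cases i <;> simp
  exact RingHom.congr_fun this h

/-- The roots of `h(x, y)` as a polynomial in `y`, for a Puiseux series `x`. -/
def curveRoots (h : MvPolynomial (Fin 2) ℂ) (x : PuiseuxField) : Multiset PuiseuxField :=
  ((toBiv h).map (place x)).roots

theorem toPolynomialPowerSeries_lineExpansion (b : ℂ) (h : MvPolynomial (Fin 2) ℂ) :
    toPolynomialPowerSeries (lineExpansion b h) = (toBiv h).map
      (Polynomial.eval₂RingHom (PowerSeries.C (R := ℂ)) (PowerSeries.C b + PowerSeries.X)) := by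
  have : toPolynomialPowerSeries.comp (lineExpansion b : MvPolynomial (Fin 2) ℂ →+* _) =
      (Polynomial.mapRingHom (Polynomial.eval₂RingHom (PowerSeries.C (R := ℂ))
        (PowerSeries.C b + PowerSeries.X))).comp
      (toBiv : MvPolynomial (Fin 2) ℂ →+* Polynomial (Polynomial ℂ)) := by
    apply MvPolynomial.ringHom_ext
    · intro c
      simp
    · intro i
      fin_cases i <;> simp
  exact RingHom.congr_fun this h

theorem map_place_add_unif (b : ℂ) (h : MvPolynomial (Fin 2) ℂ) :
    (toBiv h).map (place (HahnSeries.C b + unif)) =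
      (toPolynomialPowerSeries (lineExpansion b h)).map (HahnSeries.ofPowerSeries ℚ ℂ) := by
  rw [toPolynomialPowerSeries_lineExpansion, Polynomial.map_map]
  congr 1
  apply Polynomial.ringHom_ext
  · intro c
    simp [HahnSeries.ofPowerSeries_C]
  · simp [HahnSeries.ofPowerSeries_C, unif]

theorem curveRoots_add_unif (b : ℂ) (h : MvPolynomial (Fin 2) ℂ) :
    curveRoots h (HahnSeries.C b + unif) = allBranches (lineExpansion b h) := by
  rw [curveRoots, map_place_add_unif, allBranches]

theorem eval₂_lineExpansion (b : ℂ) (κ : PuiseuxField) (h : MvPolynomial (Fin 2) ℂ) :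
    eval₂ κ unif (lineExpansion b h) = eval₂ (HahnSeries.C b + unif) κ h := by
  rw [← eval_map_toPolynomialPowerSeries, ← map_place_add_unif, eval_map_place]

theorem map_constantCoeff_lineExpansion (b : ℂ) (h : MvPolynomial (Fin 2) ℂ) :
    (toPolynomialPowerSeries (lineExpansion b h)).map (PowerSeries.constantCoeff (R := ℂ)) =
      (toBiv h).map (Polynomial.evalRingHom b) := by
  rw [toPolynomialPowerSeries_lineExpansion, Polynomial.map_map]
  congr 1
  apply Polynomial.ringHom_ext
  · intro c
    simp
  · simp

theorem leadingCoeff_lineExpansion {h : MvPolynomial (Fin 2) ℂ} {ℓ : ℂ} (hℓ : ℓ ≠ 0)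
    (hl : (toBiv h).leadingCoeff = Polynomial.C ℓ) (b : ℂ) :
    (toPolynomialPowerSeries (lineExpansion b h)).leadingCoeff = PowerSeries.C ℓ := by
  rw [toPolynomialPowerSeries_lineExpansion,
    Polynomial.leadingCoeff_map_of_leadingCoeff_ne_zero, hl]
  · simp
  · rw [hl]
    simpa using hℓ

theorem eval₂_gLin {h : MvPolynomial (Fin 2) ℂ} {d : ℕ} (hh : h.totalDegree ≤ d)
    (κ : PuiseuxField) :
    eval₂ κ unif (gLin d h) = unif ^ d * eval₂ unif⁻¹ (unif⁻¹ * κ) h := by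
  conv_lhs => rw [h.as_sum]
  conv_rhs => rw [h.as_sum]
  rw [map_sum, map_sum, map_sum, Finset.mul_sum]
  refine Finset.sum_congr rfl fun m hm => ?_
  have hm' := degree_le_of_mem_support hh hm
  rw [gLin_monomial, monomial_eq, monomial_eq]
  have hd : d = (d - m 0 - m 1) + m 0 + m 1 := by omega
  conv_rhs => rw [hd]
  rw [Finsupp.prod_add_index' (by simp) (by intros; rw [pow_add]),
    Finsupp.prod_single_index (by simp), Finsupp.prod_single_index (by simp),
    Finsupp.prod_fintype _ _ (by simp)]
  simp only [Fin.prod_univ_two, map_mul, map_pow, eval₂_C, eval₂_X_zero, eval₂_X_one]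
  rw [pow_add, pow_add, mul_pow, inv_pow, inv_pow]
  have h0 := pow_ne_zero (m 0) unif_ne_zero
  have h1 := pow_ne_zero (m 1) unif_ne_zero
  generalize unif ^ m 0 = p at *
  generalize unif ^ m 1 = q at *
  field_simp

theorem map_ofPowerSeries_gLin {h : MvPolynomial (Fin 2) ℂ} {d : ℕ} (hh : h.totalDegree ≤ d) :
    (toPolynomialPowerSeries (gLin d h)).map (HahnSeries.ofPowerSeries ℚ ℂ) =
      Polynomial.C (unif ^ d) * ((toBiv h).map (place unif⁻¹)).comp
        (Polynomial.C unif⁻¹ * Polynomial.X + Polynomial.C 0) := by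
  have : Infinite PuiseuxField := Infinite.of_injective _ HahnSeries.C_injective
  apply Polynomial.funext
  intro κ
  rw [eval_map_toPolynomialPowerSeries, eval₂_gLin hh]
  simp [Polynomial.eval_comp, eval_map_place]

/-- The polynomial `F` of degree at most `d` has the form `ℓ y ^ d + ⋯` with `ℓ ≠ 0`. -/
structure IsRegularInY (F : MvPolynomial (Fin 2) ℂ) (d : ℕ) (ℓ : ℂ) : Prop where
  totalDegree_le : F.totalDegree ≤ d
  ne_zero : ℓ ≠ 0
  natDegree_eq : (toBiv F).natDegree = d
  leadingCoeff_eq : (toBiv F).leadingCoeff = Polynomial.C ℓ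

namespace IsRegularInY

variable {F : MvPolynomial (Fin 2) ℂ} {d : ℕ} {ℓ : ℂ}

theorem leadingCoeff_gLin (hF : IsRegularInY F d ℓ) :
    (toPolynomialPowerSeries (gLin d F)).natDegree = d ∧
      (toPolynomialPowerSeries (gLin d F)).leadingCoeff = PowerSeries.C ℓ := by
  have hinj : Function.Injective (HahnSeries.ofPowerSeries ℚ ℂ) :=
    HahnSeries.ofPowerSeries_injective
  have hne : place unif⁻¹ (toBiv F).leadingCoeff ≠ 0 := by
    rw [hF.leadingCoeff_eq, place_C]
    exact HahnSeries.C_ne_zero hF.ne_zero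
  have hlin : (Polynomial.C unif⁻¹ * Polynomial.X + Polynomial.C 0 :
      Polynomial PuiseuxField).natDegree = 1 :=
    Polynomial.natDegree_linear (inv_ne_zero unif_ne_zero)
  have hn : (toPolynomialPowerSeries (gLin d F)).natDegree = d := by
    rw [← Polynomial.natDegree_map_eq_of_injective hinj, map_ofPowerSeries_gLin hF.totalDegree_le,
      Polynomial.natDegree_C_mul (pow_ne_zero _ unif_ne_zero), Polynomial.natDegree_comp, hlin,
      Polynomial.natDegree_map_of_leadingCoeff_ne_zero _ hne, hF.natDegree_eq, mul_one]
  refine ⟨hn, hinj ?_⟩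
  rw [← Polynomial.leadingCoeff_map_of_injective hinj, map_ofPowerSeries_gLin hF.totalDegree_le,
    Polynomial.leadingCoeff_mul, Polynomial.leadingCoeff_comp (by rw [hlin]; exact one_ne_zero),
    Polynomial.leadingCoeff_linear (inv_ne_zero unif_ne_zero),
    Polynomial.natDegree_map_of_leadingCoeff_ne_zero _ hne,
    Polynomial.leadingCoeff_map_of_leadingCoeff_ne_zero _ hne, hF.leadingCoeff_eq,
    hF.natDegree_eq, Polynomial.leadingCoeff_C, place_C, HahnSeries.ofPowerSeries_C, mul_comm,
    mul_assoc, ← mul_pow, inv_mul_cancel₀ unif_ne_zero, one_pow, mul_one]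

instance : IsAddTorsionFree (PowerSeries ℂ) :=
  have : CharZero (PowerSeries ℂ) := charZero_of_injective_algebraMap
    (algebraMap ℂ (PowerSeries ℂ)).injective
  inferInstance

theorem leadingCoeff_pderiv_gLin (hF : IsRegularInY F d ℓ) :
    (toPolynomialPowerSeries (pderiv 0 (gLin d F))).leadingCoeff = PowerSeries.C (ℓ * d) := by
  rw [toPolynomialPowerSeries_pderiv_zero, Polynomial.leadingCoeff_derivative,
    hF.leadingCoeff_gLin.1, hF.leadingCoeff_gLin.2, map_mul, map_natCast]

theorem leadingCoeff_pderiv (hF : IsRegularInY F d ℓ) :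
    (toBiv (pderiv 1 F)).leadingCoeff = Polynomial.C (ℓ * d) := by
  rw [← derivative_toBiv, Polynomial.leadingCoeff_derivative, hF.natDegree_eq, hF.leadingCoeff_eq,
    map_mul, map_natCast]

theorem mul_ne_zero (hF : IsRegularInY F d ℓ) (hd : d ≠ 0) : ℓ * d ≠ 0 :=
  _root_.mul_ne_zero hF.ne_zero (Nat.cast_ne_zero.2 hd)

theorem allBranches_pderiv_gLin (hF : IsRegularInY F d ℓ) :
    allBranches (pderiv 0 (gLin d F)) =
      (curveRoots (pderiv 1 F) unif⁻¹).map fun y => unif * y := by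
  have h0 : (unif ^ d * unif⁻¹ : PuiseuxField) ≠ 0 :=
    _root_.mul_ne_zero (pow_ne_zero _ unif_ne_zero) (inv_ne_zero unif_ne_zero)
  have : (toPolynomialPowerSeries (pderiv 0 (gLin d F))).map (HahnSeries.ofPowerSeries ℚ ℂ) =
      Polynomial.C (unif ^ d * unif⁻¹) * ((toBiv (pderiv 1 F)).map (place unif⁻¹)).comp
        (Polynomial.C unif⁻¹ * Polynomial.X + Polynomial.C 0) := by
    rw [toPolynomialPowerSeries_pderiv_zero, ← Polynomial.derivative_map,
      map_ofPowerSeries_gLin hF.totalDegree_le, ← derivative_toBiv, ← Polynomial.derivative_map,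
      Polynomial.derivative_C_mul, Polynomial.derivative_comp]
    simp only [Polynomial.derivative_add, Polynomial.derivative_C_mul, Polynomial.derivative_X,
      Polynomial.derivative_C, mul_one, add_zero, map_mul]
    ring
  rw [allBranches, this, Polynomial.roots_C_mul _ h0,
    Polynomial.roots_comp_C_mul_X_add_C _ _ _ (isUnit_iff_ne_zero.2 (inv_ne_zero unif_ne_zero)),
    curveRoots]
  simp

theorem splits_infinity (hF : IsRegularInY F d ℓ) (hd : d ≠ 0) :
    ((toBiv (pderiv 1 F)).map (place unif⁻¹)).Splits ∧
      (curveRoots (pderiv 1 F) unif⁻¹).card = d - 1 := by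
  have hne : place unif⁻¹ (toBiv (pderiv 1 F)).leadingCoeff ≠ 0 := by
    rw [hF.leadingCoeff_pderiv, place_C]
    exact HahnSeries.C_ne_zero (hF.mul_ne_zero hd)
  have hdeg : (toBiv (pderiv 1 F)).natDegree = d - 1 := by
    rw [← derivative_toBiv, Polynomial.natDegree_derivative, hF.natDegree_eq]
  have hcard : (curveRoots (pderiv 1 F) unif⁻¹).card = d - 1 := by
    have h1 := congrArg Multiset.card hF.allBranches_pderiv_gLin
    have h2 := congrArg Polynomial.natDegree (allBranches_of_leadingCoeff (hF.mul_ne_zero hd)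
      hF.leadingCoeff_pderiv_gLin).1
    rw [Multiset.card_map] at h1
    rw [← h1]
    rw [Polynomial.natDegree_map_eq_of_injective HahnSeries.ofPowerSeries_injective,
      toPolynomialPowerSeries_pderiv_zero, Polynomial.natDegree_derivative,
      hF.leadingCoeff_gLin.1, Polynomial.natDegree_C_mul
        (HahnSeries.C_ne_zero (hF.mul_ne_zero hd)),
      Polynomial.natDegree_multiset_prod_X_sub_C_eq_card] at h2
    exact h2.symm
  refine ⟨Polynomial.splits_iff_card_roots.2 ?_, hcard⟩
  rw [Polynomial.natDegree_map_of_leadingCoeff_ne_zero _ hne, hdeg]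
  exact hcard

theorem splits_finite (hF : IsRegularInY F d ℓ) (hd : d ≠ 0) (b : ℂ) :
    ((toBiv (pderiv 1 F)).map (place (HahnSeries.C b + unif))).Splits := by
  rw [map_place_add_unif, (allBranches_of_leadingCoeff (hF.mul_ne_zero hd)
    (leadingCoeff_lineExpansion (hF.mul_ne_zero hd) hF.leadingCoeff_pderiv b)).1]
  exact (Polynomial.Splits.C _).mul (Polynomial.Splits.multisetProd (by simp +contextual))

end IsRegularInY

end PuiseuxField

namespace PuiseuxField

theorem order_place {x : PuiseuxField} (hx : ∀ r, x - HahnSeries.C r ≠ 0) {N : Polynomial ℂ}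
    (hN : N ≠ 0) :
    (place x N).order = (N.roots.map fun r => (x - HahnSeries.C r).order).sum := by
  have hs := (IsAlgClosed.splits N).eq_prod_roots
  have hprod : place x N = HahnSeries.C N.leadingCoeff *
      (N.roots.map fun r => x - HahnSeries.C r).prod := by
    conv_lhs => rw [hs]
    rw [map_mul, place_C, map_multiset_prod, Multiset.map_map]
    simp
  have hne : ∀ z ∈ N.roots.map (fun r => x - HahnSeries.C r), z ≠ 0 := by
    intro z hz
    obtain ⟨r, _, rfl⟩ := Multiset.mem_map.1 hz
    exact hx r
  rw [hprod, HahnSeries.order_mul (HahnSeries.C_ne_zero (Polynomial.leadingCoeff_ne_zero.2 hN))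
    (Multiset.prod_ne_zero fun h => hne 0 h rfl), order_multiset_prod hne, Multiset.map_map,
    HahnSeries.C_apply, HahnSeries.order_single (Polynomial.leadingCoeff_ne_zero.2 hN), zero_add]
  rfl

theorem order_sub_C_finite (b r : ℂ) : HahnSeries.C b + unif - HahnSeries.C r ≠ 0 ∧
    (HahnSeries.C b + unif - HahnSeries.C r).order = if b = r then 1 else 0 := by
  split_ifs with h
  · subst h
    simp [unif_ne_zero]
  · have hc : (HahnSeries.C b + unif - HahnSeries.C r).coeff 0 = b - r := by
      simp [unif, HahnSeries.coeff_single_of_ne]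
    have hi : HahnSeries.C b + unif - HahnSeries.C r ∈ integers := by
      have hC : ∀ c : ℂ, HahnSeries.C c ∈ integers := fun c => by
        rw [← HahnSeries.ofPowerSeries_C]
        exact ofPowerSeries_mem_integers _
      refine sub_mem (add_mem (hC b) ?_) (hC r)
      rw [← ofPowerSeries_X_eq]
      exact ofPowerSeries_mem_integers _
    have hne : b - r ≠ 0 := sub_ne_zero.2 h
    refine ⟨fun h0 => ?_, order_eq_zero_of_coeff_zero_ne hi (by rwa [hc])⟩
    rw [h0] at hc
    exact hne hc.symm

theorem orderTop_unif_inv : (unif⁻¹ : PuiseuxField).orderTop = ((-1 : ℚ) : WithTop ℚ) := by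
  rw [unif, HahnSeries.inv_single, HahnSeries.orderTop_single (by simp)]

theorem order_eq_of_orderTop {x : PuiseuxField} {q : ℚ} (h : x.orderTop = (q : WithTop ℚ)) :
    x ≠ 0 ∧ x.order = q := by
  have hx : x ≠ 0 := by
    rintro rfl
    simp at h
  refine ⟨hx, ?_⟩
  rw [← HahnSeries.order_eq_orderTop_of_ne_zero hx] at h
  exact_mod_cast h

theorem orderTop_C_nonneg (c : ℂ) : (0 : WithTop ℚ) ≤ (HahnSeries.C c : PuiseuxField).orderTop := by
  by_cases hc : c = 0
  · simp [hc]
  · rw [HahnSeries.C_apply, HahnSeries.orderTop_single hc]; rfl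

theorem order_sub_C_infinity (r : ℂ) : unif⁻¹ - HahnSeries.C r ≠ 0 ∧
    (unif⁻¹ - HahnSeries.C r).order = -1 := by
  apply order_eq_of_orderTop
  rw [HahnSeries.orderTop_sub, orderTop_unif_inv]
  rw [orderTop_unif_inv]
  refine lt_of_lt_of_le ?_ (orderTop_C_nonneg r)
  exact_mod_cast (by norm_num : (-1 : ℚ) < 0)

open scoped Classical in
/-- The degree of the principal divisor of a polynomial on the projective line is zero. -/
theorem sum_order_place {N : Polynomial ℂ} (hN : N ≠ 0) {B : Finset ℂ}
    (hB : ∀ b, N.eval b = 0 → b ∈ B) :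
    ∑ b ∈ B, (place (HahnSeries.C b + unif) N).order = -(place unif⁻¹ N).order := by
  rw [order_place (fun r => (order_sub_C_infinity r).1) hN]
  simp only [order_place (fun r => (order_sub_C_finite _ r).1) hN, (order_sub_C_finite _ _).2,
    (order_sub_C_infinity _).2]
  have hr : ∀ r ∈ N.roots, r ∈ B := fun r hr => hB r (Polynomial.isRoot_of_mem_roots hr)
  generalize N.roots = s at *
  induction s using Multiset.induction_on with
  | empty => simp
  | cons r s ih =>
    simp only [Multiset.map_cons, Multiset.sum_cons, Finset.sum_add_distrib]
    rw [ih fun x hx => hr x (Multiset.mem_cons_of_mem hx), Finset.sum_ite_eq' B r,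
      if_pos (hr r (Multiset.mem_cons_self r s))]
    ring

theorem place_injective {x : PuiseuxField} (hx : ∀ r, x - HahnSeries.C r ≠ 0) :
    Function.Injective (place x) := by
  rw [injective_iff_map_eq_zero]
  intro M hM
  by_contra hM0
  have h2 := (IsAlgClosed.splits M).eq_prod_roots
  rw [h2, map_mul, place_C, map_multiset_prod, Multiset.map_map] at hM
  rcases mul_eq_zero.1 hM with h3 | h3
  · exact HahnSeries.C_ne_zero (Polynomial.leadingCoeff_ne_zero.2 hM0) h3
  · obtain ⟨r, _, hr⟩ := Multiset.mem_map.1 (Multiset.prod_eq_zero_iff.1 h3)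
    apply hx r
    simpa using hr

namespace IsRegularInY

variable {F : MvPolynomial (Fin 2) ℂ} {d : ℕ} {ℓ : ℂ}

/-- The norm of a function on the curve `∂F/∂y = 0` to the `x`-axis. -/
theorem exists_norm (hF : IsRegularInY F d ℓ) (hd : d ≠ 0) (g : MvPolynomial (Fin 2) ℂ) :
    ∃ N : Polynomial ℂ, ∀ {K : Type} [Field K] (φ : Polynomial ℂ →+* K),
      ((toBiv (pderiv 1 F)).map φ).Splits →
        φ N = (((toBiv (pderiv 1 F)).map φ).roots.map fun a =>
          ((toBiv g).map φ).eval a).prod := by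
  have hn := hF.mul_ne_zero hd
  set h := pderiv 1 F with hh
  set H : Polynomial (Polynomial ℂ) := Polynomial.C (Polynomial.C (ℓ * d)⁻¹) * toBiv h with hH
  have hmonic : H.Monic := by
    apply Polynomial.monic_C_mul_of_mul_leadingCoeff_eq_one
    rw [hF.leadingCoeff_pderiv, ← map_mul, inv_mul_cancel₀ hn, map_one]
  refine ⟨LinearMap.det (LinearMap.mulLeft (Polynomial ℂ) (AdjoinRoot.mk H (toBiv g))), ?_⟩
  intro K _ φ hs
  refine AdjoinRoot.map_det_mulLeft φ H _ hmonic _ ?_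
  have hc : φ (Polynomial.C (ℓ * d)⁻¹) ≠ 0 := by
    intro h0
    have := congrArg φ (show Polynomial.C (ℓ * d)⁻¹ * Polynomial.C (ℓ * d) = 1 by
      rw [← map_mul, inv_mul_cancel₀ hn, map_one])
    rw [map_mul, h0, zero_mul, map_one] at this
    exact zero_ne_one this
  have hroots : (H.map φ).roots = ((toBiv h).map φ).roots := by
    rw [hH, Polynomial.map_mul, Polynomial.map_C, Polynomial.roots_C_mul _ hc]
  have hs' : (H.map φ).Splits := by
    rw [hH, Polynomial.map_mul, Polynomial.map_C]
    exact (Polynomial.Splits.C _).mul hs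
  rw [hs'.eq_prod_roots, hroots, (hmonic.map φ).leadingCoeff, map_one, one_mul]

theorem map_evalRingHom_ne_zero (hF : IsRegularInY F d ℓ) (hd : d ≠ 0) (b : ℂ) :
    (toBiv (pderiv 1 F)).map (Polynomial.evalRingHom b) ≠ 0 := by
  intro h0
  have hlead : Polynomial.evalRingHom b (toBiv (pderiv 1 F)).leadingCoeff ≠ 0 := by
    rw [hF.leadingCoeff_pderiv]
    simpa using hF.mul_ne_zero hd
  have := Polynomial.leadingCoeff_map_of_leadingCoeff_ne_zero _ hlead
  rw [h0, Polynomial.leadingCoeff_zero] at this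
  exact hlead this.symm

/-- If `g` vanishes on a branch at infinity of the curve `∂F/∂y = 0`, it vanishes at a point of
this curve above each `b`. -/
theorem exists_common_zero (hF : IsRegularInY F d ℓ) (hd : d ≠ 0) {g : MvPolynomial (Fin 2) ℂ}
    {y : PuiseuxField} (hy : y ∈ curveRoots (pderiv 1 F) unif⁻¹) (hg : eval₂ unif⁻¹ y g = 0)
    (b : ℂ) : ∃ z, evalP (pderiv 1 F) (b, z) = 0 ∧ evalP g (b, z) = 0 := by
  obtain ⟨N, hN⟩ := hF.exists_norm hd g
  have h0 : N = 0 := by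
    apply place_injective fun r => (order_sub_C_infinity r).1
    rw [hN _ (hF.splits_infinity hd).1, map_zero]
    apply Multiset.prod_eq_zero
    refine Multiset.mem_map.2 ⟨y, hy, ?_⟩
    rw [eval_map_place, hg]
  have h1 := hN (Polynomial.evalRingHom b) (IsAlgClosed.splits _)
  rw [h0, map_zero] at h1
  obtain ⟨z, hz, hz0⟩ := Multiset.mem_map.1 (Multiset.prod_eq_zero_iff.1 h1.symm)
  rw [eval_map_evalRingHom] at hz0
  rw [Polynomial.mem_roots (hF.map_evalRingHom_ne_zero hd b), Polynomial.IsRoot.def,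
    eval_map_evalRingHom] at hz
  exact ⟨z, hz, hz0⟩

/-- The product formula for a function on the curve `∂F/∂y = 0`. -/
theorem product_formula (hF : IsRegularInY F d ℓ) (hd : d ≠ 0)
    (g : MvPolynomial (Fin 2) ℂ)
    (hg : ∀ y ∈ curveRoots (pderiv 1 F) unif⁻¹, eval₂ unif⁻¹ y g ≠ 0) :
    (∀ b, ∀ y ∈ curveRoots (pderiv 1 F) (HahnSeries.C b + unif),
      eval₂ (HahnSeries.C b + unif) y g ≠ 0) ∧
    ∃ B₀ : Finset ℂ,
      (∀ b ∉ B₀, ∀ y, evalP (pderiv 1 F) (b, y) = 0 → evalP g (b, y) ≠ 0) ∧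
      ∀ B, B₀ ⊆ B →
        ∑ b ∈ B, ((curveRoots (pderiv 1 F) (HahnSeries.C b + unif)).map fun y =>
          (eval₂ (HahnSeries.C b + unif) y g).order).sum =
        -((curveRoots (pderiv 1 F) unif⁻¹).map fun y => (eval₂ unif⁻¹ y g).order).sum := by
  classical
  set h := pderiv 1 F with hh
  obtain ⟨N, hsplit⟩ := hF.exists_norm hd g
  rw [← hh] at hsplit
  have hplace : ∀ x : PuiseuxField, ((toBiv h).map (place x)).Splits →
      place x N = ((curveRoots h x).map fun y => eval₂ x y g).prod := by
    intro x hs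
    rw [hsplit (place x) hs, curveRoots]
    simp only [eval_map_place]
  have hinf := hplace _ (hF.splits_infinity hd).1
  have hN0 : N ≠ 0 := by
    intro h0
    rw [h0, map_zero] at hinf
    obtain ⟨y, hy, hy0⟩ := Multiset.mem_map.1 (Multiset.prod_eq_zero_iff.1 hinf.symm)
    exact hg y hy hy0
  have hfin : ∀ b, ∀ y ∈ curveRoots h (HahnSeries.C b + unif),
      eval₂ (HahnSeries.C b + unif) y g ≠ 0 := by
    intro b y hy h0
    have h1 := hplace _ (hF.splits_finite hd b)
    rw [Multiset.prod_eq_zero (Multiset.mem_map.2 ⟨y, hy, h0⟩)] at h1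
    have hi := place_injective fun r => (order_sub_C_finite b r).1
    exact hN0 (hi (h1.trans (map_zero _).symm))
  refine ⟨hfin, N.roots.toFinset, ?_, ?_⟩
  · intro b hb y hy hgy
    apply hb
    rw [Multiset.mem_toFinset, Polynomial.mem_roots hN0, Polynomial.IsRoot.def,
      ← Polynomial.coe_evalRingHom, hsplit _ (IsAlgClosed.splits _)]
    apply Multiset.prod_eq_zero
    refine Multiset.mem_map.2 ⟨y, ?_, ?_⟩
    · rw [Polynomial.mem_roots, Polynomial.IsRoot.def, eval_map_evalRingHom]
      · exact hy
      · exact hF.map_evalRingHom_ne_zero hd b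
    · rw [eval_map_evalRingHom, hgy]
  · intro B hB
    have := sum_order_place hN0 (B := B) fun b hb =>
      hB (Multiset.mem_toFinset.2 ((Polynomial.mem_roots hN0).2 hb))
    rw [hinf, order_multiset_prod, Multiset.map_map] at this
    · refine Eq.trans ?_ this
      refine Finset.sum_congr rfl fun b _ => ?_
      rw [hplace _ (hF.splits_finite hd b), order_multiset_prod, Multiset.map_map]
      · rfl
      · intro z hz
        obtain ⟨y, hy, rfl⟩ := Multiset.mem_map.1 hz
        exact hfin b y hy
    · intro z hz
      obtain ⟨y, hy, rfl⟩ := Multiset.mem_map.1 hz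
      exact hg y hy

end IsRegularInY

end PuiseuxField

open scoped Classical in
theorem Multiset.sum_fiberwise_of_forall_notMem {K : Type*} (s : Multiset K) (p : K → ℂ)
    (w : K → ℚ) (Y : Finset ℂ) (h : ∀ κ ∈ s, p κ ∉ Y → w κ = 0) :
    ∑ y ∈ Y, ((s.filter fun κ => p κ = y).map w).sum = (s.map w).sum := by
  induction s using Multiset.induction_on with
  | empty => simp
  | cons κ s ih =>
    have h1 : ∀ y, (((κ ::ₘ s).filter fun κ => p κ = y).map w).sum =
        (if p κ = y then w κ else 0) + ((s.filter fun κ => p κ = y).map w).sum := by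
      intro y
      by_cases hy : p κ = y
      · rw [Multiset.filter_cons_of_pos (p := fun κ => p κ = y) s hy, if_pos hy]; simp
      · rw [Multiset.filter_cons_of_neg (p := fun κ => p κ = y) s hy, if_neg hy]; simp
    simp only [h1, Finset.sum_add_distrib]
    rw [ih fun x hx => h x (Multiset.mem_cons_of_mem hx), Finset.sum_ite_eq Y (p κ),
      Multiset.map_cons, Multiset.sum_cons]
    split_ifs with hY
    · rfl
    · rw [h κ (Multiset.mem_cons_self κ s) hY]

theorem evalP_linSubst (α β : ℂ × ℂ) (p : MvPolynomial (Fin 2) ℂ) (q : ℂ × ℂ) :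
    evalP (linSubst α β p) q = evalP p (q.1 * α.1 + q.2 * β.1, q.1 * α.2 + q.2 * β.2) := by
  have : (MvPolynomial.eval (fun i : Fin 2 => if i = 0 then q.1 else q.2)).comp
      (linSubst α β : MvPolynomial (Fin 2) ℂ →+* _) =
      MvPolynomial.eval (fun i : Fin 2 => if i = 0 then q.1 * α.1 + q.2 * β.1
        else q.1 * α.2 + q.2 * β.2) := by
    apply MvPolynomial.ringHom_ext
    · intro c
      simp
    · intro i
      fin_cases i <;> simp <;> ring
  exact RingHom.congr_fun this p

theorem evalP_add (p q : MvPolynomial (Fin 2) ℂ) (z : ℂ × ℂ) :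
    evalP (p + q) z = evalP p z + evalP q z := by simp [evalP]

theorem evalP_mul (p q : MvPolynomial (Fin 2) ℂ) (z : ℂ × ℂ) :
    evalP (p * q) z = evalP p z * evalP q z := by simp [evalP]

@[simp] theorem evalP_C (c : ℂ) (z : ℂ × ℂ) : evalP (C c) z = c := by simp [evalP]

/-- The shear `f(x + a y, y)`. -/
abbrev shear (a : ℂ) (f : MvPolynomial (Fin 2) ℂ) : MvPolynomial (Fin 2) ℂ :=
  linSubst (1, 0) (a, 1) f

theorem mem_critPts_iff_shear (f : MvPolynomial (Fin 2) ℂ) (a b y : ℂ) :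
    (b + a * y, y) ∈ critPts f ↔
      evalP (pderiv 0 (shear a f)) (b, y) = 0 ∧ evalP (pderiv 1 (shear a f)) (b, y) = 0 := by
  rw [pderiv_zero_linSubst, pderiv_one_linSubst, critPts, Set.mem_ofPred_eq]
  simp only [evalP_add, evalP_mul, evalP_C, evalP_linSubst, mul_one, mul_zero, zero_add, one_mul,
    zero_mul, add_zero, mul_comm y a]
  constructor
  · rintro ⟨h1, h2⟩
    simp [h1, h2]
  · rintro ⟨h1, h2⟩
    exact ⟨h1, by simpa [h1] using h2⟩

namespace PuiseuxField

theorem orderTop_sub_C_pos_iff {κ : PuiseuxField} (hκ : κ ∈ integers) (c : ℂ) :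
    0 < (κ - HahnSeries.C c).orderTop ↔ κ.coeff 0 = c := by
  constructor
  · intro h
    have := HahnSeries.coeff_eq_zero_of_lt_orderTop (i := (0 : ℚ)) h
    rw [HahnSeries.coeff_sub] at this
    simpa [sub_eq_zero] using this
  · rintro rfl
    exact orderTop_sub_C_coeff_zero_pos hκ

namespace IsRegularInY

variable {F : MvPolynomial (Fin 2) ℂ} {d : ℕ} {ℓ : ℂ}

theorem mem_integers_of_mem_curveRoots (hF : IsRegularInY F d ℓ) (hd : d ≠ 0) {b : ℂ}
    {κ : PuiseuxField} (hκ : κ ∈ curveRoots (pderiv 1 F) (HahnSeries.C b + unif)) :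
    κ ∈ integers := by
  rw [curveRoots_add_unif] at hκ
  exact (allBranches_of_leadingCoeff (hF.mul_ne_zero hd)
    (leadingCoeff_lineExpansion (hF.mul_ne_zero hd) hF.leadingCoeff_pderiv b)).2.1 κ hκ

theorem map_coeff_zero_curveRoots (hF : IsRegularInY F d ℓ) (hd : d ≠ 0) (b : ℂ) :
    (curveRoots (pderiv 1 F) (HahnSeries.C b + unif)).map (fun κ => κ.coeff 0) =
      ((toBiv (pderiv 1 F)).map (Polynomial.evalRingHom b)).roots := by
  rw [curveRoots_add_unif, ← map_constantCoeff_lineExpansion]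
  exact (allBranches_of_leadingCoeff (hF.mul_ne_zero hd)
    (leadingCoeff_lineExpansion (hF.mul_ne_zero hd) hF.leadingCoeff_pderiv b)).2.2

theorem _root_.PuiseuxField.eval₂_add_unif {κ : PuiseuxField} (hκ : κ ∈ integers) (b : ℂ)
    (h : MvPolynomial (Fin 2) ℂ) :
    eval₂ (HahnSeries.C b + unif) κ h ∈ integers ∧
      (eval₂ (HahnSeries.C b + unif) κ h).coeff 0 = evalP h (b, κ.coeff 0) := by
  have := eval₂_mem_integers hκ (lineExpansion b h)
  rwa [eval₂_lineExpansion, map_constantCoeff_lineExpansion, eval_map_evalRingHom] at this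

theorem evalP_coeff_zero (hF : IsRegularInY F d ℓ) (hd : d ≠ 0) {b : ℂ}
    {κ : PuiseuxField} (hκ : κ ∈ curveRoots (pderiv 1 F) (HahnSeries.C b + unif)) :
    evalP (pderiv 1 F) (b, κ.coeff 0) = 0 := by
  have h1 := Multiset.mem_map_of_mem (fun κ => κ.coeff 0) hκ
  rw [hF.map_coeff_zero_curveRoots hd, Polynomial.mem_roots (hF.map_evalRingHom_ne_zero hd b),
    Polynomial.IsRoot.def, eval_map_evalRingHom] at h1
  exact h1

open scoped Classical in
theorem muLoc_eq_sum {f : MvPolynomial (Fin 2) ℂ} {a : ℂ}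
    (hF : IsRegularInY (shear a f) d ℓ) (hd : d ≠ 0)
    (hg : ∀ b, ∀ κ ∈ curveRoots (pderiv 1 (shear a f)) (HahnSeries.C b + unif),
      eval₂ (HahnSeries.C b + unif) κ (pderiv 0 (shear a f)) ≠ 0) (b y : ℂ) :
    (muLoc f (b + a * y, y) : ℚ) =
      (((curveRoots (pderiv 1 (shear a f)) (HahnSeries.C b + unif)).filter
        fun κ => κ.coeff 0 = y).map fun κ =>
          (eval₂ (HahnSeries.C b + unif) κ (pderiv 0 (shear a f))).order).sum := by
  rw [muLoc_eq, finrank_quotient_span_pair_shiftU]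
  · simp only [eval₂_lineExpansion]
    rw [← curveRoots_add_unif]
    congr 2
    apply Multiset.filter_congr
    intro κ hκ
    exact orderTop_sub_C_pos_iff (hF.mem_integers_of_mem_curveRoots hd hκ) y
  · rw [map_constantCoeff_lineExpansion]
    exact hF.map_evalRingHom_ne_zero hd b
  · intro κ hκ _
    rw [eval₂_lineExpansion]
    rw [← curveRoots_add_unif] at hκ
    exact hg b κ hκ

open scoped Classical in
/-- The total Milnor number is computed by the branches at infinity of the polar curve. -/
theorem sum_muLoc {f : MvPolynomial (Fin 2) ℂ} {a : ℂ}
    (hF : IsRegularInY (shear a f) d ℓ) (hd : d ≠ 0) (hcrit : (critPts f).Finite)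
    (hg : ∀ y ∈ curveRoots (pderiv 1 (shear a f)) unif⁻¹,
      eval₂ unif⁻¹ y (pderiv 0 (shear a f)) ≠ 0) :
    (∑ q ∈ hcrit.toFinset, (muLoc f q : ℚ)) =
      -((curveRoots (pderiv 1 (shear a f)) unif⁻¹).map fun y =>
        (eval₂ unif⁻¹ y (pderiv 0 (shear a f))).order).sum := by
  obtain ⟨hfin, B, hB, hsum⟩ := hF.product_formula hd _ hg
  rw [← hsum B subset_rfl]
  set Y := hcrit.toFinset.image Prod.snd with hY
  have hcoeff : ∀ b, ∀ κ ∈ curveRoots (pderiv 1 (shear a f)) (HahnSeries.C b + unif),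
      (b + a * κ.coeff 0, κ.coeff 0) ∉ critPts f →
        (eval₂ (HahnSeries.C b + unif) κ (pderiv 0 (shear a f))).order = 0 := by
    intro b κ hκ hc
    have hi := eval₂_add_unif (hF.mem_integers_of_mem_curveRoots hd hκ) b (pderiv 0 (shear a f))
    apply order_eq_zero_of_coeff_zero_ne hi.1
    rw [hi.2]
    intro h0
    exact hc ((mem_critPts_iff_shear f a b _).2 ⟨h0, hF.evalP_coeff_zero hd hκ⟩)
  have h1 : ∀ b ∈ B, ((curveRoots (pderiv 1 (shear a f)) (HahnSeries.C b + unif)).map fun κ =>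
      (eval₂ (HahnSeries.C b + unif) κ (pderiv 0 (shear a f))).order).sum =
        ∑ y ∈ Y, (muLoc f (b + a * y, y) : ℚ) := by
    intro b _
    simp only [hF.muLoc_eq_sum hd hfin]
    rw [Multiset.sum_fiberwise_of_forall_notMem]
    intro κ hκ hκY
    apply hcoeff b κ hκ
    intro hc
    exact hκY (Finset.mem_image_of_mem Prod.snd (hcrit.mem_toFinset.2 hc))
  rw [Finset.sum_congr rfl h1, ← Finset.sum_product']
  let e : ℂ × ℂ → ℂ × ℂ := fun q => (q.1 - a * q.2, q.2)
  have he : ∀ q : ℂ × ℂ, ((e q).1 + a * (e q).2, (e q).2) = q := by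
    intro q
    ext <;> simp [e]
  have hinj : Function.Injective e := fun q q' h => by rw [← he q, ← he q', h]
  have h2 : ∑ p ∈ hcrit.toFinset.image e, (muLoc f (p.1 + a * p.2, p.2) : ℚ) =
      ∑ q ∈ hcrit.toFinset, (muLoc f q : ℚ) := by
    rw [Finset.sum_image fun q _ q' _ h => hinj h]
    simp only [he]
  rw [← h2]
  apply Finset.sum_subset
  · intro p hp
    obtain ⟨q, hq, rfl⟩ := Finset.mem_image.1 hp
    rw [hcrit.mem_toFinset] at hq
    refine Finset.mem_product.2 ⟨?_, Finset.mem_image.2 ⟨q, hcrit.mem_toFinset.2 hq, rfl⟩⟩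
    by_contra hb
    rw [← he q, mem_critPts_iff_shear] at hq
    exact hB _ hb _ hq.2 hq.1
  · intro p _ hp
    rw [hF.muLoc_eq_sum hd hfin]
    apply Multiset.sum_eq_zero
    intro x hx
    obtain ⟨κ, hκ, rfl⟩ := Multiset.mem_map.1 hx
    rw [Multiset.mem_filter] at hκ
    apply hcoeff _ κ hκ.1
    intro hc
    apply hp
    refine Finset.mem_image.2 ⟨_, hcrit.mem_toFinset.2 hc, ?_⟩
    ext <;> simp [e, hκ.2]

end IsRegularInY

end PuiseuxField

open scoped Classical in
theorem Polynomial.card_filter_roots_derivative {G : Polynomial ℂ} (hG : G.natDegree ≠ 0) :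
    (G.derivative.roots.filter fun p => G.eval p = 0).card + G.roots.toFinset.card =
      G.natDegree := by
  have hG0 : G ≠ 0 := by rintro rfl; simp at hG
  have hG' : G.derivative ≠ 0 := fun h => hG (Polynomial.derivative_eq_zero.1 h)
  have h1 : (G.derivative.roots.filter fun p => G.eval p = 0).card =
      ∑ p ∈ G.roots.toFinset, G.derivative.roots.count p := by
    rw [← Multiset.sum_count_eq_card (s := G.roots.toFinset)]
    · refine Finset.sum_congr rfl fun p hp => ?_
      rw [Multiset.mem_toFinset, Polynomial.mem_roots hG0] at hp
      exact Multiset.count_filter_of_pos hp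
    · intro p hp
      rw [Multiset.mem_filter] at hp
      rw [Multiset.mem_toFinset, Polynomial.mem_roots hG0]
      exact hp.2
  rw [h1, Finset.card_eq_sum_ones, ← Finset.sum_add_distrib,
    ← (Polynomial.splits_iff_card_roots.1 (IsAlgClosed.splits G)),
    ← Multiset.toFinset_sum_count_eq]
  refine Finset.sum_congr rfl fun p hp => ?_
  rw [Multiset.mem_toFinset] at hp
  have hr := Polynomial.isRoot_of_mem_roots hp
  rw [Polynomial.count_roots, Polynomial.count_roots,
    Polynomial.derivative_rootMultiplicity_of_root hr]
  have := (Polynomial.rootMultiplicity_pos hG0).2 hr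
  omega

open scoped Classical in
theorem Multiset.sum_map_ite_one {α : Type*} (s : Multiset α) (p : α → Prop) :
    (s.map fun a => if p a then (1 : ℚ) else 0).sum = ((s.filter p).card : ℚ) := by
  induction s using Multiset.induction_on with
  | empty => simp
  | cons a s ih =>
    rw [Multiset.map_cons, Multiset.sum_cons, ih]
    by_cases h : p a
    · rw [if_pos h, Multiset.filter_cons_of_pos s h, Multiset.card_cons, Nat.cast_add, add_comm,
        Nat.cast_one]
    · rw [if_neg h, Multiset.filter_cons_of_neg s h, zero_add]

namespace PuiseuxField

theorem euler_unif_inv : euler unif⁻¹ = -unif⁻¹ := by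
  ext q
  rw [coeff_euler, unif, HahnSeries.inv_single, HahnSeries.coeff_neg, HahnSeries.coeff_single]
  split_ifs with hq <;> simp [hq]

namespace IsRegularInY

variable {F : MvPolynomial (Fin 2) ℂ} {d : ℕ} {ℓ : ℂ}

theorem eval₂_pderiv_one_of_mem {x κ : PuiseuxField} (hκ : κ ∈ curveRoots (pderiv 1 F) x) :
    eval₂ x κ (pderiv 1 F) = 0 := by
  rw [← eval_map_place]
  exact Polynomial.isRoot_of_mem_roots hκ

open scoped Classical in
theorem order_sub_C_add_unif (hF : IsRegularInY F d ℓ) (hd : d ≠ 0) {t b : ℂ}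
    (ht : ∀ b y, evalP F (b, y) = t → evalP (pderiv 1 F) (b, y) = 0 →
      evalP (pderiv 0 F) (b, y) ≠ 0) {κ : PuiseuxField}
    (hκ : κ ∈ curveRoots (pderiv 1 F) (HahnSeries.C b + unif)) :
    (eval₂ (HahnSeries.C b + unif) κ (F - C t)).order =
      if evalP F (b, κ.coeff 0) = t then 1 else 0 := by
  have hi := hF.mem_integers_of_mem_curveRoots hd hκ
  have h1 := eval₂_add_unif hi b F
  have h2 := eval₂_add_unif hi b (F - C t)
  have h3 := eval₂_add_unif hi b (pderiv 0 F)
  split_ifs with h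
  · apply (order_eq_of_orderTop (q := 1) _).2
    rw [map_sub, eval₂_C, ← h, ← h1.2, ← orderTop_euler, euler_eval₂,
      eval₂_pderiv_one_of_mem hκ, zero_mul, add_zero, map_add, euler_C, euler_unif, zero_add,
      HahnSeries.orderTop_mul, orderTop_eq_zero_of_coeff_zero_ne h3.1, zero_add, unif,
      HahnSeries.orderTop_single one_ne_zero]
    rw [h3.2]
    exact ht b _ h (hF.evalP_coeff_zero hd hκ)
  · apply order_eq_zero_of_coeff_zero_ne h2.1
    rw [h2.2]
    simpa [evalP, sub_eq_zero] using h

open scoped Classical in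
theorem sum_order_sub_C (hF : IsRegularInY F d ℓ) (hd : d ≠ 0) {t : ℂ}
    (ht : ∀ b y, evalP F (b, y) = t → evalP (pderiv 1 F) (b, y) = 0 →
      evalP (pderiv 0 F) (b, y) ≠ 0) (b : ℂ) :
    ((curveRoots (pderiv 1 F) (HahnSeries.C b + unif)).map fun κ =>
      (eval₂ (HahnSeries.C b + unif) κ (F - C t)).order).sum +
      (((toBiv (F - C t)).map (Polynomial.evalRingHom b)).roots.toFinset.card : ℚ) = d := by
  set G := (toBiv (F - C t)).map (Polynomial.evalRingHom b) with hG
  have hev : ∀ y, G.eval y = evalP F (b, y) - t := by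
    intro y
    rw [hG, eval_map_evalRingHom]
    simp [evalP]
  have hGF : G = (toBiv F).map (Polynomial.evalRingHom b) - Polynomial.C t := by
    rw [hG]
    simp
  have hdeg : G.natDegree = d := by
    rw [hGF, Polynomial.natDegree_sub_C, Polynomial.natDegree_map_of_leadingCoeff_ne_zero,
      hF.natDegree_eq]
    rw [hF.leadingCoeff_eq]
    simpa using hF.ne_zero
  have hder : G.derivative.roots =
      (curveRoots (pderiv 1 F) (HahnSeries.C b + unif)).map (fun κ => κ.coeff 0) := by
    rw [hF.map_coeff_zero_curveRoots hd, hGF, Polynomial.derivative_sub, Polynomial.derivative_C,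
      sub_zero, Polynomial.derivative_map, derivative_toBiv]
  have hc := Polynomial.card_filter_roots_derivative (G := G) (by rw [hdeg]; exact hd)
  rw [hder, Multiset.filter_map, Multiset.card_map, hdeg] at hc
  rw [← hc, Nat.cast_add]
  congr 1
  rw [Multiset.map_congr rfl fun κ hκ => hF.order_sub_C_add_unif hd ht hκ]
  simp only [Function.comp_def, hev, sub_eq_zero]
  exact Multiset.sum_map_ite_one _ _

end IsRegularInY

/-- The order of the nonconstant part of the restriction of `F` to the branch `y` at infinity. -/
def ordNonconst (F : MvPolynomial (Fin 2) ℂ) (y : PuiseuxField) : ℚ :=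
  (eval₂ unif⁻¹ y F - HahnSeries.C ((eval₂ unif⁻¹ y F).coeff 0)).order

section

variable {F : MvPolynomial (Fin 2) ℂ} {y : PuiseuxField}

theorem orderTop_nonconst (hy : y ∈ curveRoots (pderiv 1 F) unif⁻¹)
    (hg : eval₂ unif⁻¹ y (pderiv 0 F) ≠ 0) :
    (eval₂ unif⁻¹ y F - HahnSeries.C ((eval₂ unif⁻¹ y F).coeff 0)).orderTop =
      (((eval₂ unif⁻¹ y (pderiv 0 F)).order - 1 : ℚ) : WithTop ℚ) := by
  rw [← orderTop_euler, euler_eval₂, IsRegularInY.eval₂_pderiv_one_of_mem hy, zero_mul, add_zero,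
    euler_unif_inv, HahnSeries.orderTop_mul, HahnSeries.orderTop_neg, orderTop_unif_inv,
    ← HahnSeries.order_eq_orderTop_of_ne_zero hg, sub_eq_add_neg]
  rfl

theorem order_pderiv_zero_eq (hy : y ∈ curveRoots (pderiv 1 F) unif⁻¹)
    (hg : eval₂ unif⁻¹ y (pderiv 0 F) ≠ 0) :
    (eval₂ unif⁻¹ y (pderiv 0 F)).order = ordNonconst F y + 1 := by
  rw [ordNonconst, (order_eq_of_orderTop (orderTop_nonconst hy hg)).2]
  ring

theorem orderTop_nonconst_eq (hy : y ∈ curveRoots (pderiv 1 F) unif⁻¹)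
    (hg : eval₂ unif⁻¹ y (pderiv 0 F) ≠ 0) :
    (eval₂ unif⁻¹ y F - HahnSeries.C ((eval₂ unif⁻¹ y F).coeff 0)).orderTop =
      (ordNonconst F y : WithTop ℚ) := by
  have h := orderTop_nonconst hy hg
  rw [h, ordNonconst, (order_eq_of_orderTop h).2]

open scoped Classical in
theorem order_sub_C (hy : y ∈ curveRoots (pderiv 1 F) unif⁻¹)
    (hg : eval₂ unif⁻¹ y (pderiv 0 F) ≠ 0) (c : ℂ) :
    eval₂ unif⁻¹ y F - HahnSeries.C c ≠ 0 ∧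
    (eval₂ unif⁻¹ y F - HahnSeries.C c).order = min (ordNonconst F y) 0 +
      if c = (eval₂ unif⁻¹ y F).coeff 0 then max (ordNonconst F y) 0 else 0 := by
  have h := orderTop_nonconst_eq hy hg
  set w := eval₂ unif⁻¹ y F with hw
  split_ifs with hc
  · subst hc
    rw [min_add_max, add_zero]
    exact order_eq_of_orderTop h
  · apply order_eq_of_orderTop
    have hne : w.coeff 0 - c ≠ 0 := sub_ne_zero.2 (Ne.symm hc)
    have hsum : w - HahnSeries.C c = (w - HahnSeries.C (w.coeff 0)) +
        HahnSeries.C (w.coeff 0 - c) := by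
      rw [map_sub]; ring
    have hC : (HahnSeries.C (w.coeff 0 - c) : PuiseuxField).orderTop = 0 := by
      rw [HahnSeries.C_apply, HahnSeries.orderTop_single hne]; rfl
    have h0 : ordNonconst F y ≠ 0 := by
      intro h0
      have h1 := HahnSeries.coeff_order_eq_zero
        (x := w - HahnSeries.C (w.coeff 0))
      have h2 : (w - HahnSeries.C (w.coeff 0)).order = 0 := h0
      rw [h2] at h1
      exact (order_eq_of_orderTop h).1 (h1.1 (by simp))
    rw [hsum, add_zero]
    rcases lt_or_gt_of_ne h0 with hlt | hgt
    · rw [HahnSeries.orderTop_add_eq_left, h, min_eq_left hlt.le]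
      rw [h, hC]
      exact_mod_cast hlt
    · rw [HahnSeries.orderTop_add_eq_right, hC, min_eq_right hgt.le]
      · rfl
      · rw [h, hC]
        exact_mod_cast hgt

end

open scoped Classical in
/-- The branching of the projection of a generic fibre to the `x`-axis. -/
theorem IsRegularInY.exists_branch_finset {F : MvPolynomial (Fin 2) ℂ} {d : ℕ} {ℓ : ℂ}
    (hF : IsRegularInY F d ℓ) (hd : d ≠ 0) {t : ℂ}
    (hg : ∀ y ∈ curveRoots (pderiv 1 F) unif⁻¹, eval₂ unif⁻¹ y (pderiv 0 F) ≠ 0)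
    (ht : ∀ b y, evalP F (b, y) = t → evalP (pderiv 1 F) (b, y) = 0 →
      evalP (pderiv 0 F) (b, y) ≠ 0)
    (ht' : ∀ y ∈ curveRoots (pderiv 1 F) unif⁻¹, t ≠ (eval₂ unif⁻¹ y F).coeff 0) :
    ∃ B : Finset ℂ, B.Nonempty ∧
      (∀ b ∉ B, ∀ y, evalP F (b, y) = t → evalP (pderiv 1 F) (b, y) ≠ 0) ∧
      ∑ b ∈ B, ((d : ℚ) - (((toBiv (F - C t)).map
        (Polynomial.evalRingHom b)).roots.toFinset.card : ℚ)) =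
          -((curveRoots (pderiv 1 F) unif⁻¹).map fun y => min (ordNonconst F y) 0).sum := by
  obtain ⟨_, B, hB, hsum⟩ := hF.product_formula hd (F - C t) fun y hy => by
    rw [map_sub, eval₂_C]
    exact (order_sub_C hy (hg y hy) t).1
  refine ⟨insert 0 B, Finset.insert_nonempty _ _, ?_, ?_⟩
  · intro b hb y hy hy'
    apply hB b (fun h => hb (Finset.mem_insert_of_mem h)) y hy'
    simp [evalP] at hy ⊢
    rw [hy, sub_self]
  · have h1 := hsum (insert 0 B) (Finset.subset_insert _ _)
    rw [Finset.sum_congr rfl fun b _ => (eq_sub_of_add_eq (hF.sum_order_sub_C hd ht b))] at h1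
    rw [h1]
    congr 2
    apply Multiset.map_congr rfl
    intro y hy
    rw [map_sub, eval₂_C, (order_sub_C hy (hg y hy) t).2, if_neg (ht' y hy), add_zero]

end PuiseuxField

theorem sum_homogeneousComponent_of_le {p : MvPolynomial (Fin 2) ℂ} {d : ℕ}
    (hp : p.totalDegree ≤ d) : ∑ i ∈ Finset.range (d + 1), homogeneousComponent i p = p := by
  conv_rhs => rw [← sum_homogeneousComponent p]
  symm
  apply Finset.sum_subset (Finset.range_mono (Nat.succ_le_succ hp))
  intro i _ hi
  apply homogeneousComponent_eq_zero
  simpa using hi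

theorem isHomogeneous_linSubst {p : MvPolynomial (Fin 2) ℂ} {n : ℕ} (hp : p.IsHomogeneous n)
    (α β : ℂ × ℂ) : (linSubst α β p).IsHomogeneous n := by
  have h : ∀ i, ((![C α.1 * X 0 + C β.1 * X 1, C α.2 * X 0 + C β.2 * X 1] :
      Fin 2 → MvPolynomial (Fin 2) ℂ) i).IsHomogeneous 1 := by
    intro i
    fin_cases i <;>
    · refine IsHomogeneous.add ?_ ?_ <;>
        simpa using (isHomogeneous_C (Fin 2) _).mul (isHomogeneous_X ℂ _)
  have := hp.aeval _ h
  rwa [one_mul] at this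

theorem homogeneousComponent_linSubst (α β : ℂ × ℂ) {p : MvPolynomial (Fin 2) ℂ} {d : ℕ}
    (hp : p.totalDegree ≤ d) :
    homogeneousComponent d (linSubst α β p) = linSubst α β (homogeneousComponent d p) := by
  conv_lhs => rw [← sum_homogeneousComponent_of_le hp]
  rw [map_sum, map_sum, Finset.sum_eq_single d]
  · rw [homogeneousComponent_of_mem (isHomogeneous_linSubst
      (homogeneousComponent_isHomogeneous d p) α β), if_pos rfl]
  · intro i _ hi
    rw [homogeneousComponent_of_mem (isHomogeneous_linSubst
      (homogeneousComponent_isHomogeneous i p) α β), if_neg (Ne.symm hi)]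
  · simp

theorem totalDegree_linSubst_le (α β : ℂ × ℂ) {p : MvPolynomial (Fin 2) ℂ} {d : ℕ}
    (hp : p.totalDegree ≤ d) : (linSubst α β p).totalDegree ≤ d := by
  conv_lhs => rw [← sum_homogeneousComponent_of_le hp]
  rw [map_sum]
  refine (totalDegree_finsetSum _ _).trans (Finset.sup_le fun i hi => ?_)
  exact (isHomogeneous_linSubst (homogeneousComponent_isHomogeneous i p) α β).totalDegree_le.trans
    (by simpa [Nat.lt_succ_iff] using hi)

namespace PuiseuxField

theorem toBiv_monomial (m : Fin 2 →₀ ℕ) (c : ℂ) :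
    toBiv (monomial m c) =
      Polynomial.C (Polynomial.C c * Polynomial.X ^ m 0) * Polynomial.X ^ m 1 := by
  rw [monomial_eq, Finsupp.prod_fintype _ _ (fun _ => pow_zero _), Fin.prod_univ_two, map_mul,
    map_mul, map_pow, map_pow]
  simp [mul_assoc]

theorem toBiv_coeff_degree {p : MvPolynomial (Fin 2) ℂ} {d : ℕ} (hp : p.totalDegree ≤ d) :
    (toBiv p).natDegree ≤ d ∧
      (toBiv p).coeff d = Polynomial.C (evalP (homogeneousComponent d p) (0, 1)) := by
  rw [p.as_sum, map_sum, map_sum, evalP, map_sum, map_sum, Polynomial.finsetSum_coeff]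
  have hm : ∀ m ∈ p.support, (toBiv (monomial m (coeff m p))).natDegree ≤ d ∧
      (toBiv (monomial m (coeff m p))).coeff d =
        Polynomial.C (evalP (homogeneousComponent d (monomial m (coeff m p))) (0, 1)) := by
    intro m hm
    have h := degree_le_of_mem_support hp hm
    rw [toBiv_monomial]
    constructor
    · refine (Polynomial.natDegree_C_mul_X_pow_le _ _).trans (by omega)
    · have h1 : (monomial m (coeff m p)).IsHomogeneous (m 0 + m 1) := by
        apply isHomogeneous_monomial
        simp [Finsupp.degree_eq_sum]
      rw [homogeneousComponent_of_mem h1, Polynomial.coeff_C_mul_X_pow]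
      have h2 : evalP (monomial m (coeff m p)) (0, 1) = coeff m p * 0 ^ m 0 := by
        rw [evalP, eval_monomial, Finsupp.prod_fintype _ _ (fun _ => pow_zero _)]
        simp
      split_ifs with h3 h4 h4
      · rw [h2]
        have : m 0 = 0 := by omega
        simp [this]
      · exfalso; omega
      · have : m 0 ≠ 0 := by omega
        rw [h2]; simp [this]
      · simp [evalP]
  exact ⟨Polynomial.natDegree_sum_le_of_forall_le _ _ fun m h => (hm m h).1,
    Finset.sum_congr rfl fun m h => (hm m h).2⟩

theorem isRegularInY_shear {f : MvPolynomial (Fin 2) ℂ} {d : ℕ} (hf : f.totalDegree ≤ d) {a : ℂ}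
    (ha : evalP (homogeneousComponent d f) (a, 1) ≠ 0) :
    IsRegularInY (shear a f) d (evalP (homogeneousComponent d f) (a, 1)) := by
  have hF := totalDegree_linSubst_le (1, 0) (a, 1) hf
  have h := toBiv_coeff_degree hF
  rw [homogeneousComponent_linSubst _ _ hf, evalP_linSubst] at h
  simp only [zero_mul, one_mul, zero_add] at h
  have hd : (toBiv (shear a f)).natDegree = d := by
    apply le_antisymm h.1
    apply Polynomial.le_natDegree_of_ne_zero
    rw [h.2]
    simpa using ha
  exact ⟨hF, ha, hd, by rw [Polynomial.leadingCoeff, hd, h.2]⟩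

theorem eval_map_constantCoeff_gLin {F : MvPolynomial (Fin 2) ℂ} {d : ℕ} (hF : F.totalDegree ≤ d)
    (u : ℂ) :
    ((toPolynomialPowerSeries (gLin d F)).map (PowerSeries.constantCoeff (R := ℂ))).eval u =
      evalP (homogeneousComponent d F) (1, u) := by
  conv_lhs => rw [← sum_homogeneousComponent_of_le hF]
  have key : ∀ p : MvPolynomial (Fin 2) ℂ, ((toPolynomialPowerSeries
      (aeval ![1, (X 0 : MvPolynomial (Fin 2) ℂ)] p)).map
        (PowerSeries.constantCoeff (R := ℂ))).eval u = evalP p (1, u) := by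
    intro p
    have : (((Polynomial.evalRingHom u).comp (Polynomial.mapRingHom
        (PowerSeries.constantCoeff (R := ℂ)))).comp toPolynomialPowerSeries).comp
        (aeval ![1, (X 0 : MvPolynomial (Fin 2) ℂ)] : _ →ₐ[ℂ] _).toRingHom =
        MvPolynomial.eval (fun i : Fin 2 => if i = 0 then 1 else u) := by
      apply MvPolynomial.ringHom_ext
      · intro c; simp [MvPolynomial.algebraMap_eq]
      · intro i; fin_cases i <;> simp
    exact congrArg (fun φ => φ p) this
  rw [map_sum, map_sum, Polynomial.map_sum, Polynomial.eval_finsetSum, Finset.sum_eq_single d]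
  · rw [gLin_of_isHomogeneous (homogeneousComponent_isHomogeneous d F), Nat.sub_self, pow_zero,
      mul_one, key]
  · intro i hi hid
    rw [gLin_of_isHomogeneous (homogeneousComponent_isHomogeneous i F)]
    have : d - i ≠ 0 := by
      have := Finset.mem_range.1 hi
      omega
    simp [this]
  · simp

end PuiseuxField

open scoped Classical in
theorem Multiset.sum_map_ite_eq_sum_filter {α : Type*} (s : Multiset α) (p : α → Prop)
    (w : α → ℚ) : (s.map fun a => if p a then w a else 0).sum = ((s.filter p).map w).sum := by
  induction s using Multiset.induction_on with
  | empty => simp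
  | cons a s ih =>
    rw [Multiset.map_cons, Multiset.sum_cons, ih]
    by_cases h : p a
    · rw [if_pos h, Multiset.filter_cons_of_pos s h, Multiset.map_cons, Multiset.sum_cons]
    · rw [if_neg h, Multiset.filter_cons_of_neg s h, zero_add]

open scoped Classical in
/-- The sum of the jumps of a function that differs from a constant by point contributions. -/
theorem finsum_sub_generic {K : Type*} (s : Multiset K) (p : K → ℂ) (w : K → ℚ) (A : ℚ)
    (ν : ℂ → ℕ) (hν : ∀ c, (ν c : ℚ) = A + ((s.filter fun κ => p κ = c).map w).sum) {g : ℕ}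
    (hg : ∃ S : Set ℂ, S.Finite ∧ ∀ t ∉ S, ν t = g) :
    ((∑ᶠ c, ((ν c : ℤ) - (g : ℤ)) : ℤ) : ℚ) = (s.map w).sum := by
  obtain ⟨S, hS, hSg⟩ := hg
  have hzero : ∀ c ∉ (s.map p).toFinset, ((s.filter fun κ => p κ = c).map w).sum = 0 := by
    intro c hc
    rw [Multiset.filter_eq_nil.2]
    · simp
    · rintro κ hκ rfl
      exact hc (Multiset.mem_toFinset.2 (Multiset.mem_map_of_mem p hκ))
  obtain ⟨t, ht⟩ := (hS.union (s.map p).toFinset.finite_toSet).exists_notMem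
  rw [Set.mem_union, not_or] at ht
  have hA : A = g := by
    have := hν t
    rw [hSg t ht.1, hzero t (by simpa using ht.2), add_zero] at this
    exact this.symm
  have hdiff : ∀ c, (((ν c : ℤ) - (g : ℤ) : ℤ) : ℚ) =
      ((s.filter fun κ => p κ = c).map w).sum := by
    intro c
    push_cast
    rw [hν, hA]
    ring
  rw [finsum_eq_sum_of_support_subset (s := (s.map p).toFinset), Int.cast_sum,
    Finset.sum_congr rfl fun c _ => hdiff c]
  · apply Multiset.sum_fiberwise_of_forall_notMem
    intro κ hκ h
    exact absurd (Multiset.mem_toFinset.2 (Multiset.mem_map_of_mem p hκ)) h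
  · intro c hc
    by_contra h
    apply hc
    have := hdiff c
    rw [hzero c (by simpa using h)] at this
    exact_mod_cast this

namespace PuiseuxField

variable {f : MvPolynomial (Fin 2) ℂ} {d : ℕ} {ℓ : ℂ}

theorem eval₂_gPoly {F : MvPolynomial (Fin 2) ℂ} (hF : F.totalDegree ≤ d) (c : ℂ)
    (y : PuiseuxField) :
    eval₂ (unif * y) unif (gPoly F d c) =
      unif ^ d * (eval₂ unif⁻¹ y F - HahnSeries.C c) := by
  rw [gPoly_eq, map_sub, eval₂_gLin hF, inv_mul_cancel_left₀ unif_ne_zero, map_mul, map_pow,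
    eval₂_C]
  have : eval₂ (unif * y) unif (X 1) = unif := by simp
  rw [this]
  ring

theorem order_eval₂_gPoly {F : MvPolynomial (Fin 2) ℂ} (hF : F.totalDegree ≤ d) (c : ℂ)
    {y : PuiseuxField} (h : eval₂ unif⁻¹ y F - HahnSeries.C c ≠ 0) :
    (eval₂ (unif * y) unif (gPoly F d c)).order =
      d + (eval₂ unif⁻¹ y F - HahnSeries.C c).order := by
  rw [eval₂_gPoly hF, HahnSeries.order_mul (pow_ne_zero _ unif_ne_zero) h, HahnSeries.order_pow,
    order_unif]
  simp

theorem IsRegularInY.mem_integers_mul {F : MvPolynomial (Fin 2) ℂ} (hF : IsRegularInY F d ℓ)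
    (hd : d ≠ 0) {y : PuiseuxField} (hy : y ∈ curveRoots (pderiv 1 F) unif⁻¹) :
    unif * y ∈ integers := by
  apply (allBranches_of_leadingCoeff (hF.mul_ne_zero hd) (hF.leadingCoeff_pderiv_gLin)).2.1
  rw [hF.allBranches_pderiv_gLin]
  exact Multiset.mem_map_of_mem _ hy

open scoped Classical in
theorem finsum_mu_sub (hf : f.totalDegree ≤ d) {a : ℂ} (hF : IsRegularInY (shear a f) d ℓ)
    (hd : d ≠ 0)
    (hg : ∀ y ∈ curveRoots (pderiv 1 (shear a f)) unif⁻¹,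
      eval₂ unif⁻¹ y (pderiv 0 (shear a f)) ≠ 0)
    {m ρ σ τ : ℂ} {α β : ℂ × ℂ} (hρ : ρ ≠ 0) (hτ : τ ≠ 0)
    (hα : ((1, 0) : ℂ × ℂ) + m • ((a, 1) : ℂ × ℂ) = ρ • α)
    (hβ : ((a, 1) : ℂ × ℂ) = τ • β + σ • α)
    (hm : evalP (homogeneousComponent d f) (1 + a * m, m) = 0) {g : ℕ}
    (hadm : IsAdmissible (linSubst α β f) d g) :
    ((∑ᶠ c, ((mu (linSubst α β f) d c : ℤ) - (g : ℤ)) : ℤ) : ℚ) =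
      (((curveRoots (pderiv 1 (shear a f)) unif⁻¹).filter fun y => (unif * y).coeff 0 = m).map
        fun y => max (ordNonconst (shear a f) y) 0).sum := by
  set F := shear a f with hFdef
  set R := (toPolynomialPowerSeries (gLin d F)).map (PowerSeries.constantCoeff (R := ℂ)) with hR
  have hlc := hF.leadingCoeff_gLin
  have hR0 : R ≠ 0 := by
    intro h
    have h1 : R.coeff d = ℓ := by
      have h2 := hlc.2
      rw [Polynomial.leadingCoeff, hlc.1] at h2
      rw [hR, Polynomial.coeff_map, h2]
      simp
    rw [h, Polynomial.coeff_zero] at h1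
    exact hF.ne_zero h1.symm
  have hroot : R.IsRoot m := by
    rw [Polynomial.IsRoot.def, hR, eval_map_constantCoeff_gLin hF.totalDegree_le, hFdef,
      homogeneousComponent_linSubst _ _ hf, evalP_linSubst]
    simpa [mul_comm m a] using hm
  obtain ⟨e, he⟩ : ∃ e, R.rootMultiplicity m = e + 1 :=
    Nat.exists_eq_succ_of_ne_zero ((Polynomial.rootMultiplicity_pos hR0).2 hroot).ne'
  set Y := curveRoots (pderiv 1 F) unif⁻¹ with hY
  have hfilter : ((allBranches (pderiv 0 (gLin d F))).filter fun κ =>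
      0 < (κ - HahnSeries.C m).orderTop) =
      (Y.filter fun y => (unif * y).coeff 0 = m).map fun y => unif * y := by
    rw [hF.allBranches_pderiv_gLin, Multiset.filter_map]
    congr 1
    exact Multiset.filter_congr fun y hy => orderTop_sub_C_pos_iff (hF.mem_integers_mul hd hy) m
  have hmu : ∀ c, (mu (linSubst α β f) d c : ℚ) =
      (((Y.filter fun y => (unif * y).coeff 0 = m).map fun y =>
        (d + min (ordNonconst F y) 0 : ℚ)).sum - e) +
      (((Y.filter fun y => (unif * y).coeff 0 = m).filter fun y =>
        (eval₂ unif⁻¹ y F).coeff 0 = c).map fun y => max (ordNonconst F y) 0).sum := by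
    intro c
    rw [mu_linSubst_eq hd hf hρ hτ hα hβ hR0 he, hfilter, Multiset.map_map,
      ← Multiset.sum_map_ite_eq_sum_filter _ (fun y => (eval₂ unif⁻¹ y F).coeff 0 = c),
          sub_add_eq_add_sub, ← Multiset.sum_map_add]
    · congr 2
      apply Multiset.map_congr rfl
      intro y hy
      have hy' := (Multiset.mem_filter.1 hy).1
      have := order_sub_C hy' (hg y hy') c
      rw [Function.comp_apply, order_eval₂_gPoly hF.totalDegree_le c this.1, this.2, add_assoc]
      congr 2
      exact if_congr eq_comm rfl rfl
    · intro κ hκ _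
      change κ ∈ allBranches (pderiv 0 (gLin d F)) at hκ
      rw [hF.allBranches_pderiv_gLin] at hκ
      obtain ⟨y, hy, rfl⟩ := Multiset.mem_map.1 hκ
      change eval₂ (unif * y) unif (gPoly F d c) ≠ 0
      rw [eval₂_gPoly hF.totalDegree_le]
      exact _root_.mul_ne_zero (pow_ne_zero _ unif_ne_zero) (order_sub_C hy (hg y hy) c).1
  exact finsum_sub_generic _ _ _ _ _ hmu hadm.2

end PuiseuxField

theorem evalP_smul_of_isHomogeneous {p : MvPolynomial (Fin 2) ℂ} {n : ℕ} (hp : p.IsHomogeneous n)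
    (r x y : ℂ) : evalP p (r * x, r * y) = r ^ n * evalP p (x, y) := by
  rw [evalP, evalP, p.as_sum, map_sum, map_sum, Finset.mul_sum]
  refine Finset.sum_congr rfl fun m hm => ?_
  have h1 : m 0 + m 1 = n := by
    have := hp (mem_support_iff.1 hm)
    rwa [Finsupp.weight_apply, Finsupp.sum_fintype _ _ (fun _ => by simp), Fin.sum_univ_two,
      Pi.one_apply, Pi.one_apply, smul_eq_mul, smul_eq_mul, mul_one, mul_one] at this
  rw [eval_monomial, eval_monomial, Finsupp.prod_fintype _ _ (fun _ => pow_zero _),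
    Finsupp.prod_fintype _ _ (fun _ => pow_zero _), Fin.prod_univ_two, Fin.prod_univ_two, ← h1]
  simp [mul_pow, pow_add]
  ring

namespace PuiseuxField

variable {f : MvPolynomial (Fin 2) ℂ} {d : ℕ} {ℓ : ℂ}

theorem IsRegularInY.max_ordNonconst_eq_zero {F : MvPolynomial (Fin 2) ℂ}
    (hF : IsRegularInY F d ℓ) (hd : d ≠ 0) {y : PuiseuxField}
    (hy : y ∈ curveRoots (pderiv 1 F) unif⁻¹) (hg : eval₂ unif⁻¹ y (pderiv 0 F) ≠ 0)
    (hm : evalP (homogeneousComponent d F) (1, (unif * y).coeff 0) ≠ 0) :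
    max (ordNonconst F y) 0 = 0 := by
  set c := (eval₂ unif⁻¹ y F).coeff 0 with hc
  have h1 := order_eval₂_gPoly hF.totalDegree_le c (order_sub_C hy hg c).1
  have h2 := eval₂_mem_integers (hF.mem_integers_mul hd hy) (gPoly F d c)
  rw [order_eq_zero_of_coeff_zero_ne h2.1] at h1
  · have h3 : (0 : ℚ) = d + ordNonconst F y := h1
    have : (0 : ℚ) ≤ d := Nat.cast_nonneg d
    apply max_eq_right
    linarith
  · rwa [h2.2, map_constantCoeff_gPoly F hd, eval_map_constantCoeff_gLin hF.totalDegree_le]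

open scoped Classical in
/-- The total jump of the Milnor numbers at infinity. -/
theorem sum_jumps (hf : f.totalDegree ≤ d) {a : ℂ}
    (ha : evalP (homogeneousComponent d f) (a, 1) ≠ 0) (hd : d ≠ 0)
    (hg : ∀ y ∈ curveRoots (pderiv 1 (shear a f)) unif⁻¹,
      eval₂ unif⁻¹ y (pderiv 0 (shear a f)) ≠ 0)
    {μm : ℂ → ℕ}
    (hadm : ∀ m : ℂ, evalP (homogeneousComponent d f) (1, m) = 0 →
      IsAdmissible (fSlope f m) d (μm m))
    {μs : ℕ}
    (hadms : evalP (homogeneousComponent d f) (0, 1) = 0 → IsAdmissible (fSwap f) d μs) :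
    (((∑ᶠ m ∈ {m : ℂ | evalP (homogeneousComponent d f) (1, m) = 0},
        ∑ᶠ c : ℂ, ((mu (fSlope f m) d c : ℤ) - (μm m : ℤ)))
      + if evalP (homogeneousComponent d f) (0, 1) = 0
        then ∑ᶠ c : ℂ, ((mu (fSwap f) d c : ℤ) - (μs : ℤ)) else 0 : ℤ) : ℚ) =
      ((curveRoots (pderiv 1 (shear a f)) unif⁻¹).map fun y =>
        max (ordNonconst (shear a f) y) 0).sum := by
  have hF := isRegularInY_shear hf ha
  set p := homogeneousComponent d f with hp
  have hsm := evalP_smul_of_isHomogeneous (homogeneousComponent_isHomogeneous d f)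
  rw [← hp] at hsm
  set Y := curveRoots (pderiv 1 (shear a f)) unif⁻¹ with hY
  set Λ : ℂ → ℚ := fun m' => ((Y.filter fun y => (unif * y).coeff 0 = m').map
    fun y => max (ordNonconst (shear a f) y) 0).sum with hΛ
  set M := {m : ℂ | evalP p (1, m) = 0} with hM
  set φ : ℂ → ℂ := fun m => m / (1 - a * m) with hφ
  have hden : ∀ m ∈ M, 1 - a * m ≠ 0 := by
    intro m hm h
    have ham : m * a = 1 := by linear_combination -h
    have h1 := hsm m a 1
    rw [ham, mul_one] at h1
    have hm' : evalP p (1, m) = 0 := hm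
    rw [hm'] at h1
    have hm0 : m ≠ 0 := by rintro rfl; simp at ham
    exact _root_.mul_ne_zero (pow_ne_zero d hm0) ha h1.symm
  have hone : ∀ m ∈ M, 1 + a * φ m = 1 / (1 - a * m) := by
    intro m hm
    have := hden m hm
    rw [hφ]
    field_simp
    ring
  have hzero : ∀ m ∈ M, evalP p (1 + a * φ m, φ m) = 0 := by
    intro m hm
    have h1 := hsm (1 / (1 - a * m)) 1 m
    have hm' : evalP p (1, m) = 0 := hm
    rw [hm', mul_zero, mul_one, ← hone m hm] at h1
    rw [← h1, hφ]
    congr 2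
    rw [hone m hm]
    ring
  have hinj : Set.InjOn φ M := by
    intro m hm n hn h
    have h1 := hden m hm
    have h2 := hden n hn
    have h3 : m * (1 - a * n) = n * (1 - a * m) := (div_eq_div_iff h1 h2).1 h
    linear_combination h3
  obtain ⟨Z, hZ⟩ : ∃ Z : Finset ℂ, ∀ m', m' ∈ Z ↔ evalP p (1 + a * m', m') = 0 := by
    set R := (toPolynomialPowerSeries (gLin d (shear a f))).map
      (PowerSeries.constantCoeff (R := ℂ)) with hR
    have hlc := hF.leadingCoeff_gLin
    have hR0 : R ≠ 0 := by
      intro h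
      have h1 : R.coeff d = evalP p (a, 1) := by
        have h2 := hlc.2
        rw [Polynomial.leadingCoeff, hlc.1] at h2
        rw [hR, Polynomial.coeff_map, h2]
        simp
      rw [h, Polynomial.coeff_zero] at h1
      exact ha h1.symm
    refine ⟨R.roots.toFinset, fun m' => ?_⟩
    rw [Multiset.mem_toFinset, Polynomial.mem_roots hR0, Polynomial.IsRoot.def, hR,
      eval_map_constantCoeff_gLin hF.totalDegree_le, homogeneousComponent_linSubst _ _ hf,
      evalP_linSubst]
    simp [mul_comm m' a, hp]
  have hMfin : M.Finite :=
    Set.Finite.of_injOn (fun m hm => (hZ _).2 (hzero m hm)) hinj Z.finite_toSet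
  have hslope : ∀ m ∈ M,
      ((∑ᶠ c : ℂ, ((mu (fSlope f m) d c : ℤ) - (μm m : ℤ)) : ℤ) : ℚ) = Λ (φ m) := by
    intro m hm
    have h1 := hden m hm
    have had := hadm m hm
    rw [fSlope_eq] at had ⊢
    apply finsum_mu_sub hf hF hd hg (m := φ m) (ρ := 1 + a * φ m) (τ := 1 - a * m) (σ := a)
      _ h1 _ _ (hzero m hm) had
    · rw [hone m hm]
      exact one_div_ne_zero h1
    · ext
      · simp [mul_comm]
      · rw [hone m hm]
        simp [hφ]
        ring
    · ext
      · simp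
      · simp
  have hswap : evalP p (0, 1) = 0 → a ≠ 0 ∧
      ((∑ᶠ c : ℂ, ((mu (fSwap f) d c : ℤ) - (μs : ℤ)) : ℤ) : ℚ) = Λ (-(1 / a)) := by
    intro h
    have ha0 : a ≠ 0 := by rintro rfl; exact ha h
    have had := hadms h
    refine ⟨ha0, ?_⟩
    rw [fSwap_eq] at had ⊢
    apply finsum_mu_sub hf hF hd hg (m := -(1 / a)) (ρ := -(1 / a)) (τ := a) (σ := 1)
      _ ha0 _ _ _ had
    · simpa using ha0
    · ext
      · simp [ha0]
      · simp
    · ext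
      · simp
      · simp
    · have h1 := hsm (-(1 / a)) 0 1
      rw [h, mul_zero, mul_zero, mul_one] at h1
      rw [← hp, ← h1]
      congr 2
      field_simp
      ring
  have htotal : ∑ m' ∈ Z, Λ m' = (Y.map fun y => max (ordNonconst (shear a f) y) 0).sum := by
    apply Multiset.sum_fiberwise_of_forall_notMem
    intro y hy hyZ
    apply hF.max_ordNonconst_eq_zero hd hy (hg y hy)
    rw [hZ] at hyZ
    rw [homogeneousComponent_linSubst _ _ hf, evalP_linSubst]
    simpa [mul_comm _ a] using hyZ
  rw [← htotal, Int.cast_add, finsum_mem_eq_finite_toFinset_sum _ hMfin, Int.cast_sum,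
    Finset.sum_congr rfl fun m hm => hslope m (hMfin.mem_toFinset.1 hm),
    ← Finset.sum_image (g := φ) (f := Λ) (by simpa using hinj)]
  have hsub : hMfin.toFinset.image φ ⊆ Z := by
    intro m' hm'
    obtain ⟨m, hm, rfl⟩ := Finset.mem_image.1 hm'
    exact (hZ _).2 (hzero m (hMfin.mem_toFinset.1 hm))
  rw [← Finset.sum_sdiff hsub, add_comm]
  congr 1
  have hmem : ∀ m' ∈ Z, m' ∉ hMfin.toFinset.image φ ↔ 1 + a * m' = 0 := by
    intro m' hm'
    rw [hZ] at hm'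
    constructor
    · intro h
      by_contra hne
      apply h
      refine Finset.mem_image.2 ⟨m' / (1 + a * m'), hMfin.mem_toFinset.2 ?_, ?_⟩
      · have h1 := hsm (1 / (1 + a * m')) (1 + a * m') m'
        rw [hm', mul_zero, one_div_mul_cancel hne] at h1
        rw [hM, Set.mem_ofPred_eq, ← h1]
        congr 2
        ring
      · rw [hφ]
        have : 1 - a * (m' / (1 + a * m')) = 1 / (1 + a * m') := by
          field_simp
          ring
        simp only [this]
        rw [div_div_div_cancel_right₀ hne, div_one]
    · rintro h h1
      obtain ⟨m, hm, rfl⟩ := Finset.mem_image.1 h1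
      rw [hone m (hMfin.mem_toFinset.1 hm)] at h
      exact one_div_ne_zero (hden m (hMfin.mem_toFinset.1 hm)) h
  split_ifs with h
  · obtain ⟨ha0, hs⟩ := hswap h
    rw [hs, eq_comm, Finset.sum_eq_single_of_mem]
    · have h1 : 1 + a * -(1 / a) = 0 := by field_simp; ring
      have h2 : -(1 / a) ∈ Z := by
        rw [hZ, h1]
        have h3 := hsm (-(1 / a)) 0 1
        rwa [h, mul_zero, mul_zero, mul_one] at h3
      rw [Finset.mem_sdiff]
      exact ⟨h2, (hmem _ h2).2 h1⟩
    · intro b hb hne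
      rw [Finset.mem_sdiff] at hb
      have := (hmem b hb.1).1 hb.2
      exfalso
      apply hne
      field_simp
      linear_combination this
  · rw [Int.cast_zero, eq_comm]
    apply Finset.sum_eq_zero
    intro b hb
    rw [Finset.mem_sdiff] at hb
    have h1 := (hmem b hb.1).1 hb.2
    have h2 := (hZ b).1 hb.1
    rw [h1] at h2
    have h3 := hsm b 0 1
    rw [mul_zero, mul_one, h2] at h3
    have hb0 : b ≠ 0 := by rintro rfl; simp at h1
    exact absurd ((mul_eq_zero.1 h3.symm).resolve_left (pow_ne_zero _ hb0)) h

end PuiseuxField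

theorem Polynomial.exists_derivative_eq (q : Polynomial ℂ) :
    ∃ p : Polynomial ℂ, Polynomial.derivative p = q := by
  induction q using Polynomial.induction_on' with
  | add p q hp hq =>
    obtain ⟨a, rfl⟩ := hp
    obtain ⟨b, rfl⟩ := hq
    exact ⟨a + b, Polynomial.derivative_add⟩
  | monomial n c =>
    refine ⟨Polynomial.monomial (n + 1) (c / (n + 1)), ?_⟩
    rw [Polynomial.derivative_monomial, Nat.add_sub_cancel]
    congr 1
    push_cast
    have : (n : ℂ) + 1 ≠ 0 := by exact_mod_cast Nat.succ_ne_zero n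
    field_simp

theorem totalDegree_pderiv_le (i : Fin 2) (p : MvPolynomial (Fin 2) ℂ) :
    (pderiv i p).totalDegree ≤ p.totalDegree := by
  refine Finset.sup_le fun m hm => ?_
  rw [mem_support_iff, coeff_pderiv] at hm
  have h := le_totalDegree (mem_support_iff.2 (left_ne_zero_of_mul hm))
  refine le_trans ?_ h
  rw [Finsupp.sum_add_index' (by simp) (by simp)]
  exact Nat.le_add_right _ _

theorem eq_C_of_pderiv_eq_zero {p : MvPolynomial (Fin 2) ℂ} (h : ∀ i, pderiv i p = 0) :
    ∃ c, p = C c := by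
  refine ⟨coeff 0 p, ?_⟩
  ext m
  rw [coeff_C]
  split_ifs with hm
  · rw [hm]
  · obtain ⟨i, hi⟩ : ∃ i, m i ≠ 0 := by
      by_contra! hall
      exact hm (Finsupp.ext fun i => (hall i).symm)
    have h1 := coeff_pderiv (i := i) p (m - Finsupp.single i 1)
    have h2 : m - Finsupp.single i 1 + Finsupp.single i 1 = m :=
      tsub_add_cancel_of_le (Finsupp.single_le_iff.2 (Nat.one_le_iff_ne_zero.2 hi))
    rw [h i, h2, coeff_zero] at h1
    refine (mul_eq_zero.1 h1.symm).resolve_right ?_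
    exact Nat.cast_add_one_ne_zero _

/-- The Jacobian determinant of two polynomials in the plane. -/
def jac (p q : MvPolynomial (Fin 2) ℂ) : MvPolynomial (Fin 2) ℂ :=
  pderiv 0 p * pderiv 1 q - pderiv 1 p * pderiv 0 q

theorem jac_mul (p q r : MvPolynomial (Fin 2) ℂ) : jac p (q * r) = q * jac p r + r * jac p q := by
  simp only [jac, Derivation.leibniz, smul_eq_mul]
  ring

theorem pderiv_comm (p : MvPolynomial (Fin 2) ℂ) :
    pderiv 1 (pderiv 0 p) = pderiv 0 (pderiv 1 p) := by
  have : ⁅pderiv (R := ℂ) (1 : Fin 2), pderiv (R := ℂ) (0 : Fin 2)⁆ = 0 := by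
    apply MvPolynomial.derivation_ext
    intro i
    fin_cases i <;> simp [Derivation.commutator_apply]
  have h := congrArg (fun D => D p) this
  simpa [Derivation.commutator_apply, sub_eq_zero] using h

theorem pderiv_aeval (i : Fin 2) (p : MvPolynomial (Fin 2) ℂ) (q : Polynomial ℂ) :
    pderiv i (Polynomial.aeval p q) =
      Polynomial.aeval p (Polynomial.derivative q) * pderiv i p := by
  rw [Derivation.map_aeval, smul_eq_mul]

theorem jac_aeval_self (p : MvPolynomial (Fin 2) ℂ) (q : Polynomial ℂ) :
    jac p (Polynomial.aeval p q) = 0 := by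
  rw [jac, pderiv_aeval, pderiv_aeval]
  ring

theorem evalP_aeval (p : MvPolynomial (Fin 2) ℂ) (q : Polynomial ℂ) (z : ℂ × ℂ) :
    evalP (Polynomial.aeval p q) z = q.eval (evalP p z) := by
  rw [evalP, evalP, Polynomial.aeval_def, Polynomial.hom_eval₂]
  have : (MvPolynomial.eval fun i : Fin 2 => if i = 0 then z.1 else z.2).comp
      (algebraMap ℂ (MvPolynomial (Fin 2) ℂ)) = RingHom.id ℂ := by
    ext c; simp [MvPolynomial.algebraMap_eq]
  rw [this]
  rfl

namespace PuiseuxField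

theorem isUnit_leadingCoeff_of_dvd {p r : MvPolynomial (Fin 2) ℂ}
    (hp : IsUnit (toBiv p).leadingCoeff) (h : r ∣ p) : IsUnit (toBiv r).leadingCoeff := by
  obtain ⟨s, rfl⟩ := h
  rw [map_mul, Polynomial.leadingCoeff_mul] at hp
  exact isUnit_of_mul_isUnit_left hp

theorem isUnit_of_natDegree_eq_zero {p : MvPolynomial (Fin 2) ℂ}
    (hp : IsUnit (toBiv p).leadingCoeff) (h : (toBiv p).natDegree = 0) : IsUnit p := by
  rw [Polynomial.leadingCoeff, h] at hp
  have h1 : IsUnit (toBiv p) := by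
    rw [Polynomial.eq_C_of_natDegree_eq_zero h]
    exact Polynomial.isUnit_C.2 hp
  exact (MulEquiv.isUnit_map toBiv).1 h1

theorem exists_evalP_eq_zero {p : MvPolynomial (Fin 2) ℂ}
    (hp : IsUnit (toBiv p).leadingCoeff) (h : ¬ IsUnit p) (b : ℂ) : ∃ z, evalP p (b, z) = 0 := by
  have hdeg : ((toBiv p).map (Polynomial.evalRingHom b)).natDegree = (toBiv p).natDegree :=
    Polynomial.natDegree_map_of_leadingCoeff_ne_zero _ (hp.map _).ne_zero
  obtain ⟨z, hz⟩ := IsAlgClosed.exists_root ((toBiv p).map (Polynomial.evalRingHom b)) (by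
    intro h0
    rw [Polynomial.natDegree_eq_of_degree_eq_some h0] at hdeg
    exact h (isUnit_of_natDegree_eq_zero hp hdeg.symm))
  exact ⟨z, by rwa [Polynomial.IsRoot.def, eval_map_evalRingHom] at hz⟩

theorem evalP_eq_zero_of_dvd {r p : MvPolynomial (Fin 2) ℂ} (h : r ∣ p) {z : ℂ × ℂ}
    (hz : evalP r z = 0) : evalP p z = 0 := by
  obtain ⟨s, rfl⟩ := h
  rw [evalP_mul, hz, zero_mul]

namespace IsRegularInY

variable {F : MvPolynomial (Fin 2) ℂ} {d : ℕ} {ℓ : ℂ}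

theorem isRelPrime_pderiv (hF : IsRegularInY F d ℓ) (hd : d ≠ 0) (hcrit : (critPts F).Finite) :
    IsRelPrime (pderiv 1 F) (pderiv 0 F) := by
  intro r h1 h0
  by_contra hr
  have hu : IsUnit (toBiv r).leadingCoeff := by
    refine isUnit_leadingCoeff_of_dvd ?_ h1
    rw [hF.leadingCoeff_pderiv]
    exact Polynomial.isUnit_C.2 (hF.mul_ne_zero hd).isUnit
  choose z hz using exists_evalP_eq_zero hu hr
  have : Function.Injective fun b : ℂ => (b, z b) := fun b c h => congrArg Prod.fst h
  refine Set.infinite_of_injective_forall_mem this (fun b => ?_) hcrit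
  exact ⟨evalP_eq_zero_of_dvd h0 (hz b), evalP_eq_zero_of_dvd h1 (hz b)⟩

theorem pderiv_one_ne_zero (hF : IsRegularInY F d ℓ) (hd : d ≠ 0) : pderiv 1 F ≠ 0 := by
  intro h
  have := hF.leadingCoeff_pderiv
  rw [h, map_zero, Polynomial.leadingCoeff_zero, eq_comm, Polynomial.C_eq_zero] at this
  exact hF.mul_ne_zero hd this

theorem exists_eq_mul_pderiv (hF : IsRegularInY F d ℓ) (hd : d ≠ 0) (hcrit : (critPts F).Finite)
    {A B : MvPolynomial (Fin 2) ℂ} (h : pderiv 0 F * B = pderiv 1 F * A) :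
    ∃ K, A = K * pderiv 0 F ∧ B = K * pderiv 1 F := by
  obtain ⟨K, rfl⟩ := (hF.isRelPrime_pderiv hd hcrit).dvd_of_dvd_mul_left (Dvd.intro A h.symm)
  refine ⟨K, mul_left_cancel₀ (hF.pderiv_one_ne_zero hd) ?_, mul_comm _ _⟩
  rw [← h]
  ring

/-- The constants of the Hamiltonian derivation of `F` are the polynomials in `F`. -/
theorem exists_eq_aeval_of_jac_eq_zero (hF : IsRegularInY F d ℓ) (hd : d ≠ 0)
    (hcrit : (critPts F).Finite) (N : MvPolynomial (Fin 2) ℂ) (hN : jac F N = 0) :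
    ∃ q : Polynomial ℂ, N = Polynomial.aeval F q := by
  induction hn : (toBiv N).natDegree using Nat.strong_induction_on generalizing N with
  | h n ih =>
  obtain ⟨K, h0, h1⟩ := hF.exists_eq_mul_pderiv hd hcrit (A := pderiv 0 N) (B := pderiv 1 N)
    (sub_eq_zero.1 hN)
  obtain ⟨q, hq⟩ : ∃ q : Polynomial ℂ, K = Polynomial.aeval F q := by
    have hder : Polynomial.derivative (toBiv N) = toBiv K * toBiv (pderiv 1 F) := by
      rw [derivative_toBiv, h1, map_mul]
    have hF0 : toBiv (pderiv 1 F) ≠ 0 := by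
      simpa using hF.pderiv_one_ne_zero hd
    by_cases hK : K = 0
    · exact ⟨0, by rw [hK, map_zero]⟩
    · have hK0 : toBiv K ≠ 0 := by simpa using hK
      have hn0 : (toBiv N).natDegree ≠ 0 := by
        intro h
        rw [Polynomial.derivative_eq_zero.2 h] at hder
        exact _root_.mul_ne_zero hK0 hF0 hder.symm
      refine ih (toBiv K).natDegree ?_ K ?_ rfl
      · have h := Polynomial.natDegree_derivative_lt hn0
        rw [hder, Polynomial.natDegree_mul hK0 hF0, hn] at h
        omega
      · have h := pderiv_comm N
        rw [h0, h1, Derivation.leibniz, Derivation.leibniz, pderiv_comm F] at h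
        simp only [smul_eq_mul] at h
        rw [jac]
        linear_combination h
  obtain ⟨Q, hQ⟩ := Polynomial.exists_derivative_eq q
  obtain ⟨c, hc⟩ := eq_C_of_pderiv_eq_zero (p := N - Polynomial.aeval F Q) (by
    intro i
    rw [map_sub, pderiv_aeval, hQ, ← hq]
    fin_cases i
    · simp [h0]
    · simp [h1])
  refine ⟨Q + Polynomial.C c, ?_⟩
  rw [map_add, Polynomial.aeval_C, MvPolynomial.algebraMap_eq, ← hc]
  ring

end IsRegularInY

end PuiseuxField

section

variable {ι : Type*} [DecidableEq ι] (s : Finset ι) (c : ι → ℂ)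
  (P : ι → MvPolynomial (Fin 2) ℂ)

/-- The components of `∏ P_k · ∑ c_i dP_i / P_i`. -/
def logForm (j : Fin 2) : MvPolynomial (Fin 2) ℂ :=
  ∑ i ∈ s, C (c i) * ((∏ k ∈ s.erase i, P k) * pderiv j (P i))

theorem logForm_closed :
    (∏ k ∈ s, P k) * (pderiv 0 (logForm s c P 1) - pderiv 1 (logForm s c P 0)) =
      pderiv 0 (∏ k ∈ s, P k) * logForm s c P 1 - pderiv 1 (∏ k ∈ s, P k) * logForm s c P 0 := by
  simp only [logForm, map_sum, Finset.mul_sum, ← Finset.sum_sub_distrib]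
  refine Finset.sum_congr rfl fun i hi => ?_
  rw [← Finset.mul_prod_erase s P hi]
  simp only [Derivation.leibniz, smul_eq_mul, pderiv_C, pderiv_comm (P i)]
  ring

theorem wedge_logForm (F : MvPolynomial (Fin 2) ℂ) {g : ι → MvPolynomial (Fin 2) ℂ}
    (hg : ∀ i ∈ s, jac F (P i) = P i * g i) :
    pderiv 0 F * logForm s c P 1 - pderiv 1 F * logForm s c P 0 =
      (∏ k ∈ s, P k) * ∑ i ∈ s, C (c i) * g i := by
  simp only [logForm, Finset.mul_sum, ← Finset.sum_sub_distrib]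
  refine Finset.sum_congr rfl fun i hi => ?_
  rw [← Finset.mul_prod_erase s P hi]
  have := hg i hi
  rw [jac] at this
  linear_combination C (c i) * (∏ k ∈ s.erase i, P k) * this

end

namespace PuiseuxField

theorem degree_toBiv_logForm_lt {ι : Type*} [DecidableEq ι] {s : Finset ι} {c : ι → ℂ}
    {P : ι → MvPolynomial (Fin 2) ℂ} (hP : ∀ i ∈ s, P i ≠ 0) :
    (toBiv (logForm s c P 1)).degree < (toBiv (∏ k ∈ s, P k)).degree := by
  have h0 : toBiv (∏ k ∈ s, P k) ≠ 0 := by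
    rw [ne_eq, EmbeddingLike.map_eq_zero_iff]
    exact Finset.prod_ne_zero_iff.2 hP
  rw [logForm, map_sum]
  refine (Polynomial.degree_sum_le _ _).trans_lt ?_
  rw [Finset.sup_lt_iff (bot_lt_iff_ne_bot.2 (by simpa using h0))]
  intro i hi
  have h1 : toBiv (P i) ≠ 0 := by simpa using hP i hi
  have h2 : toBiv (∏ k ∈ s.erase i, P k) ≠ 0 := by
    rw [ne_eq, EmbeddingLike.map_eq_zero_iff]
    exact Finset.prod_ne_zero_iff.2 fun k hk => hP k (Finset.mem_of_mem_erase hk)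
  rw [← Finset.mul_prod_erase s P hi, map_mul, map_mul, map_mul, Polynomial.degree_mul,
    Polynomial.degree_mul, Polynomial.degree_mul, ← derivative_toBiv]
  have h3 := Polynomial.degree_derivative_lt h1
  have h4 : (toBiv (C (c i))).degree ≤ 0 := by
    have : toBiv (C (c i)) = Polynomial.C (Polynomial.C (c i)) := by simp
    rw [this]
    exact Polynomial.degree_C_le
  have h5 : (toBiv (∏ k ∈ s.erase i, P k)).degree ≠ ⊥ := by simpa using h2
  calc _ ≤ 0 + ((toBiv (∏ k ∈ s.erase i, P k)).degree +
        (Polynomial.derivative (toBiv (P i))).degree) := by gcongr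
    _ < _ := by
      rw [zero_add, add_comm (toBiv (P i)).degree]
      exact WithBot.add_lt_add_left h5 h3

namespace IsRegularInY

variable {F : MvPolynomial (Fin 2) ℂ} {d : ℕ} {ℓ : ℂ}

theorem sub_C (hF : IsRegularInY F d ℓ) (hd : d ≠ 0) (t : ℂ) : IsRegularInY (F - C t) d ℓ := by
  have h : toBiv (F - C t) = toBiv F - Polynomial.C (Polynomial.C t) := by simp
  have hn : (toBiv (F - C t)).natDegree = d := by
    rw [h, Polynomial.natDegree_sub_C, hF.natDegree_eq]
  refine ⟨?_, hF.ne_zero, hn, ?_⟩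
  · refine (totalDegree_sub _ _).trans ?_
    simpa using hF.totalDegree_le
  · rw [Polynomial.leadingCoeff, hn, h, Polynomial.coeff_sub,
      Polynomial.coeff_C_of_ne_zero hd, sub_zero, ← hF.leadingCoeff_eq, Polynomial.leadingCoeff,
      hF.natDegree_eq]

theorem isUnit_leadingCoeff (hF : IsRegularInY F d ℓ) : IsUnit (toBiv F).leadingCoeff := by
  rw [hF.leadingCoeff_eq]
  exact Polynomial.isUnit_C.2 hF.ne_zero.isUnit

/-- A factor of a noncritical fibre is invariant under the Hamiltonian derivation. -/
theorem exists_cofactor (hF : IsRegularInY F d ℓ) (hd : d ≠ 0) {t : ℂ}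
    (ht : ∀ z ∈ critPts F, evalP F z ≠ t) {P Q : MvPolynomial (Fin 2) ℂ} (h : F - C t = P * Q) :
    ∃ g : MvPolynomial (Fin 2) ℂ, g.totalDegree ≤ 2 * d ∧ jac F P = P * g := by
  have hlc := (hF.sub_C hd t).isUnit_leadingCoeff
  have hder : ∀ i, pderiv i F = P * pderiv i Q + Q * pderiv i P := by
    intro i
    have h1 := congrArg (pderiv i) h
    rwa [map_sub, pderiv_C, sub_zero, Derivation.leibniz, smul_eq_mul, smul_eq_mul] at h1
  have hrel : IsRelPrime P Q := by
    intro r hrP hrQ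
    by_contra hr
    have hdvd : r ∣ F - C t := h ▸ hrP.mul_right Q
    obtain ⟨z, hz⟩ := exists_evalP_eq_zero (isUnit_leadingCoeff_of_dvd hlc hdvd) hr 0
    have hpz := evalP_eq_zero_of_dvd hrP hz
    have hqz := evalP_eq_zero_of_dvd hrQ hz
    refine ht (0, z) ⟨?_, ?_⟩ ?_
    · rw [hder, evalP_add, evalP_mul, evalP_mul, hpz, hqz]; ring
    · rw [hder, evalP_add, evalP_mul, evalP_mul, hpz, hqz]; ring
    · have := evalP_eq_zero_of_dvd hdvd hz
      simpa [evalP, sub_eq_zero] using this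
  have hj : jac F P = P * (pderiv 0 Q * pderiv 1 P - pderiv 1 Q * pderiv 0 P) := by
    rw [jac, hder, hder]
    ring
  refine ⟨_, ?_, hj⟩
  have hPQ : P ≠ 0 ∧ Q ≠ 0 := by
    rw [← mul_ne_zero_iff, ← h]
    intro h0
    rw [h0, map_zero, Polynomial.leadingCoeff_zero] at hlc
    exact not_isUnit_zero hlc
  have hsum : P.totalDegree + Q.totalDegree ≤ d := by
    rw [← totalDegree_mul_of_isDomain hPQ.1 hPQ.2, ← h]
    exact (hF.sub_C hd t).totalDegree_le
  have hb : ∀ i j, (pderiv i Q * pderiv j P).totalDegree ≤ 2 * d := by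
    intro i j
    refine (totalDegree_mul _ _).trans ?_
    have := totalDegree_pderiv_le i Q
    have := totalDegree_pderiv_le j P
    omega
  exact (totalDegree_sub _ _).trans (max_le (hb 0 1) (hb 1 0))

end IsRegularInY

end PuiseuxField

namespace PuiseuxField

namespace IsRegularInY

variable {F : MvPolynomial (Fin 2) ℂ} {d : ℕ} {ℓ : ℂ}

section

variable {ι : Type*} [DecidableEq ι] {s : Finset ι} {c : ι → ℂ} {τ : ι → ℂ}
  {P Q g : ι → MvPolynomial (Fin 2) ℂ}

/-- If a combination of the cofactors of factors of distinct fibres vanishes, then so does the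
corresponding logarithmic form. -/
theorem logForm_eq_zero (hF : IsRegularInY F d ℓ) (hd : d ≠ 0) (hcrit : (critPts F).Finite)
    (hτ : Set.InjOn τ s) (hPQ : ∀ i ∈ s, F - C (τ i) = P i * Q i)
    (hQ : ∀ i ∈ s, ¬ IsUnit (Q i)) (hg : ∀ i ∈ s, jac F (P i) = P i * g i)
    (hc : ∑ i ∈ s, C (c i) * g i = 0) : logForm s c P 1 = 0 := by
  have hlc : ∀ i ∈ s, IsUnit (toBiv (P i * Q i)).leadingCoeff := fun i hi =>
    hPQ i hi ▸ (hF.sub_C hd (τ i)).isUnit_leadingCoeff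
  have hne : ∀ i ∈ s, P i ≠ 0 ∧ Q i ≠ 0 := by
    intro i hi
    rw [← mul_ne_zero_iff]
    intro h
    have := hlc i hi
    rw [h, map_zero, Polynomial.leadingCoeff_zero] at this
    exact not_isUnit_zero this
  have hP0 : ∏ k ∈ s, P k ≠ 0 := Finset.prod_ne_zero_iff.2 fun i hi => (hne i hi).1
  have hQ0 : ∏ k ∈ s, Q k ≠ 0 := Finset.prod_ne_zero_iff.2 fun i hi => (hne i hi).2
  have hw := wedge_logForm s c P F hg
  rw [hc, mul_zero, sub_eq_zero] at hw
  obtain ⟨K, h0, h1⟩ := hF.exists_eq_mul_pderiv hd hcrit hw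
  have hcl := logForm_closed s c P
  rw [h0, h1] at hcl
  have hprod : (∏ k ∈ s, P k) * ∏ k ∈ s, Q k =
      Polynomial.aeval F (∏ k ∈ s, (Polynomial.X - Polynomial.C (τ k))) := by
    rw [← Finset.prod_mul_distrib, map_prod]
    refine Finset.prod_congr rfl fun i hi => ?_
    rw [← hPQ i hi]
    simp [MvPolynomial.algebraMap_eq]
  have hj : jac F (K * ∏ k ∈ s, Q k) = 0 := by
    have hjp : jac F ((∏ k ∈ s, P k) * ∏ k ∈ s, Q k) = 0 := by rw [hprod, jac_aeval_self]
    rw [jac_mul] at hjp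
    refine (mul_eq_zero.1 (?_ : (∏ k ∈ s, P k) * jac F (K * ∏ k ∈ s, Q k) = 0)).resolve_left hP0
    rw [jac_mul]
    simp only [Derivation.leibniz, smul_eq_mul, pderiv_comm F] at hcl
    have hcl' : (∏ k ∈ s, P k) * jac F K = K * jac F (∏ k ∈ s, P k) := by
      rw [jac, jac]
      linear_combination -hcl
    linear_combination K * hjp + (∏ k ∈ s, Q k) * hcl'
  obtain ⟨q, hq⟩ := hF.exists_eq_aeval_of_jac_eq_zero hd hcrit _ hj
  have hroot : ∀ i ∈ s, (Polynomial.X - Polynomial.C (τ i)) ∣ q := by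
    intro i hi
    obtain ⟨z, hz⟩ := exists_evalP_eq_zero (isUnit_leadingCoeff_of_dvd (hlc i hi)
      (Dvd.intro_left _ rfl)) (hQ i hi) 0
    have hFz : evalP F (0, z) = τ i := by
      have := evalP_eq_zero_of_dvd (Dvd.intro_left (P i) rfl) hz
      rw [← hPQ i hi] at this
      simpa [evalP, sub_eq_zero] using this
    rw [Polynomial.dvd_iff_isRoot, Polynomial.IsRoot, ← hFz, ← evalP_aeval, ← hq]
    exact evalP_eq_zero_of_dvd ((Finset.dvd_prod_of_mem Q hi).mul_left K) hz
  obtain ⟨M, rfl⟩ : (∏ k ∈ s, (Polynomial.X - Polynomial.C (τ k))) ∣ q := by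
    refine Finset.prod_dvd_of_coprime (fun i hi j hj hij => ?_) hroot
    exact Polynomial.isCoprime_X_sub_C_of_isUnit_sub
      (sub_ne_zero.2 fun h => hij (hτ hi hj h)).isUnit
  rw [map_mul, ← hprod] at hq
  have hK : K = (∏ k ∈ s, P k) * Polynomial.aeval F M := by
    apply mul_right_cancel₀ hQ0
    rw [hq]; ring
  have hdvd : toBiv (∏ k ∈ s, P k) ∣ toBiv (logForm s c P 1) := by
    apply map_dvd
    rw [h1, hK, mul_assoc]
    exact Dvd.intro _ rfl
  have := Polynomial.eq_zero_of_dvd_of_degree_lt hdvd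
    (degree_toBiv_logForm_lt fun i hi => (hne i hi).1)
  simpa using this

theorem eq_zero_of_logForm_eq_zero (hF : IsRegularInY F d ℓ) (hd : d ≠ 0)
    (hτ : Set.InjOn τ s) (hPQ : ∀ i ∈ s, F - C (τ i) = P i * Q i)
    (hP : ∀ i ∈ s, ¬ IsUnit (P i)) (h : logForm s c P 1 = 0) {i : ι} (hi : i ∈ s) : c i = 0 := by
  by_contra hci
  have hlc : IsUnit (toBiv (P i)).leadingCoeff := isUnit_leadingCoeff_of_dvd
    (hPQ i hi ▸ (hF.sub_C hd (τ i)).isUnit_leadingCoeff) (Dvd.intro _ rfl)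
  have hP0 : toBiv (P i) ≠ 0 := by
    intro h0
    rw [h0, Polynomial.leadingCoeff_zero] at hlc
    exact not_isUnit_zero hlc
  have hrel : IsRelPrime (P i) (∏ k ∈ s.erase i, P k) := by
    refine IsRelPrime.prod_right fun k hk => ?_
    obtain ⟨hki, hks⟩ := Finset.mem_erase.1 hk
    intro r hri hrk
    have h1 : r ∣ C (τ k - τ i) := by
      have : C (τ k - τ i) = P i * Q i - P k * Q k := by
        rw [← hPQ i hi, ← hPQ k hks, C_sub]
        ring
      rw [this]
      exact dvd_sub (hri.mul_right _) (hrk.mul_right _)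
    refine isUnit_of_dvd_unit h1 ?_
    exact (IsUnit.mk0 _ (sub_ne_zero.2 fun h => hki (hτ hks hi h))).map C
  have hdvd : P i ∣ C (c i) * ((∏ k ∈ s.erase i, P k) * pderiv 1 (P i)) := by
    rw [logForm, ← Finset.add_sum_erase s _ hi] at h
    rw [eq_neg_of_add_eq_zero_left h]
    refine (Finset.dvd_sum fun k hk => ?_).neg_right
    obtain ⟨hki, -⟩ := Finset.mem_erase.1 hk
    exact ((Finset.dvd_prod_of_mem P (Finset.mem_erase.2 ⟨hki.symm, hi⟩)).mul_right _).mul_left _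
  have hu : IsUnit (C (c i) : MvPolynomial (Fin 2) ℂ) := (IsUnit.mk0 _ hci).map C
  rw [hu.dvd_mul_left] at hdvd
  have h2 := map_dvd toBiv (hrel.dvd_of_dvd_mul_left hdvd)
  rw [← derivative_toBiv] at h2
  have h3 := Polynomial.eq_zero_of_dvd_of_degree_lt h2 (Polynomial.degree_derivative_lt hP0)
  exact hP i hi (isUnit_of_natDegree_eq_zero hlc (Polynomial.derivative_eq_zero.1 h3))

end

/-- All but finitely many fibres are irreducible. -/
theorem finite_not_irreducible (hF : IsRegularInY F d ℓ) (hd : d ≠ 0)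
    (hcrit : (critPts F).Finite) : {t : ℂ | ¬ Irreducible (F - C t)}.Finite := by
  classical
  suffices h : {t : ℂ | ¬ Irreducible (F - C t) ∧ ∀ z ∈ critPts F, evalP F z ≠ t}.Finite by
    refine (h.union (hcrit.image (evalP F))).subset fun t ht => ?_
    by_cases h' : ∀ z ∈ critPts F, evalP F z ≠ t
    · exact Or.inl ⟨ht, h'⟩
    · push Not at h'
      exact Or.inr h'
  set T := {t : ℂ | ¬ Irreducible (F - C t) ∧ ∀ z ∈ critPts F, evalP F z ≠ t} with hT
  have key : ∀ t : T, ∃ P Q g : MvPolynomial (Fin 2) ℂ, F - C t.1 = P * Q ∧ ¬ IsUnit P ∧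
      ¬ IsUnit Q ∧ g.totalDegree ≤ 2 * d ∧ jac F P = P * g := by
    rintro ⟨t, ht, htc⟩
    have hnu : ¬ IsUnit (F - C t) := by
      intro hu
      have h1 := Polynomial.natDegree_eq_zero_of_isUnit (hu.map toBiv)
      exact hd ((hF.sub_C hd t).natDegree_eq ▸ h1)
    rw [irreducible_iff] at ht
    push Not at ht
    obtain ⟨P, Q, h, hP, hQ⟩ := ht hnu
    obtain ⟨g, hg, hg'⟩ := hF.exists_cofactor hd htc h
    exact ⟨P, Q, g, h, hP, hQ, hg, hg'⟩
  choose P Q g hPQ hP hQ hdeg hg using key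
  have hli : LinearIndependent ℂ fun t : T =>
      (⟨g t, (mem_restrictTotalDegree (Fin 2) (2 * d) (g t)).2 (hdeg t)⟩ :
        restrictTotalDegree (Fin 2) ℂ (2 * d)) := by
    rw [linearIndependent_iff']
    intro s c hc i hi
    have hinj : Set.InjOn (Subtype.val : T → ℂ) s := Subtype.val_injective.injOn
    refine hF.eq_zero_of_logForm_eq_zero hd hinj (fun i _ => hPQ i) (fun i _ => hP i)
      (hF.logForm_eq_zero hd hcrit hinj (fun i _ => hPQ i) (fun i _ => hQ i) (fun i _ => hg i) ?_)
      hi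
    have := congrArg Subtype.val hc
    simpa [MvPolynomial.smul_eq_C_mul] using this
  have := hli.finite
  exact T.toFinite

end IsRegularInY

end PuiseuxField

theorem homologyRank_congr {X Y : Type} [TopologicalSpace X] [TopologicalSpace Y] (e : X ≃ₜ Y)
    (n : ℕ) : homologyRank X n = homologyRank Y n :=
  LinearEquiv.finrank_eq (HomologicalComplex.homologyMapIso
    ((AlgebraicTopology.alternatingFaceMapComplex (ModuleCat.{0} ℚ)).mapIso
      (((CategoryTheory.SimplicialObject.whiskering _ _).obj (ModuleCat.free ℚ)).mapIso
        (TopCat.toSSet.mapIso (TopCat.isoOfHomeo (X := TopCat.of X) (Y := TopCat.of Y) e))))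
    n).toLinearEquiv

/-- The fibre of `f` in sheared coordinates. -/
def fibreHomeomorph (f : MvPolynomial (Fin 2) ℂ) (a t : ℂ) :
    {q : ℂ × ℂ // evalP f q = t} ≃ₜ {q : ℂ × ℂ // evalP (shear a f) q = t} where
  toFun q := ⟨(q.1.1 - a * q.1.2, q.1.2), by
    rw [evalP_linSubst]
    refine Eq.trans (congrArg (evalP f) ?_) q.2
    ext <;> simp [mul_comm]⟩
  invFun q := ⟨(q.1.1 + a * q.1.2, q.1.2), by
    refine Eq.trans ?_ ((evalP_linSubst _ _ _ _).symm.trans q.2)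
    refine congrArg (evalP f) ?_
    ext <;> simp [mul_comm]⟩
  left_inv q := by ext <;> simp
  right_inv q := by ext <;> simp
  continuous_toFun := by fun_prop
  continuous_invFun := by fun_prop

theorem exists_evalP_homogeneousComponent_ne_zero {f : MvPolynomial (Fin 2) ℂ} {d : ℕ}
    (hd : d ≠ 0) (hdeg : f.totalDegree = d) :
    ∃ a, evalP (homogeneousComponent d f) (a, 1) ≠ 0 := by
  by_contra! h
  have hp := homogeneousComponent_isHomogeneous d f
  have h0 : homogeneousComponent d f * X 1 = 0 := by
    apply MvPolynomial.funext
    intro x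
    have hx : x = fun i : Fin 2 => if i = 0 then (x 0, x 1).1 else (x 0, x 1).2 := by
      ext i
      fin_cases i <;> simp
    rw [map_mul, map_zero, eval_X]
    by_cases h1 : x 1 = 0
    · rw [h1, mul_zero]
    · have := evalP_smul_of_isHomogeneous hp (x 1) (x 0 / x 1) 1
      rw [h, mul_zero, mul_one, mul_div_cancel₀ _ h1, evalP, ← hx] at this
      rw [this, zero_mul]
  have h1 : homogeneousComponent d f = 0 := (mul_eq_zero.1 h0).resolve_right (X_ne_zero 1)
  obtain ⟨m, hm, hmd⟩ := Finset.exists_mem_eq_sup f.support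
    (support_nonempty.2 fun h => hd (by rw [← hdeg, h, totalDegree_zero]))
    (fun s => s.sum fun _ e => e)
  have hmd' : m.degree = d := by
    rw [← hdeg, totalDegree, hmd]
    rfl
  have h2 := congrArg (coeff m) h1
  rw [coeff_homogeneousComponent, if_pos hmd', coeff_zero] at h2
  exact mem_support_iff.1 hm h2

theorem finite_critPts_shear {f : MvPolynomial (Fin 2) ℂ} (h : (critPts f).Finite) (a : ℂ) :
    (critPts (shear a f)).Finite := by
  refine Set.Finite.of_finite_image (f := fun q : ℂ × ℂ => (q.1 + a * q.2, q.2))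
    (h.subset ?_) ?_
  · rintro _ ⟨⟨b, y⟩, hq, rfl⟩
    exact (mem_critPts_iff_shear f a b y).2 hq
  · rintro ⟨x, y⟩ - ⟨x', y'⟩ - h
    simp only [Prod.mk.injEq] at h
    obtain ⟨h1, rfl⟩ := h
    simpa using h1

namespace PuiseuxField

namespace IsRegularInY

variable {F : MvPolynomial (Fin 2) ℂ} {d : ℕ} {ℓ : ℂ}

theorem eval₂_pderiv_zero_ne_zero (hF : IsRegularInY F d ℓ) (hd : d ≠ 0)
    (hcrit : (critPts F).Finite) {y : PuiseuxField} (hy : y ∈ curveRoots (pderiv 1 F) unif⁻¹) :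
    eval₂ unif⁻¹ y (pderiv 0 F) ≠ 0 := by
  intro h
  choose z hz hz' using hF.exists_common_zero hd hy h
  refine Set.infinite_of_injective_forall_mem (s := critPts F) (f := fun b : ℂ => (b, z b)) ?_
    (fun b => ⟨hz' b, hz b⟩) hcrit
  intro b b' hb
  exact (Prod.mk.inj hb).1

open scoped Classical in
/-- The first Betti number of a smooth irreducible fibre. -/
theorem homologyRank_fibre (hF : IsRegularInY F d ℓ) (hd : d ≠ 0) {t : ℂ}
    (hirr : Irreducible (F - C t)) {B : Finset ℂ} (hne : B.Nonempty)
    (hB : ∀ b ∉ B, ∀ y, evalP F (b, y) = t → evalP (pderiv 1 F) (b, y) ≠ 0) :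
    (homologyRank {q : ℂ × ℂ // evalP F q = t} 1 : ℚ) =
      1 - d + ∑ b ∈ B, ((d : ℚ) -
        (((toBiv (F - C t)).map (Polynomial.evalRingHom b)).roots.toFinset.card : ℚ)) := by
  have hFt := hF.sub_C hd t
  have hu : IsUnit (Polynomial.C (Polynomial.C ℓ⁻¹)) :=
    Polynomial.isUnit_C.2 (Polynomial.isUnit_C.2 (inv_ne_zero hF.ne_zero).isUnit)
  set P := Polynomial.C (Polynomial.C ℓ⁻¹) * toBiv (F - C t) with hP
  have hmonic : P.Monic := by
    rw [Polynomial.Monic, hP, Polynomial.leadingCoeff_mul, hFt.leadingCoeff_eq,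
      Polynomial.leadingCoeff_C, ← Polynomial.C_mul, inv_mul_cancel₀ hF.ne_zero, Polynomial.C_1]
  have hnat : P.natDegree = d := by
    rw [hP, Polynomial.natDegree_mul hu.ne_zero (fun h => by
      have := hFt.natDegree_eq
      rw [h, Polynomial.natDegree_zero] at this
      exact hd this.symm), Polynomial.natDegree_C, zero_add, hFt.natDegree_eq]
  have hirrP : Irreducible P := by
    rw [hP, irreducible_isUnit_mul hu]
    exact (MulEquiv.irreducible_iff toBiv).2 hirr
  have heval : ∀ (g : MvPolynomial (Fin 2) ℂ) x y,
      (Polynomial.C (Polynomial.C ℓ⁻¹) * toBiv g).evalEval x y = ℓ⁻¹ * evalP g (x, y) := by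
    intro g x y
    rw [Polynomial.evalEval_mul, Polynomial.evalEval_C, Polynomial.eval_C,
      ← Polynomial.map_evalRingHom_eval, eval_map_evalRingHom]
  have hzero : ∀ x y, P.evalEval x y = 0 ↔ evalP F (x, y) = t := by
    intro x y
    rw [hP, heval, mul_eq_zero, or_iff_right (inv_ne_zero hF.ne_zero)]
    simp [evalP, sub_eq_zero]
  have hroots : ∀ b, (P.map (Polynomial.evalRingHom b)).roots =
      ((toBiv (F - C t)).map (Polynomial.evalRingHom b)).roots := by
    intro b
    rw [hP, Polynomial.map_mul, Polynomial.map_C, Polynomial.coe_evalRingHom, Polynomial.eval_C,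
      Polynomial.roots_C_mul _ (inv_ne_zero hF.ne_zero)]
  have key := PlaneCurve.finrank_pathCohomology hmonic (hnat.symm ▸ hd) hirrP hne (by
    intro x hx y hxy
    have h1 : P.derivative = Polynomial.C (Polynomial.C ℓ⁻¹) * toBiv (pderiv 1 F) := by
      rw [hP, Polynomial.derivative_C_mul, derivative_toBiv, map_sub, pderiv_C, sub_zero]
    rw [h1, heval]
    exact _root_.mul_ne_zero (inv_ne_zero hF.ne_zero) (hB x hx y ((hzero x y).1 hxy)))
  have hrank : homologyRank {q : ℂ × ℂ // evalP F q = t} 1 =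
      homologyRank (PlaneCurve P) 1 :=
    homologyRank_congr ((Homeomorph.refl (ℂ × ℂ)).subtype fun q => (hzero q.1 q.2).symm) 1
  rw [← homologyRank_one_eq] at key
  change homologyRank (PlaneCurve P) 1 + _ + _ = _ at key
  rw [← hrank, hnat] at key
  simp only [hroots] at key
  have key' := congrArg (Nat.cast : ℕ → ℚ) key
  push_cast at key'
  rw [Finset.sum_sub_distrib, Finset.sum_const, nsmul_eq_mul]
  linear_combination key'

end IsRegularInY

end PuiseuxField

open scoped Classical in
/-- Suzuki's formula.  Let `f` have degree `d ≥ 1`, finitely many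
critical points in `ℂ²` with finite local Milnor numbers, and total Milnor number
`μ = ∑ μ_q(f)`.  Assume `f^[m]` is admissible (with generic Milnor number `μm m`) for
every `m` with `f_d(1,m) = 0`, and `f^σ` is admissible (with generic Milnor number `μσ`)
if `f_d(0,1) = 0`.  Let `λ` be the sum over the points of the line at infinity met by the
level curves of `f` of all the jumps `ν_c` of the Milnor numbers there.  Then for all but
finitely many `t`, the generic fiber `f⁻¹(t)` satisfies
`dim_ℚ H₁(f⁻¹(t); ℚ) = μ + λ`. -/
theorem statement13 (f : MvPolynomial (Fin 2) ℂ) (d : ℕ) (hd : 1 ≤ d)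
    (hdeg : f.totalDegree = d)
    (hcrit : (critPts f).Finite)
    (hlocfin : ∀ q ∈ critPts f,
      Module.Finite ℂ (MvPowerSeries (Fin 2) ℂ ⧸ milnorIdeal (shiftPoly f q)))
    (μm : ℂ → ℕ)
    (hadm : ∀ m : ℂ, evalP (homogeneousComponent d f) (1, m) = 0 →
      IsAdmissible (fSlope f m) d (μm m))
    (μσ : ℕ)
    (hadmσ : evalP (homogeneousComponent d f) (0, 1) = 0 → IsAdmissible (fSwap f) d μσ) :
    ∃ S : Set ℂ, S.Finite ∧ ∀ t ∉ S,
      (homologyRank {q : ℂ × ℂ // evalP f q = t} 1 : ℤ)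
        = (∑ q ∈ hcrit.toFinset, muLoc f q : ℤ)
          + ((∑ᶠ m ∈ {m : ℂ | evalP (homogeneousComponent d f) (1, m) = 0},
                ∑ᶠ c : ℂ, ((mu (fSlope f m) d c : ℤ) - (μm m : ℤ)))
             + if evalP (homogeneousComponent d f) (0, 1) = 0
               then ∑ᶠ c : ℂ, ((mu (fSwap f) d c : ℤ) - (μσ : ℤ)) else 0) := by
  have hd0 : d ≠ 0 := Nat.one_le_iff_ne_zero.1 hd
  obtain ⟨a, ha⟩ := exists_evalP_homogeneousComponent_ne_zero hd0 hdeg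
  have hF := PuiseuxField.isRegularInY_shear hdeg.le ha
  have hcritF := finite_critPts_shear hcrit a
  have hg := fun y (hy : y ∈ PuiseuxField.curveRoots (pderiv 1 (shear a f))
    PuiseuxField.unif⁻¹) => hF.eval₂_pderiv_zero_ne_zero hd0 hcritF hy
  have hlam := PuiseuxField.sum_jumps hdeg.le ha hd0 hg hadm hadmσ
  refine ⟨{t | ¬ Irreducible (shear a f - C t)} ∪ evalP (shear a f) '' critPts (shear a f) ∪
    ((PuiseuxField.curveRoots (pderiv 1 (shear a f)) PuiseuxField.unif⁻¹).map fun y =>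
      (PuiseuxField.eval₂ PuiseuxField.unif⁻¹ y (shear a f)).coeff 0).toFinset,
    ((hF.finite_not_irreducible hd0 hcritF).union (hcritF.image _)).union (Finset.finite_toSet _),
    fun t ht => ?_⟩
  simp only [Set.mem_union, not_or] at ht
  obtain ⟨⟨hirr, hcv⟩, hinf⟩ := ht
  obtain ⟨B, hne, hB, hsum⟩ := hF.exists_branch_finset hd0 hg (t := t)
    (fun b y h1 h2 h3 => hcv ⟨(b, y), ⟨h3, h2⟩, h1⟩)
    (fun y hy h => hinf (by
      rw [Finset.mem_coe, Multiset.mem_toFinset, Multiset.mem_map]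
      exact ⟨y, hy, h.symm⟩))
  have hrank := hF.homologyRank_fibre hd0 (not_not.1 hirr) hne hB
  rw [hsum] at hrank
  have hmu := hF.sum_muLoc hd0 hcrit hg
  rw [Multiset.map_congr rfl fun y hy => PuiseuxField.order_pderiv_zero_eq hy (hg y hy),
    Multiset.sum_map_add, Multiset.map_const', Multiset.sum_replicate,
    (hF.splits_infinity hd0).2, nsmul_eq_mul, Nat.cast_sub hd] at hmu
  have hsplit : ((PuiseuxField.curveRoots (pderiv 1 (shear a f)) PuiseuxField.unif⁻¹).map
      (PuiseuxField.ordNonconst (shear a f))).sum =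
      ((PuiseuxField.curveRoots (pderiv 1 (shear a f)) PuiseuxField.unif⁻¹).map fun y =>
        min (PuiseuxField.ordNonconst (shear a f) y) 0).sum +
      ((PuiseuxField.curveRoots (pderiv 1 (shear a f)) PuiseuxField.unif⁻¹).map fun y =>
        max (PuiseuxField.ordNonconst (shear a f) y) 0).sum := by
    rw [← Multiset.sum_map_add]
    simp only [min_add_max, add_zero]
  rw [homologyRank_congr (fibreHomeomorph f a t) 1]
  refine Int.cast_injective (α := ℚ) ?_
  rw [Int.cast_add, hlam]
  push_cast
  rw [hrank, hmu]
  push_cast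
  linear_combination hsplit

end
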